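/- Let n ≥ 20 be a natural number, and let G = Sym(n) if n is even and G = Alt(n) if n is odd. Then γ(G) ≥ (n/2)·(1 − √(1 − 8ζ₂(n))) − √n, where ζ₂(n) := (1/12)·∏_{p | n, p prime} (1 − 1/p²). -/

import Mathlib

/-- The normal covering number of a group `G`: the least `s` such that there exist
proper subgroups `H₁, …, H_s` of `G` with every element of `G` lying in some
conjugate of some `Hᵢ`. -/
noncomputable def normalCoveringNumber (G : Type*) [Group G] : ℕ :=
  sInf {s : ℕ | ∃ H : Fin s → Subgroup G, (∀ i, H i ≠ ⊤) ∧
    ∀ g : G, ∃ i : Fin s, ∃ x : G, x * g * x⁻¹ ∈ H i}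

/-- `ζ₂(n) = (1/12) ∏_{p ∣ n, p prime} (1 − 1/p²)`. -/
noncomputable def zeta2 (n : ℕ) : ℝ :=
  (1 / 12) * ∏ p ∈ n.primeFactors, (1 - 1 / (p : ℝ) ^ 2)

open Equiv Finset

/-- `g` is the product of three disjoint cycles with supports `A`, `B`, `C` covering everything. -/
structure IsTriCycle {α : Type*} [Fintype α] [DecidableEq α] (g : Perm α) (A B C : Finset α) :
    Prop where
  cycA : g.IsCycleOn (A : Set α)
  cycB : g.IsCycleOn (B : Set α)
  cycC : g.IsCycleOn (C : Set α)
  disjAB : Disjoint A B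
  disjAC : Disjoint A C
  disjBC : Disjoint B C
  cover : ∀ x, x ∈ A ∨ x ∈ B ∨ x ∈ C

/-- Primitivity of a permutation group, in elementary terms. -/
structure PermPrim {α : Type*} (G : Subgroup (Perm α)) : Prop where
  trans : ∀ x y, ∃ h ∈ G, h x = y
  block : ∀ r : Setoid α, (∀ h ∈ G, ∀ x y, r x y → r (h x) (h y)) →
    (∃ x y, x ≠ y ∧ r x y) → ∀ x y, r x y

/-- Two-transitivity of a permutation group, in elementary terms. -/
def PermTwoTrans {α : Type*} (G : Subgroup (Perm α)) : Prop :=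
  ∀ x y u v : α, x ≠ y → u ≠ v → ∃ h ∈ G, h x = u ∧ h y = v

section TwoTrans

variable {α : Type*}

theorem PermPrim.exists_crossing {G : Subgroup (Perm α)} (hG : PermPrim G) {P : α → α → Prop}
    (symm : ∀ x y, P x y → P y x) (inv : ∀ h ∈ G, ∀ x y, P x y → P (h x) (h y))
    (hne : ∃ x y, x ≠ y ∧ P x y) {S : Set α} {s t : α} (hs : s ∈ S) (ht : t ∉ S) :
    ∃ x ∈ S, ∃ y ∉ S, P x y := by
  by_contra! hc
  have key : ∀ x y, Relation.EqvGen P x y → (x ∈ S ↔ y ∈ S) := by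
    intro x y h
    induction h with
    | rel x y h =>
      constructor
      · intro hx; by_contra hy; exact hc x hx y hy h
      · intro hy; by_contra hx; exact hc y hy x hx (symm _ _ h)
    | refl => rfl
    | symm _ _ _ ih => exact ih.symm
    | trans _ _ _ _ _ ih1 ih2 => exact ih1.trans ih2
  have tot := hG.block (Relation.EqvGen.setoid P) (by
    intro h hh x y hxy
    change Relation.EqvGen P _ _ at hxy
    change Relation.EqvGen P _ _
    induction hxy with
    | rel x y h' => exact .rel _ _ (inv h hh _ _ h')
    | refl => exact .refl _
    | symm _ _ _ ih => exact ih.symm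
    | trans _ _ _ _ _ ih1 ih2 => exact ih1.trans _ _ _ ih2) (by
      obtain ⟨x, y, hxy, h⟩ := hne
      exact ⟨x, y, hxy, .rel _ _ h⟩) s t
  exact ht ((key s t tot).1 hs)

variable {g : Perm α}

theorem Equiv.Perm.IsCycleOn.exists_pow_eq_pair {B C : Finset α} (hB : g.IsCycleOn (B : Set α))
    (hC : g.IsCycleOn (C : Set α)) (h : Nat.Coprime #B #C) {x x' y y' : α} (hx : x ∈ B)
    (hx' : x' ∈ B) (hy : y ∈ C) (hy' : y' ∈ C) : ∃ t : ℕ, (g ^ t) x = x' ∧ (g ^ t) y = y' := by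
  obtain ⟨i, -, hi⟩ := hB.exists_pow_eq hx hx'
  obtain ⟨j, -, hj⟩ := hC.exists_pow_eq hy hy'
  obtain ⟨t, ht1, ht2⟩ := Nat.chineseRemainder h i j
  exact ⟨t, by rw [← hi, hB.pow_apply_eq_pow_apply hx]; exact ht1,
    by rw [← hj, hC.pow_apply_eq_pow_apply hy]; exact ht2⟩

end TwoTrans

section TwoTrans

variable {α : Type*} [Fintype α] [DecidableEq α] {G : Subgroup (Perm α)} {g : Perm α}
  {A B C : Finset α}

theorem card_filter_eq_of_perm (h : Perm α) (p q : α → Prop) [DecidablePred p] [DecidablePred q]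
    (hpq : ∀ z, p z ↔ q (h z)) : #{z | p z} = #{z | q z} :=
  Finset.card_equiv h (by simp [hpq])

open Classical in
/-- The orbit of an arc of a transitive group is not a tournament dominating `C` from `B` in the
presence of two vertices of `B` with the same out-neighbours outside `B`. -/
theorem not_tournament_of_arc_orbit (trans : ∀ x y, ∃ h ∈ G, h x = y) {E : α → α → Prop}
    (inv : ∀ h ∈ G, ∀ x y, E x y → E (h x) (h y))
    (orb : ∀ x y u v, E x y → E u v → ∃ h ∈ G, h x = u ∧ h y = v)
    (tot : ∀ x y, x ≠ y → E x y ∨ E y x) (asymm : ∀ x y, E x y → ¬ E y x)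
    {x x' y : α} (hx : x ≠ x') (hBy : ∀ z ∈ B, E z y)
    (hB : ∀ z ∉ B, E x z ↔ E x' z) : False := by
  have inv' : ∀ h ∈ G, ∀ x y, E x y ↔ E (h x) (h y) := fun h hh x y =>
    ⟨inv h hh x y, fun hE => by simpa using inv h⁻¹ (G.inv_mem hh) _ _ hE⟩
  have irr : ∀ x, ¬ E x x := fun x h => asymm _ _ h h
  obtain ⟨k, hk⟩ : ∃ k, ∀ x, #{z | E x z} = k := by
    refine ⟨#{z | E x z}, fun w => ?_⟩
    obtain ⟨h, hh, hw⟩ := trans w x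
    rw [← hw]
    exact card_filter_eq_of_perm h _ _ (inv' h hh w)
  obtain ⟨k', hk'⟩ : ∃ k, ∀ x, #{z | E z x} = k := by
    refine ⟨#{z | E z x}, fun w => ?_⟩
    obtain ⟨h, hh, hw⟩ := trans w x
    rw [← hw]
    exact card_filter_eq_of_perm h _ _ (fun z => inv' h hh z w)
  have hcard : 0 < Fintype.card α := Fintype.card_pos_iff.2 ⟨x⟩
  have hkk : k = k' := by
    have := Finset.sum_card_bipartiteAbove_eq_sum_card_bipartiteBelow E (s := (univ : Finset α))
      (t := univ)
    simp only [Finset.bipartiteAbove, Finset.bipartiteBelow, hk, hk', sum_const, smul_eq_mul,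
      card_univ] at this
    exact Nat.eq_of_mul_eq_mul_left hcard this
  have hn : 2 * k + 1 = Fintype.card α := by
    have h1 : #(univ.erase x : Finset α) = #{z | E x z} + #{z | E z x} := by
      rw [← card_union_of_disjoint]
      · congr 1
        ext z
        simp only [mem_erase, mem_univ, and_true, mem_union, mem_filter, true_and]
        exact ⟨fun h => tot _ _ h.symm, by rintro (h | h) rfl <;> exact irr _ h⟩
      · rw [disjoint_filter]
        exact fun z _ h => asymm _ _ h
    rw [hk, hk', card_erase_of_mem (mem_univ _), card_univ] at h1
    omega
  obtain ⟨l, hl⟩ : ∃ l, ∀ u v, u ≠ v → #{z | E u z ∧ E v z} = l := by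
    have key : ∃ l, ∀ u v, E u v → #{z | E u z ∧ E v z} = l := by
      obtain ⟨u, v, huv⟩ : ∃ u v, E u v := by
        rcases tot x x' hx with h | h
        exacts [⟨_, _, h⟩, ⟨_, _, h⟩]
      refine ⟨#{z | E u z ∧ E v z}, fun u' v' h' => ?_⟩
      obtain ⟨h, hh, rfl, rfl⟩ := orb _ _ _ _ h' huv
      exact card_filter_eq_of_perm h _ _ (fun z => and_congr (inv' h hh _ _) (inv' h hh _ _))
    obtain ⟨l, hl⟩ := key
    refine ⟨l, fun u v huv => ?_⟩
    rcases tot u v huv with h | h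
    · exact hl _ _ h
    · simpa only [and_comm] using hl _ _ h
  have hkpos : 0 < k := by
    rcases tot x x' hx with h | h
    · rw [← hk x]; exact card_pos.2 ⟨x', by simpa using h⟩
    · rw [← hk x']; exact card_pos.2 ⟨x, by simpa using h⟩
  have h2l : 2 * l + 1 = k := by
    have := Finset.sum_card_bipartiteAbove_eq_sum_card_bipartiteBelow E
      (s := (univ.erase x : Finset α)) (t := ({z | E x z} : Finset α))
    simp only [Finset.bipartiteAbove, Finset.bipartiteBelow] at this
    rw [sum_congr rfl (g := fun _ => l), sum_congr (s₂ := ({z | E x z} : Finset α)) rfl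
      (g := fun _ => k - 1)] at this
    · simp only [sum_const, smul_eq_mul, hk, card_erase_of_mem (mem_univ x), card_univ, ← hn] at this
      have h3 : k * (2 * l) = k * (k - 1) := by rw [← this]; simp only [Nat.add_sub_cancel]; ring
      have := Nat.eq_of_mul_eq_mul_left hkpos h3
      omega
    · intro z hz
      simp only [mem_filter, mem_univ, true_and] at hz
      rw [← hk' z] at hkk
      rw [hkk, filter_erase, card_erase_of_mem]
      simpa using hz
    · intro z hz
      rw [filter_filter]
      exact hl _ _ (ne_of_mem_erase hz).symm
  have hd : ∀ u v, u ≠ v → #{z | E u z ∧ ¬ E v z} = l + 1 := by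
    intro u v huv
    have := card_filter_add_card_filter_not (s := ({z | E u z} : Finset α)) (fun z => E v z)
    rw [filter_filter, filter_filter, hl u v huv, hk] at this
    omega
  have h3 : #(({z | E x z ∧ ¬ E x' z} : Finset α) ∪ ({z | E x' z ∧ ¬ E x z} : Finset α)) ≤ #B := by
    apply card_le_card
    intro z hz
    by_contra hzB
    have := hB z hzB
    simp only [mem_union, mem_filter, mem_univ, true_and] at hz
    tauto
  rw [card_union_of_disjoint, hd _ _ hx, hd _ _ hx.symm] at h3
  · have h4 : #B ≤ #{z | E z y} := card_le_card fun z hz => by simpa using hBy z hz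
    rw [hk'] at h4
    omega
  · rw [disjoint_filter]
    tauto

end TwoTrans

section TwoTrans

variable {α : Type*} [Fintype α] [DecidableEq α] {G : Subgroup (Perm α)} {g : Perm α}
  {A B C : Finset α}

theorem card_mul_card_filter_eq {N : α → α → Prop} [∀ x y, Decidable (N x y)]
    (symm : ∀ x y, N x y → N y x) {S T : Finset α} {p q : ℕ}
    (hp : ∀ x ∈ S, #{y ∈ T | N x y} = p) (hq : ∀ x ∈ T, #{y ∈ S | N x y} = q) :
    #S * p = #T * q := by
  have := Finset.sum_card_bipartiteAbove_eq_sum_card_bipartiteBelow N (s := S) (t := T)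
  simp only [Finset.bipartiteAbove, Finset.bipartiteBelow] at this
  rw [sum_congr rfl hp, sum_congr (s₁ := T) rfl (g := fun _ => q)] at this
  · simpa using this
  · intro z hz
    rw [← hq z hz]
    congr 1
    ext y
    simp only [mem_filter]
    exact and_congr_right fun _ => ⟨symm _ _, symm _ _⟩

theorem Equiv.Perm.IsCycleOn.card_filter_eq (hA : g.IsCycleOn (A : Set α))
    (hB : g.IsCycleOn (B : Set α))
    {N : α → α → Prop} [∀ x y, Decidable (N x y)] (inv : ∀ x y, N x y → N (g x) (g y))
    (inv' : ∀ x y, N x y → N (g⁻¹ x) (g⁻¹ y))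
    {x x' : α} (hx : x ∈ B) (hx' : x' ∈ B) :
    #{y ∈ A | N x y} = #{y ∈ A | N x' y} := by
  obtain ⟨i, -, rfl⟩ := hB.exists_pow_eq hx hx'
  clear hx'
  induction i with
  | zero => rfl
  | succ i ih =>
    rw [ih]
    refine Finset.card_equiv g fun z => ?_
    rw [pow_succ', Perm.mul_apply, mem_filter, mem_filter]
    refine and_congr ?_ ⟨inv _ _, fun h => by simpa using inv' _ _ h⟩
    exact (hA.apply_mem_iff (x := z)).symm

theorem mul_le_six_of_add_eq_five {t t' : ℕ} (h : t + t' = 5) : t * t' ≤ 6 := by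
  obtain rfl : t' = 5 - t := by omega
  have h3 : t ≤ 5 := by omega
  interval_cases t <;> omega

set_option maxHeartbeats 1000000 in
open Classical in
/-- A non-empty graph `N` preserved by a primitive group containing a suitable product of three
cycles, whose complement consists of a single orbit on edges, has an edge between `B` and `C`. -/
theorem PermPrim.graph_edge (hG : PermPrim G) (hg : g ∈ G) (hT : IsTriCycle g A B C)
    (hA : A.Nonempty) (hb : 16 < #B) (hc : 2 ≤ #C) (he : Nat.gcd #A #B ≤ 4)
    {N : α → α → Prop} (symm : ∀ x y, N x y → N y x) (irr : ∀ x, ¬ N x x)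
    (inv : ∀ h ∈ G, ∀ x y, N x y → N (h x) (h y))
    (orb : ∀ x y u v, x ≠ y → ¬ N x y → u ≠ v → ¬ N u v →
      ∃ h ∈ G, (h x = u ∧ h y = v) ∨ (h x = v ∧ h y = u))
    (hne : ∃ x y, N x y) : ∃ β ∈ B, ∃ γ ∈ C, N β γ := by
  by_contra! hBC
  have inv' : ∀ h ∈ G, ∀ x y, N x y ↔ N (h x) (h y) := fun h hh x y =>
    ⟨inv h hh x y, fun hE => by simpa using inv h⁻¹ (G.inv_mem hh) _ _ hE⟩
  obtain ⟨β₀, hβ₀⟩ : B.Nonempty := card_pos.1 (by omega)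
  obtain ⟨γ₀, hγ₀⟩ : C.Nonempty := card_pos.1 (by omega)
  obtain ⟨α₀, hα₀⟩ := hA
  have hAB := fun {x} (h : x ∈ A) => Finset.disjoint_left.1 hT.disjAB h
  have hAC := fun {x} (h : x ∈ A) => Finset.disjoint_left.1 hT.disjAC h
  have hBC' := fun {x} (h : x ∈ B) => Finset.disjoint_left.1 hT.disjBC h
  have hCB' := fun {x} (h : x ∈ C) => Finset.disjoint_right.1 hT.disjBC h
  -- every edge is equivalent to an `A`-`B` edge and to an `A`-`C` edge
  have edge : ∀ S : Set α, (∃ s, s ∈ S) → (∃ t, t ∉ S) → ∀ x y, N x y → ∃ u ∈ S, ∃ v ∉ S,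
      N u v ∧ ∃ h ∈ G, (h x = u ∧ h y = v) ∨ (h x = v ∧ h y = u) := by
    rintro S ⟨s, hs⟩ ⟨t, ht⟩ x y hxy
    obtain ⟨u, hu, v, hv, h⟩ := hG.exists_crossing
      (P := fun u v => ∃ h ∈ G, (h x = u ∧ h y = v) ∨ (h x = v ∧ h y = u))
      (by rintro u v ⟨h, hh, h'⟩; exact ⟨h, hh, h'.symm⟩)
      (by
        rintro k hk u v ⟨h, hh, h'⟩
        refine ⟨k * h, G.mul_mem hk hh, ?_⟩
        rcases h' with ⟨rfl, rfl⟩ | ⟨rfl, rfl⟩ <;> simp)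
      ⟨x, y, fun h => irr x (h ▸ hxy), 1, G.one_mem, by simp⟩ hs ht
    refine ⟨u, hu, v, hv, ?_, h⟩
    obtain ⟨h, hh, h'⟩ := h
    rcases h' with ⟨rfl, rfl⟩ | ⟨rfl, rfl⟩
    · exact inv h hh _ _ hxy
    · exact symm _ _ (inv h hh _ _ hxy)
  have edgeB : ∀ x y, N x y → ∃ u ∈ B, ∃ v ∈ A,
      N u v ∧ ∃ h ∈ G, (h x = u ∧ h y = v) ∨ (h x = v ∧ h y = u) := by
    intro x y hxy
    obtain ⟨u, hu, v, hv, h, h'⟩ := edge B ⟨β₀, hβ₀⟩ ⟨α₀, hAB hα₀⟩ x y hxy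
    refine ⟨u, hu, v, ?_, h, h'⟩
    rcases hT.cover v with h1 | h1 | h1
    exacts [h1, (hv h1).elim, (hBC u hu v h1 h).elim]
  have edgeC : ∀ x y, N x y → ∃ u ∈ C, ∃ v ∈ A,
      N u v ∧ ∃ h ∈ G, (h x = u ∧ h y = v) ∨ (h x = v ∧ h y = u) := by
    intro x y hxy
    obtain ⟨u, hu, v, hv, h, h'⟩ := edge C ⟨γ₀, hγ₀⟩ ⟨α₀, hAC hα₀⟩ x y hxy
    refine ⟨u, hu, v, ?_, h, h'⟩
    rcases hT.cover v with h1 | h1 | h1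
    exacts [h1, (hBC v h1 u hu (symm _ _ h)).elim, (hv h1).elim]
  -- the parameters
  obtain ⟨X, hX⟩ : ∃ X, ∀ x ∈ B, #{y ∈ A | N x y} = X := ⟨_, fun x hx =>
    hT.cycA.card_filter_eq hT.cycB (inv g hg) (inv g⁻¹ (G.inv_mem hg)) hx hβ₀⟩
  obtain ⟨Y, hY⟩ : ∃ X, ∀ x ∈ C, #{y ∈ A | N x y} = X := ⟨_, fun x hx =>
    hT.cycA.card_filter_eq hT.cycC (inv g hg) (inv g⁻¹ (G.inv_mem hg)) hx hγ₀⟩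
  obtain ⟨q, hq⟩ : ∃ X, ∀ x ∈ A, #{y ∈ B | N x y} = X := ⟨_, fun x hx =>
    hT.cycB.card_filter_eq hT.cycA (inv g hg) (inv g⁻¹ (G.inv_mem hg)) hx hα₀⟩
  obtain ⟨p, hp⟩ : ∃ X, ∀ x ∈ A, #{y ∈ C | N x y} = X := ⟨_, fun x hx =>
    hT.cycC.card_filter_eq hT.cycA (inv g hg) (inv g⁻¹ (G.inv_mem hg)) hx hα₀⟩
  have hXq : #B * X = #A * q := card_mul_card_filter_eq symm hX hq
  have hYp : #C * Y = #A * p := card_mul_card_filter_eq symm hY hp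
  have hXpos : 0 < X := by
    obtain ⟨x, y, hxy⟩ := hne
    obtain ⟨u, hu, v, hv, h, -⟩ := edgeB x y hxy
    rw [← hX u hu]
    exact card_pos.2 ⟨v, by simp [hv, h]⟩
  have hapos : 0 < #A := card_pos.2 ⟨α₀, hα₀⟩
  have hqpos : 0 < q := by
    by_contra h
    have : q = 0 := by omega
    rw [this] at hXq
    have : 0 < #B * X := Nat.mul_pos (by omega) hXpos
    omega
  have hneBC : ∀ {x y}, x ∈ B → y ∈ C → x ≠ y := fun hx hy h => hBC' hx (h ▸ hy)
  obtain ⟨μ, hμ⟩ : ∃ μ, ∀ x y, x ≠ y → ¬ N x y → #{z | N x z ∧ N y z} = μ := by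
    refine ⟨#{z | N β₀ z ∧ N γ₀ z}, fun x y hxy hN => ?_⟩
    obtain ⟨h, hh, h' | h'⟩ := orb x y β₀ γ₀ hxy hN (hneBC hβ₀ hγ₀) (hBC _ hβ₀ _ hγ₀)
    · rw [← h'.1, ← h'.2]
      exact card_filter_eq_of_perm h _ _ fun z => and_congr (inv' h hh _ _) (inv' h hh _ _)
    · rw [← h'.1, ← h'.2]
      refine card_filter_eq_of_perm h _ _ fun z => ?_
      rw [and_comm]
      exact and_congr (inv' h hh _ _) (inv' h hh _ _)
  have nbC : ∀ γ ∈ C, ∀ z, N γ z → z ∉ B := fun γ hγ z hz hB => hBC z hB γ hγ (symm _ _ hz)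
  have nbB : ∀ β ∈ B, ∀ z, N β z → z ∉ C := fun β hβ z hz hC => hBC β hβ z hC hz
  have hμXY : #A * μ = X * Y := by
    have h1 : ∑ β ∈ B, ∑ γ ∈ C, #{z ∈ A | N β z ∧ N γ z} = #B * (#C * μ) := by
      rw [sum_const_nat (m := #C * μ)]
      intro β hβ
      rw [sum_const_nat (m := μ)]
      intro γ hγ
      rw [← hμ β γ (hneBC hβ hγ) (hBC _ hβ _ hγ)]
      congr 1
      ext z
      simp only [mem_filter, mem_univ, true_and, and_iff_right_iff_imp]
      rintro ⟨h1, h2⟩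
      rcases hT.cover z with h | h | h
      exacts [h, (nbC γ hγ z h2 h).elim, (nbB β hβ z h1 h).elim]
    have h2 : ∑ β ∈ B, ∑ γ ∈ C, #{z ∈ A | N β z ∧ N γ z} = #A * (q * p) := by
      have : ∀ β ∈ B, ∑ γ ∈ C, #{z ∈ A | N β z ∧ N γ z} = #{z ∈ A | N β z} * p := by
        intro β hβ
        have := Finset.sum_card_bipartiteAbove_eq_sum_card_bipartiteBelow N (s := C)
          (t := {z ∈ A | N β z})
        simp only [Finset.bipartiteAbove, Finset.bipartiteBelow, filter_filter] at this
        rw [this]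
        apply sum_const_nat
        intro z hz
        rw [mem_filter] at hz
        rw [← hp z hz.1]
        congr 1
        ext y
        simp only [mem_filter]
        exact and_congr_right fun _ => ⟨symm _ _, symm _ _⟩
      rw [sum_congr rfl this, ← sum_mul, sum_congr rfl hX, sum_const, smul_eq_mul, hXq]
      ring
    have h3 : (#B * #C) * (#A * (#A * μ)) = (#B * #C) * (#A * (X * Y)) := by
      calc (#B * #C) * (#A * (#A * μ)) = #A * (#A * (#B * (#C * μ))) := by ring
        _ = (#A * q) * (#A * p) * #A := by rw [← h1, h2]; ring
        _ = _ := by rw [← hXq, ← hYp]; ring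
    have h4 := Nat.eq_of_mul_eq_mul_left (Nat.mul_pos (by omega) (by omega)) h3
    exact Nat.eq_of_mul_eq_mul_left hapos h4
  have hXa : X ≤ #A := by rw [← hX β₀ hβ₀]; exact card_filter_le _ _
  have hYa : Y < #A := by
    refine lt_of_le_of_ne (by rw [← hY γ₀ hγ₀]; exact card_filter_le _ _) fun hYa => ?_
    have hall : ∀ γ ∈ C, ∀ z ∈ A, N γ z := by
      intro γ hγ
      have := hY γ hγ
      rw [hYa] at this
      exact filter_card_eq this
    have hR : ∀ x y, N x y → #{z | z ≠ x ∧ ¬ N x z ∧ z ≠ y ∧ ¬ N y z} = #B - q := by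
      intro x y hxy
      obtain ⟨u, hu, v, hv, huv, h, hh, h'⟩ := edgeC x y hxy
      have key : #{z | z ≠ u ∧ ¬ N u z ∧ z ≠ v ∧ ¬ N v z} = #B - q := by
        rw [← hq v hv]
        have := card_filter_add_card_filter_not (s := B) (fun z => N v z)
        rw [← this, Nat.add_sub_cancel_left]
        congr 1
        ext z
        simp only [mem_filter, mem_univ, true_and]
        constructor
        · rintro ⟨h1, h2, h3, h4⟩
          refine ⟨?_, h4⟩
          rcases hT.cover z with h | h | h
          exacts [(h2 (hall _ hu _ h)).elim, h, (h4 (symm _ _ (hall _ h _ hv))).elim]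
        · rintro ⟨h1, h2⟩
          refine ⟨fun h => hBC' h1 (h ▸ hu), fun h => nbC _ hu _ h h1, fun h => ?_, h2⟩
          subst h
          exact hAB hv h1
      rw [← key]
      rcases h' with ⟨rfl, rfl⟩ | ⟨rfl, rfl⟩
      · exact card_filter_eq_of_perm h _ _ fun z => by
          simp only [ne_eq, EmbeddingLike.apply_eq_iff_eq, ← inv' h hh]
      · exact card_filter_eq_of_perm h _ _ fun z => by
          simp only [ne_eq, EmbeddingLike.apply_eq_iff_eq, ← inv' h hh]
          tauto
    have hCC : ∀ γ ∈ C, ∀ γ' ∈ C, ¬ N γ γ' := by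
      intro γ hγ γ' hγ' hN
      have h1 := hR _ _ hN
      have h2 : #B ≤ #{z | z ≠ γ ∧ ¬ N γ z ∧ z ≠ γ' ∧ ¬ N γ' z} := by
        apply card_le_card
        intro z hz
        simp only [mem_filter, mem_univ, true_and]
        exact ⟨hneBC hz hγ, fun h => nbC _ hγ _ h hz, hneBC hz hγ', fun h => nbC _ hγ' _ h hz⟩
      omega
    obtain ⟨γ, hγ, γ', hγ', hγγ⟩ := one_lt_card.1 hc
    have h1 := hμ γ γ' hγγ (hCC _ hγ _ hγ')
    have h2 : #A ≤ μ := by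
      rw [← h1]
      apply card_le_card
      intro z hz
      simp only [mem_filter, mem_univ, true_and]
      exact ⟨hall _ hγ _ hz, hall _ hγ' _ hz⟩
    have h3 : #A ≤ X := by
      rw [hYa] at hμXY
      have : #A * μ = #A * X := by rw [hμXY]; ring
      have := Nat.eq_of_mul_eq_mul_left hapos this
      omega
    have hallB : ∀ β ∈ B, ∀ z ∈ A, N β z := by
      intro β hβ
      have := hX β hβ
      rw [le_antisymm hXa h3] at this
      exact filter_card_eq this
    obtain ⟨u, hu, v, hv, huv⟩ := hG.exists_crossing (P := fun u v => u ≠ v ∧ ¬ N u v)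
      (fun x y h => ⟨h.1.symm, fun h' => h.2 (symm _ _ h')⟩)
      (fun h hh x y h' => ⟨by simpa using h'.1, by rw [← inv' h hh]; exact h'.2⟩)
      ⟨β₀, γ₀, hneBC hβ₀ hγ₀, hneBC hβ₀ hγ₀, hBC _ hβ₀ _ hγ₀⟩ (S := (A : Set α)) hα₀
      (fun h => hAB h hβ₀)
    rcases hT.cover v with h | h | h
    exacts [hv h, huv.2 (symm _ _ (hallB _ h _ hu)), huv.2 (symm _ _ (hall _ h _ hu))]
  -- two vertices of `B` with the same neighbours in `A` are adjacent
  have hadj : ∀ β ∈ B, ∀ β' ∈ B, β ≠ β' → (∀ z ∈ A, N β z ↔ N β' z) → N β β' := by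
    intro β hβ β' hβ' hββ hz
    by_contra hN
    have h1 : X ≤ μ := by
      rw [← hμ β β' hββ hN, ← hX β hβ]
      apply card_le_card
      intro z hz'
      simp only [mem_filter, mem_univ, true_and] at hz' ⊢
      exact ⟨hz'.2, (hz z hz'.1).1 hz'.2⟩
    have h2 : #A * X ≤ X * Y := by rw [← hμXY]; exact Nat.mul_le_mul_left _ h1
    have h3 : X * Y < X * #A := Nat.mul_lt_mul_of_pos_left hYa hXpos
    rw [mul_comm X #A] at h3
    omega
  obtain ⟨deg, hdeg⟩ : ∃ k, ∀ x, #{z | N x z} = k := by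
    refine ⟨#{z | N α₀ z}, fun w => ?_⟩
    obtain ⟨h, hh, hw⟩ := hG.trans w α₀
    rw [← hw]
    exact card_filter_eq_of_perm h _ _ (inv' h hh w)
  have hδsymm : ∀ x y, N x y → #{z | N x z ∧ z ≠ y ∧ ¬ N y z} =
      #{z | N y z ∧ z ≠ x ∧ ¬ N x z} := by
    have key : ∀ x y, N x y →
        #{z | N x z ∧ z ≠ y ∧ ¬ N y z} + 1 + #{z | N x z ∧ N y z} = deg := by
      intro x y hxy
      rw [← hdeg x, ← card_filter_add_card_filter_not (s := ({z | N x z} : Finset α))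
        (fun z => N y z), filter_filter, filter_filter, add_comm]
      congr 1
      have : ({z | N x z ∧ ¬ N y z} : Finset α) =
          insert y ({z | N x z ∧ z ≠ y ∧ ¬ N y z} : Finset α) := by
        ext z
        simp only [mem_filter, mem_univ, true_and, mem_insert]
        constructor
        · intro h; by_cases hz : z = y <;> tauto
        · rintro (rfl | h)
          exacts [⟨hxy, irr _⟩, ⟨h.1, h.2.2⟩]
      rw [this, card_insert_of_notMem (by simp)]
    intro x y hxy
    have h1 := key x y hxy
    have h2 := key y x (symm _ _ hxy)
    simp only [and_comm (a := N y _) (b := N x _)] at h2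
    omega
  have hδ : ∀ x y, N x y → q ≤ #{z | N x z ∧ z ≠ y ∧ ¬ N y z} := by
    intro x y hxy
    obtain ⟨u, hu, v, hv, huv, h, hh, h'⟩ := edgeC x y hxy
    have key : q ≤ #{z | N v z ∧ z ≠ u ∧ ¬ N u z} := by
      rw [← hq v hv]
      apply card_le_card
      intro z hz
      simp only [mem_filter, mem_univ, true_and] at hz ⊢
      exact ⟨hz.2, hneBC hz.1 hu, fun h => nbC _ hu _ h hz.1⟩
    refine key.trans ?_
    rcases h' with ⟨rfl, rfl⟩ | ⟨rfl, rfl⟩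
    · rw [hδsymm x y hxy]
      exact (card_filter_eq_of_perm h _ _ fun z => by
          simp only [ne_eq, EmbeddingLike.apply_eq_iff_eq, ← inv' h hh]).ge
    · exact (card_filter_eq_of_perm h _ _ fun z => by
          simp only [ne_eq, EmbeddingLike.apply_eq_iff_eq, ← inv' h hh]).ge
  set e := Nat.gcd #A #B with he_def
  have hepos : 0 < e := Nat.gcd_pos_of_pos_left _ hapos
  obtain ⟨a', ha'⟩ : e ∣ #A := Nat.gcd_dvd_left _ _
  obtain ⟨b', hb'⟩ : e ∣ #B := Nat.gcd_dvd_right _ _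
  have hcop : Nat.Coprime b' a' := by
    have h := Nat.gcd_mul_left e a' b'
    rw [← ha', ← hb', ← he_def] at h
    have : e * 1 = e * a'.gcd b' := by rw [mul_one]; exact h
    exact (Nat.gcd_comm _ _).trans (Nat.eq_of_mul_eq_mul_left hepos this).symm
  have hb'5 : 5 ≤ b' := by
    by_contra h
    have : e * b' ≤ 4 * 4 := Nat.mul_le_mul he (by omega)
    omega
  have hbq : b' ≤ q := by
    rw [ha', hb', mul_assoc, mul_assoc] at hXq
    have h1 := Nat.eq_of_mul_eq_mul_left hepos hXq
    exact Nat.le_of_dvd hqpos (hcop.dvd_of_dvd_mul_left ⟨X, h1.symm⟩)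
  -- the `g ^ #A`-orbit of `β₀`
  let c : ℕ → α := fun i => (g ^ (#A * i)) β₀
  have hcB : ∀ i, c i ∈ B := fun i => by
    have := (hT.cycB.1.perm_pow (#A * i)).mapsTo (x := β₀) hβ₀
    exact this
  have hcA : ∀ i, ∀ z ∈ A, N β₀ z ↔ N (c i) z := by
    intro i z hz
    rw [inv' (g ^ (#A * i)) (G.pow_mem hg _) β₀ z]
    have : (g ^ (#A * i)) z = z := (hT.cycA.pow_apply_eq hz).2 (dvd_mul_right _ _)
    rw [this]
  have hcinj : ∀ i < b', ∀ j < b', c i = c j → i = j := by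
    intro i hi j hj hij
    have h1 := (hT.cycB.pow_apply_eq_pow_apply hβ₀).1 hij
    rw [ha', hb', mul_assoc, mul_assoc] at h1
    have h2 := Nat.ModEq.mul_left_cancel' hepos.ne' h1
    have h3 := Nat.ModEq.cancel_left_of_coprime hcop h2
    exact Nat.ModEq.eq_of_lt_of_lt h3 hi hj
  let Cl : Finset α := (range b').image c
  have hClcard : #Cl = b' := by
    rw [card_image_of_injOn, card_range]
    intro i hi j hj
    exact hcinj i (by simpa using hi) j (by simpa using hj)
  have hClB : Cl ⊆ B := by
    intro z hz
    obtain ⟨i, -, rfl⟩ := mem_image.1 hz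
    exact hcB i
  have hClA : ∀ u ∈ Cl, ∀ v ∈ Cl, ∀ z ∈ A, N u z ↔ N v z := by
    intro u hu v hv z hz
    obtain ⟨i, -, rfl⟩ := mem_image.1 hu
    obtain ⟨j, -, rfl⟩ := mem_image.1 hv
    rw [← hcA i z hz, ← hcA j z hz]
  let M : Finset α := (range 5).image c
  have hMcard : #M = 5 := by
    rw [card_image_of_injOn, card_range]
    intro i hi j hj
    simp only [coe_range, Set.mem_Iio] at hi hj
    exact hcinj i (by omega) j (by omega)
  have hMCl : M ⊆ Cl := image_subset_image (range_subset_range.2 hb'5)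
  let D : Finset α := B \ Cl
  have hDcard : #D + b' = e * b' := by
    rw [← hb', ← hClcard, card_sdiff_of_subset hClB]
    exact Nat.sub_add_cancel (card_le_card hClB)
  have hlow : ∀ u ∈ M, ∀ v ∈ M, u ≠ v → b' ≤ #{z ∈ D | N u z ∧ ¬ N v z} := by
    intro u hu v hv huv
    have hN := hadj u (hClB (hMCl hu)) v (hClB (hMCl hv)) huv
      (hClA u (hMCl hu) v (hMCl hv))
    refine (hbq.trans (hδ u v hN)).trans (card_le_card ?_)
    intro z hz
    simp only [mem_filter, mem_univ, true_and] at hz ⊢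
    refine ⟨?_, hz.1, hz.2.2⟩
    rcases hT.cover z with h | h | h
    · exact (hz.2.2 ((hClA u (hMCl hu) v (hMCl hv) z h).1 hz.1)).elim
    · refine mem_sdiff.2 ⟨h, fun hCl => hz.2.2 ?_⟩
      exact hadj v (hClB (hMCl hv)) z h hz.2.1.symm (hClA v (hMCl hv) z hCl)
    · exact (nbB u (hClB (hMCl hu)) z hz.1 h).elim
  have hsum1 : 20 * b' ≤ ∑ P ∈ M.offDiag, #{z ∈ D | N P.1 z ∧ ¬ N P.2 z} := by
    have h20 : #M.offDiag = 20 := by rw [offDiag_card, hMcard]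
    rw [← h20, ← smul_eq_mul]
    apply card_nsmul_le_sum
    intro P hP
    rw [mem_offDiag] at hP
    exact hlow _ hP.1 _ hP.2.1 hP.2.2
  have hsum2 : ∑ P ∈ M.offDiag, #{z ∈ D | N P.1 z ∧ ¬ N P.2 z} ≤ #D * 6 := by
    have := Finset.sum_card_bipartiteAbove_eq_sum_card_bipartiteBelow
      (fun (P : α × α) z => N P.1 z ∧ ¬ N P.2 z) (s := M.offDiag) (t := D)
    simp only [Finset.bipartiteAbove, Finset.bipartiteBelow] at this
    rw [this, ← smul_eq_mul]
    apply sum_le_card_nsmul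
    intro z hz
    have h1 : ({P ∈ M.offDiag | N P.1 z ∧ ¬ N P.2 z} : Finset (α × α)) ⊆
        ({u ∈ M | N u z} : Finset α) ×ˢ ({u ∈ M | ¬ N u z} : Finset α) := by
      intro P hP
      simp only [mem_filter, mem_offDiag, mem_product] at hP ⊢
      tauto
    have h2 := card_filter_add_card_filter_not (s := M) (fun u => N u z)
    rw [hMcard] at h2
    refine (card_le_card h1).trans ?_
    rw [card_product]
    have h3 : #({u ∈ M | N u z} : Finset α) ≤ 5 := by omega
    exact mul_le_six_of_add_eq_five h2
  have h4 : e * b' ≤ 4 * b' := Nat.mul_le_mul_right _ he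
  omega

open Classical in
theorem PermPrim.twoTrans (hG : PermPrim G) (hg : g ∈ G) (hT : IsTriCycle g A B C)
    (hA : A.Nonempty) (hb : 16 < #B) (hc : 2 ≤ #C) (he : Nat.gcd #A #B ≤ 4)
    (hbc : Nat.Coprime #B #C) : PermTwoTrans G := by
  obtain ⟨β₀, hβ₀⟩ : B.Nonempty := card_pos.1 (by omega)
  obtain ⟨γ₀, hγ₀⟩ : C.Nonempty := card_pos.1 (by omega)
  let E : α → α → Prop := fun x y => ∃ h ∈ G, h β₀ = x ∧ h γ₀ = y
  have hEinv : ∀ h ∈ G, ∀ x y, E x y → E (h x) (h y) := by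
    rintro k hk x y ⟨h, hh, rfl, rfl⟩
    exact ⟨k * h, G.mul_mem hk hh, by simp⟩
  have hEorb : ∀ x y u v, E x y → E u v → ∃ h ∈ G, h x = u ∧ h y = v := by
    rintro x y u v ⟨h, hh, rfl, rfl⟩ ⟨k, hk, rfl, rfl⟩
    exact ⟨k * h⁻¹, G.mul_mem hk (G.inv_mem hh), by simp⟩
  have hEBC : ∀ β ∈ B, ∀ γ ∈ C, E β γ := by
    intro β hβ γ hγ
    obtain ⟨t, ht⟩ := hT.cycB.exists_pow_eq_pair hT.cycC hbc hβ₀ hβ hγ₀ hγ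
    exact ⟨g ^ t, G.pow_mem hg t, ht⟩
  have tot : ∀ x y, x ≠ y → E x y ∨ E y x := by
    by_contra! hne
    obtain ⟨x, y, hxy, h1, h2⟩ := hne
    obtain ⟨β, hβ, γ, hγ, h⟩ := hG.graph_edge hg hT hA hb hc he
      (N := fun x y => x ≠ y ∧ ¬ E x y ∧ ¬ E y x)
      (fun x y h => ⟨h.1.symm, h.2.2, h.2.1⟩) (fun x h => h.1 rfl)
      (fun h hh x y hN => by
        have : ∀ x y, E (h x) (h y) → E x y := fun x y h' => by
          simpa using hEinv h⁻¹ (G.inv_mem hh) _ _ h'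
        exact ⟨by simpa using hN.1, fun h' => hN.2.1 (this _ _ h'), fun h' => hN.2.2 (this _ _ h')⟩)
      (fun x y u v hxy h1 huv h2 => by
        have h1 : E x y ∨ E y x := by tauto
        have h2 : E u v ∨ E v u := by tauto
        rcases h1 with h1 | h1 <;> rcases h2 with h2 | h2
        · obtain ⟨h, hh, h3⟩ := hEorb _ _ _ _ h1 h2; exact ⟨h, hh, .inl h3⟩
        · obtain ⟨h, hh, h3⟩ := hEorb _ _ _ _ h1 h2; exact ⟨h, hh, .inr h3⟩
        · obtain ⟨h, hh, h3⟩ := hEorb _ _ _ _ h1 h2; exact ⟨h, hh, .inr h3.symm⟩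
        · obtain ⟨h, hh, h3⟩ := hEorb _ _ _ _ h1 h2; exact ⟨h, hh, .inl h3.symm⟩)
      ⟨x, y, hxy, h1, h2⟩
    exact h.2.1 (hEBC β hβ γ hγ)
  by_cases hsym : ∃ x y, E x y ∧ E y x
  · obtain ⟨x, y, h1, h2⟩ := hsym
    have hsymm : ∀ u v, E u v → E v u := by
      intro u v huv
      obtain ⟨h, hh, rfl, rfl⟩ := hEorb _ _ _ _ h1 huv
      exact hEinv h hh _ _ h2
    have all : ∀ u v, u ≠ v → E u v := fun u v huv => (tot u v huv).elim id (hsymm v u)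
    exact fun x y u v hxy huv => hEorb _ _ _ _ (all x y hxy) (all u v huv)
  · push Not at hsym
    exfalso
    refine not_tournament_of_arc_orbit (B := B) hG.trans hEinv hEorb tot
      hsym (x := β₀) (x' := (g ^ #A) β₀) (y := γ₀) ?_ (fun z hz => hEBC z hz γ₀ hγ₀) ?_
    · intro h
      have := (hT.cycB.pow_apply_eq hβ₀).1 h.symm
      rw [Nat.gcd_eq_right this] at he
      omega
    · intro z hz
      rcases hT.cover z with h | h | h
      · have h1 : (g ^ #A) z = z := (hT.cycA.pow_apply_eq h).2 dvd_rfl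
        constructor
        · intro h'
          have := hEinv (g ^ #A) (G.pow_mem hg _) _ _ h'
          rwa [h1] at this
        · intro h'
          have := hEinv (g ^ #A)⁻¹ (G.inv_mem (G.pow_mem hg _)) _ _ h'
          rw [Perm.inv_eq_iff_eq.2 h1.symm] at this
          simpa using this
      · exact (hz h).elim
      · have h1 : (g ^ #A) β₀ ∈ B := (hT.cycB.1.perm_pow #A).mapsTo (x := β₀) hβ₀
        exact iff_of_true (hEBC _ hβ₀ _ h) (hEBC _ h1 _ h)

end TwoTrans

section Bochert

variable {α : Type*} [Fintype α] [DecidableEq α] {G : Subgroup (Perm α)}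

theorem PermTwoTrans.isPreprimitive (hG : PermTwoTrans G) : MulAction.IsPreprimitive G α :=
  MulAction.isPreprimitive_of_is_two_pretransitive <| MulAction.is_two_pretransitive_iff.2 <| by
    intro a b c d hab hcd
    obtain ⟨h, hh, h1, h2⟩ := hG a b c d hab hcd
    exact ⟨⟨h, hh⟩, h1, h2⟩

open Classical in
theorem PermTwoTrans.exists_sum_eq (hG : PermTwoTrans G) :
    ∃ c : ℕ, 0 < c ∧ ∀ (F : α → α → ℤ) (x y : α), x ≠ y →
      ∑ h ∈ (univ : Finset (Perm α)) with h ∈ G, F (h x) (h y) = c * ∑ u, ∑ v, if u ≠ v then F u v else 0 := by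
  by_cases hne : ∃ x y : α, x ≠ y
  swap
  · push Not at hne
    exact ⟨1, one_pos, fun F x y hxy => (hxy (hne x y)).elim⟩
  obtain ⟨x₀, y₀, hxy₀⟩ := hne
  refine ⟨#{h : Perm α | h ∈ G ∧ h x₀ = x₀ ∧ h y₀ = y₀},
    card_pos.2 ⟨1, by simp [G.one_mem]⟩, fun F x y hxy => ?_⟩
  have key : ∀ u v, u ≠ v → #{h : Perm α | h ∈ G ∧ h x = u ∧ h y = v} =
      #{h : Perm α | h ∈ G ∧ h x₀ = x₀ ∧ h y₀ = y₀} := by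
    intro u v huv
    obtain ⟨k, hk, hk1, hk2⟩ := hG u v x₀ y₀ huv hxy₀
    obtain ⟨l, hl, hl1, hl2⟩ := hG x₀ y₀ x y hxy₀ hxy
    refine Finset.card_equiv ((Equiv.mulLeft k).trans (Equiv.mulRight l)) fun h => ?_
    simp only [mem_filter, mem_univ, true_and, trans_apply, coe_mulLeft, coe_mulRight,
      Perm.mul_apply, hl1, hl2]
    refine and_congr ?_ (and_congr ?_ ?_)
    · rw [G.mul_mem_cancel_right hl, G.mul_mem_cancel_left hk]
    · rw [← hk1]; simp
    · rw [← hk2]; simp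
  have h1 : ∀ h ∈ ({h : Perm α | h ∈ G} : Finset (Perm α)), F (h x) (h y) =
      ∑ u, ∑ v, if h x = u ∧ h y = v then F u v else 0 := by
    intro h _
    simp [ite_and]
  rw [sum_congr rfl h1, sum_comm, mul_sum]
  refine sum_congr rfl fun u _ => ?_
  rw [sum_comm, mul_sum]
  refine sum_congr rfl fun v _ => ?_
  rw [← sum_filter, sum_const, filter_filter, nsmul_eq_mul]
  split_ifs with huv
  · rw [key u v huv]
  · push Not at huv
    subst huv
    have : ({h : Perm α | h ∈ G ∧ h x = u ∧ h y = u} : Finset (Perm α)) = ∅ := by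
      rw [filter_eq_empty_iff]
      rintro h - ⟨-, h2, h3⟩
      exact hxy (h.injective (h2.trans h3.symm))
    simp [this]

theorem Equiv.Perm.card_support_commutator_le (x y : Perm α) :
    #(x * y * x⁻¹ * y⁻¹).support ≤ 3 * #(x.support ∩ y.support) := by
  set D := x.support ∩ y.support with hD
  have : (x * y * x⁻¹ * y⁻¹).support ⊆ D ∪ (D.image x ∪ D.image y) := by
    intro z
    contrapose!
    intro hz
    simp only [mem_union, mem_image, not_or, not_exists, not_and] at hz
    obtain ⟨h1, h2, h3⟩ := hz
    have hx : x⁻¹ z ∉ D := fun h => h2 _ h (by simp)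
    have hy : y⁻¹ z ∉ D := fun h => h3 _ h (by simp)
    simp only [hD, mem_inter, not_and_or, Perm.mem_support, not_not] at h1 hx hy
    rw [Perm.notMem_support]
    have e : ∀ {w : Perm α} {v}, w v = v ↔ w⁻¹ v = v := fun {w v} => by
      rw [Perm.inv_eq_iff_eq, eq_comm]
    suffices x⁻¹ (y⁻¹ z) = y⁻¹ (x⁻¹ z) by
      simp only [Perm.mul_apply, this]; simp
    by_cases hzx : x z = z
    · have hzx' := e.1 hzx
      rw [hzx']
      rcases hy with hy | hy
      · exact e.1 hy
      · have : y⁻¹ z = z := by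
          have := congrArg (fun w => y⁻¹ w) hy
          simpa using this.symm
        rw [this, hzx']
    · have hyz : y⁻¹ z = z := e.1 (h1.resolve_left hzx)
      rw [hyz]
      rcases hx with hx | hx
      · have : x⁻¹ z = z := by
          have := congrArg (fun w => x⁻¹ w) hx
          simpa using this.symm
        exact (hzx (e.2 this)).elim
      · exact (e.1 hx).symm
  calc _ ≤ #(D ∪ (D.image x ∪ D.image y)) := card_le_card this
    _ ≤ #D + (#(D.image x) + #(D.image y)) := by
      exact (card_union_le _ _).trans (Nat.add_le_add_left (card_union_le _ _) _)
    _ ≤ #D + (#D + #D) :=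
      Nat.add_le_add_left (Nat.add_le_add card_image_le card_image_le) _
    _ = 3 * #D := by ring

open Classical in
/-- A Bochert-type bound: the minimal support of a two-transitive group is not small, unless the
group contains a transposition or a three-cycle. -/
theorem PermTwoTrans.card_support_bound (hG : PermTwoTrans G) {x : Perm α} (hx : x ∈ G)
    (hx1 : x ≠ 1)
    (hmin : ∀ y ∈ G, y ≠ 1 → #x.support ≤ #y.support)
    {n m : ℤ}
    (hn : n = Fintype.card α) (hm : m = (#x.support : ℕ)) (hmn : 3 * m < n) :
    m * (n - 3 * m) ^ 2 ≤ 3 * n * (n - m) := by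
  set Δ := x.support with hΔ
  have hΔpos : 0 < #Δ := Nat.pos_of_ne_zero fun h => hx1 (Perm.card_support_eq_zero.1 h)
  have hm0 : 0 < m := by omega
  obtain ⟨c, hc, hF⟩ := hG.exists_sum_eq
  set S : Finset (Perm α) := {h : Perm α | h ∈ G} with hS
  let I : Perm α → ℤ := fun h => ∑ ω ∈ Δ, if h ω ∈ Δ then 1 else 0
  let J : Perm α → ℤ := fun h => ∑ ω ∈ Δ, if h ω ∈ Δ ∧ h (x ω) ∈ Δᶜ then 1 else 0
  have hIcard : ∀ h, I h = #{ω ∈ Δ | h ω ∈ Δ} := fun h => by simp [I]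
  have hJcard : ∀ h, J h = #{ω ∈ Δ | h ω ∈ Δ ∧ h (x ω) ∈ Δᶜ} := fun h => by simp [J]
  have pt : ∀ h ∈ S, J h * (m * (n - 3 * m) ^ 2) ≤ 3 * (n * I h - m ^ 2) ^ 2 := by
    intro h hh
    rw [hS, mem_filter] at hh
    by_cases hJ : J h = 0
    · rw [hJ, zero_mul]; positivity
    have hJI : J h ≤ I h := by
      rw [hIcard, hJcard]
      exact_mod_cast card_le_card fun z hz => by
        simp only [mem_filter] at hz ⊢; exact ⟨hz.1, hz.2.1⟩
    have h3 : m ≤ 3 * I h := by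
      rw [hJcard] at hJ
      obtain ⟨ω, hω⟩ : ({ω ∈ Δ | h ω ∈ Δ ∧ h (x ω) ∈ Δᶜ} : Finset α).Nonempty := by
        rw [nonempty_iff_ne_empty]; intro h0; rw [h0] at hJ; simp at hJ
      rw [mem_filter] at hω
      set y := h⁻¹ * x * h with hy
      have hyG : y ∈ G := G.mul_mem (G.mul_mem (G.inv_mem hh.2) hx) hh.2
      have hysupp : ∀ z, z ∈ y.support ↔ h z ∈ Δ := by
        intro z
        rw [hΔ, Perm.mem_support, Perm.mem_support, hy, Perm.mul_apply, Perm.mul_apply, ne_eq,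
          Perm.inv_eq_iff_eq]
      have hne : x * y * x⁻¹ * y⁻¹ ≠ 1 := by
        intro h1
        have h2 : x * y = y * x := by
          have := congrArg (· * (y * x)) h1
          simpa [mul_assoc] using this
        have h3 : y (x ω) = x ω := by
          by_contra h3
          exact mem_compl.1 hω.2.2 ((hysupp _).1 (Perm.mem_support.2 h3))
        have h4 := congrArg (fun f : Perm α => f ω) h2
        simp only [Perm.mul_apply, h3, EmbeddingLike.apply_eq_iff_eq] at h4
        exact Perm.mem_support.1 ((hysupp ω).2 hω.2.1) h4
      have h5 := hmin _ (G.mul_mem (G.mul_mem (G.mul_mem hx hyG) (G.inv_mem hx))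
        (G.inv_mem hyG)) hne
      have h6 := h5.trans (Perm.card_support_commutator_le x y)
      have h7 : x.support ∩ y.support = {ω ∈ Δ | h ω ∈ Δ} := by
        ext z; rw [mem_inter, mem_filter, hysupp]
      rw [h7] at h6
      rw [hIcard, hm]
      exact_mod_cast h6
    have h4 : 0 ≤ I h := by omega
    have h5 : I h * (m * (n - 3 * m) ^ 2) ≤ 3 * (n * I h - m ^ 2) ^ 2 := by
      generalize I h = i at *
      obtain ⟨d, rfl⟩ : ∃ d, n = 3 * m + d := ⟨n - 3 * m, by ring⟩
      have hd : 0 < d := by omega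
      obtain ⟨e, he⟩ : ∃ e, 3 * i = m + e := ⟨3 * i - m, by ring⟩
      have he0 : 0 ≤ e := by omega
      have : 0 ≤ (3 * m + d) * e := by positivity
      have h6 : 3 * ((3 * m + d) * i - m ^ 2) = d * m + (3 * m + d) * e := by
        linear_combination (3 * m + d) * he
      have h7 : 3 * (i * (m * (3 * m + d - 3 * m) ^ 2)) = (m + e) * m * d ^ 2 := by
        linear_combination (m * d ^ 2) * he
      have h8 : 9 * (3 * ((3 * m + d) * i - m ^ 2) ^ 2) = 3 * (d * m + (3 * m + d) * e) ^ 2 := by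
        rw [← h6]; ring
      have h9 : 9 * (i * (m * (3 * m + d - 3 * m) ^ 2)) ≤
          9 * (3 * ((3 * m + d) * i - m ^ 2) ^ 2) := by
        rw [h8]
        have : 9 * (i * (m * (3 * m + d - 3 * m) ^ 2)) = 3 * ((m + e) * m * d ^ 2) := by
          rw [← h7]; ring
        rw [this]
        have h10 : (m + e) * m * d ^ 2 = (d * m) ^ 2 + d * (d * (m * e)) := by ring
        have h11 : (d * m + (3 * m + d) * e) ^ 2 = (d * m) ^ 2 + d * (d * (m * e)) +
          (d * d * (m * e) + 6 * (d * m * m * e) + ((3 * m + d) * e) ^ 2) := by ring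
        rw [h10, h11]
        have : 0 ≤ (d * d * (m * e) + 6 * (d * m * m * e) + ((3 * m + d) * e) ^ 2) := by positivity
        linarith
      linarith
    exact (mul_le_mul_of_nonneg_right hJI (by positivity)).trans h5
  obtain ⟨x₀, y₀, hxy₀⟩ : ∃ x₀ y₀ : α, x₀ ≠ y₀ := by
    by_contra! h0
    exact hx1 (by ext z; exact h0 _ _)
  -- sums over the group
  have pair : ∀ U V : Finset α, ∀ ω ω', ω ≠ ω' →
      ∑ h ∈ S, (if h ω ∈ U ∧ h ω' ∈ V then (1 : ℤ) else 0) = c * (#U * #V - #(U ∩ V)) := by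
    intro U V ω ω' hω
    rw [hF (fun u v => if u ∈ U ∧ v ∈ V then (1 : ℤ) else 0) ω ω' hω]
    congr 1
    rw [eq_sub_iff_add_eq]
    have hsum : ∀ W : Finset α, (#W : ℤ) = ∑ u, if u ∈ W then (1 : ℤ) else 0 := fun W => by simp
    rw [hsum U, hsum V, hsum (U ∩ V), sum_mul_sum, ← sum_add_distrib]
    refine sum_congr rfl fun u _ => ?_
    have : (if u ∈ U ∩ V then (1 : ℤ) else 0) =
        ∑ v, if u = v then (if u ∈ U ∧ v ∈ V then (1 : ℤ) else 0) else 0 := by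
      simp [mem_inter]
    rw [this, ← sum_add_distrib]
    refine sum_congr rfl fun v _ => ?_
    by_cases h : u = v
    · subst h
      by_cases h1 : u ∈ U <;> by_cases h2 : u ∈ V <;> simp [h1, h2]
    · by_cases h1 : u ∈ U <;> by_cases h2 : v ∈ V <;> simp [h, h1, h2]
  have hnot : (#Δᶜ : ℤ) = n - m := by
    rw [card_compl, Nat.cast_sub (card_le_univ _), hn, hm]
  have huniv : (#(univ : Finset α) : ℤ) = n := by rw [hn, card_univ]
  have s0 : (∑ h ∈ S, (1 : ℤ)) = c * (n * (n - 1)) := by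
    have := pair univ univ x₀ y₀ hxy₀
    simp only [mem_univ, and_self, if_true, inter_univ, huniv] at this
    rw [this]; ring
  have one : ∀ ω, ∑ h ∈ S, (if h ω ∈ Δ then (1 : ℤ) else 0) = c * (m * (n - 1)) := by
    intro ω
    obtain ⟨ω', hω⟩ : ∃ ω', ω ≠ ω' := by
      by_cases h : ω = x₀
      · exact ⟨y₀, h ▸ hxy₀⟩
      · exact ⟨x₀, h⟩
    have := pair Δ univ ω ω' hω
    simp only [mem_univ, and_true, inter_univ, huniv, ← hm] at this
    rw [this]; ring
  have two : ∀ ω ω', ω ≠ ω' → ∑ h ∈ S, (if h ω ∈ Δ ∧ h ω' ∈ Δ then (1 : ℤ) else 0) =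
      c * (m * (m - 1)) := by
    intro ω ω' hω
    rw [pair Δ Δ ω ω' hω, inter_self, ← hm]; ring
  have sI : ∑ h ∈ S, I h = m * (c * (m * (n - 1))) := by
    rw [sum_comm, sum_congr rfl fun ω _ => one ω]
    simp [hm]
  have sJ : ∑ h ∈ S, J h = m * (c * (m * (n - m))) := by
    have : ∀ ω ∈ Δ, ∑ h ∈ S, (if h ω ∈ Δ ∧ h (x ω) ∈ Δᶜ then (1 : ℤ) else 0) =
        c * (m * (n - m)) := by
      intro ω hω
      rw [pair Δ Δᶜ ω (x ω) (Perm.mem_support.1 hω).symm, inter_compl, hnot, ← hm]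
      simp
    rw [sum_comm, sum_congr rfl this]
    simp [hm]
  have sI2 : ∑ h ∈ S, I h ^ 2 = m * (c * (m * (n - 1)) + (m - 1) * (c * (m * (m - 1)))) := by
    have e1 : ∀ h, I h ^ 2 = ∑ ω ∈ Δ, ∑ ω' ∈ Δ, if h ω ∈ Δ ∧ h ω' ∈ Δ then (1 : ℤ) else 0 := by
      intro h
      rw [sq, sum_mul_sum]
      refine sum_congr rfl fun ω _ => sum_congr rfl fun ω' _ => ?_
      by_cases h1 : h ω ∈ Δ <;> by_cases h2 : h ω' ∈ Δ <;> simp [h1, h2]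
    simp only [e1]
    rw [sum_comm]
    have e2 : ∀ ω ∈ Δ, ∑ h ∈ S, ∑ ω' ∈ Δ, (if h ω ∈ Δ ∧ h ω' ∈ Δ then (1 : ℤ) else 0) =
        c * (m * (n - 1)) + (m - 1) * (c * (m * (m - 1))) := by
      intro ω hω
      rw [sum_comm, ← add_sum_erase _ _ hω]
      congr 1
      · simp only [and_self]; exact one ω
      · rw [sum_congr rfl (g := fun _ => (c : ℤ) * (m * (m - 1))) fun ω' hω' =>
          two ω ω' (ne_of_mem_erase hω').symm, sum_const, card_erase_of_mem hω, nsmul_eq_mul,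
          Nat.cast_sub hΔpos, hm]
        simp
    rw [sum_congr rfl e2, sum_const, nsmul_eq_mul, hm]
  have final := sum_le_sum pt
  rw [← sum_mul, sJ] at final
  have e : ∀ h ∈ S, 3 * (n * I h - m ^ 2) ^ 2 =
      3 * n ^ 2 * I h ^ 2 - 6 * n * m ^ 2 * I h + 3 * m ^ 4 * 1 := fun h _ => by ring
  rw [sum_congr rfl e, sum_add_distrib, sum_sub_distrib, ← mul_sum, ← mul_sum, ← mul_sum, s0, sI,
    sI2] at final
  have hc' : (0 : ℤ) < c := by exact_mod_cast hc
  have hpos : 0 < c * m ^ 2 * (n - m) := by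
    have : 0 < n - m := by omega
    positivity
  refine le_of_mul_le_mul_left ?_ hpos
  nlinarith [final]

open Classical in
theorem PermTwoTrans.alternatingGroup_le (hG : PermTwoTrans G) {x : Perm α} (hx : x ∈ G)
    (hx1 : x ≠ 1) (hn : 12 ≤ Fintype.card α)
    (hM : ∀ m : ℕ, 4 ≤ m → m ≤ #x.support → 3 * m < Fintype.card α ∧
      3 * Fintype.card α * (Fintype.card α - m) < m * (Fintype.card α - 3 * m) ^ 2) :
    alternatingGroup α ≤ G := by
  obtain ⟨y, hy, hmin⟩ := Finset.exists_min_image ({y : Perm α | y ∈ G ∧ y ≠ 1} : Finset (Perm α))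
    (fun y => #y.support) ⟨x, by simp [hx, hx1]⟩
  simp only [mem_filter, mem_univ, true_and] at hy hmin
  have hmx := hmin x ⟨hx, hx1⟩
  have h2 := Perm.two_le_card_support_of_ne_one hy.2
  have hprim := hG.isPreprimitive
  by_cases h4 : 4 ≤ #y.support
  · obtain ⟨h5, h6⟩ := hM _ h4 hmx
    have := hG.card_support_bound hy.1 hy.2 (fun z hz hz1 => hmin z ⟨hz, hz1⟩)
      (n := Fintype.card α) (m := #y.support) rfl rfl (by exact_mod_cast h5)
    zify [h5.le, (show #y.support ≤ Fintype.card α by omega)] at h6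
    omega
  · by_cases h3 : #y.support = 3
    · exact Perm.alternatingGroup_le_of_isPreprimitive_of_isThreeCycle_mem hprim
        (card_support_eq_three_iff.1 h3) hy.1
    · have : #y.support = 2 := by omega
      rw [Perm.subgroup_eq_top_of_isPreprimitive_of_isSwap_mem hprim y
        (Perm.card_support_eq_two.1 this) hy.1]
      exact le_top

end Bochert

/-- The arithmetic condition on the cycle lengths `a`, `b`, `c` of a permutation preserving a
system of blocks of size `k` and mixing the first two cycles. -/
def BlockType (k a b c : ℕ) : Prop := k ∣ c ∧ ∃ d, d ∣ a ∧ d ∣ b ∧ d * k = a + b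

section

variable {α : Type*} [Fintype α] [DecidableEq α] {G : Subgroup (Perm α)} {g : Perm α}
  {A B C : Finset α}

theorem IsTriCycle.swap₁₂ (h : IsTriCycle g A B C) : IsTriCycle g B A C :=
  ⟨h.cycB, h.cycA, h.cycC, h.disjAB.symm, h.disjBC, h.disjAC, fun x => by
    have := h.cover x; tauto⟩

theorem IsTriCycle.rotate (h : IsTriCycle g A B C) : IsTriCycle g B C A :=
  ⟨h.cycB, h.cycC, h.cycA, h.disjBC, h.disjAB.symm, h.disjAC.symm, fun x => by
    have := h.cover x; tauto⟩

theorem IsTriCycle.exists_small_support (h : IsTriCycle g A B C) (hg : g ∈ G) (hA : A.Nonempty)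
    (hne : ¬ #A ∣ Nat.gcd #A #B * Nat.gcd #A #C) : ∃ x ∈ G, x ≠ 1 ∧ #x.support ≤ #A := by
  refine ⟨g ^ (#B * #C), G.pow_mem hg _, fun h1 => hne ?_, card_le_card fun z hz => ?_⟩
  · obtain ⟨x, hx⟩ := hA
    have h2 : (g ^ (#B * #C)) x = x := by rw [h1]; rfl
    rw [h.cycA.pow_apply_eq hx] at h2
    exact (Nat.dvd_gcd dvd_rfl h2).trans (Nat.gcd_mul_right_dvd_mul_gcd _ _ _)
  · rw [Perm.mem_support] at hz
    rcases h.cover z with h1 | h1 | h1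
    · exact h1
    · exact (hz ((h.cycB.pow_apply_eq h1).2 (dvd_mul_right _ _))).elim
    · exact (hz ((h.cycC.pow_apply_eq h1).2 (dvd_mul_left _ _))).elim

theorem PermPrim.alternatingGroup_le (hG : PermPrim G) (hg : g ∈ G) (hT : IsTriCycle g A B C)
    (hA : A.Nonempty) (hb : 16 < #B) (hc : 2 ≤ #C) (he : Nat.gcd #A #B ≤ 4)
    (hbc : Nat.Coprime #B #C) {U V W : Finset α} (hU : IsTriCycle g U V W) (hUne : U.Nonempty)
    (hne : ¬ #U ∣ Nat.gcd #U #V * Nat.gcd #U #W) {M : ℕ} (hUM : #U ≤ M) (h4M : 4 ≤ M)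
    (hM : 3 * M < Fintype.card α) (hn : 90 ≤ Fintype.card α)
    (hMn : 3 * Fintype.card α ^ 2 ≤ M * (Fintype.card α - 3 * M) ^ 2) :
    alternatingGroup α ≤ G := by
  obtain ⟨x, hx, hx1, hxU⟩ := hU.exists_small_support hg hUne hne
  refine (hG.twoTrans hg hT hA hb hc he hbc).alternatingGroup_le hx hx1 (by omega) fun m hm4 hm => ?_
  have hmM : m ≤ M := by omega
  refine ⟨by omega, ?_⟩
  generalize Fintype.card α = n at *
  clear hxU hx hx1 hUM hm
  zify [show 3 * m ≤ n by omega, show 3 * M ≤ n by omega, show m ≤ n by omega] at *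
  generalize (n : ℤ) = n at *
  generalize (m : ℤ) = m at *
  generalize (M : ℤ) = M at *
  have h4 : 3 * n ^ 2 ≤ 4 * (n - 12) ^ 2 := by nlinarith
  have hlt : 3 * n * (n - m) < 3 * n ^ 2 := by nlinarith
  by_contra! hcon
  have hf4 : (m - 4) * (n ^ 2 - 6 * n * (m + 4) + 9 * (m ^ 2 + 4 * m + 16)) < 0 := by nlinarith
  have hfM : (M - m) * (n ^ 2 - 6 * n * (m + M) + 9 * (m ^ 2 + m * M + M ^ 2)) > 0 := by nlinarith
  have q4 : n ^ 2 - 6 * n * (m + 4) + 9 * (m ^ 2 + 4 * m + 16) < 0 := by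
    by_contra! h
    have := mul_nonneg (sub_nonneg.2 hm4) h
    linarith
  have qM : 0 < n ^ 2 - 6 * n * (m + M) + 9 * (m ^ 2 + m * M + M ^ 2) := by
    by_contra! h
    have := mul_nonneg (sub_nonneg.2 hmM) (neg_nonneg.2 h)
    linarith
  have qn : -(3 * m * (n - 3 * m)) ≤ 0 := by
    have : 0 ≤ 3 * m * (n - 3 * m) := mul_nonneg (by linarith) (by linarith)
    linarith
  have e1 : 0 < (n - 12) * (n ^ 2 - 6 * n * (m + M) + 9 * (m ^ 2 + m * M + M ^ 2)) :=
    mul_pos (by linarith) qM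
  have e2 : (n - 3 * M) * (n ^ 2 - 6 * n * (m + 4) + 9 * (m ^ 2 + 4 * m + 16)) ≤ 0 :=
    mul_nonpos_of_nonneg_of_nonpos (by linarith) q4.le
  have e3 : (M - 4) * (-(3 * m * (n - 3 * m))) ≤ 0 :=
    mul_nonpos_of_nonneg_of_nonpos (by linarith) qn
  have e4 : 0 ≤ (M - 4) * (n - 3 * M) * (n - 12) :=
    mul_nonneg (mul_nonneg (by linarith) (by linarith)) (by linarith)
  nlinarith

open Classical in
/-- Cycle lengths of a product of three cycles in a transitive imprimitive group. -/
theorem IsTriCycle.exists_blockType (hT : IsTriCycle g A B C) (hg : g ∈ G)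
    (trans : ∀ x y, ∃ h ∈ G, h x = y) (hG : ¬ PermPrim G)
    (hA : A.Nonempty) (hB : B.Nonempty) (hC : C.Nonempty)
    (hgcd : ∀ m, m ∣ #A → m ∣ #B → m ∣ #C → m = 1) :
    ∃ k, 1 < k ∧ k < Fintype.card α ∧
      (BlockType k #A #B #C ∨ BlockType k #B #C #A ∨ BlockType k #C #A #B) := by
  obtain ⟨r, hr, ⟨x₀, y₀, hxy₀, hr₀⟩, hnt⟩ : ∃ r : Setoid α,
      (∀ h ∈ G, ∀ x y, r x y → r (h x) (h y)) ∧ (∃ x y, x ≠ y ∧ r x y) ∧ ∃ x y, ¬ r x y := by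
    by_contra! hcon
    exact hG ⟨trans, hcon⟩
  have hr' : ∀ h ∈ G, ∀ x y, r x y ↔ r (h x) (h y) := fun h hh x y =>
    ⟨hr h hh x y, fun hE => by simpa using hr h⁻¹ (G.inv_mem hh) _ _ hE⟩
  obtain ⟨k, hk⟩ : ∃ k, ∀ x, #{z | r x z} = k := by
    refine ⟨#{z | r x₀ z}, fun w => ?_⟩
    obtain ⟨h, hh, hw⟩ := trans w x₀
    rw [← hw]
    exact card_filter_eq_of_perm h _ _ (hr' h hh w)
  have hk1 : 1 < k := by
    rw [← hk x₀, one_lt_card]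
    exact ⟨x₀, by simp, y₀, by simpa using hr₀, hxy₀⟩
  have hkn : k < Fintype.card α := by
    obtain ⟨x, y, hxy⟩ := hnt
    rw [← hk x, ← card_univ]
    exact card_lt_card (filter_ssubset.2 ⟨y, mem_univ _, hxy⟩)
  refine ⟨k, hk1, hkn, ?_⟩
  -- the number of blocks meeting `S`
  let D : Finset α → ℕ := fun S => #(S.image (Quotient.mk r))
  have hcls : ∀ S : Finset α, g.IsCycleOn (S : Set α) → ∀ x ∈ S, #S = D S * #{y ∈ S | r x y} := by
    intro S hS x hx
    rw [card_eq_sum_card_image (Quotient.mk r) S]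
    apply sum_const_nat
    intro q hq
    obtain ⟨z, hz, rfl⟩ := mem_image.1 hq
    rw [hS.card_filter_eq hS (N := fun x y => r x y) (hr g hg) (hr g⁻¹ (G.inv_mem hg)) hx hz]
    congr 1
    ext y
    simp only [mem_filter]
    exact and_congr_right fun _ => Quotient.eq.trans ⟨r.symm', r.symm'⟩
  have himg : ∀ S T : Finset α, g.IsCycleOn (S : Set α) → g.IsCycleOn (T : Set α) →
      (∃ x ∈ S, ∃ y ∈ T, r x y) → ∀ x ∈ S, ∃ y ∈ T, r x y := by
    rintro S T hS hT' ⟨x, hx, y, hy, hxy⟩ z hz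
    obtain ⟨i, -, rfl⟩ := hS.exists_pow_eq hx hz
    exact ⟨(g ^ i) y, (hT'.1.perm_pow i).mapsTo (x := y) hy, hr _ (G.pow_mem hg i) _ _ hxy⟩
  have hD : ∀ S T : Finset α, g.IsCycleOn (S : Set α) → g.IsCycleOn (T : Set α) →
      (∃ x ∈ S, ∃ y ∈ T, r x y) → D S = D T := by
    have key : ∀ S T : Finset α, g.IsCycleOn (S : Set α) → g.IsCycleOn (T : Set α) →
      (∃ x ∈ S, ∃ y ∈ T, r x y) → S.image (Quotient.mk r) ⊆ T.image (Quotient.mk r) := by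
      intro S T hS hT' h q hq
      obtain ⟨x, hx, rfl⟩ := mem_image.1 hq
      obtain ⟨y, hy, hxy⟩ := himg S T hS hT' h x hx
      exact mem_image.2 ⟨y, hy, Quotient.eq.2 (r.symm' hxy)⟩
    intro S T hS hT' h
    have h' : ∃ x ∈ T, ∃ y ∈ S, r x y := by
      obtain ⟨x, hx, y, hy, hxy⟩ := h
      exact ⟨y, hy, x, hx, r.symm' hxy⟩
    exact congrArg card ((key S T hS hT' h).antisymm (key T S hT' hS h'))
  -- the case in which the third cycle is a union of blocks
  have alone : ∀ A B C : Finset α, IsTriCycle g A B C → C.Nonempty →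
      (¬ ∃ x ∈ C, ∃ y ∈ A, r x y) → (¬ ∃ x ∈ C, ∃ y ∈ B, r x y) → k ∣ #C := by
    rintro A B C hT ⟨x, hx⟩ h1 h2
    rw [hcls C hT.cycC x hx]
    refine Dvd.intro_left _ (congrArg _ ?_)
    rw [← hk x]
    congr 1
    ext y
    simp only [mem_filter, mem_univ, true_and, iff_and_self]
    intro hxy
    push Not at h1 h2
    rcases hT.cover y with h | h | h
    exacts [(h1 x hx y h hxy).elim, (h2 x hx y h hxy).elim, h]
  have sym : ∀ S T : Finset α, (¬ ∃ x ∈ S, ∃ y ∈ T, r x y) → ¬ ∃ x ∈ T, ∃ y ∈ S, r x y :=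
    fun S T h ⟨x, hx, y, hy, hxy⟩ => h ⟨y, hy, x, hx, r.symm' hxy⟩
  have mixed : ∀ A B C : Finset α, IsTriCycle g A B C → C.Nonempty →
      (∃ x ∈ A, ∃ y ∈ B, r x y) →
      (¬ ∃ x ∈ C, ∃ y ∈ A, r x y) → (¬ ∃ x ∈ C, ∃ y ∈ B, r x y) → BlockType k #A #B #C := by
    intro A B C hT hC hAB h1 h2
    have hDAB := hD A B hT.cycA hT.cycB hAB
    obtain ⟨x, hx, y, hy, hxy⟩ := hAB
    have ha := hcls A hT.cycA x hx
    have hb := hcls B hT.cycB y hy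
    refine ⟨alone A B C hT hC h1 h2, D A, Dvd.intro _ ha.symm, hDAB ▸ Dvd.intro _ hb.symm, ?_⟩
    rw [ha, hb, ← hDAB, ← mul_add, ← hk x, ← card_union_of_disjoint]
    · congr 2
      ext z
      simp only [mem_filter, mem_univ, true_and, mem_union]
      constructor
      · intro h
        rcases hT.cover z with h' | h' | h'
        · exact .inl ⟨h', h⟩
        · exact .inr ⟨h', r.trans' (r.symm' hxy) h⟩
        · exact (h1 ⟨z, h', x, hx, r.symm' h⟩).elim
      · rintro (h | h)
        exacts [h.2, r.trans' hxy h.2]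
    · exact (hT.disjAB.mono (filter_subset _ _) (filter_subset _ _))
  have three : ∀ A B C : Finset α, IsTriCycle g A B C → (∀ m, m ∣ #A → m ∣ #B → m ∣ #C → m = 1) →
      (∃ x ∈ A, ∃ y ∈ B, r x y) → ¬ (∃ x ∈ C, ∃ y ∈ A, r x y) := by
    intro A B C hT hgcd hAB hCA
    have hDAB := hD A B hT.cycA hT.cycB hAB
    have hDCA := hD C A hT.cycC hT.cycA hCA
    obtain ⟨x, hx, y, hy, hxy⟩ := hAB
    obtain ⟨z, hz, w, hw, hzw⟩ := hCA
    have hD1 : D A = 1 := hgcd _ (Dvd.intro _ (hcls A hT.cycA x hx).symm)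
      (hDAB ▸ Dvd.intro _ (hcls B hT.cycB y hy).symm)
      (hDCA ▸ Dvd.intro _ (hcls C hT.cycC z hz).symm)
    obtain ⟨q, hq⟩ := card_eq_one.1 hD1
    have hAq : ∀ u ∈ A, Quotient.mk r u = q := fun u hu =>
      mem_singleton.1 (hq ▸ mem_image_of_mem _ hu)
    have all : ∀ u, Quotient.mk r u = q := by
      intro u
      rcases hT.cover u with h | h | h
      · exact hAq u h
      · obtain ⟨v, hv, huv⟩ := himg B A hT.cycB hT.cycA ⟨y, hy, x, hx, r.symm' hxy⟩ u h
        rw [Quotient.eq.2 huv, hAq v hv]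
      · obtain ⟨v, hv, huv⟩ := himg C A hT.cycC hT.cycA ⟨z, hz, w, hw, hzw⟩ u h
        rw [Quotient.eq.2 huv, hAq v hv]
    obtain ⟨u, v, huv⟩ := hnt
    exact huv (Quotient.eq.1 ((all u).trans (all v).symm))
  have hT2 := hT.rotate
  have hT3 := hT2.rotate
  by_cases hAB : ∃ x ∈ A, ∃ y ∈ B, r x y
  · have h1 := three A B C hT hgcd hAB
    have h2 := three B A C hT.swap₁₂ (fun m h1 h2 h3 => hgcd m h2 h1 h3)
      (by obtain ⟨x, hx, y, hy, hxy⟩ := hAB; exact ⟨y, hy, x, hx, r.symm' hxy⟩)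
    exact .inl (mixed A B C hT hC hAB h1 h2)
  by_cases hBC : ∃ x ∈ B, ∃ y ∈ C, r x y
  · have h1 := three B C A hT2 (fun m h1 h2 h3 => hgcd m h3 h1 h2) hBC
    have h2 := three C B A hT2.swap₁₂ (fun m h1 h2 h3 => hgcd m h3 h2 h1)
      (by obtain ⟨x, hx, y, hy, hxy⟩ := hBC; exact ⟨y, hy, x, hx, r.symm' hxy⟩)
    exact .inr (.inl (mixed B C A hT2 hA hBC h1 h2))
  by_cases hCA : ∃ x ∈ C, ∃ y ∈ A, r x y
  · have h1 := three C A B hT3 (fun m h1 h2 h3 => hgcd m h2 h3 h1) hCA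
    have h2 := three A C B hT3.swap₁₂ (fun m h1 h2 h3 => hgcd m h1 h3 h2)
      (by obtain ⟨x, hx, y, hy, hxy⟩ := hCA; exact ⟨y, hy, x, hx, r.symm' hxy⟩)
    exact .inr (.inr (mixed C A B hT3 hB hCA h1 h2))
  have := hgcd k (alone B C A hT2 hA hAB (sym _ _ hCA))
    (alone C A B hT3 hB hBC (sym _ _ hAB)) (alone A B C hT hC hCA (sym _ _ hBC))
  omega

end

section

variable {α : Type*} [Fintype α] [DecidableEq α] {G : Subgroup (Perm α)}

theorem exists_mem_extending_of_isCycle (hG : MulAction.IsPreprimitive G α) {p : ℕ} (hp : p.Prime)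
    (hp3 : p + 3 ≤ Fintype.card α) {x : Perm α} (hx : x.IsCycle) (hxp : #x.support = p)
    (hxG : x ∈ G) (σ : Perm α) : ∃ h ∈ G, ∀ d ∉ x.support, h d = σ d := by
  rw [← Nat.card_eq_fintype_card] at hp3
  obtain ⟨n, hn⟩ := Nat.exists_eq_add_of_le hp3
  have hsc : Set.ncard ((x.support)ᶜ : Set α) = (n + 2) + 1 := by
    apply Nat.add_left_cancel (n := #x.support)
    rw [← Set.ncard_coe_finset, Set.ncard_add_ncard_compl, Set.ncard_coe_finset, hxp]
    omega
  have hmp : MulAction.IsMultiplyPreprimitive G α (n + 2 + 2) := by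
    apply hG.isMultiplyPreprimitive hsc
    · have := hp.two_le; omega
    have := Perm.isPretransitive_of_isCycle_mem hx hxG
    apply MulAction.IsPreprimitive.of_prime_card
    convert! hp
    classical
    rw [Nat.card_eq_fintype_card, Fintype.card_subtype, ← hxp]
    apply congr_arg
    ext x
    simp [SubMulAction.mem_ofFixingSubgroup_iff]
  have hmt : MulAction.IsMultiplyPretransitive G α (n + 2 + 2) :=
    MulAction.IsMultiplyPreprimitive.isMultiplyPretransitive ..
  have hmt : MulAction.IsMultiplyPretransitive G α (n + 3) :=
    MulAction.isMultiplyPretransitive_of_le (n := n + 2 + 2) (by omega)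
      (by have := hp.two_le; omega)
  have hc : Fintype.card {d // d ∉ x.support} = n + 3 := by
    rw [Fintype.card_subtype_compl, ← Nat.card_eq_fintype_card, Fintype.card_coe, hxp]; omega
  let e : Fin (n + 3) ≃ {d // d ∉ x.support} := (Fintype.equivFinOfCardEq hc).symm
  obtain ⟨h, hh⟩ := MulAction.exists_smul_eq G
    (e.toEmbedding.trans (Function.Embedding.subtype _))
    ((e.toEmbedding.trans (Function.Embedding.subtype _)).trans σ.toEmbedding)
  refine ⟨h, h.2, fun d hd => ?_⟩
  have := DFunLike.congr_fun hh (e.symm ⟨d, hd⟩)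
  simpa [Subgroup.smul_def] using this

theorem exists_mem_extending_normalizing (hG : MulAction.IsPreprimitive G α) {p : ℕ} (hp : p.Prime)
    (hp3 : p + 3 ≤ Fintype.card α) {x : Perm α} (hx : x.IsCycle) (hxp : #x.support = p)
    (hxG : x ∈ G) (σ : Perm α) (hσ : ∀ d, σ d ∈ x.support ↔ d ∈ x.support) :
    ∃ h ∈ G, (∀ d ∉ x.support, h d = σ d) ∧ ∃ i : ℤ, x * h = h * x ^ i := by
  obtain ⟨h, hh, hhσ⟩ := exists_mem_extending_of_isCycle hG hp hp3 hx hxp hxG σ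
  have := Fact.mk hp
  set K : Subgroup (Perm α) := G ⊓ (Perm.ofSubtype (p := (· ∈ x.support))).range with hK
  have hmem : ∀ y : Perm α, y ∈ K ↔ y ∈ G ∧ ∀ d ∉ x.support, y d = d := by
    intro y
    rw [hK, Subgroup.mem_inf, MonoidHom.mem_range]
    refine and_congr_right fun _ => ⟨?_, fun hy => ?_⟩
    · rintro ⟨z, rfl⟩ d hd
      exact Perm.ofSubtype_apply_of_not_mem z hd
    · refine ⟨y.subtypePerm fun d => ?_, Perm.ofSubtype_subtypePerm _ fun d hd => ?_⟩
      · constructor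
        · intro hd; contrapose! hd; rwa [hy d hd]
        · intro hd; contrapose! hd
          have := hy _ hd
          rw [y.injective this] at hd
          exact hd
      · by_contra h2; exact hd (hy d h2)
  have hKc : Nat.card K ∣ p.factorial := by
    refine (Subgroup.card_dvd_of_le (inf_le_right)).trans ?_
    refine (Subgroup.card_range_dvd _).trans ?_
    rw [Nat.card_perm, Nat.card_eq_fintype_card, Fintype.card_coe, hxp]
  have hox : orderOf x = p := by rw [hx.orderOf, hxp]
  have hxK : x ∈ K := (hmem x).2 ⟨hxG, fun d hd => by simpa using hd⟩
  have hyK : h * x * h⁻¹ ∈ K := by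
    refine (hmem _).2 ⟨G.mul_mem (G.mul_mem hh hxG) (G.inv_mem hh), fun d hd => ?_⟩
    have h1 : σ⁻¹ d ∉ x.support := by
      rw [← hσ]; simpa using hd
    have h2 : h⁻¹ d = σ⁻¹ d := by
      rw [Perm.inv_eq_iff_eq, hhσ _ h1]; simp
    rw [Perm.mul_apply, Perm.mul_apply, h2]
    rw [Perm.notMem_support] at h1
    rw [h1, ← h2]; simp
  have hfac : (Nat.card K).factorization p = 1 := by
    have hp1 : orderOf (⟨x, hxK⟩ : K) ∣ Nat.card K := orderOf_dvd_natCard _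
    rw [Subgroup.orderOf_mk, hox] at hp1
    refine le_antisymm ?_ ((hp.dvd_iff_one_le_factorization Nat.card_pos.ne').1 hp1)
    have h1 := (Nat.factorization_le_iff_dvd Nat.card_pos.ne' p.factorial_ne_zero).2 hKc p
    have h2 : p.factorial.factorization p = 1 := by
      rw [← Nat.mul_factorial_pred hp.ne_zero, Nat.factorization_mul hp.ne_zero (Nat.factorial_ne_zero _),
        Finsupp.add_apply, hp.factorization_self, Nat.factorization_eq_zero_of_not_dvd]
      rw [hp.dvd_factorial]; have := hp.two_le; omega
    omega
  have hcard : ∀ y (hy : y ∈ K), orderOf y = p →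
      Nat.card (Subgroup.zpowers (⟨y, hy⟩ : K)) = p ^ (Nat.card K).factorization p := by
    intro y hy hyp
    rw [hfac, pow_one, Nat.card_zpowers, Subgroup.orderOf_mk, hyp]
  let P : Sylow p K := Sylow.ofCard _ (hcard x hxK hox)
  let Q : Sylow p K := Sylow.ofCard _ (hcard (h * x * h⁻¹) hyK (by
    rw [← hox]; exact MulAut.conj h |>.orderOf_eq x))
  obtain ⟨k, hk⟩ := MulAction.exists_smul_eq K P Q
  have hmemQ : k * ⟨x, hxK⟩ * k⁻¹ ∈ (Q : Subgroup K) := by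
    rw [← hk]
    exact ⟨⟨x, hxK⟩, Subgroup.mem_zpowers _, by simp [MulAut.conj_apply]⟩
  obtain ⟨i, hi⟩ := hmemQ
  have hi : (h * x * h⁻¹) ^ i = k * x * (k : Perm α)⁻¹ := congrArg Subtype.val hi
  obtain ⟨hkG, hkf⟩ := (hmem k).1 k.2
  refine ⟨(k : Perm α)⁻¹ * h, G.mul_mem (G.inv_mem hkG) hh, fun d hd => ?_, i, ?_⟩
  · rw [Perm.mul_apply, hhσ d hd, Perm.inv_eq_iff_eq, hkf]
    rwa [hσ]
  · rw [conj_zpow] at hi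
    have : (k : Perm α) * x * (k : Perm α)⁻¹ * h = h * x ^ i := by rw [← hi]; group
    rw [mul_assoc _ h, ← this]; group

theorem alternatingGroup_le_of_isCycle_of_prime (hG : MulAction.IsPreprimitive G α) {p : ℕ}
    (hp : p.Prime) (hp3 : p + 3 ≤ Fintype.card α) {x : Perm α} (hx : x.IsCycle)
    (hxp : #x.support = p) (hxG : x ∈ G) : alternatingGroup α ≤ G := by
  have hc : 2 < #(x.supportᶜ) := by rw [card_compl, hxp]; omega
  obtain ⟨a, ha, b, hb, c, hc, hab, hac, hbc⟩ := Finset.two_lt_card.1 hc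
  simp only [mem_compl] at ha hb hc
  have hsw : ∀ u v, u ∉ x.support → v ∉ x.support → ∀ d, swap u v d ∈ x.support ↔ d ∈ x.support := by
    intro u v hu hv d
    rcases eq_or_ne d u with rfl | h1
    · simp only [swap_apply_left]; tauto
    rcases eq_or_ne d v with rfl | h2
    · simp only [swap_apply_right]; tauto
    rw [swap_apply_of_ne_of_ne h1 h2]
  obtain ⟨h, hh, hhσ, i, hi⟩ := exists_mem_extending_normalizing hG hp hp3 hx hxp hxG (swap a b)
    (hsw a b ha hb)
  obtain ⟨k, hk, hkσ, j, hj⟩ := exists_mem_extending_normalizing hG hp hp3 hx hxp hxG (swap a c)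
    (hsw a c ha hc)
  have e1 : h⁻¹ * x * h = x ^ i := by rw [mul_assoc, hi]; group
  have e2 : k⁻¹ * x * k = x ^ j := by rw [mul_assoc, hj]; group
  have e1' : ∀ m : ℤ, h⁻¹ * x ^ m * h = x ^ (i * m) := fun m => by
    have := conj_zpow (a := h⁻¹) (b := x) (i := m)
    rw [inv_inv] at this
    rw [← this, e1, zpow_mul]
  have e2' : ∀ m : ℤ, k⁻¹ * x ^ m * k = x ^ (j * m) := fun m => by
    have := conj_zpow (a := k⁻¹) (b := x) (i := m)
    rw [inv_inv] at this
    rw [← this, e2, zpow_mul]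
  set z := h * k * h⁻¹ * k⁻¹ with hz
  have hcomm : Commute z x := by
    have h1 : (h * k)⁻¹ * x * (h * k) = (k * h)⁻¹ * x * (k * h) := by
      calc _ = k⁻¹ * (h⁻¹ * x * h) * k := by group
        _ = x ^ (j * i) := by rw [e1, e2']
        _ = h⁻¹ * (k⁻¹ * x * k) * h := by rw [e2, e1', mul_comm]
        _ = _ := by group
    have h2 : z = (h * k) * (k * h)⁻¹ := by rw [hz]; group
    have h3 : x * z = z * x := by
      rw [h2]
      calc x * (h * k * (k * h)⁻¹) = (h * k) * ((h * k)⁻¹ * x * (h * k)) * (k * h)⁻¹ := by group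
        _ = _ := by rw [h1]; group
    exact h3.symm
  have hzG : z ∈ G := G.mul_mem (G.mul_mem (G.mul_mem hh hk) (G.inv_mem hh)) (G.inv_mem hk)
  have hzd : ∀ d ∉ x.support, z d = (swap a b * swap a c * swap a b * swap a c) d := by
    intro d hd
    have inv : ∀ (y : Perm α) u v, u ∉ x.support → v ∉ x.support →
        (∀ d ∉ x.support, y d = swap u v d) → ∀ d ∉ x.support, y⁻¹ d = swap u v d := by
      intro y u v hu hv hy d hd
      rw [Perm.inv_eq_iff_eq, hy _ (by rwa [hsw u v hu hv])]
      simp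
    simp only [hz, Perm.mul_apply]
    have s1 := hsw a b ha hb
    have s2 := hsw a c ha hc
    rw [inv k a c ha hc hkσ d hd, inv h a b ha hb hhσ _ (by rwa [s2]), hkσ _ (by rwa [s1, s2]),
      hhσ _ (by rwa [s2, s1, s2])]
  obtain ⟨u, hu⟩ : x.support.Nonempty := by rw [← card_pos, hxp]; exact hp.pos
  have hzu : z u ∈ x.support := by
    rw [Perm.mem_support] at hu ⊢
    rw [← Perm.mul_apply, ← hcomm.eq, Perm.mul_apply]
    exact fun h => hu (z.injective h)
  obtain ⟨m, hm⟩ := hx.exists_zpow_eq (Perm.mem_support.1 hu) (Perm.mem_support.1 hzu)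
  have hw : z * x ^ (-m) = (swap a b * swap a c) * (swap a b * swap a c) := by
    ext d
    by_cases hd : d ∈ x.support
    · have hne : ∀ v, v ∉ x.support → d ≠ v := fun v hv h => hv (h ▸ hd)
      have r1 : swap a b d = d := swap_apply_of_ne_of_ne (hne a ha) (hne b hb)
      have r2 : swap a c d = d := swap_apply_of_ne_of_ne (hne a ha) (hne c hc)
      simp only [Perm.mul_apply, r1, r2]
      obtain ⟨l, rfl⟩ := hx.exists_zpow_eq (Perm.mem_support.1 hu) (Perm.mem_support.1 hd)
      rw [← Perm.mul_apply (x ^ (-m)), ← zpow_add, ← Perm.mul_apply,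
        (hcomm.zpow_right _).eq, Perm.mul_apply, ← hm, ← Perm.mul_apply, ← zpow_add]
      congr 2; ring
    · have : (x ^ (-m)) d = d := Perm.zpow_apply_eq_self_of_apply_eq_self (by simpa using hd) _
      rw [Perm.mul_apply, this, hzd d hd]
      simp only [Perm.mul_apply]
  have h3 := (Perm.isThreeCycle_swap_mul_swap_same hab hac hbc).isThreeCycle_sq
  rw [← hw] at h3
  exact Perm.alternatingGroup_le_of_isPreprimitive_of_isThreeCycle_mem hG h3
    (G.mul_mem hzG (G.zpow_mem hxG _))

theorem PermPrim.isPreprimitive [Nonempty α] (hG : PermPrim G) : MulAction.IsPreprimitive G α where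
  exists_smul_eq x y := by
    obtain ⟨h, hh, e⟩ := hG.trans x y
    exact ⟨⟨h, hh⟩, e⟩
  isTrivialBlock_of_isBlock {B} hB := by
    refine or_iff_not_imp_left.2 fun hns => ?_
    obtain ⟨x, hx, y, hy, hxy⟩ := Set.not_subsingleton_iff.1 hns
    let r : Setoid α :=
      ⟨fun u v => ∀ h : G, h • u ∈ B ↔ h • v ∈ B, fun _ _ => Iff.rfl, fun e h => (e h).symm,
        fun e f h => (e h).trans (f h)⟩
    have key : ∀ u v, u ∈ B → v ∈ B → ∀ h : G, h • u ∈ B → h • v ∈ B := by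
      intro u v hu hv h hhu
      have := hB.smul_eq_of_mem hu hhu
      rw [← this]
      exact Set.smul_mem_smul_set hv
    have hr := hG.block r (fun h hh u v huv k => by
      have := huv (k * ⟨h, hh⟩)
      rw [mul_smul, mul_smul] at this
      exact this) ⟨x, y, hxy, fun h => ⟨key x y hx hy h, key y x hy hx h⟩⟩ x
    ext z
    simpa [hx] using hr z 1

theorem PermPrim.alternatingGroup_le_of_prime (hG : PermPrim G) {g : Perm α} (hg : g ∈ G)
    {A B C : Finset α} (hT : IsTriCycle g A B C) (hp : (#A).Prime)
    (hB : ¬ #A ∣ #B) (hC : ¬ #A ∣ #C) (h3 : #A + 3 ≤ Fintype.card α) :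
    alternatingGroup α ≤ G := by
  have hne : A.Nonempty := card_pos.1 hp.pos
  obtain ⟨u, hu⟩ := hne
  have : Nonempty α := ⟨u⟩
  have hN : ¬ #A ∣ #B * #C := by rw [hp.dvd_mul]; tauto
  have hfix : ∀ d, (g ^ (#B * #C)) d ≠ d ↔ d ∈ A := by
    intro d
    constructor
    · intro hd
      rcases hT.cover d with h | h | h
      · exact h
      · exact (hd ((hT.cycB.pow_apply_eq h).2 (dvd_mul_right _ _))).elim
      · exact (hd ((hT.cycC.pow_apply_eq h).2 (dvd_mul_left _ _))).elim
    · intro h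
      rwa [Ne, hT.cycA.pow_apply_eq h]
  refine alternatingGroup_le_of_isCycle_of_prime hG.isPreprimitive hp h3
    (x := g ^ (#B * #C)) ⟨u, (hfix u).2 hu, fun y hy => ?_⟩ ?_ (G.pow_mem hg _)
  · obtain ⟨m, -, hm⟩ := hT.cycA.exists_pow_eq hu ((hfix y).1 hy)
    obtain ⟨k, -, hk⟩ := Nat.exists_mul_mod_eq_one_of_coprime
      ((hp.coprime_iff_not_dvd.2 hN).symm) hp.one_lt
    refine ⟨(k * m : ℕ), ?_⟩
    rw [zpow_natCast, ← pow_mul, ← hm, hT.cycA.pow_apply_eq_pow_apply hu, ← mul_assoc]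
    have : #B * #C * k ≡ 1 [MOD #A] := by
      rw [Nat.ModEq, hk, Nat.mod_eq_of_lt hp.one_lt]
    simpa using this.mul_right m
  · congr 1
    ext d
    rw [Perm.mem_support, hfix]

end

theorem exists_normalCovering {G : Type*} [Group G] [Finite G] (hG : ¬ IsCyclic G) :
    ∃ H : Fin (normalCoveringNumber G) → Subgroup G, (∀ i, H i ≠ ⊤) ∧
      ∀ g : G, ∃ i, ∃ x : G, x * g * x⁻¹ ∈ H i := by
  have hne : {s : ℕ | ∃ H : Fin s → Subgroup G, (∀ i, H i ≠ ⊤) ∧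
      ∀ g : G, ∃ i : Fin s, ∃ x : G, x * g * x⁻¹ ∈ H i}.Nonempty := by
    refine ⟨Nat.card G, fun i => Subgroup.zpowers ((Finite.equivFin G).symm i), fun i hi => hG ?_,
      fun g => ⟨Finite.equivFin G g, 1, by simp⟩⟩
    exact ⟨(Finite.equivFin G).symm i, fun x => by
      have : x ∈ (⊤ : Subgroup G) := Subgroup.mem_top x
      rwa [← hi] at this⟩
  exact Nat.sInf_mem hne

theorem not_isCyclic_alternatingGroup {n : ℕ} (hn : 4 ≤ n) : ¬ IsCyclic (alternatingGroup (Fin n)) := by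
  intro h
  have hc := alternatingGroup.center_eq_bot (α := Fin n) (by simpa using hn)
  have hnt : Nontrivial (alternatingGroup (Fin n)) :=
    alternatingGroup.nontrivial_of_three_le_card (by simp; omega)
  have hcm : IsMulCommutative (alternatingGroup (Fin n)) := IsCyclic.isMulCommutative
  have ht : Subgroup.center (alternatingGroup (Fin n)) = ⊤ := by
    rw [eq_top_iff]
    intro x _
    rw [Subgroup.mem_center_iff]
    intro y
    exact IsMulCommutative.is_comm.comm y x
  rw [hc] at ht
  exact bot_ne_top ht

theorem Equiv.Perm.IsCycleOn.congr_of_eqOn {α : Type*} [DecidableEq α] {f g : Perm α} {s : Finset α}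
    (hf : f.IsCycleOn (s : Set α)) (h : ∀ x ∈ s, g x = f x) : g.IsCycleOn (s : Set α) := by
  refine ⟨hf.1.congr fun x hx => (h x hx).symm, fun x hx y hy => ?_⟩
  obtain ⟨k, -, rfl⟩ := hf.exists_pow_eq hx hy
  have : ∀ k : ℕ, (g ^ k) x = (f ^ k) x ∧ (f ^ k) x ∈ s := by
    intro k
    induction k with
    | zero => exact ⟨rfl, hx⟩
    | succ k ih =>
      rw [pow_succ', pow_succ', Perm.mul_apply, Perm.mul_apply, ih.1]
      exact ⟨h _ ih.2, hf.1.mapsTo ih.2⟩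
  exact ⟨k, by rw [zpow_natCast, (this k).1]⟩

theorem Equiv.Perm.exists_isCycleOn_sign {α : Type*} [Fintype α] [DecidableEq α] {s : Finset α}
    (hs : s.Nonempty) : ∃ f : Perm α, f.IsCycleOn (s : Set α) ∧ f.support ⊆ s ∧
      Perm.sign f = -(-1) ^ #s := by
  obtain ⟨f, hf, hfs⟩ := Finset.exists_cycleOn s
  refine ⟨f, hf, hfs, ?_⟩
  rcases hs.exists_eq_singleton_or_nontrivial with ⟨a, rfl⟩ | hs
  · have : f = 1 := by
      rw [← Perm.support_eq_empty_iff]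
      by_contra hne
      have h1 := Perm.two_le_card_support_of_ne_one (f := f) (by rwa [Ne, ← Perm.support_eq_empty_iff])
      have := card_le_card hfs
      rw [card_singleton] at this; omega
    simp [this]
  · have hsupp : f.support = s := by
      refine hfs.antisymm fun x hx => ?_
      rw [Perm.mem_support]
      exact hf.apply_ne hs hx
    have : f.IsCycle := by
      obtain ⟨x, hx⟩ := hs.nonempty
      refine ⟨x, hf.apply_ne hs hx, fun y hy => hf.2 hx ?_⟩
      rw [mem_coe, ← hsupp]; exact Perm.mem_support.2 hy
    rw [this.sign, hsupp]

theorem exists_isTriCycle {n a b c : ℕ} (ha : 0 < a) (hb : 0 < b) (hc : 0 < c) (h : a + b + c = n) :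
    ∃ (g : Perm (Fin n)) (A B C : Finset (Fin n)), IsTriCycle g A B C ∧ #A = a ∧ #B = b ∧ #C = c ∧
      Perm.sign g = -(-1) ^ n := by
  obtain ⟨A, -, hA⟩ := exists_subset_card_eq (s := (univ : Finset (Fin n))) (n := a)
    (by rw [card_univ, Fintype.card_fin]; omega)
  obtain ⟨B, hBA, hB⟩ := exists_subset_card_eq (s := Aᶜ) (n := b)
    (by rw [card_compl, Fintype.card_fin]; omega)
  have hAB : Disjoint A B := by
    rw [disjoint_right]; intro x hx; simpa using hBA hx
  set C := (A ∪ B)ᶜ with hCdef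
  have hC : #C = c := by
    rw [hCdef, card_compl, Fintype.card_fin, card_union_of_disjoint hAB]; omega
  have hAC : Disjoint A C := by
    rw [disjoint_left]; intro x hx; simp [hCdef, hx]
  have hBC : Disjoint B C := by
    rw [disjoint_left]; intro x hx; simp [hCdef, hx]
  obtain ⟨f, hf, hfs, hfsg⟩ := Perm.exists_isCycleOn_sign (card_pos.1 (hA ▸ ha))
  obtain ⟨g, hg, hgs, hgsg⟩ := Perm.exists_isCycleOn_sign (card_pos.1 (hB ▸ hb))
  obtain ⟨k, hk, hks, hksg⟩ := Perm.exists_isCycleOn_sign (card_pos.1 (hC ▸ hc))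
  have ff : ∀ x ∉ A, f x = x := fun x hx => Perm.notMem_support.1 fun h => hx (hfs h)
  have gf : ∀ x ∉ B, g x = x := fun x hx => Perm.notMem_support.1 fun h => hx (hgs h)
  have kf : ∀ x ∉ C, k x = x := fun x hx => Perm.notMem_support.1 fun h => hx (hks h)
  refine ⟨f * g * k, A, B, C, ⟨hf.congr_of_eqOn fun x hx => ?_, hg.congr_of_eqOn fun x hx => ?_,
    hk.congr_of_eqOn fun x hx => ?_, hAB, hAC, hBC, fun x => ?_⟩, hA, hB, hC, ?_⟩
  · rw [Perm.mul_apply, Perm.mul_apply, kf x (disjoint_left.1 hAC hx), gf x (disjoint_left.1 hAB hx)]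
  · have : g x ∈ B := hg.1.mapsTo hx
    rw [Perm.mul_apply, Perm.mul_apply, kf x (disjoint_left.1 hBC hx),
      ff _ (disjoint_right.1 hAB this)]
  · have : k x ∈ C := hk.1.mapsTo hx
    rw [Perm.mul_apply, Perm.mul_apply, gf _ (disjoint_right.1 hBC this),
      ff _ (disjoint_right.1 hAC this)]
  · simp [hCdef]; tauto
  · rw [Perm.sign_mul, Perm.sign_mul, hfsg, hgsg, hksg, hA, hB, hC, ← h, pow_add, pow_add]
    simp [mul_comm, mul_assoc]

/-- Every transitive group containing a permutation with cycle type `(a, b, c)` contains the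
alternating group. -/
def ForcesAlt (n a b c : ℕ) : Prop :=
  ∀ (g : Perm (Fin n)) (A B C : Finset (Fin n)), IsTriCycle g A B C → #A = a → #B = b → #C = c →
    ∀ G : Subgroup (Perm (Fin n)), g ∈ G → (∀ x y, ∃ h ∈ G, h x = y) →
      alternatingGroup (Fin n) ≤ G

theorem IsTriCycle.conj {α : Type*} [Fintype α] [DecidableEq α] {g : Perm α} {A B C : Finset α}
    (h : IsTriCycle g A B C) (x : Perm α) :
    IsTriCycle (x * g * x⁻¹) (A.map x.toEmbedding) (B.map x.toEmbedding) (C.map x.toEmbedding) := by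
  have key : ∀ D : Finset α, g.IsCycleOn (D : Set α) →
      (x * g * x⁻¹).IsCycleOn (D.map x.toEmbedding : Set α) := by
    intro D hD
    have := hD.conj (g := x)
    convert this using 1
    ext y
    simp
  refine ⟨key _ h.cycA, key _ h.cycB, key _ h.cycC, ?_, ?_, ?_, fun y => ?_⟩
  · rw [disjoint_map]; exact h.disjAB
  · rw [disjoint_map]; exact h.disjAC
  · rw [disjoint_map]; exact h.disjBC
  · simpa [mem_map_equiv] using h.cover (x⁻¹ y)

theorem IsTriCycle.subset_or_disjoint {α : Type*} [DecidableEq α] {g : Perm α} {A O : Finset α}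
    (h : g.IsCycleOn (A : Set α)) (hO : ∀ x ∈ O, g x ∈ O) : A ⊆ O ∨ Disjoint A O := by
  rw [or_iff_not_imp_right, not_disjoint_iff]
  rintro ⟨x, hxA, hxO⟩ y hy
  obtain ⟨k, -, rfl⟩ := h.exists_pow_eq hxA hy
  have : ∀ k : ℕ, (g ^ k) x ∈ O := by
    intro k
    induction k with
    | zero => exact hxO
    | succ k ih => rw [pow_succ', Perm.mul_apply]; exact hO _ ih
  exact this k

theorem exists_hitting_set {n s : ℕ} (K : Fin s → Subgroup (Perm (Fin n)))
    (hK : ∀ (g : Perm (Fin n)) (A B C : Finset (Fin n)), IsTriCycle g A B C →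
      Perm.sign g = -(-1) ^ n →
      ∃ i, ¬ alternatingGroup (Fin n) ≤ K i ∧ ∃ x, x * g * x⁻¹ ∈ K i) :
    ∃ X : Finset ℕ, #X ≤ 2 * s ∧ (∀ x ∈ X, 0 < x ∧ x < n ∧ n - x ∈ X) ∧
      ∀ a b c, 0 < a → 0 < b → 0 < c → a + b + c = n → ForcesAlt n a b c →
        a ∈ X ∨ b ∈ X ∨ c ∈ X := by
  classical
  have horb : ∀ i, ∃ k, (¬ (∀ x y, ∃ h ∈ K i, h x = y)) → 0 < k ∧ k < n ∧
      ∃ O : Finset (Fin n), #O = k ∧ ∀ h ∈ K i, ∀ x ∈ O, h x ∈ O := by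
    intro i
    by_cases ht : ∀ x y, ∃ h ∈ K i, h x = y
    · exact ⟨0, fun h => (h ht).elim⟩
    · push Not at ht
      obtain ⟨x, y, hxy⟩ := ht
      let O : Finset (Fin n) := {z | ∃ h ∈ K i, h x = z}
      refine ⟨#O, fun _ => ⟨card_pos.2 ⟨x, ?_⟩, ?_, O, rfl, ?_⟩⟩
      · simp only [O, mem_filter, mem_univ, true_and]
        exact ⟨1, (K i).one_mem, rfl⟩
      · have := card_lt_univ_of_notMem (s := O) (x := y) (by
          simp only [O, mem_filter, mem_univ, true_and, not_exists, not_and]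
          exact hxy)
        simpa using this
      · intro h hh z hz
        simp only [O, mem_filter, mem_univ, true_and] at hz ⊢
        obtain ⟨l, hl, rfl⟩ := hz
        exact ⟨h * l, (K i).mul_mem hh hl, rfl⟩
  choose k hk using horb
  let I : Finset (Fin s) := {i | ¬ (∀ x y, ∃ h ∈ K i, h x = y)}
  have hI : ∀ i, i ∈ I ↔ ¬ (∀ x y, ∃ h ∈ K i, h x = y) := by simp [I]
  refine ⟨I.image k ∪ I.image (fun i => n - k i), ?_, ?_, ?_⟩
  · have hIs : #I ≤ s := by simpa using card_le_univ I
    have h1 := card_image_le (s := I) (f := k)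
    have h2 := card_image_le (s := I) (f := fun i => n - k i)
    have h3 := card_union_le (I.image k) (I.image (fun i => n - k i))
    omega
  · intro x hx
    simp only [mem_union, mem_image] at hx ⊢
    rcases hx with ⟨i, hi, rfl⟩ | ⟨i, hi, rfl⟩
    all_goals
      obtain ⟨h1, h2, -⟩ := hk i ((hI i).1 hi)
    · exact ⟨h1, h2, Or.inr ⟨i, hi, rfl⟩⟩
    · exact ⟨by omega, by omega, Or.inl ⟨i, hi, by omega⟩⟩
  · intro a b c ha hb hc habc hF
    obtain ⟨g, A, B, C, hT, hA, hB, hC, hs⟩ := exists_isTriCycle ha hb hc habc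
    obtain ⟨i, hi, x, hx⟩ := hK g A B C hT hs
    have hT' := hT.conj x
    have hnt : i ∈ I := by
      rw [hI]
      intro ht
      exact hi (hF _ _ _ _ hT' (by simpa) (by simpa) (by simpa) _ hx ht)
    obtain ⟨h1, h2, O, hO, hOK⟩ := hk i ((hI i).1 hnt)
    have hmem : ∀ m, m = k i ∨ m = n - k i →
        m ∈ I.image k ∪ I.image (fun i => n - k i) := by
      intro m hm
      simp only [mem_union, mem_image]
      rcases hm with rfl | rfl
      · exact Or.inl ⟨i, hnt, rfl⟩
      · exact Or.inr ⟨i, hnt, rfl⟩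
    set A' := A.map x.toEmbedding
    set B' := B.map x.toEmbedding
    set C' := C.map x.toEmbedding
    have hA' : #A' = a := by simpa [A'] using hA
    have hB' : #B' = b := by simpa [B'] using hB
    have hC' : #C' = c := by simpa [C'] using hC
    have hOe : O = (A' ∩ O) ∪ ((B' ∩ O) ∪ (C' ∩ O)) := by
      ext z
      have := hT'.cover z
      simp only [mem_union, mem_inter]
      tauto
    have hcard : #(A' ∩ O) + (#(B' ∩ O) + #(C' ∩ O)) = k i := by
      rw [← hO]
      conv_rhs => rw [hOe]
      rw [card_union_of_disjoint, card_union_of_disjoint]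
      · exact hT'.disjBC.mono inter_subset_left inter_subset_left
      · rw [disjoint_union_right]
        exact ⟨hT'.disjAB.mono inter_subset_left inter_subset_left,
          hT'.disjAC.mono inter_subset_left inter_subset_left⟩
    have hval : ∀ D : Finset (Fin n), (D ⊆ O ∨ Disjoint D O) → #(D ∩ O) = #D ∨ #(D ∩ O) = 0 := by
      rintro D (h | h)
      · left; rw [inter_eq_left.2 h]
      · right; rw [card_eq_zero, ← disjoint_iff_inter_eq_empty]; exact h
    have e1 := hval A' (IsTriCycle.subset_or_disjoint hT'.cycA (hOK _ hx))
    have e2 := hval B' (IsTriCycle.subset_or_disjoint hT'.cycB (hOK _ hx))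
    have e3 := hval C' (IsTriCycle.subset_or_disjoint hT'.cycC (hOK _ hx))
    have : (a = k i ∨ a = n - k i) ∨ (b = k i ∨ b = n - k i) ∨ (c = k i ∨ c = n - k i) := by
      omega
    rcases this with h | h | h
    · exact Or.inl (hmem _ h)
    · exact Or.inr (Or.inl (hmem _ h))
    · exact Or.inr (Or.inr (hmem _ h))

theorem exists_hitting_set_perm {n : ℕ} (hn : 4 ≤ n) (he : Even n) :
    ∃ X : Finset ℕ, #X ≤ 2 * normalCoveringNumber (Perm (Fin n)) ∧
      (∀ x ∈ X, 0 < x ∧ x < n ∧ n - x ∈ X) ∧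
      ∀ a b c, 0 < a → 0 < b → 0 < c → a + b + c = n → ForcesAlt n a b c →
        a ∈ X ∨ b ∈ X ∨ c ∈ X := by
  obtain ⟨H, hH, hcov⟩ := exists_normalCovering (G := Perm (Fin n)) (fun h =>
    not_isCyclic_alternatingGroup hn (Subgroup.isCyclic _))
  refine exists_hitting_set H fun g A B C hT hs => ?_
  obtain ⟨i, x, hx⟩ := hcov g
  refine ⟨i, fun hle => hH i ?_, x, hx⟩
  rw [eq_top_iff]
  intro y _
  rcases Int.units_eq_one_or (Perm.sign y) with hy | hy
  · exact hle (Perm.mem_alternatingGroup.2 hy)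
  · rw [← (H i).mul_mem_cancel_right hx]
    refine hle (Perm.mem_alternatingGroup.2 ?_)
    simp [hs, he.neg_one_pow, hy]

theorem exists_hitting_set_alternatingGroup {n : ℕ} (hn : 4 ≤ n) (ho : Odd n) :
    ∃ X : Finset ℕ, #X ≤ 2 * normalCoveringNumber (alternatingGroup (Fin n)) ∧
      (∀ x ∈ X, 0 < x ∧ x < n ∧ n - x ∈ X) ∧
      ∀ a b c, 0 < a → 0 < b → 0 < c → a + b + c = n → ForcesAlt n a b c →
        a ∈ X ∨ b ∈ X ∨ c ∈ X := by
  obtain ⟨H, hH, hcov⟩ := exists_normalCovering (not_isCyclic_alternatingGroup hn)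
  refine exists_hitting_set (fun i => (H i).map (alternatingGroup (Fin n)).subtype)
    fun g A B C hT hs => ?_
  have hg : g ∈ alternatingGroup (Fin n) := by
    rw [Perm.mem_alternatingGroup, hs, ho.neg_one_pow, neg_neg]
  obtain ⟨i, x, hx⟩ := hcov ⟨g, hg⟩
  refine ⟨i, fun hle => hH i ?_, x, ⟨_, hx, rfl⟩⟩
  rw [eq_top_iff]
  intro y _
  obtain ⟨z, hz, hzy⟩ := hle y.2
  rwa [← Subtype.ext hzy]

theorem ForcesAlt.swap {n a b c : ℕ} (h : ForcesAlt n a b c) : ForcesAlt n b a c :=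
  fun g A B C hT hA hB hC => h g B A C hT.swap₁₂ hB hA hC

theorem ForcesAlt.rotate {n a b c : ℕ} (h : ForcesAlt n a b c) : ForcesAlt n b c a :=
  fun g A B C hT hA hB hC => h g C A B hT.rotate.rotate hC hA hB

/-- Some cyclic rotation of the cycle type `(a, b, c)` preserves a block system with
`1 < k < n` blocks. -/
def HasBlocks (n a b c : ℕ) : Prop :=
  ∃ k, 1 < k ∧ k < n ∧ (BlockType k a b c ∨ BlockType k b c a ∨ BlockType k c a b)

theorem BlockType.swap {k a b c : ℕ} (h : BlockType k a b c) : BlockType k b a c := by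
  obtain ⟨h1, d, h2, h3, h4⟩ := h
  exact ⟨h1, d, h3, h2, h4.trans (add_comm _ _)⟩

theorem IsTriCycle.permPrim {n : ℕ} {g : Perm (Fin n)} {A B C : Finset (Fin n)}
    (hT : IsTriCycle g A B C) (hA : 0 < #A) (hB : 0 < #B) (hC : 0 < #C)
    (hgcd : ∀ m, m ∣ #A → m ∣ #B → m ∣ #C → m = 1) (hblk : ¬ HasBlocks n #A #B #C)
    {G : Subgroup (Perm (Fin n))} (hg : g ∈ G) (htr : ∀ x y, ∃ h ∈ G, h x = y) : PermPrim G := by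
  by_contra hG
  obtain ⟨k, hk, hkn, h⟩ := hT.exists_blockType hg htr hG (card_pos.1 hA) (card_pos.1 hB)
    (card_pos.1 hC) hgcd
  exact hblk ⟨k, hk, by simpa using hkn, h⟩

theorem forcesAlt_of_prime {n a b c : ℕ} (ha : a.Prime) (hb : 0 < b) (hc : 0 < c)
    (hab : ¬ a ∣ b) (hac : ¬ a ∣ c) (h3 : a + 3 ≤ n)
    (hgcd : ∀ m, m ∣ a → m ∣ b → m ∣ c → m = 1) (hblk : ¬ HasBlocks n a b c) :
    ForcesAlt n a b c := by
  rintro g A B C hT rfl rfl rfl G hg htr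
  exact (hT.permPrim ha.pos hb hc hgcd hblk hg htr).alternatingGroup_le_of_prime hg hT ha hab hac
    (by simpa using h3)

theorem forcesAlt_of_class {n a b c M : ℕ} (hn : 90 ≤ n) (hM4 : 4 ≤ M) (hM3 : 3 * M < n)
    (hMn : 3 * n ^ 2 ≤ M * (n - 3 * M) ^ 2)
    (hgcd : ∀ m, m ∣ a → m ∣ b → m ∣ c → m = 1) (hblk : ¬ HasBlocks n a b c)
    (ha : 0 < a) (hb : 16 < b) (hc : 2 ≤ c) (hab : Nat.gcd a b ≤ 4) (hbc : Nat.Coprime b c)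
    (hU : (a ≤ M ∧ ¬ a ∣ Nat.gcd a b * Nat.gcd a c) ∨ (b ≤ M ∧ ¬ b ∣ Nat.gcd b a * Nat.gcd b c) ∨
      (c ≤ M ∧ ¬ c ∣ Nat.gcd c a * Nat.gcd c b)) : ForcesAlt n a b c := by
  rintro g A B C hT rfl rfl rfl G hg htr
  have hP := hT.permPrim ha (by omega) (by omega) hgcd hblk hg htr
  have hA := card_pos.1 ha
  rcases hU with ⟨h1, h2⟩ | ⟨h1, h2⟩ | ⟨h1, h2⟩
  · exact hP.alternatingGroup_le hg hT hA hb hc hab hbc hT hA h2 h1 hM4 (by simpa using hM3)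
      (by simpa using hn) (by simpa using hMn)
  · exact hP.alternatingGroup_le hg hT hA hb hc hab hbc hT.swap₁₂ (card_pos.1 (by omega)) h2 h1 hM4
      (by simpa using hM3) (by simpa using hn) (by simpa using hMn)
  · exact hP.alternatingGroup_le hg hT hA hb hc hab hbc hT.rotate.rotate (card_pos.1 (by omega)) h2
      h1 hM4 (by simpa using hM3) (by simpa using hn) (by simpa using hMn)

/-- A divisor-closed family test set: every `m ≥ 5` has a divisor among these numbers. -/
def IsKeyDivisor (f : ℕ) : Prop := f = 6 ∨ f = 8 ∨ f = 9 ∨ (f.Prime ∧ 5 ≤ f)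

theorem exists_prime_or_key_dvd {m : ℕ} (hm : 5 ≤ m) : ∃ f, IsKeyDivisor f ∧ f ∣ m := by
  by_contra! h
  have hp : ∀ p, p.Prime → p ∣ m → p = 2 ∨ p = 3 := by
    intro p hp hpm
    have : ¬ 5 ≤ p := fun h5 => h p (.inr (.inr (.inr ⟨hp, h5⟩))) hpm
    have h2 := hp.two_le
    have : p ≠ 4 := by rintro rfl; revert hp; norm_num
    omega
  by_cases h2 : 2 ∣ m
  · by_cases h3 : 3 ∣ m
    · exact h 6 (.inl rfl) (Nat.Coprime.mul_dvd_of_dvd_of_dvd (by norm_num : Nat.Coprime 2 3) h2 h3)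
    · have := Nat.eq_prime_pow_of_unique_prime_dvd (p := 2) (by omega : m ≠ 0)
        (fun {d} hd hdm => (hp d hd hdm).resolve_right (by rintro rfl; exact h3 hdm))
      refine h 8 (.inr (.inl rfl)) ?_
      rw [this] at hm ⊢
      have : 3 ≤ m.primeFactorsList.length := by
        by_contra! hlt
        interval_cases m.primeFactorsList.length <;> omega
      exact pow_dvd_pow 2 this
  · have := Nat.eq_prime_pow_of_unique_prime_dvd (p := 3) (by omega : m ≠ 0)
        (fun {d} hd hdm => (hp d hd hdm).resolve_left (by rintro rfl; exact h2 hdm))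
    refine h 9 (.inr (.inr (.inl rfl))) ?_
    rw [this] at hm ⊢
    have : 2 ≤ m.primeFactorsList.length := by
      by_contra! hlt
      interval_cases m.primeFactorsList.length <;> omega
    exact pow_dvd_pow 3 this

theorem coprime_small_cases {x y : ℕ} (hx : x < 5) (hy : y < 5) (hx0 : 0 < x) (hy0 : 0 < y)
    (hx1 : x ≠ 1) (hy1 : y ≠ 1) (h : Nat.gcd x y = 1) : (2 ∣ x ∧ 3 ∣ y) ∨ (3 ∣ x ∧ 2 ∣ y) := by
  have key : ∀ x y : Fin 5, Nat.gcd x y = 1 →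
    x.1 < 2 ∨ y.1 < 2 ∨ (2 ∣ x.1 ∧ 3 ∣ y.1) ∨ (3 ∣ x.1 ∧ 2 ∣ y.1) := by decide
  rcases key ⟨x, hx⟩ ⟨y, hy⟩ h with h | h | h
  · simp at h; omega
  · simp at h; omega
  · exact h

theorem coprime_small_triple {x y z : ℕ} (hx : x < 5) (hy : y < 5) (hz : z < 5) (hx0 : 0 < x)
    (hy0 : 0 < y) (hz0 : 0 < z) (hxy : Nat.gcd x y = 1) (hxz : Nat.gcd x z = 1)
    (hyz : Nat.gcd y z = 1) : x = 1 ∨ y = 1 ∨ z = 1 := by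
  by_contra! h
  have h1 := coprime_small_cases hx hy hx0 hy0 h.1 h.2.1 hxy
  have h2 := coprime_small_cases hx hz hx0 hz0 h.1 h.2.2 hxz
  have h3 := coprime_small_cases hy hz hy0 hz0 h.2.1 h.2.2 hyz
  omega

/-- The configurations of `(x, y, z)` not covered by the criteria above. -/
inductive BadCore (n M x y z : ℕ) : Prop
  | block (k : ℕ) (h1 : 1 < k) (h2 : k < n) (h : BlockType k x y z)
  | two (f g : ℕ) (hf : IsKeyDivisor f) (hg : IsKeyDivisor g) (hfg : f.Coprime g) (h1 : f ∣ x)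
      (h2 : f ∣ y) (h3 : g ∣ x) (h4 : g ∣ z)
  | mixed (p : ℕ) (hp : p.Prime) (h5 : 5 ≤ p) (h1 : 2 ∣ x) (h2 : 2 ∣ y) (h3 : 3 ∣ x) (h4 : 3 ∣ z)
      (hy : p ∣ y) (hz : p ∣ z)
  | small (f : ℕ) (hf : IsKeyDivisor f) (h1 : f ∣ x) (h2 : f ∣ y) (h3 : z ≤ 16)
  | one (h : x = 1)
  | tiny (h1 : x ≤ 16) (h2 : y ≤ 16)
  | central (h1 : M < x) (h2 : M < y) (h3 : M < z)
  | split (e g : ℕ) (h1 : M < x) (h2 : y ≤ M) (he : e ≤ 4) (heg : e.Coprime g) (hy : y = e * g)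
      (hx : e ∣ x) (hz : g ∣ z) (hz' : M < z ∨ z = g)

/-- Some ordering of `(a, b, c)` is a `BadCore` configuration. -/
def BadTriple (n M a b c : ℕ) : Prop :=
  BadCore n M a b c ∨ BadCore n M a c b ∨ BadCore n M b a c ∨ BadCore n M c a b ∨
    BadCore n M b c a ∨ BadCore n M c b a

theorem BadTriple.swap {n M a b c : ℕ} (h : BadTriple n M a b c) : BadTriple n M b a c := by
  unfold BadTriple at *; tauto

theorem BadTriple.rotate {n M a b c : ℕ} (h : BadTriple n M a b c) : BadTriple n M b c a := by
  unfold BadTriple at *; tauto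

theorem not_hasBlocks {n M a b c : ℕ} (h : ¬ BadTriple n M a b c) : ¬ HasBlocks n a b c := by
  rintro ⟨k, h1, h2, h3 | h3 | h3⟩
  · exact h (.inl (.block k h1 h2 h3))
  · exact h (.inr (.inr (.inr (.inr (.inl (.block k h1 h2 h3))))))
  · exact h (.inr (.inr (.inr (.inl (.block k h1 h2 h3)))))

section

variable {n M a b c : ℕ} (hn : 90 ≤ n) (hM4 : 4 ≤ M) (hM3 : 3 * M < n)
    (hMn : 3 * n ^ 2 ≤ M * (n - 3 * M) ^ 2)

include hn hM4 hM3 hMn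

theorem forcesAlt_of_vertex (ha : 0 < a) (hb : 16 < b) (hc : 2 ≤ c)
    (hgcd : ∀ m, m ∣ a → m ∣ b → m ∣ c → m = 1) (hbad : ¬ BadTriple n M a b c)
    (hab : Nat.gcd a b ≤ 4) (hbc : Nat.Coprime b c) : ForcesAlt n a b c := by
  have hcop : ∀ {x y z : ℕ}, (∀ m, m ∣ x → m ∣ y → m ∣ z → m = 1) →
      Nat.Coprime (Nat.gcd x y) (Nat.gcd x z) := fun h => h _
    ((Nat.gcd_dvd_left _ _).trans (Nat.gcd_dvd_left _ _))
    ((Nat.gcd_dvd_left _ _).trans (Nat.gcd_dvd_right _ _))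
    ((Nat.gcd_dvd_right _ _).trans (Nat.gcd_dvd_right _ _))
  have hmul : ∀ {x y z : ℕ}, (∀ m, m ∣ x → m ∣ y → m ∣ z → m = 1) →
      x ∣ Nat.gcd x y * Nat.gcd x z → x = Nat.gcd x y * Nat.gcd x z := fun h hd =>
    Nat.dvd_antisymm hd ((hcop h).mul_dvd_of_dvd_of_dvd (Nat.gcd_dvd_left _ _)
      (Nat.gcd_dvd_left _ _))
  refine forcesAlt_of_class hn hM4 hM3 hMn hgcd (not_hasBlocks hbad) ha hb hc hab hbc ?_
  by_contra! hU
  obtain ⟨hU1, hU2, hU3⟩ := hU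
  have hbM : M < b := by
    by_contra! hbM
    have := Nat.le_of_dvd (by simp; omega) (hU2 hbM)
    rw [Nat.Coprime.gcd_eq_one hbc, Nat.gcd_comm] at this
    omega
  by_cases haM : a ≤ M
  · refine hbad (.inr (.inr (.inl (.split (Nat.gcd a b) (Nat.gcd a c) hbM haM hab (hcop hgcd)
      (hmul hgcd (hU1 haM)) (Nat.gcd_dvd_right _ _) (Nat.gcd_dvd_right _ _) ?_))))
    by_contra! hcM
    have hd := hU3 hcM.1
    rw [Nat.gcd_comm c b, Nat.Coprime.gcd_eq_one hbc] at hd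
    refine hcM.2 (Nat.dvd_antisymm ?_ (Nat.gcd_dvd_right _ _))
    rw [Nat.gcd_comm a c]
    simpa using hd
  by_cases hcM : c ≤ M
  · have hg' : ∀ m, m ∣ c → m ∣ b → m ∣ a → m = 1 := fun m h1 h2 h3 => hgcd m h3 h2 h1
    have hbc' : Nat.gcd c b = 1 := by rw [Nat.gcd_comm]; exact hbc
    refine hbad (.inr (.inr (.inr (.inr (.inl (.split (Nat.gcd c b) (Nat.gcd c a) hbM hcM
      (by omega) (hcop hg') (hmul hg' ?_) (Nat.gcd_dvd_right _ _) (Nat.gcd_dvd_right _ _)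
      (.inl (by omega))))))))
    rw [mul_comm]; exact hU3 hcM
  · exact hbad (.inl (.central (by omega) hbM (by omega)))

/-- One edge is divisible by a key divisor, the other two edges at `b` are at most `4`. -/
theorem forcesAlt_of_one_edge (ha : 0 < a) (hb : 0 < b) (hc : 0 < c)
    (hgcd : ∀ m, m ∣ a → m ∣ b → m ∣ c → m = 1) (hbad : ¬ BadTriple n M a b c)
    (hab : Nat.gcd a b ≤ 4) (hbc : Nat.gcd b c ≤ 4) (hac : 5 ≤ Nat.gcd a c) :
    ForcesAlt n a b c := by
  obtain ⟨f, hf, hfd⟩ := exists_prime_or_key_dvd hac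
  have hfa := hfd.trans (Nat.gcd_dvd_left _ _)
  have hfc := hfd.trans (Nat.gcd_dvd_right _ _)
  have hb16 : 16 < b := by
    by_contra! h
    exact hbad (.inr (.inl (.small f hf hfa hfc h)))
  have ha1 : a ≠ 1 := fun h => hbad (.inl (.one h))
  have hc1 : c ≠ 1 := fun h => hbad (.inr (.inr (.inr (.inl (.one h)))))
  by_cases h1 : Nat.gcd b c = 1
  · exact forcesAlt_of_vertex hn hM4 hM3 hMn ha hb16 (by omega) hgcd hbad hab h1
  by_cases h2 : Nat.gcd a b = 1
  · have := forcesAlt_of_vertex hn hM4 hM3 hMn (a := c) (c := a) hc hb16 (by omega)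
      (fun m h1 h2 h3 => hgcd m h3 h2 h1) (fun h => hbad h.rotate.swap.rotate.rotate.rotate)
      (by rw [Nat.gcd_comm]; exact hbc) (by rw [Nat.coprime_comm]; exact h2)
    exact this.swap.rotate.rotate
  exfalso
  have hco : Nat.Coprime (Nat.gcd a b) (Nat.gcd b c) := hgcd _
    ((Nat.gcd_dvd_left _ _).trans (Nat.gcd_dvd_left _ _))
    ((Nat.gcd_dvd_left _ _).trans (Nat.gcd_dvd_right _ _))
    ((Nat.gcd_dvd_right _ _).trans (Nat.gcd_dvd_right _ _))
  have h0 : 0 < Nat.gcd a b := Nat.gcd_pos_of_pos_left _ ha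
  have h0' : 0 < Nat.gcd b c := Nat.gcd_pos_of_pos_left _ hb
  have key : ∀ x y z : ℕ, ¬ BadCore n M x y z → 5 ≤ Nat.gcd y z → 2 ∣ Nat.gcd x y → 3 ∣ Nat.gcd x z →
      (∀ m, m ∣ x → m ∣ y → m ∣ z → m = 1) → False := by
    intro x y z hbad h5 h2 h3 hg
    rw [Nat.dvd_gcd_iff] at h2 h3
    obtain ⟨p, hp, hpd⟩ := exists_prime_or_key_dvd h5
    rw [Nat.dvd_gcd_iff] at hpd
    have n2 : ¬ 2 ∣ p := fun h => by simpa using hg 2 h2.1 h2.2 (h.trans hpd.2)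
    have n3 : ¬ 3 ∣ p := fun h => by simpa using hg 3 h3.1 (h.trans hpd.1) h3.2
    rcases hp with rfl | rfl | rfl | ⟨hp, hp5⟩
    · omega
    · omega
    · omega
    · exact hbad (.mixed p hp hp5 h2.1 h2.2 h3.1 h3.2 hpd.1 hpd.2)
  have h4 : (2 ∣ Nat.gcd a b ∧ 3 ∣ Nat.gcd b c) ∨ (3 ∣ Nat.gcd a b ∧ 2 ∣ Nat.gcd b c) := by
    exact coprime_small_cases (by omega) (by omega) h0 h0' h2 h1 hco
  rcases h4 with ⟨h2, h3⟩ | ⟨h3, h2⟩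
  · exact key b a c (fun h => hbad (.inr (.inr (.inl h)))) hac (by rwa [Nat.gcd_comm]) h3
      fun m h1 h2 h3 => hgcd m h2 h1 h3
  · exact key b c a (fun h => hbad (.inr (.inr (.inr (.inr (.inl h)))))) (by rwa [Nat.gcd_comm]) h2
      (by rwa [Nat.gcd_comm]) fun m h1 h2 h3 => hgcd m h3 h1 h2

theorem forcesAlt_of_coprime_pair (ha : 0 < a) (hb : 0 < b) (hc : 0 < c)
    (hgcd : ∀ m, m ∣ a → m ∣ b → m ∣ c → m = 1) (hbad : ¬ BadTriple n M a b c)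
    (hab : Nat.gcd a b ≤ 4) (hac : Nat.gcd a c ≤ 4) (hbc : Nat.gcd b c = 1) :
    ForcesAlt n a b c := by
  have hb1 : b ≠ 1 := fun h => hbad (.inr (.inr (.inl (.one h))))
  have hc1 : c ≠ 1 := fun h => hbad (.inr (.inr (.inr (.inl (.one h)))))
  by_cases hb16 : 16 < b
  · exact forcesAlt_of_vertex hn hM4 hM3 hMn ha hb16 (by omega) hgcd hbad hab hbc
  by_cases hc16 : 16 < c
  · exact (forcesAlt_of_vertex hn hM4 hM3 hMn (a := a) (b := c) (c := b) ha hc16 (by omega)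
      (fun m h1 h2 h3 => hgcd m h1 h3 h2) (fun h => hbad h.swap.rotate) hac
      (by rw [Nat.coprime_comm]; exact hbc)).swap.rotate
  · exact (hbad (.inr (.inr (.inr (.inr (.inl (.tiny (by omega) (by omega)))))))).elim

theorem badTriple_of_not_forcesAlt (ha : 0 < a) (hb : 0 < b) (hc : 0 < c)
    (hgcd : ∀ m, m ∣ a → m ∣ b → m ∣ c → m = 1) (hF : ¬ ForcesAlt n a b c) :
    BadTriple n M a b c := by
  by_contra hbad
  have hg2 : ∀ m, m ∣ b → m ∣ c → m ∣ a → m = 1 := fun m h1 h2 h3 => hgcd m h3 h1 h2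
  have hg3 : ∀ m, m ∣ c → m ∣ a → m ∣ b → m = 1 := fun m h1 h2 h3 => hgcd m h2 h3 h1
  have two : ∀ x y z : ℕ, (∀ m, m ∣ x → m ∣ y → m ∣ z → m = 1) → 5 ≤ Nat.gcd x y → 5 ≤ Nat.gcd x z →
      BadCore n M x y z := by
    intro x y z hg h1 h2
    obtain ⟨f, hf, hfd⟩ := exists_prime_or_key_dvd h1
    obtain ⟨g, hg', hgd⟩ := exists_prime_or_key_dvd h2
    rw [Nat.dvd_gcd_iff] at hfd hgd
    exact .two f g hf hg' (hg _ ((Nat.gcd_dvd_left _ _).trans hfd.1)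
      ((Nat.gcd_dvd_left _ _).trans hfd.2) ((Nat.gcd_dvd_right _ _).trans hgd.2)) hfd.1 hfd.2
      hgd.1 hgd.2
  have n1 : ¬ (5 ≤ Nat.gcd a b ∧ 5 ≤ Nat.gcd a c) := fun h => hbad (.inl (two _ _ _ hgcd h.1 h.2))
  have n2 : ¬ (5 ≤ Nat.gcd a b ∧ 5 ≤ Nat.gcd b c) := fun h =>
    hbad (.inr (.inr (.inr (.inr (.inl (two _ _ _ hg2 h.2 (by rw [Nat.gcd_comm]; exact h.1)))))))
  have n3 : ¬ (5 ≤ Nat.gcd a c ∧ 5 ≤ Nat.gcd b c) := fun h =>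
    hbad (.inr (.inr (.inr (.inl (two _ _ _ hg3 (by rw [Nat.gcd_comm]; exact h.1)
      (by rw [Nat.gcd_comm]; exact h.2))))))
  by_cases e1 : 5 ≤ Nat.gcd a b
  · exact hF (forcesAlt_of_one_edge hn hM4 hM3 hMn (a := b) (b := c) (c := a) hb hc ha hg2
      (fun h => hbad h.rotate.rotate) (by omega) (by rw [Nat.gcd_comm]; omega)
      (by rw [Nat.gcd_comm]; omega)).rotate.rotate
  by_cases e2 : 5 ≤ Nat.gcd a c
  · exact hF (forcesAlt_of_one_edge hn hM4 hM3 hMn ha hb hc hgcd hbad (by omega) (by omega) e2)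
  by_cases e3 : 5 ≤ Nat.gcd b c
  · exact hF (forcesAlt_of_one_edge hn hM4 hM3 hMn (a := c) (b := a) (c := b) hc ha hb hg3
      (fun h => hbad h.rotate) (by rw [Nat.gcd_comm]; omega) (by omega)
      (by rw [Nat.gcd_comm]; omega)).rotate
  have hone : Nat.gcd a b = 1 ∨ Nat.gcd a c = 1 ∨ Nat.gcd b c = 1 := by
    have c1 : Nat.Coprime (Nat.gcd a b) (Nat.gcd a c) := hgcd _
      ((Nat.gcd_dvd_left _ _).trans (Nat.gcd_dvd_left _ _))
      ((Nat.gcd_dvd_left _ _).trans (Nat.gcd_dvd_right _ _))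
      ((Nat.gcd_dvd_right _ _).trans (Nat.gcd_dvd_right _ _))
    have c2 : Nat.Coprime (Nat.gcd a b) (Nat.gcd b c) := hgcd _
      ((Nat.gcd_dvd_left _ _).trans (Nat.gcd_dvd_left _ _))
      ((Nat.gcd_dvd_left _ _).trans (Nat.gcd_dvd_right _ _))
      ((Nat.gcd_dvd_right _ _).trans (Nat.gcd_dvd_right _ _))
    have c3 : Nat.Coprime (Nat.gcd a c) (Nat.gcd b c) := hgcd _
      ((Nat.gcd_dvd_left _ _).trans (Nat.gcd_dvd_left _ _))
      ((Nat.gcd_dvd_right _ _).trans (Nat.gcd_dvd_left _ _))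
      ((Nat.gcd_dvd_left _ _).trans (Nat.gcd_dvd_right _ _))
    have p1 : 0 < Nat.gcd a b := Nat.gcd_pos_of_pos_left _ ha
    have p2 : 0 < Nat.gcd a c := Nat.gcd_pos_of_pos_left _ ha
    have p3 : 0 < Nat.gcd b c := Nat.gcd_pos_of_pos_left _ hb
    exact coprime_small_triple (by omega) (by omega) (by omega) p1 p2 p3 c1 c2 c3
  rcases hone with h | h | h
  · exact hF (forcesAlt_of_coprime_pair hn hM4 hM3 hMn (a := c) (b := a) (c := b) hc ha hb hg3
      (fun h => hbad h.rotate) (by rw [Nat.gcd_comm]; omega) (by rw [Nat.gcd_comm]; omega) h).rotate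
  · exact hF (forcesAlt_of_coprime_pair hn hM4 hM3 hMn (a := b) (b := c) (c := a) hb hc ha hg2
      (fun h => hbad h.rotate.rotate) (by omega) (by rw [Nat.gcd_comm]; omega)
      (by rw [Nat.gcd_comm]; exact h)).rotate.rotate
  · exact hF (forcesAlt_of_coprime_pair hn hM4 hM3 hMn ha hb hc hgcd hbad (by omega) (by omega) h)

end

/-- The number of `b` for which the cycle types `(a, b, n - a - b)` does not force a subgroup to contain
the alternating group. -/
noncomputable def badCount (n a : ℕ) : ℕ := by
  classical exact #{b ∈ Ico 1 (n - a) | ¬ ForcesAlt n a b (n - a - b)}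

/-- A set of cycle lengths, closed under `x ↦ n - x`, which meets every generating partition. -/
structure IsHittingSet (n : ℕ) (X : Finset ℕ) : Prop where
  pos : ∀ x ∈ X, 0 < x
  lt : ∀ x ∈ X, x < n
  compl_mem : ∀ x ∈ X, n - x ∈ X
  hits : ∀ a b c, 0 < a → 0 < b → 0 < c → a + b + c = n → ForcesAlt n a b c →
    a ∈ X ∨ b ∈ X ∨ c ∈ X

namespace IsHittingSet

variable {n s : ℕ} {X : Finset ℕ}

theorem le_badCount (hX : IsHittingSet n X) {a : ℕ} (ha : a ∉ X) (ha0 : 0 < a) (han : a < n) :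
    n - 2 ≤ badCount n a + badCount n (n - a) + 2 * #X := by
  classical
  have hna : n - a ∉ X := fun h => ha (by simpa [Nat.sub_sub_self han.le] using hX.compl_mem _ h)
  have hsub : (Ico 1 n).erase (n - a) ⊆
      (((Ico 1 (n - a)).filter fun b => ¬ ForcesAlt n a b (n - a - b)) ∪
        ((Ico 1 (n - (n - a))).filter
          fun b => ¬ ForcesAlt n (n - a) b (n - (n - a) - b)).image (n - ·)) ∪
      (X ∪ X.image fun w => if a < w then w - a else w + n - a) := by
    intro y hy
    simp only [mem_erase, mem_Ico] at hy
    simp only [mem_union, mem_filter, mem_image, mem_Ico]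
    by_cases hya : y < n - a
    · by_cases hF : ForcesAlt n a y (n - a - y)
      · right
        rcases hX.hits _ _ _ ha0 (by omega) (by omega) (by omega) hF with h | h | h
        · exact absurd h ha
        · exact .inl h
        · refine .inr ⟨a + y, ?_, by rw [if_pos (by omega)]; omega⟩
          have := hX.compl_mem _ h
          rwa [show n - (n - a - y) = a + y by omega] at this
      · exact .inl (.inl ⟨by omega, hF⟩)
    · by_cases hF : ForcesAlt n (n - a) (n - y) (n - (n - a) - (n - y))
      · right
        rcases hX.hits _ _ _ (by omega) (by omega) (by omega) (by omega) hF with h | h | h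
        · exact absurd h hna
        · refine .inl ?_
          have := hX.compl_mem _ h
          rwa [show n - (n - y) = y by omega] at this
        · exact .inr ⟨_, h, by rw [if_neg (by omega)]; omega⟩
      · exact .inl (.inr ⟨n - y, ⟨by omega, hF⟩, by omega⟩)
  have h1 := card_le_card hsub
  rw [card_erase_of_mem (by simp; omega), Nat.card_Ico] at h1
  have h2 := card_union_le
    (((Ico 1 (n - a)).filter fun b => ¬ ForcesAlt n a b (n - a - b)) ∪
        ((Ico 1 (n - (n - a))).filter
          fun b => ¬ ForcesAlt n (n - a) b (n - (n - a) - b)).image (n - ·))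
      (X ∪ X.image fun w => if a < w then w - a else w + n - a)
  have h3 := card_union_le ((Ico 1 (n - a)).filter fun b => ¬ ForcesAlt n a b (n - a - b))
        (((Ico 1 (n - (n - a))).filter
          fun b => ¬ ForcesAlt n (n - a) b (n - (n - a) - b)).image (n - ·))
  have h4 := card_union_le X (X.image fun w => if a < w then w - a else w + n - a)
  have h5 : #(X.image fun w => if a < w then w - a else w + n - a) ≤ #X := card_image_le
  have h6 : #(((Ico 1 (n - (n - a))).filter
          fun b => ¬ ForcesAlt n (n - a) b (n - (n - a) - b)).image (n - ·)) ≤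
      #((Ico 1 (n - (n - a))).filter fun b => ¬ ForcesAlt n (n - a) b (n - (n - a) - b)) :=
    card_image_le
  have e1 : badCount n a = #((Ico 1 (n - a)).filter fun b => ¬ ForcesAlt n a b (n - a - b)) := by
    unfold badCount; congr
  have e2 : badCount n (n - a) = #((Ico 1 (n - (n - a))).filter
      fun b => ¬ ForcesAlt n (n - a) b (n - (n - a) - b)) := by
    unfold badCount; congr
  omega

theorem card_lower_half_le (hX : IsHittingSet n X) (hs : #X ≤ 2 * s) :
    #{x ∈ X | 2 * x < n} ≤ s := by
  have h1 : #({x ∈ X | 2 * x < n}.image (n - ·)) = #{x ∈ X | 2 * x < n} := by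
    refine card_image_of_injOn fun x hx y hy hxy => ?_
    have hx := (mem_filter.1 (mem_coe.1 hx)).2
    have hy := (mem_filter.1 (mem_coe.1 hy)).2
    have hxy : n - x = n - y := hxy
    omega
  have h2 : Disjoint {x ∈ X | 2 * x < n} ({x ∈ X | 2 * x < n}.image (n - ·)) := by
    rw [disjoint_left]
    simp only [mem_filter, mem_image, not_exists]
    rintro x ⟨hx, hx2⟩ y ⟨⟨hy, hy2⟩, rfl⟩
    omega
  have h3 := card_le_card (show {x ∈ X | 2 * x < n} ∪ ({x ∈ X | 2 * x < n}.image (n - ·)) ⊆ X by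
    intro x
    simp only [mem_union, mem_filter, mem_image]
    rintro (h | ⟨y, ⟨h, -⟩, rfl⟩)
    · exact h.1
    · exact hX.compl_mem _ h)
  rw [card_union_of_disjoint h2] at h3
  omega

/-- If many `a` have few bad partitions, the hitting set is large. -/
theorem card_good_le (hX : IsHittingSet n X) (hs : #X ≤ 2 * s) (G : Finset ℕ)
    (hG : ∀ a ∈ G, 0 < a ∧ 2 * a < n ∧ badCount n a + badCount n (n - a) + 4 * s < n - 2) :
    #G ≤ s := by
  refine (card_le_card fun a ha => ?_).trans (hX.card_lower_half_le hs)
  obtain ⟨h1, h2, h3⟩ := hG a ha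
  rw [mem_filter]
  refine ⟨?_, h2⟩
  by_contra haX
  have := hX.le_badCount haX h1 (by omega)
  omega

theorem sum_badCount_ge (hX : IsHittingSet n X) (hs : #X ≤ 2 * s) (h4 : 4 * s ≤ n - 2)
    (A : Finset ℕ) (hA : ∀ a ∈ A, 0 < a ∧ a < n ∧ n - a ∈ A) :
    (#A - 2 * s) * (n - 2 - 4 * s) ≤ 2 * ∑ a ∈ A, badCount n a := by
  have h1 : ∑ a ∈ A, badCount n (n - a) = ∑ a ∈ A, badCount n a := by
    refine sum_bij' (fun a _ => n - a) (fun a _ => n - a) (fun a ha => (hA a ha).2.2)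
      (fun a ha => (hA a ha).2.2) ?_ ?_ fun a ha => rfl
    all_goals
      intro a ha
      have := hA a ha
      omega
  have h2 : #A - 2 * s ≤ #(A \ X) := by
    have := le_card_sdiff X A
    omega
  calc (#A - 2 * s) * (n - 2 - 4 * s) ≤ #(A \ X) * (n - 2 - 4 * s) := Nat.mul_le_mul_right _ h2
    _ = #(A \ X) • (n - 2 - 4 * s) := by simp
    _ ≤ ∑ a ∈ A \ X, (badCount n a + badCount n (n - a)) := by
      refine card_nsmul_le_sum _ _ _ fun a ha => ?_
      rw [mem_sdiff] at ha
      have := hX.le_badCount ha.2 (hA a ha.1).1 (hA a ha.1).2.1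
      omega
    _ ≤ ∑ a ∈ A, (badCount n a + badCount n (n - a)) :=
      sum_le_sum_of_subset sdiff_subset
    _ = 2 * ∑ a ∈ A, badCount n a := by rw [sum_add_distrib, h1, two_mul]

end IsHittingSet

/-- At most `x` elements of `S` satisfy `P`. -/
def CardBound {α : Type*} (S : Finset α) (P : α → Prop) (x : ℝ) : Prop :=
  ∀ U ⊆ S, (∀ b ∈ U, P b) → (#U : ℝ) ≤ x

namespace CardBound

variable {α ι : Type*} {S : Finset α} {P Q : α → Prop} {x y : ℝ}

theorem nonneg (h : CardBound S P x) : 0 ≤ x := by simpa using h ∅ (by simp) (by simp)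

theorem mono (h : CardBound S P x) (hQ : ∀ b ∈ S, Q b → P b) (hxy : x ≤ y) : CardBound S Q y :=
  fun U hU hUQ => (h U hU fun b hb => hQ b (hU hb) (hUQ b hb)).trans hxy

theorem le (h : CardBound S P x) (hxy : x ≤ y) : CardBound S P y :=
  h.mono (fun _ _ h => h) hxy

theorem or (h : CardBound S P x) (h' : CardBound S Q y) :
    CardBound S (fun b => P b ∨ Q b) (x + y) := by
  classical
  intro U hU hUP
  have h1 : U ⊆ {b ∈ U | P b} ∪ {b ∈ U | Q b} := by
    intro b hb
    simpa [hb] using hUP b hb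
  have h2 := h {b ∈ U | P b} ((filter_subset _ _).trans hU) (by simp)
  have h3 := h' {b ∈ U | Q b} ((filter_subset _ _).trans hU) (by simp)
  have h4 : (#U : ℝ) ≤ #{b ∈ U | P b} + #{b ∈ U | Q b} := by
    exact_mod_cast (card_le_card h1).trans (card_union_le _ _)
  linarith

theorem exists_mem {I : Finset ι} {P : ι → α → Prop} {c : ι → ℝ}
    (h : ∀ i ∈ I, CardBound S (P i) (c i)) :
    CardBound S (fun b => ∃ i ∈ I, P i b) (∑ i ∈ I, c i) := by
  classical
  intro T hTS hT
  have h1 : T ⊆ I.biUnion fun i => {b ∈ T | P i b} := by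
    intro b hb
    obtain ⟨i, hi, hP⟩ := hT b hb
    simp only [mem_biUnion, mem_filter]
    exact ⟨i, hi, hb, hP⟩
  calc (#T : ℝ) ≤ ((∑ i ∈ I, #{b ∈ T | P i b} : ℕ) : ℝ) := by
        exact_mod_cast (card_le_card h1).trans card_biUnion_le
    _ = ∑ i ∈ I, (#{b ∈ T | P i b} : ℝ) := by push_cast; rfl
    _ ≤ _ := sum_le_sum fun i hi => h i hi _ ((filter_subset _ _).trans hTS)
      fun b hb => (mem_filter.1 hb).2

theorem of_forall_not (h : ∀ b ∈ S, ¬ P b) : CardBound S P 0 := by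
  intro U hU hP
  rw [show U = ∅ from eq_empty_of_forall_notMem fun b hb => h b (hU hb) (hP b hb)]
  simp

theorem ite {p : Prop} [Decidable p] (h : p → CardBound S P x) :
    CardBound S (fun b => p ∧ P b) (if p then x else 0) := by
  split_ifs with hp
  · exact (h hp).mono (fun b _ h => h.2) le_rfl
  · exact of_forall_not fun b _ h => hp h.1

theorem subset {S' : Finset α} (h : CardBound S P x) (hS : ∀ b ∈ S', P b → b ∈ S) :
    CardBound S' P x :=
  fun U hU hP => h U (fun b hb => hS b (hU hb) (hP b hb)) hP

theorem eq_image [DecidableEq α] (S : Finset α) (I : Finset ι) (f : ι → α) :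
    CardBound S (fun b => ∃ i ∈ I, b = f i) #I := by
  intro U _ hU
  have : U ⊆ I.image f := fun b hb => by
    obtain ⟨i, hi, rfl⟩ := hU b hb
    exact mem_image_of_mem _ hi
  exact_mod_cast (card_le_card this).trans card_image_le

theorem modEq {m lo hi : ℕ} {P : ℕ → Prop}
    (h : ∀ x ∈ Ico lo hi, ∀ y ∈ Ico lo hi, P x → P y → x ≡ y [MOD m]) :
    CardBound (Ico lo hi) P (((hi - lo) / m : ℕ) + 1) := by
  intro T hT hP
  have h1 : #T ≤ #(range ((hi - lo) / m + 1)) := by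
    refine card_le_card_of_injOn (fun x => (x - lo) / m) (fun x hx => ?_) fun x hx y hy hxy => ?_
    · have := mem_Ico.1 (hT hx)
      simp only [coe_range, Set.mem_Iio]
      exact Nat.lt_succ_of_le (Nat.div_le_div_right (by omega))
    · have h1 := mem_Ico.1 (hT hx)
      have h2 := mem_Ico.1 (hT hy)
      have h3 : (x - lo) ≡ (y - lo) [MOD m] := by
        have := h x (hT hx) y (hT hy) (hP x hx) (hP y hy)
        refine Nat.ModEq.add_right_cancel' lo ?_
        rwa [Nat.sub_add_cancel h1.1, Nat.sub_add_cancel h2.1]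
      have h4 : x - lo = y - lo := by
        rw [← Nat.div_add_mod (x - lo) m, ← Nat.div_add_mod (y - lo) m, h3]
        exact congrArg (fun t => m * t + (y - lo) % m) hxy
      omega
  rw [card_range] at h1
  exact_mod_cast h1

theorem dvd {m : ℕ} (hm : 0 < m) (hi : ℕ) :
    CardBound (Ico 1 hi) (fun b => m ∣ b) (((hi - 1) / m : ℕ) : ℝ) := by
  intro T hT h
  have h1 : #T ≤ #(Ioc 0 ((hi - 1) / m)) := by
    refine card_le_card_of_injOn (fun x => x / m) (fun x hx => ?_) fun x hx y hy hxy => ?_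
    · have := mem_Ico.1 (hT hx)
      simp only [coe_Ioc, Set.mem_Ioc]
      exact ⟨Nat.div_pos (Nat.le_of_dvd (by omega) (h x hx)) hm, Nat.div_le_div_right (by omega)⟩
    · rw [← Nat.div_mul_cancel (h x hx), ← Nat.div_mul_cancel (h y hy)]
      exact congrArg (· * m) hxy
  exact_mod_cast (by simpa using h1)

theorem reflect {L : ℕ} {P : ℕ → Prop} {x : ℝ} (h : CardBound (Ico 1 L) P x) :
    CardBound (Ico 1 L) (fun b => P (L - b)) x := by
  intro U hU hP
  have h1 := h (U.image (L - ·)) (fun b hb => by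
    obtain ⟨c, hc, rfl⟩ := mem_image.1 hb
    have := mem_Ico.1 (hU hc)
    exact mem_Ico.2 (by omega)) fun b hb => by
      obtain ⟨c, hc, rfl⟩ := mem_image.1 hb
      exact hP c hc
  rwa [card_image_of_injOn fun b hb c hc hbc => ?_] at h1
  have e1 := mem_Ico.1 (hU hb)
  have e2 := mem_Ico.1 (hU hc)
  have hbc : L - b = L - c := hbc
  omega

end CardBound

theorem modEq_of_dvd_of_dvd_sub {f g L x y : ℕ} (hfg : f.Coprime g) (hx : x ≤ L) (hy : y ≤ L)
    (h1 : f ∣ x) (h2 : f ∣ y) (h3 : g ∣ L - x) (h4 : g ∣ L - y) : x ≡ y [MOD f * g] := by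
  rw [← Nat.modEq_and_modEq_iff_modEq_mul hfg]
  refine ⟨((Nat.modEq_zero_iff_dvd.2 h1).trans (Nat.modEq_zero_iff_dvd.2 h2).symm), ?_⟩
  have h5 : L - y + x ≡ L - y + y [MOD g] := by
    have e1 : L - y + x ≡ 0 + x [MOD g] := (Nat.modEq_zero_iff_dvd.2 h4).add_right _
    have e2 : L - x + x ≡ 0 + x [MOD g] := (Nat.modEq_zero_iff_dvd.2 h3).add_right _
    rw [Nat.sub_add_cancel hy]
    rw [Nat.sub_add_cancel hx] at e2
    exact e1.trans e2.symm
  exact Nat.ModEq.add_left_cancel' _ h5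

theorem IsKeyDivisor.pos {f : ℕ} (hf : IsKeyDivisor f) : 0 < f := by
  rcases hf with h | h | h | ⟨-, h⟩ <;> omega

open Classical in
/-- The key divisors of `m`. -/
noncomputable def keyDivisors (m : ℕ) : Finset ℕ := {f ∈ m.divisors | IsKeyDivisor f}

theorem mem_keyDivisors {m f : ℕ} (hm : 0 < m) : f ∈ keyDivisors m ↔ f ∣ m ∧ IsKeyDivisor f := by
  simp [keyDivisors, hm.ne']

/-- The divisors of `m` which are at most `4`. -/
def smallDivisors (m : ℕ) : Finset ℕ := {e ∈ Icc 1 4 | e ∣ m}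

theorem mem_smallDivisors {m e : ℕ} : e ∈ smallDivisors m ↔ (1 ≤ e ∧ e ≤ 4) ∧ e ∣ m := by
  simp [smallDivisors]

theorem BlockType.symm {k a b c : ℕ} (h : BlockType k a b c) : BlockType k b a c := by
  obtain ⟨h1, d, h2, h3, h4⟩ := h
  exact ⟨h1, d, h3, h2, by omega⟩

theorem BlockType.dvd_sum {k a b c : ℕ} (h : BlockType k a b c) : k ∣ a + b + c := by
  obtain ⟨h1, d, -, -, h4⟩ := h
  exact (Nat.dvd_add_right (h4 ▸ Dvd.intro_left d rfl)).2 h1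

theorem badCount_le_of_cardBound {n a : ℕ} {x : ℝ} {P : ℕ → Prop}
    (hP : ∀ b ∈ Ico 1 (n - a), ¬ ForcesAlt n a b (n - a - b) → P b)
    (h : CardBound (Ico 1 (n - a)) P x) : (badCount n a : ℝ) ≤ x := by
  classical
  unfold badCount
  refine h _ (filter_subset _ _) fun b hb => ?_
  rw [mem_filter] at hb
  exact hP b hb.1 hb.2

theorem badCount_le_sub (n a : ℕ) : badCount n a ≤ n - a - 1 := by
  classical
  unfold badCount
  exact (card_le_card (filter_subset _ _)).trans (by simp)

/-- The divisors of `n` other than `1` and `n`. -/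
def nontrivialDivisors (n : ℕ) : Finset ℕ := (n.divisors.erase 1).erase n

theorem mem_nontrivialDivisors {n k : ℕ} (hn : 0 < n) :
    k ∈ nontrivialDivisors n ↔ k ≠ n ∧ k ≠ 1 ∧ k ∣ n := by
  simp [nontrivialDivisors, hn.ne']

theorem card_nontrivialDivisors {n : ℕ} (hn : 1 < n) :
    #(nontrivialDivisors n) = #n.divisors - 2 := by
  rw [nontrivialDivisors, card_erase_of_mem (by simp; omega), card_erase_of_mem (by simp; omega)]
  omega

theorem three_mul_le_of_dvd_odd {n k : ℕ} (hn : 0 < n) (hk : k ∣ n) (hkn : k ≠ n) :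
    (if n % 2 = 0 then 2 else 3) * k ≤ n := by
  obtain ⟨m, rfl⟩ := hk
  have h0 : m ≠ 0 := by rintro rfl; simp at hn
  have h1 : m ≠ 1 := by rintro rfl; simp at hkn
  rw [mul_comm]
  refine Nat.mul_le_mul_left _ ?_
  split_ifs with h
  · omega
  · have : m ≠ 2 := by rintro rfl; omega
    omega

theorem badCount_le_of_prime {n a : ℕ} (ha : a.Prime) (hna : ¬ a ∣ n) (h3 : a + 3 ≤ n) :
    (badCount n a : ℝ) ≤ 2 * (((n - a - 1) / a : ℕ) +
      if (if n % 2 = 0 then 2 else 3) * a < n then ((#n.divisors - 2 : ℕ) : ℝ) else 0) := by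
  set q := if n % 2 = 0 then 2 else 3 with hq
  set L := n - a with hL
  have h1 : CardBound (Ico 1 L) (fun b => a ∣ b) (((L - 1) / a : ℕ) : ℝ) := .dvd ha.pos L
  have h2 : CardBound (Ico 1 L) (fun b => q * a < n ∧ ∃ k ∈ nontrivialDivisors n, b = k - a)
      (if q * a < n then ((#n.divisors - 2 : ℕ) : ℝ) else 0) := by
    refine .ite fun _ => ?_
    rw [← card_nontrivialDivisors (by omega)]
    exact .eq_image _ _ _
  have h3' := h1.or h2
  have h4 := h3'.or h3'.reflect
  rw [two_mul]
  refine badCount_le_of_cardBound (fun b hb hF => ?_) h4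
  rw [mem_Ico] at hb
  by_contra! hbad
  obtain ⟨⟨hb1, hb2⟩, hb3, hb4⟩ := hbad
  have key : ∀ x y, 0 < x → 0 < y → x + y = L → ¬ a ∣ x →
      (q * a < n → ∀ k ∈ nontrivialDivisors n, x ≠ k - a) → ∀ k, 1 < k → k < n →
      ¬ BlockType k a x y := by
    intro x y hx hy hxy hax h k hk1 hkn hB
    have hdn := hB.dvd_sum
    rw [show a + x + y = n by omega] at hdn
    obtain ⟨h5, d, h6, h7, h8⟩ := hB
    rcases (Nat.dvd_prime ha).1 h6 with rfl | rfl
    · rw [one_mul] at h8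
      have := three_mul_le_of_dvd_odd (by omega) hdn (by omega)
      rw [← hq] at this
      have h9 : q * a < q * k := Nat.mul_lt_mul_of_pos_left (by omega) (by rw [hq]; split_ifs <;> omega)
      exact h (by omega) k ((mem_nontrivialDivisors (by omega)).2 ⟨by omega, by omega, hdn⟩)
        (by omega)
    · exact hax h7
  refine hF (forcesAlt_of_prime ha (by omega) (by omega) hb1 hb3 h3 (fun m h5 h6 h7 => ?_) ?_)
  · rcases (Nat.dvd_prime ha).1 h5 with rfl | rfl
    · rfl
    · exact absurd h6 hb1
  · rintro ⟨k, hk1, hkn, h5 | h5 | h5⟩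
    · exact key b _ (by omega) (by omega) (by omega) hb1 hb2 k hk1 hkn h5
    · have hdn := h5.dvd_sum
      rw [show b + (n - a - b) + a = n by omega] at hdn
      rcases (Nat.dvd_prime ha).1 h5.1 with rfl | rfl
      · omega
      · exact hna hdn
    · exact key (n - a - b) b (by omega) (by omega) (by omega) hb3 hb4 k hk1 hkn h5.symm

section

variable {n M a : ℕ}

/-- The bad partitions `(a, b, L - b)`, up to swapping `b` and `L - b`, apart from the central ones. -/
def HalfBad (n M a L b : ℕ) : Prop :=
  (∃ t ∈ nontrivialDivisors n ×ˢ a.divisors, b = t.2 * t.1 - a) ∨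
  (∃ t ∈ (keyDivisors a ×ˢ keyDivisors a).filter (fun t => t.1 < t.2 ∧ t.1.Coprime t.2),
    t.1 ∣ b ∧ t.2 ∣ L - b) ∨
  (∃ t ∈ keyDivisors a ×ˢ keyDivisors L, t.1 * t.2 ∣ b) ∨
  (6 ∣ a ∧ ∃ p ∈ keyDivisors L, Nat.Coprime p 6 ∧ (2 * p) ∣ b ∧ 3 ∣ L - b) ∨
  (((2 ∣ a ∧ 3 ∣ L) ∨ (3 ∣ a ∧ 2 ∣ L)) ∧
    ∃ p ∈ keyDivisors a, Nat.Coprime p 6 ∧ 6 ∣ b ∧ p ∣ L - b) ∨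
  (∃ f ∈ keyDivisors a, f ∣ b ∧ L - b ≤ 16) ∨
  (∃ i ∈ ({1} : Finset ℕ), b = i) ∨
  (M < a ∧ ∃ t ∈ smallDivisors a ×ˢ L.divisors, b = t.1 * t.2) ∨
  (M < a ∧ ∃ t ∈ smallDivisors L ×ˢ a.divisors, b = t.1 * t.2) ∨
  (a ≤ M ∧ ∃ e ∈ smallDivisors a, Nat.Coprime e (a / e) ∧ e ∣ b ∧ a / e ∣ L - b ∧ M < b ∧
    (M < L - b ∨ L - b = a / e)) ∨
  (a ≤ M ∧ ∃ e ∈ Icc 1 4, b = e * a)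

theorem halfBad_of_badTriple {b c L : ℕ} (hcop : a.Coprime n) (ha16 : 16 < a) (hL : 32 < L)
    (haL : a + L = n) (hb : 0 < b) (hc : 0 < c) (hbc : b + c = L) (h : BadTriple n M a b c) :
    HalfBad n M a L b ∨ HalfBad n M a L c ∨ (M < a ∧ M < b ∧ M < c) := by
  have hn : 0 < n := by omega
  have hpr : ∀ {x}, x ∣ a → x ∣ n → x = 1 := fun h1 h2 =>
    Nat.dvd_one.1 (hcop ▸ Nat.dvd_gcd h1 h2)
  have hkey : ∀ {p}, p.Prime → 5 ≤ p → Nat.Coprime p 6 := by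
    intro p hp h5
    rw [hp.coprime_iff_not_dvd, show 6 = 2 * 3 from rfl, hp.dvd_mul]
    intro h
    have := h.imp (Nat.le_of_dvd (by omega)) (Nat.le_of_dvd (by omega))
    omega
  -- the cases in which `a` is the first of the three
  have first : ∀ {b c}, 0 < b → 0 < c → b + c = L → BadCore n M a b c →
      HalfBad n M a L b ∨ HalfBad n M a L c ∨ (M < a ∧ M < b ∧ M < c) := by
    clear h hb hc hbc b c
    intro b c hb hc hbc h
    have hLb : L - b = c := by omega
    have hLc : L - c = b := by omega
    rcases h with ⟨k, h1, h2, h3⟩ | ⟨f, g, hf, hg, hfg, h1, h2, h3, h4⟩ |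
      ⟨p, hp, h5, h1, h2, h3, h4, hy, hz⟩ | ⟨f, hf, h1, h2, h3⟩ | h | ⟨h1, h2⟩ | ⟨h1, h2, h3⟩ |
      ⟨e, g, h1, h2, he, heg, hy, hx, hz, hz'⟩
    · have hdn := h3.dvd_sum
      rw [show a + b + c = n by omega] at hdn
      obtain ⟨-, d, h4, h5, h6⟩ := h3
      refine .inl (.inl ⟨(k, d), ?_, ?_⟩)
      · simp only [mem_product, mem_nontrivialDivisors hn, Nat.mem_divisors]
        exact ⟨⟨by omega, by omega, hdn⟩, h4, by omega⟩
      · simp only; omega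
    · rcases lt_trichotomy f g with h | h | h
      · refine .inl (.inr (.inl ⟨(f, g), ?_, h2, by rwa [hLb]⟩))
        simp only [mem_filter, mem_product, mem_keyDivisors (show 0 < a by omega)]
        exact ⟨⟨⟨h1, hf⟩, h3, hg⟩, h, hfg⟩
      · subst h
        rw [Nat.coprime_self] at hfg
        subst hfg
        rcases hf with h | h | h | ⟨-, h⟩ <;> omega
      · refine .inr (.inl (.inr (.inl ⟨(g, f), ?_, h4, by rwa [hLc]⟩)))
        simp only [mem_filter, mem_product, mem_keyDivisors (show 0 < a by omega)]
        exact ⟨⟨⟨h3, hg⟩, h1, hf⟩, h, hfg.symm⟩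
    · refine .inl (.inr (.inr (.inr (.inl ⟨?_, p, ?_, hkey hp h5, ?_, by rwa [hLb]⟩))))
      · exact Nat.Coprime.mul_dvd_of_dvd_of_dvd (by norm_num) h1 h3
      · rw [mem_keyDivisors (by omega)]
        exact ⟨hbc ▸ Nat.dvd_add hy hz, .inr (.inr (.inr ⟨hp, h5⟩))⟩
      · refine Nat.Coprime.mul_dvd_of_dvd_of_dvd ?_ h2 hy
        exact (Nat.Coprime.coprime_dvd_right (by norm_num : 2 ∣ 6) (hkey hp h5)).symm
    · refine .inl (.inr (.inr (.inr (.inr (.inr (.inl ⟨f, ?_, h2, by omega⟩))))))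
      rw [mem_keyDivisors (by omega)]
      exact ⟨h1, hf⟩
    · omega
    · omega
    · exact .inr (.inr ⟨h1, h2, h3⟩)
    · refine .inl (.inr (.inr (.inr (.inr (.inr (.inr (.inr (.inl ⟨h1, (e, g), ?_, hy⟩))))))))
      have he0 : e ≠ 0 := by rintro rfl; omega
      simp only [mem_product, mem_smallDivisors, Nat.mem_divisors]
      exact ⟨⟨by omega, hx⟩, hbc ▸ Nat.dvd_add (hy ▸ Dvd.intro_left e rfl) hz, by omega⟩
  have second : ∀ {b c}, 0 < b → 0 < c → b + c = L → BadCore n M b a c →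
      HalfBad n M a L b ∨ HalfBad n M a L c ∨ (M < a ∧ M < b ∧ M < c) := by
    clear h hb hc hbc b c
    intro b c hb hc hbc h
    have hLb : L - b = c := by omega
    have hLc : L - c = b := by omega
    rcases h with ⟨k, h1, h2, h3⟩ | ⟨f, g, hf, hg, hfg, h1, h2, h3, h4⟩ |
      ⟨p, hp, h5, h1, h2, h3, h4, hy, hz⟩ | ⟨f, hf, h1, h2, h3⟩ | h | ⟨h1, h2⟩ | ⟨h1, h2, h3⟩ |
      ⟨e, g, h1, h2, he, heg, hy, hx, hz, hz'⟩
    · exact first hb hc hbc (.block k h1 h2 h3.symm)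
    · refine .inl (.inr (.inr (.inl ⟨(f, g), ?_, hfg.mul_dvd_of_dvd_of_dvd h1 h3⟩)))
      simp only [mem_product, mem_keyDivisors (show 0 < a by omega),
        mem_keyDivisors (show 0 < L by omega)]
      exact ⟨⟨h2, hf⟩, hbc ▸ Nat.dvd_add h3 h4, hg⟩
    · refine .inl (.inr (.inr (.inr (.inr (.inl ⟨.inl ⟨h2, hbc ▸ Nat.dvd_add h3 h4⟩, p, ?_,
        hkey hp h5, Nat.Coprime.mul_dvd_of_dvd_of_dvd (by norm_num) h1 h3, by rwa [hLb]⟩)))))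
      rw [mem_keyDivisors (by omega)]
      exact ⟨hy, .inr (.inr (.inr ⟨hp, h5⟩))⟩
    · exact first hb hc hbc (.small f hf h2 h1 h3)
    · exact .inl (.inr (.inr (.inr (.inr (.inr (.inr (.inl ⟨1, by simp, h⟩)))))))
    · omega
    · exact .inr (.inr ⟨h2, h1, h3⟩)
    · have he0 : e ≠ 0 := by rintro rfl; omega
      refine .inl (.inr (.inr (.inr (.inr (.inr (.inr (.inr (.inr (.inr (.inl ⟨h2, e, ?_, ?_⟩))))))))))
      · rw [mem_smallDivisors]
        exact ⟨by omega, Dvd.intro _ hy.symm⟩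
      · rw [show a / e = g by rw [hy]; exact Nat.mul_div_cancel_left g (by omega), hLb]
        exact ⟨heg, hx, hz, h1, hz'⟩
  have third : ∀ {b c}, 0 < b → 0 < c → b + c = L → BadCore n M b c a →
      HalfBad n M a L b ∨ HalfBad n M a L c ∨ (M < a ∧ M < b ∧ M < c) := by
    clear h hb hc hbc b c
    intro b c hb hc hbc h
    have hLb : L - b = c := by omega
    have hLc : L - c = b := by omega
    rcases h with ⟨k, h1, h2, h3⟩ | ⟨f, g, hf, hg, hfg, h1, h2, h3, h4⟩ |
      ⟨p, hp, h5, h1, h2, h3, h4, hy, hz⟩ | ⟨f, hf, h1, h2, h3⟩ | h | ⟨h1, h2⟩ | ⟨h1, h2, h3⟩ |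
      ⟨e, g, h1, h2, he, heg, hy, hx, hz, hz'⟩
    · have hdn := h3.dvd_sum
      rw [show b + c + a = n by omega] at hdn
      have := hpr h3.1 hdn
      omega
    · exact second hb hc hbc (.two g f hg hf hfg.symm h3 h4 h1 h2)
    · refine .inl (.inr (.inr (.inr (.inr (.inl ⟨.inr ⟨h4, hbc ▸ Nat.dvd_add h1 h2⟩, p, ?_,
        hkey hp h5, Nat.Coprime.mul_dvd_of_dvd_of_dvd (by norm_num) h1 h3, by rwa [hLb]⟩)))))
      rw [mem_keyDivisors (by omega)]
      exact ⟨hz, .inr (.inr (.inr ⟨hp, h5⟩))⟩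
    · omega
    · exact .inl (.inr (.inr (.inr (.inr (.inr (.inr (.inl ⟨1, by simp, h⟩)))))))
    · omega
    · exact .inr (.inr ⟨h3, h1, h2⟩)
    · have he0 : e ≠ 0 := by rintro rfl; omega
      by_cases haM : M < a
      · refine .inr (.inl (.inr (.inr (.inr (.inr (.inr (.inr (.inr (.inr (.inl
          ⟨haM, (e, g), ?_, hy⟩))))))))))
        simp only [mem_product, mem_smallDivisors, Nat.mem_divisors]
        exact ⟨⟨by omega, hbc ▸ Nat.dvd_add hx (hy ▸ Dvd.intro _ rfl)⟩, hz, by omega⟩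
      · refine .inr (.inl (.inr (.inr (.inr (.inr (.inr (.inr (.inr (.inr (.inr (.inr
          ⟨by omega, e, by simp; omega, ?_⟩)))))))))))
        rw [hy, hz'.resolve_left haM]
  have sw : ∀ {b c}, (HalfBad n M a L b ∨ HalfBad n M a L c ∨ (M < a ∧ M < b ∧ M < c)) →
      (HalfBad n M a L c ∨ HalfBad n M a L b ∨ (M < a ∧ M < c ∧ M < b)) := by tauto
  rcases h with h | h | h | h | h | h
  · exact first hb hc hbc h
  · exact sw (first hc hb (by omega) h)
  · exact second hb hc hbc h
  · exact sw (second hc hb (by omega) h)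
  · exact third hb hc hbc h
  · exact sw (third hc hb (by omega) h)

end

/-- The sum of the reciprocals of the key divisors of `m`. -/
noncomputable def keySum (m : ℕ) : ℝ := ∑ f ∈ keyDivisors m, (1 / f : ℝ)

/-- The sum of the squares of the reciprocals of the key divisors of `m`. -/
noncomputable def keySqSum (m : ℕ) : ℝ := ∑ f ∈ keyDivisors m, (1 / f : ℝ) ^ 2

theorem two_mul_sum_lt_eq (K : Finset ℕ) (h : ℕ → ℕ → ℝ) (hsymm : ∀ f g, h f g = h g f) :
    2 * ∑ t ∈ (K ×ˢ K).filter (fun t => t.1 < t.2), h t.1 t.2 =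
      ∑ f ∈ K, ∑ g ∈ K, h f g - ∑ f ∈ K, h f f := by
  have h1 : ∑ t ∈ (K ×ˢ K).filter (fun t => t.1 < t.2), h t.1 t.2 =
      ∑ f ∈ K, ∑ g ∈ K, if f < g then h f g else 0 := by
    rw [sum_filter, sum_product]
  have h2 : ∑ f ∈ K, ∑ g ∈ K, (if f < g then h f g else 0) =
      ∑ f ∈ K, ∑ g ∈ K, if g < f then h f g else 0 := by
    rw [sum_comm]
    exact sum_congr rfl fun f _ => sum_congr rfl fun g _ => by rw [hsymm]
  have h3 : ∑ f ∈ K, h f f = ∑ f ∈ K, ∑ g ∈ K, if f = g then h f g else 0 :=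
    sum_congr rfl fun f hf => by rw [sum_ite_eq, if_pos hf]
  rw [two_mul, h1]
  nth_rewrite 2 [h2]
  rw [h3, ← sum_add_distrib, ← sum_sub_distrib]
  refine sum_congr rfl fun f _ => ?_
  rw [← sum_add_distrib, ← sum_sub_distrib]
  refine sum_congr rfl fun g _ => ?_
  rcases lt_trichotomy f g with h | h | h
  · rw [if_pos h, if_neg (by omega), if_neg (by omega)]; ring
  · rw [if_neg (by omega), if_neg (by omega), if_pos h]; ring
  · rw [if_neg (by omega), if_pos h, if_neg (by omega)]; ring

/-- A bound for the number of `b` satisfying `HalfBad n M a L b`. -/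
noncomputable def halfBound (n M a L : ℕ) : ℝ :=
  (#n.divisors - 2 : ℕ) * #a.divisors +
  ((L * (keySum a ^ 2 - keySqSum a) + #(keyDivisors a) * (#(keyDivisors a) - 1)) / 2 +
  (L * keySum a * keySum L +
  ((if 6 ∣ a then L * keySum L / 6 + #(keyDivisors L) else 0) +
  ((if (2 ∣ a ∧ 3 ∣ L) ∨ (3 ∣ a ∧ 2 ∣ L) then L * keySum a / 6 + #(keyDivisors a) else 0) +
  ((16 * keySum a + #(keyDivisors a)) +
  (1 +
  ((if M < a then (#(smallDivisors a) * #L.divisors : ℝ) else 0) +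
  ((if M < a then (#(smallDivisors L) * #a.divisors : ℝ) else 0) +
  ((if a ≤ M then (#(smallDivisors a) * (((L - 2 * M) / a : ℕ) + 2) : ℝ) else 0) +
  (if a ≤ M then 4 else 0))))))))))

theorem cardBound_halfBad {n M a L : ℕ} (hn : 1 < n) (ha : 0 < a) (hL : 32 < L) :
    CardBound (Ico 1 L) (HalfBad n M a L) (halfBound n M a L) := by
  have hkpos : ∀ {m f}, 0 < m → f ∈ keyDivisors m → 0 < f := fun hm hf =>
    ((mem_keyDivisors hm).1 hf).2.pos
  refine .or ?_ (.or ?_ (.or ?_ (.or ?_ (.or ?_ (.or ?_ (.or ?_ (.or ?_ (.or ?_ (.or ?_ ?_)))))))))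
  · refine (CardBound.eq_image _ _ _).le ?_
    rw [card_product, card_nontrivialDivisors hn]
    push_cast
    exact le_rfl
  · have h1 : CardBound (Ico 1 L) (fun b => ∃ t ∈ (keyDivisors a ×ˢ keyDivisors a).filter
        (fun t => t.1 < t.2 ∧ t.1.Coprime t.2), t.1 ∣ b ∧ t.2 ∣ L - b)
        (∑ t ∈ (keyDivisors a ×ˢ keyDivisors a).filter (fun t => t.1 < t.2 ∧ t.1.Coprime t.2),
          ((L : ℝ) * ((1 / t.1) * (1 / t.2)) + 1)) := by
      refine .exists_mem fun t ht => ?_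
      have hc := (mem_filter.1 ht).2.2
      refine (CardBound.modEq (m := t.1 * t.2) fun x hx y hy h1 h2 => ?_).le ?_
      · rw [mem_Ico] at hx hy
        exact modEq_of_dvd_of_dvd_sub hc hx.2.le hy.2.le h1.1 h2.1 h1.2 h2.2
      · gcongr
        refine Nat.cast_div_le.trans ?_
        rw [Nat.cast_mul, one_div_mul_one_div, ← div_eq_mul_one_div]
        gcongr
        omega
    refine h1.le ?_
    have h2 := two_mul_sum_lt_eq (keyDivisors a)
      (fun f g => (L : ℝ) * ((1 / f) * (1 / g)) + 1) (fun f g => by ring)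
    have h3 : ∑ t ∈ (keyDivisors a ×ˢ keyDivisors a).filter (fun t => t.1 < t.2 ∧ t.1.Coprime t.2),
          ((L : ℝ) * ((1 / t.1) * (1 / t.2)) + 1) ≤
        ∑ t ∈ (keyDivisors a ×ˢ keyDivisors a).filter (fun t => t.1 < t.2),
          ((L : ℝ) * ((1 / t.1) * (1 / t.2)) + 1) :=
      sum_le_sum_of_subset_of_nonneg
        (fun t ht => by rw [mem_filter] at ht ⊢; exact ⟨ht.1, ht.2.1⟩) fun _ _ _ => by positivity
    have h4 : ∑ f ∈ keyDivisors a, ∑ g ∈ keyDivisors a, ((L : ℝ) * ((1 / f) * (1 / g)) + 1) =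
        L * keySum a ^ 2 + #(keyDivisors a) * #(keyDivisors a) := by
      simp only [sum_add_distrib, ← mul_sum, sum_const, keySum, ← sum_mul, sq]
      simp
    have h5 : ∑ f ∈ keyDivisors a, ((L : ℝ) * ((1 / f) * (1 / f)) + 1) =
        L * keySqSum a + #(keyDivisors a) := by
      simp only [sum_add_distrib, ← mul_sum, sum_const, keySqSum, sq]
      simp
    rw [h4, h5] at h2
    linarith
  · have h1 : CardBound (Ico 1 L) (fun b => ∃ t ∈ keyDivisors a ×ˢ keyDivisors L, t.1 * t.2 ∣ b)
        (∑ t ∈ keyDivisors a ×ˢ keyDivisors L, ((L : ℝ) * (1 / t.1) * (1 / t.2))) := by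
      refine .exists_mem fun t ht => ?_
      rw [mem_product] at ht
      refine (CardBound.dvd (Nat.mul_pos (hkpos ha ht.1) (hkpos (by omega) ht.2)) L).le ?_
      refine Nat.cast_div_le.trans ?_
      rw [Nat.cast_mul, mul_assoc, one_div_mul_one_div, ← div_eq_mul_one_div]
      gcongr
      omega
    refine h1.le (le_of_eq ?_)
    rw [sum_product, keySum, keySum, mul_assoc, sum_mul_sum, mul_sum]
    exact sum_congr rfl fun f _ => by
      rw [mul_sum]
      exact sum_congr rfl fun g _ => mul_assoc _ _ _
  · refine .ite fun _ => ?_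
    have h1 : CardBound (Ico 1 L)
        (fun b => ∃ p ∈ keyDivisors L, Nat.Coprime p 6 ∧ 2 * p ∣ b ∧ 3 ∣ L - b)
        (∑ p ∈ keyDivisors L, ((L : ℝ) * (1 / p) / 6 + 1)) := by
      refine .exists_mem fun p _ => ?_
      by_cases hp : Nat.Coprime p 6
      · refine (CardBound.modEq (m := 2 * p * 3) fun x hx y hy h1 h2 => ?_).le ?_
        · rw [mem_Ico] at hx hy
          refine modEq_of_dvd_of_dvd_sub ?_ hx.2.le hy.2.le h1.2.1 h2.2.1 h1.2.2 h2.2.2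
          exact Nat.Coprime.mul_left (by norm_num) (hp.coprime_dvd_right (by norm_num))
        · gcongr
          refine Nat.cast_div_le.trans ?_
          rw [show (L : ℝ) * (1 / p) / 6 = L / ((2 * p * 3 : ℕ) : ℝ) by
            push_cast; rw [← div_eq_mul_one_div, div_div]; ring_nf]
          gcongr
          omega
      · exact (CardBound.of_forall_not fun b _ h => hp h.1).le (by positivity)
    refine h1.le (le_of_eq ?_)
    rw [sum_add_distrib, ← sum_div, ← mul_sum, keySum]
    simp
  · refine .ite fun _ => ?_
    have h1 : CardBound (Ico 1 L)
        (fun b => ∃ p ∈ keyDivisors a, Nat.Coprime p 6 ∧ 6 ∣ b ∧ p ∣ L - b)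
        (∑ p ∈ keyDivisors a, ((L : ℝ) * (1 / p) / 6 + 1)) := by
      refine .exists_mem fun p _ => ?_
      by_cases hp : Nat.Coprime p 6
      · refine (CardBound.modEq (m := 6 * p) fun x hx y hy h1 h2 => ?_).le ?_
        · rw [mem_Ico] at hx hy
          exact modEq_of_dvd_of_dvd_sub hp.symm hx.2.le hy.2.le h1.2.1 h2.2.1 h1.2.2 h2.2.2
        · gcongr
          refine Nat.cast_div_le.trans ?_
          rw [show (L : ℝ) * (1 / p) / 6 = L / ((6 * p : ℕ) : ℝ) by
            push_cast; rw [← div_eq_mul_one_div, div_div]; ring_nf]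
          gcongr
          omega
      · exact (CardBound.of_forall_not fun b _ h => hp h.1).le (by positivity)
    refine h1.le (le_of_eq ?_)
    rw [sum_add_distrib, ← sum_div, ← mul_sum, keySum]
    simp
  · have h1 : CardBound (Ico 1 L) (fun b => ∃ f ∈ keyDivisors a, f ∣ b ∧ L - b ≤ 16)
        (∑ f ∈ keyDivisors a, (16 * (1 / f : ℝ) + 1)) := by
      refine .exists_mem fun f _ => ?_
      have h2 : CardBound (Ico (L - 16) L) (fun b => f ∣ b ∧ L - b ≤ 16)
          (((L - (L - 16)) / f : ℕ) + 1) := CardBound.modEq fun x _ y _ h1 h2 =>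
        (Nat.modEq_zero_iff_dvd.2 h1.1).trans (Nat.modEq_zero_iff_dvd.2 h2.1).symm
      refine (h2.subset fun b hb h => ?_).le ?_
      · rw [mem_Ico] at hb ⊢
        omega
      · gcongr
        refine Nat.cast_div_le.trans ?_
        rw [show L - (L - 16) = 16 by omega, ← div_eq_mul_one_div]
        norm_num
    refine h1.le (le_of_eq ?_)
    rw [sum_add_distrib, ← mul_sum, keySum]
    simp
  · exact (CardBound.eq_image _ _ _).le (by simp)
  · refine .ite fun _ => (CardBound.eq_image _ _ _).le ?_
    rw [card_product]
    push_cast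
    exact le_rfl
  · refine .ite fun _ => (CardBound.eq_image _ _ _).le ?_
    rw [card_product]
    push_cast
    exact le_rfl
  · refine .ite fun _ => ?_
    have h1 : CardBound (Ico 1 L) (fun b => ∃ e ∈ smallDivisors a, Nat.Coprime e (a / e) ∧ e ∣ b ∧
        a / e ∣ L - b ∧ M < b ∧ (M < L - b ∨ L - b = a / e))
        (∑ _e ∈ smallDivisors a, (((L - 2 * M) / a : ℕ) + 2 : ℝ)) := by
      refine .exists_mem fun e he => ?_
      have hea : e * (a / e) = a := Nat.mul_div_cancel' (mem_smallDivisors.1 he).2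
      by_cases hco : Nat.Coprime e (a / e)
      · have h2 : CardBound (Ico (M + 1) (L - M)) (fun b => e ∣ b ∧ a / e ∣ L - b)
            (((L - M - (M + 1)) / (e * (a / e)) : ℕ) + 1) := by
          refine CardBound.modEq fun x hx y hy h1 h2 => ?_
          rw [mem_Ico] at hx hy
          exact modEq_of_dvd_of_dvd_sub hco (by omega) (by omega) h1.1 h2.1 h1.2 h2.2
        have h3 : CardBound (Ico 1 L) (fun b => (e ∣ b ∧ a / e ∣ L - b) ∧ M < b ∧ M < L - b)
            (((L - M - (M + 1)) / (e * (a / e)) : ℕ) + 1) :=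
          (h2.mono (fun b _ h => h.1) le_rfl).subset fun b hb h => by
            rw [mem_Ico] at hb ⊢
            omega
        have h4 : CardBound (Ico 1 L) (fun b => ∃ i ∈ ({L - a / e} : Finset ℕ), b = i) 1 :=
          (CardBound.eq_image _ _ _).le (by simp)
        refine (h3.or h4).mono (fun b hb h => ?_) ?_
        · obtain ⟨-, h5, h6, h7, h8 | h8⟩ := h
          · exact .inl ⟨⟨h5, h6⟩, h7, h8⟩
          · refine .inr ⟨_, mem_singleton_self _, ?_⟩
            rw [mem_Ico] at hb
            omega
        · rw [hea, add_assoc, one_add_one_eq_two]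
          gcongr ?_ + 2
          exact_mod_cast Nat.div_le_div_right (by omega)
      · exact (CardBound.of_forall_not fun b _ h => hco h.1).le (by positivity)
    refine h1.le (le_of_eq ?_)
    rw [sum_const, nsmul_eq_mul]
  · exact .ite fun _ => (CardBound.eq_image _ _ _).le (by simp)

theorem badCount_le_halfBound {n M a : ℕ} (hn : 90 ≤ n) (hM4 : 4 ≤ M) (hM3 : 3 * M < n)
    (hMn : 3 * n ^ 2 ≤ M * (n - 3 * M) ^ 2) (hcop : a.Coprime n) (ha : 16 < a)
    (hL : a + 32 < n) :
    (badCount n a : ℝ) ≤ 2 * halfBound n M a (n - a) +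
      (if M < a then ((n - a - 2 * M - 1 : ℕ) : ℝ) else 0) := by
  have h1 := cardBound_halfBad (n := n) (M := M) (a := a) (L := n - a) (by omega) (by omega)
    (by omega)
  have h2 : CardBound (Ico 1 (n - a)) (fun b => M < a ∧ M < b ∧ M < n - a - b)
      (if M < a then ((n - a - 2 * M - 1 : ℕ) : ℝ) else 0) := by
    refine .ite fun _ U _ hU => ?_
    have : U ⊆ Ico (M + 1) (n - a - M) := fun b hb => by
      have := hU b hb
      rw [mem_Ico]
      omega
    have h3 := card_le_card this
    rw [Nat.card_Ico] at h3
    exact_mod_cast h3.trans (by omega)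
  rw [two_mul]
  refine badCount_le_of_cardBound (fun b hb hF => ?_) ((h1.or h1.reflect).or h2)
  rw [mem_Ico] at hb
  have h3 := badTriple_of_not_forcesAlt hn hM4 hM3 hMn (by omega) (by omega)
    (show 0 < n - a - b by omega) (fun m h4 h5 h6 => ?_) hF
  · rw [or_assoc]
    exact halfBad_of_badTriple hcop ha (by omega) (by omega) (by omega) (by omega) (by omega) h3
  · have h7 : m ∣ n := by
      have := Nat.dvd_add (Nat.dvd_add h4 h5) h6
      rwa [show a + b + (n - a - b) = n by omega] at this
    exact Nat.dvd_one.1 (hcop ▸ Nat.dvd_gcd h4 h7)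

namespace KernelCheck

/-- `f x`, where evaluation in the kernel computes `x` first. -/
def force {α : Type} (x : ℕ) (f : ℕ → α) : α := Nat.rec (f 0) (fun m _ => f m) (Nat.add x 1)

/-- `if b then x else y`. -/
def pick {α : Type} (b : Bool) (x y : α) : α := Bool.rec y x b

/-- The minimum of `x` and `y`. -/
def least (x y : ℕ) : ℕ := force x fun x => force y fun y => pick (Nat.ble x y) x y

/-- Whether `k < 54 ^ 2` is a key divisor. -/
def isKey (k : ℕ) : Bool :=
  pick (Nat.ble k 53) (Nat.beq (Nat.mod (Nat.shiftRight 9159071991737312 k) 2) 1)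
    (Nat.beq (Nat.gcd k 32589158477190044730) 1)

/-- The contribution of the divisor `k` to `divisorData`. -/
def divisorTerm (k : ℕ) : ℕ :=
  Nat.add 302231454903657293676544 (Nat.add (pick (Nat.ble k 4) 1237940039285380274899124224 0)
      (pick (isKey k) (Nat.add (Nat.div (Nat.add 16383 k) k) (Nat.add (Nat.mul (Nat.div 268435456
      (Nat.mul k k)) 67108864) 73786976294838206464)) 0))

/-- The packed divisor sums of `x`. -/
def divisorData (x : ℕ) : ℕ :=
  Nat.rec 0 (fun d ih => pick (Nat.beq (Nat.mod x (Nat.succ d)) 0)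
    (Nat.add ih (Nat.add (divisorTerm (Nat.succ d)) (pick (Nat.ble (Nat.div x (Nat.succ d)) 53) 0
        (divisorTerm (Nat.div x (Nat.succ d)))))) ih) 53

/-- The number with base `2 ^ w` digits `f 0, …, f (m - 1)`. -/
def pack (w : ℕ) (f : ℕ → ℕ) (m : ℕ) : ℕ :=
  Nat.rec 0 (fun k ih => Nat.add ih (Nat.shiftLeft (f k) (Nat.mul w k))) m

/-- The table of all `divisorData x` for `x < 54 ^ 2`. -/
def table : ℕ := pack 5616 (fun i => pack 104 (fun j => divisorData (Nat.add (Nat.mul 54 i) j)) 54)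
    54

/-- The `x`-th entry of the table. -/
def entry (tab x : ℕ) : ℕ :=
  Nat.land (Nat.shiftRight tab (Nat.mul 104 x)) 20282409603651670423947251286015

/-- The sum of `⌈2 ^ 14 / f⌉` over the key divisors, from packed divisor sums. -/
def keyField (r : ℕ) : ℕ := Nat.mod r 67108864

/-- The sum of `⌊2 ^ 28 / f ^ 2⌋` over the key divisors, from packed divisor sums. -/
def sqField (r : ℕ) : ℕ := Nat.mod (Nat.shiftRight r 26) 1099511627776

/-- The number of key divisors, from packed divisor sums. -/
def keyCount (r : ℕ) : ℕ := Nat.mod (Nat.shiftRight r 66) 4096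

/-- The number of divisors, from packed divisor sums. -/
def divisorCount (r : ℕ) : ℕ := Nat.mod (Nat.shiftRight r 78) 4096

/-- The number of divisors which are at most `4`, from packed divisor sums. -/
def smallCount (r : ℕ) : ℕ := Nat.shiftRight r 90

/-- A bound for `2 ^ 28 * badCount n x` in terms of the packed divisor sums of `x` and `L = n - x`,
where `S = keyField r`, `w = keyCount r` and `τ = divisorCount r`. -/
def mainCost (t M x L r r' S w τ : ℕ) : ℕ :=
  Nat.add
    (Nat.add (Nat.mul (Nat.add (Nat.add (Nat.mul (Nat.mul 2 t) τ) (Nat.mul w (Nat.succ w))) (pick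
        (Nat.ble x M) (Nat.add (Nat.mul (Nat.mul 2 (smallCount r)) (Nat.add (Nat.div (Nat.sub L
        (Nat.mul 2 M)) x) 2)) 10) (Nat.add (Nat.add (Nat.mul 2 (Nat.add (Nat.mul (smallCount r)
        (divisorCount r')) (Nat.mul (smallCount r') τ))) (Nat.sub (Nat.sub L (Nat.mul 2 M)) 1))
        2))) 268435456) (Nat.sub (Nat.mul S (Nat.add 524288 (Nat.mul L (Nat.add S (Nat.mul 2
        (keyField r')))))) (Nat.mul L (sqField r))))
    (pick (Nat.beq (Nat.mod x 6) 0)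
      (Nat.add (Nat.mul (keyCount r') 536870912) (Nat.mul (Nat.add (Nat.div (Nat.mul L (keyField
          r')) 3) 1) 16384))
      (pick (Nat.beq (Nat.mod (Nat.mul x L) 6) 0)
        (pick (Nat.beq (Nat.mod L 6) 0) 0 (Nat.add (Nat.mul w 536870912) (Nat.mul (Nat.add (Nat.div
            (Nat.mul L S) 3) 1) 16384))) 0))

/-- A bound for `2 ^ 28 * badCount n x` for a prime number `x`. -/
def primeCost (n t x L : ℕ) : ℕ :=
  Nat.mul (Nat.add (Nat.mul 2 (Nat.div (Nat.sub L 1) x)) (pick (Nat.ble n (Nat.mul (pick (Nat.beq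
      (Nat.mod n 2) 0) 2 3) x)) 0 (Nat.mul 2 t))) 268435456

/-- A bound for `2 ^ 28 * badCount n x`. -/
def cost (n t M lo x L r r' : ℕ) : ℕ :=
  force (divisorCount r) fun τ =>
  pick (Nat.beq τ 2)
    (pick (Nat.ble L 2) (Nat.mul (Nat.sub L 1) 268435456) (primeCost n t x L))
    (pick (Nat.ble x 16) (Nat.mul (Nat.sub L 1) 268435456)
    (pick (Nat.ble L lo) (Nat.mul (Nat.sub L 1) 268435456)
    (least (Nat.mul (Nat.sub L 1) 268435456)
      (force (keyField r) fun S => force (keyCount r) fun w => mainCost t M x L r r' S w τ))))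

/-- Whether the costs of `a` and `n - a` have a sum below `th`. -/
def isGood (tab n t M lo th a : ℕ) : Bool :=
  force (Nat.sub n a) fun L => force (entry tab a) fun r => force (entry tab L) fun r' =>
  Nat.ble (Nat.succ (Nat.add (cost n t M lo a L r r') (cost n t M lo L a r' r))) th

/-- Whether at least `k` of the numbers `a, …, a + m - 1` are coprime to `n` and good. -/
def hasGood (tab n t M lo th m : ℕ) : ℕ → ℕ → Bool :=
  Nat.rec (fun _ k => Nat.beq k 0) (fun _ ih a k => force a fun a =>
    Nat.rec true (fun k' _ =>
      pick (pick (Nat.beq (Nat.gcd a n) 1) (isGood tab n t M lo th a) false)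
        (ih (Nat.succ a) k') (ih (Nat.succ a) (Nat.succ k'))) k) m

/-- The integer part of the square root of `x < 4 ^ m`. -/
def isqrt (x m : ℕ) : ℕ :=
  Nat.rec (fun r => r) (fun i ih r =>
    force (Nat.add r (Nat.pow 2 i)) fun r' => pick (Nat.ble (Nat.mul r' r') x) (ih r') (ih r)) m 0

/-- The product of `p ^ 2 - 1` over the primes `p ≤ 53` dividing `n`. -/
def numProd (n : ℕ) (l : List ℕ) : ℕ :=
  List.rec 1 (fun p _ ih => pick (Nat.beq (Nat.mod n p) 0) (Nat.mul (Nat.sub (Nat.mul p p) 1) ih)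
      ih) l

/-- The product of `p ^ 2` over the primes `p ≤ 53` dividing `n`. -/
def denProd (n : ℕ) (l : List ℕ) : ℕ :=
  List.rec 1 (fun p _ ih => pick (Nat.beq (Nat.mod n p) 0) (Nat.mul (Nat.mul p p) ih) ih) l

/-- The primes up to `53`. -/
def primesList : List ℕ := [2, 3, 5, 7, 11, 13, 17, 19, 23, 29, 31, 37, 41, 43, 47, 53]

/-- Whether `M` is an admissible parameter. -/
def isValid (n M : ℕ) : Bool :=
  pick (Nat.ble 90 n) (pick (Nat.ble 4 M) (pick (Nat.ble (Nat.succ (Nat.mul 3 M)) n)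
    (Nat.ble (Nat.mul 3 (Nat.mul n n)) (Nat.mul M (Nat.mul (Nat.sub n (Nat.mul 3 M)) (Nat.sub n
        (Nat.mul 3 M))))) false) false) false

/-- The first admissible parameter among `q`, …, `q - m + 1`. -/
def findValid (n m : ℕ) : ℕ → ℕ :=
  Nat.rec (fun q => q) (fun _ ih q => pick (isValid n q) q (force (Nat.sub q 1) ih)) m

/-- A sufficient condition for the main theorem for `n`. -/
def check (tab n : ℕ) : Bool :=
  force (numProd n primesList) fun P => force (denProd n primesList) fun Q =>
  force (isqrt (Nat.mul 1048576 n) 16) fun t =>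
  force (isqrt (Nat.div (Nat.mul (Nat.mul 1048576 (Nat.mul n n)) (Nat.sub (Nat.mul 3 Q) (Nat.mul 2
      P))) (Nat.mul 3 Q)) 22) fun R =>
  force (Nat.div (Nat.add (Nat.sub (Nat.sub (Nat.mul 1024 n) R) (Nat.mul 2 t)) 2047) 2048) fun k =>
  force (findValid n 30 (Nat.div (Nat.sub (Nat.sub n (Nat.mul 3 (Nat.div t 1024))) 5) 3)) fun M =>
  force (pick (isValid n M) 33 n) fun lo =>
  force (Nat.sub (divisorCount (entry tab n)) 2) fun τ =>
  force (Nat.mul (Nat.sub (Nat.add n 2) (Nat.mul 4 k)) 268435456) fun th =>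
  hasGood tab n τ M lo th (Nat.div (Nat.sub n 1) 2) 1 k

/-- The bound below which `check` is used, depending on the residue class of `n` modulo `6`. -/
def threshold (n : ℕ) : ℕ :=
  pick (Nat.beq (Nat.mod n 2) 0) (pick (Nat.beq (Nat.mod n 3) 0) 2850 1050)
    (pick (Nat.beq (Nat.mod n 3) 0) 1200 2000)

/-- Whether `check` succeeds on all `n` from `n₀` to `n₀ + m - 1` up to the threshold. -/
def checkAll (tab m : ℕ) : ℕ → Bool :=
  Nat.rec (fun _ => true) (fun _ ih n =>
    pick (pick (Nat.ble n (threshold n)) (check tab n) true) (force (Nat.succ n) ih) false) m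

end KernelCheck

namespace KernelCheck

@[simp] theorem force_eq {α : Type} (x : ℕ) (f : ℕ → α) : force x f = f x := rfl

@[simp] theorem pick_eq {α : Type} (b : Bool) (x y : α) : pick b x y = if b then x else y := by
  cases b <;> rfl

theorem least_eq (x y : ℕ) : least x y = min x y := by
  simp only [least, force_eq, pick_eq, Nat.ble_eq]
  rcases le_total x y with h | h
  · rw [if_pos h, min_eq_left h]
  · split_ifs with h'
    · omega
    · omega

/-- A list of all small key divisors, as a bit mask. -/
theorem isKey_of_le {k : ℕ} (hk : k ≤ 53) : isKey k = true ↔ IsKeyDivisor k := by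
  have h : isKey k = true ↔ (k = 6 ∨ k = 8 ∨ k = 9 ∨ (k.Prime ∧ 5 ≤ k)) := by
    interval_cases k <;> first | (norm_num [isKey]; done) | (simp [isKey] <;> norm_num)
  exact h

theorem isKey_of_lt {k : ℕ} (hk : 53 < k) (hk' : k < 54 ^ 2) : isKey k = true ↔ IsKeyDivisor k := by
  have h1 : isKey k = true ↔ k.Coprime 32589158477190044730 := by
    simp only [isKey, pick_eq, Nat.ble_eq, if_neg (not_le.2 hk), Nat.beq_eq]
  have h2 : IsKeyDivisor k ↔ k.Prime := by
    unfold IsKeyDivisor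
    constructor
    · rintro (h | h | h | h)
      · omega
      · omega
      · omega
      · exact h.1
    · exact fun h => Or.inr (Or.inr (Or.inr ⟨h, by omega⟩))
  rw [h1, h2]
  have h3 : (32589158477190044730 : ℕ) = primesList.prod := by simp [primesList]
  constructor
  · intro h
    by_contra hp
    have hm := Nat.minFac_prime (n := k) (by omega)
    have h4 : k.minFac < 54 := by
      have := Nat.minFac_sq_le_self (by omega) hp
      exact lt_of_pow_lt_pow_left₀ 2 (by norm_num) (this.trans_lt hk')
    have h5 : k.minFac ∣ 32589158477190044730 := by
      have h6 : ∀ p < 54, p.Prime → p ∈ primesList := by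
        intro p hp hpp
        interval_cases p <;> first | (simp [primesList]; done) | (exfalso; revert hpp; norm_num)
      rw [h3]
      exact List.dvd_prod (h6 _ h4 hm)
    exact hm.one_lt.ne' (Nat.eq_one_of_dvd_coprimes h (Nat.minFac_dvd k) h5)
  · intro hp
    rw [hp.coprime_iff_not_dvd, h3]
    intro h
    obtain ⟨q, hq, hkq⟩ := (Prime.dvd_prod_iff hp.prime).1 h
    have : q ≤ 53 ∧ 0 < q := by
      revert q
      simp [primesList]
    have := Nat.le_of_dvd this.2 hkq
    omega

theorem isKey_iff {k : ℕ} (hk : k < 54 ^ 2) : isKey k = true ↔ IsKeyDivisor k := by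
  rcases le_or_gt k 53 with h | h
  · exact isKey_of_le h
  · exact isKey_of_lt h hk

end KernelCheck

namespace KernelCheck

theorem pack_eq_sum (w : ℕ) (f : ℕ → ℕ) (m : ℕ) : pack w f m = ∑ k ∈ range m, f k * 2 ^ (w * k) := by
  induction m with
  | zero => rfl
  | succ m ih => rw [sum_range_succ, ← ih, ← Nat.shiftLeft_eq]; rfl

theorem pack_add (w : ℕ) (f : ℕ → ℕ) (m k : ℕ) :
    pack w f (m + k) = pack w f m + pack w (fun j => f (m + j)) k * 2 ^ (w * m) := by
  rw [pack_eq_sum, sum_range_add, pack_eq_sum, pack_eq_sum, sum_mul]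
  congr 1
  refine sum_congr rfl fun j _ => ?_
  rw [mul_add, pow_add]
  ring

theorem pack_mul (w c : ℕ) (f : ℕ → ℕ) (m : ℕ) :
    pack (w * c) (fun i => pack w (fun j => f (c * i + j)) c) m = pack w f (c * m) := by
  induction m with
  | zero => rfl
  | succ m ih =>
    rw [mul_add_one, pack_add, pack_add, ih]
    simp [pack_eq_sum, mul_assoc]

theorem pack_lt {w : ℕ} {f : ℕ → ℕ} (hf : ∀ k, f k < 2 ^ w) (m : ℕ) : pack w f m < 2 ^ (w * m) := by
  induction m with
  | zero => exact Nat.one_pos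
  | succ m ih =>
    rw [pack_add, mul_add_one, pow_add]
    have h1 : pack w (fun j => f (m + j)) 1 = f m := by simp [pack_eq_sum]
    rw [h1]
    have := Nat.mul_le_mul_right (2 ^ (w * m)) (Nat.succ_le_of_lt (hf m))
    rw [Nat.succ_mul] at this
    linarith [mul_comm (2 ^ (w * m)) (2 ^ w)]

theorem pack_div_mod {w : ℕ} {f : ℕ → ℕ} (hf : ∀ k, f k < 2 ^ w) {m k : ℕ} (hk : k < m) :
    pack w f m / 2 ^ (w * k) % 2 ^ w = f k := by
  obtain ⟨j, rfl⟩ := Nat.exists_eq_add_of_lt hk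
  rw [add_assoc, pack_add, Nat.add_mul_div_right _ _ (by positivity), Nat.div_eq_of_lt (pack_lt hf k),
    zero_add, add_comm j 1, pack_add]
  simp [pack_eq_sum (m := 1), Nat.mod_eq_of_lt (hf k)]

theorem divisorTerm_eq (k : ℕ) : divisorTerm k = 302231454903657293676544 +
    ((if Nat.ble k 4 then 1237940039285380274899124224 else 0) +
    (if isKey k then (16383 + k) / k + (268435456 / (k * k) * 67108864 + 73786976294838206464)
      else 0)) := by
  simp only [divisorTerm, pick_eq]; rfl

theorem divisorTerm_lt (k : ℕ) : divisorTerm k < 2 ^ 92 := by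
  have h1 : (16383 + k) / k ≤ 16384 := by
    rcases Nat.eq_zero_or_pos k with rfl | h
    · simp
    · rw [Nat.div_le_iff_le_mul_add_pred h]
      nlinarith
  have h2 : 268435456 / (k * k) ≤ 268435456 := Nat.div_le_self _ _
  rw [divisorTerm_eq]
  split_ifs <;> omega

theorem divisorData_eq (x : ℕ) : divisorData x = ∑ d ∈ range 53, if (d + 1) ∣ x then
    divisorTerm (d + 1) + (if x / (d + 1) ≤ 53 then 0 else divisorTerm (x / (d + 1))) else 0 := by
  suffices h : ∀ m, Nat.rec 0 (fun d ih => pick (Nat.beq (Nat.mod x (Nat.succ d)) 0)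
      (Nat.add ih (Nat.add (divisorTerm (Nat.succ d)) (pick (Nat.ble (Nat.div x (Nat.succ d)) 53) 0
        (divisorTerm (Nat.div x (Nat.succ d)))))) ih) m = ∑ d ∈ range m, if (d + 1) ∣ x then
      divisorTerm (d + 1) + (if x / (d + 1) ≤ 53 then 0 else divisorTerm (x / (d + 1))) else 0 from
    h 53
  intro m
  induction m with
  | zero => rfl
  | succ m ih =>
    rw [sum_range_succ, ← ih]
    simp only [pick_eq, Nat.ble_eq, Nat.beq_eq, Nat.dvd_iff_mod_eq_zero]
    change (if x % (m + 1) = 0 then (_ + (_ + if x / (m + 1) ≤ 53 then _ else _) : ℕ)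
      else _) = _
    split_ifs
    · rfl
    · rfl
    · exact (add_zero _).symm

theorem divisorData_lt (x : ℕ) : divisorData x < 2 ^ 104 := by
  have h : divisorData x ≤ 53 * 2 ^ 93 := by
    rw [divisorData_eq]
    calc _ ≤ ∑ d ∈ range 53, 2 ^ 93 := ?_
      _ = _ := by simp
    refine sum_le_sum fun d _ => ?_
    have h1 := divisorTerm_lt (d + 1)
    have h2 := divisorTerm_lt (x / (d + 1))
    split_ifs <;> omega
  omega

theorem entry_table {x : ℕ} (hx : x < 2916) : entry table x = divisorData x := by
  have h1 : table = pack 104 divisorData (54 * 54) := pack_mul 104 54 divisorData 54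
  have h2 : entry table x = (table >>> (104 * x)) &&& (2 ^ 104 - 1) := by
    unfold entry
    rfl
  rw [h2, Nat.and_two_pow_sub_one_eq_mod, Nat.shiftRight_eq_div_pow, h1,
    pack_div_mod divisorData_lt (by omega)]

theorem divisorData_eq_sum_divisors {x : ℕ} (hx0 : 0 < x) (hx : x < 54 ^ 2) :
    divisorData x = ∑ k ∈ x.divisors, divisorTerm k := by
  have h1 : divisorData x = ∑ d ∈ x.divisors with d ≤ 53,
      (divisorTerm d + if x / d ≤ 53 then 0 else divisorTerm (x / d)) := by
    rw [divisorData_eq, ← sum_filter]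
    refine sum_nbij' (· + 1) (· - 1) ?_ ?_ ?_ ?_ ?_
    · simp; omega
    · simp only [mem_filter, Nat.mem_divisors, mem_range]
      rintro d ⟨⟨hd, _⟩, hd'⟩
      have := Nat.pos_of_dvd_of_pos hd hx0
      rw [Nat.sub_add_cancel this]
      exact ⟨by omega, hd⟩
    · simp
    · simp only [mem_filter, Nat.mem_divisors]
      rintro d ⟨⟨hd, _⟩, hd'⟩
      exact Nat.sub_add_cancel (Nat.pos_of_dvd_of_pos hd hx0)
    · simp
  rw [h1, sum_add_distrib, ← sum_filter_add_sum_filter_not x.divisors (· ≤ 53)]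
  congr 1
  simp_rw [← ite_not (p := _ ≤ 53)]
  rw [← sum_filter, filter_filter]
  refine sum_nbij' (x / ·) (x / ·) ?_ ?_ ?_ ?_ ?_
  · simp only [mem_filter, Nat.mem_divisors]
    rintro d ⟨⟨hd, _⟩, hd', h⟩
    exact ⟨⟨Nat.div_dvd_of_dvd hd, hx0.ne'⟩, h⟩
  · simp only [mem_filter, Nat.mem_divisors]
    rintro d ⟨⟨hd, _⟩, hd'⟩
    refine ⟨⟨Nat.div_dvd_of_dvd hd, hx0.ne'⟩, ?_, ?_⟩
    · have : x / d < 54 := by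
        rw [Nat.div_lt_iff_lt_mul (by omega)]
        omega
      omega
    · rwa [Nat.div_div_self hd hx0.ne']
  · simp only [mem_filter, Nat.mem_divisors]
    rintro d ⟨⟨hd, _⟩, -⟩
    exact Nat.div_div_self hd hx0.ne'
  · simp only [mem_filter, Nat.mem_divisors]
    rintro d ⟨⟨hd, _⟩, -⟩
    exact Nat.div_div_self hd hx0.ne'
  · simp

theorem card_divisors_lt {x : ℕ} (hx0 : 0 < x) (hx : x < 54 ^ 2) : #x.divisors < 2916 := by
  have := Nat.card_divisors_le_self x
  omega

theorem divisorData_eq_fields {x : ℕ} (hx0 : 0 < x) (hx : x < 54 ^ 2) :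
    divisorData x = ∑ k ∈ keyDivisors x, ((16383 + k) / k) + 2 ^ 26 *
      (∑ k ∈ keyDivisors x, 268435456 / (k * k) + 2 ^ 40 * (#(keyDivisors x) +
        2 ^ 12 * (#x.divisors + 2 ^ 12 * #(smallDivisors x)))) := by
  classical
  have h1 : ∀ k ∈ x.divisors, divisorTerm k = (if IsKeyDivisor k then (16383 + k) / k else 0) +
      2 ^ 26 * (if IsKeyDivisor k then 268435456 / (k * k) else 0) +
      2 ^ 66 * (if IsKeyDivisor k then 1 else 0) + 2 ^ 78 + 2 ^ 90 * (if k ≤ 4 then 1 else 0) := by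
    intro k hk
    have hk' := Nat.divisor_le hk
    rw [divisorTerm_eq, if_congr (isKey_iff (hk'.trans_lt hx)) rfl rfl,
      if_congr (Nat.ble_eq (x := k) (y := 4)).to_iff rfl rfl]
    split_ifs <;> ring
  have h2 : smallDivisors x = {k ∈ x.divisors | k ≤ 4} := by
    ext k
    rw [mem_smallDivisors, mem_filter, Nat.mem_divisors]
    constructor
    · rintro ⟨h, h'⟩
      exact ⟨⟨h', hx0.ne'⟩, h.2⟩
    · rintro ⟨⟨h, -⟩, h'⟩
      exact ⟨⟨Nat.pos_of_dvd_of_pos h hx0, h'⟩, h⟩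
  rw [divisorData_eq_sum_divisors hx0 hx, sum_congr rfl h1, h2, keyDivisors]
  simp only [sum_add_distrib, ← mul_sum, ← sum_filter, sum_const, smul_eq_mul, mul_one]
  ring

theorem fields_lt {x : ℕ} (hx0 : 0 < x) (hx : x < 54 ^ 2) :
    ∑ k ∈ keyDivisors x, ((16383 + k) / k) < 2 ^ 26 ∧
    ∑ k ∈ keyDivisors x, 268435456 / (k * k) < 2 ^ 40 ∧ #(keyDivisors x) < 2 ^ 12 ∧
      #x.divisors < 2 ^ 12 := by
  have h1 := card_divisors_lt hx0 hx
  have h2 : #(keyDivisors x) ≤ #x.divisors :=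
    card_le_card fun k hk => Nat.mem_divisors.2 ⟨((mem_keyDivisors hx0).1 hk).1, hx0.ne'⟩
  have h3 := sum_le_card_nsmul (keyDivisors x) (fun k => (16383 + k) / k) 16384 (by
    intro k hk
    have h := ((mem_keyDivisors hx0).1 hk).2.pos
    rw [Nat.div_le_iff_le_mul_add_pred h]
    nlinarith)
  have h4 := sum_le_card_nsmul (keyDivisors x) (fun k => 268435456 / (k * k)) 268435456
    fun k hk => Nat.div_le_self _ _
  simp only [smul_eq_mul] at h3 h4
  omega

section fields
variable {x : ℕ} (hx0 : 0 < x) (hx : x < 54 ^ 2)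
include hx0 hx

theorem keyField_divisorData :
    keyField (divisorData x) = ∑ k ∈ keyDivisors x, ((16383 + k) / k) := by
  have := fields_lt hx0 hx
  change divisorData x % 67108864 = _
  rw [divisorData_eq_fields hx0 hx]
  omega

theorem sqField_divisorData :
    sqField (divisorData x) = ∑ k ∈ keyDivisors x, 268435456 / (k * k) := by
  have := fields_lt hx0 hx
  change (divisorData x >>> 26) % 1099511627776 = _
  rw [divisorData_eq_fields hx0 hx, Nat.shiftRight_eq_div_pow]
  omega

theorem keyCount_divisorData : keyCount (divisorData x) = #(keyDivisors x) := by
  have := fields_lt hx0 hx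
  change (divisorData x >>> 66) % 4096 = _
  rw [divisorData_eq_fields hx0 hx, Nat.shiftRight_eq_div_pow]
  omega

theorem divisorCount_divisorData : divisorCount (divisorData x) = #x.divisors := by
  have := fields_lt hx0 hx
  change (divisorData x >>> 78) % 4096 = _
  rw [divisorData_eq_fields hx0 hx, Nat.shiftRight_eq_div_pow]
  omega

theorem smallCount_divisorData : smallCount (divisorData x) = #(smallDivisors x) := by
  have := fields_lt hx0 hx
  change (divisorData x >>> 90) = _
  rw [divisorData_eq_fields hx0 hx, Nat.shiftRight_eq_div_pow]
  omega

end fields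

end KernelCheck

namespace KernelCheck

theorem keySum_le_keyField {x : ℕ} (hx0 : 0 < x) (hx : x < 54 ^ 2) :
    2 ^ 14 * keySum x ≤ (keyField (divisorData x) : ℝ) := by
  rw [keyField_divisorData hx0 hx, keySum, mul_sum]
  push_cast
  refine sum_le_sum fun k hk => ?_
  have h0 := ((mem_keyDivisors hx0).1 hk).2.pos
  have h1 := Nat.lt_div_mul_add (a := 16383 + k) h0
  have h2 : 16384 ≤ (16383 + k) / k * k := by omega
  have h3 : (16384 : ℝ) ≤ ((16383 + k) / k : ℕ) * k := by exact_mod_cast h2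
  rw [mul_one_div, div_le_iff₀ (by exact_mod_cast h0)]
  norm_num at h3 ⊢
  exact h3

theorem sqField_le_keySqSum {x : ℕ} (hx0 : 0 < x) (hx : x < 54 ^ 2) :
    (sqField (divisorData x) : ℝ) ≤ 2 ^ 28 * keySqSum x := by
  rw [sqField_divisorData hx0 hx, keySqSum, mul_sum]
  push_cast
  refine sum_le_sum fun k hk => ?_
  refine (Nat.cast_div_le (α := ℝ)).trans (le_of_eq ?_)
  push_cast
  ring

theorem mainCost_eq (t M x L r r' S w τ : ℕ) : mainCost t M x L r r' S w τ =
    (2 * t * τ + w * (w + 1) +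
      (if Nat.ble x M then 2 * smallCount r * ((L - 2 * M) / x + 2) + 10 else
        2 * (smallCount r * divisorCount r' + smallCount r' * τ) + (L - 2 * M - 1) + 2)) *
        268435456 +
      (S * (524288 + L * (S + 2 * keyField r')) - L * sqField r) +
    (if Nat.beq (x % 6) 0 then
      keyCount r' * 536870912 + (L * keyField r' / 3 + 1) * 16384 else
      if Nat.beq (x * L % 6) 0 then
        if Nat.beq (L % 6) 0 then 0 else w * 536870912 + (L * S / 3 + 1) * 16384 else 0) := by
  simp only [mainCost, pick_eq]
  rfl

theorem primeCost_eq (n t x L : ℕ) : primeCost n t x L =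
    (2 * ((L - 1) / x) + if Nat.ble n ((if Nat.beq (n % 2) 0 then 2 else 3) * x) then 0 else
      2 * t) * 268435456 := by
  simp only [primeCost, pick_eq]
  rfl

theorem cost_eq (n t M lo x L r r' : ℕ) : cost n t M lo x L r r' =
    if Nat.beq (divisorCount r) 2 then
      if Nat.ble L 2 then (L - 1) * 268435456 else primeCost n t x L
    else if Nat.ble x 16 then (L - 1) * 268435456 else
    if Nat.ble L lo then (L - 1) * 268435456 else
    min ((L - 1) * 268435456)
      (mainCost t M x L r r' (keyField r) (keyCount r) (divisorCount r)) := by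
  simp only [cost, force_eq, pick_eq, least_eq]
  rfl

theorem prime_of_card_divisors {x : ℕ} (h : #x.divisors = 2) : x.Prime := by
  have hx : 2 ≤ x := by
    by_contra! h'
    interval_cases x <;> simp at h
  rw [Nat.prime_def_lt]
  refine ⟨hx, fun m hm hmx => ?_⟩
  by_contra h1
  have h2 : ({1, m, x} : Finset ℕ) ⊆ x.divisors := by
    intro k
    simp only [mem_insert, mem_singleton, Nat.mem_divisors]
    rintro (rfl | rfl | rfl)
    · exact ⟨one_dvd _, by omega⟩
    · exact ⟨hmx, by omega⟩
    · exact ⟨dvd_rfl, by omega⟩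
  have h3 := card_le_card h2
  rw [card_eq_three.2 ⟨1, m, x, Ne.symm h1, by omega, by omega, rfl⟩] at h3
  omega

theorem halfBound_le_mainCost {n t M x L : ℕ} (hx0 : 0 < x) (hx : x < 54 ^ 2) (hL0 : 0 < L)
    (hL : L < 54 ^ 2) (hcop : x.Coprime L) (ht : #n.divisors - 2 = t) :
    2 ^ 28 * (2 * halfBound n M x L + if M < x then ((L - 2 * M - 1 : ℕ) : ℝ) else 0) ≤
      (mainCost t M x L (divisorData x) (divisorData L) (keyField (divisorData x))
        (keyCount (divisorData x)) (divisorCount (divisorData x)) : ℝ) := by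
  rw [mainCost_eq, halfBound, ht, smallCount_divisorData hx0 hx, smallCount_divisorData hL0 hL,
    keyCount_divisorData hx0 hx, keyCount_divisorData hL0 hL, divisorCount_divisorData hx0 hx,
    divisorCount_divisorData hL0 hL]
  have hS := keySum_le_keyField hx0 hx
  have hS' := keySum_le_keyField hL0 hL
  have hD := sqField_le_keySqSum hx0 hx
  have hK : 0 ≤ keySum x := sum_nonneg fun _ _ => by positivity
  have hK' : 0 ≤ keySum L := sum_nonneg fun _ _ => by positivity
  generalize keyField (divisorData x) = S at *
  generalize keyField (divisorData L) = S' at *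
  generalize sqField (divisorData x) = D at *
  generalize keySum x = K at *
  generalize keySum L = K' at *
  generalize keySqSum x = Q at *
  generalize #(keyDivisors x) = w
  generalize #(keyDivisors L) = w'
  generalize #x.divisors = τ
  generalize #L.divisors = τ'
  generalize #(smallDivisors x) = e
  generalize #(smallDivisors L) = e'
  have hLr : (0 : ℝ) ≤ L := Nat.cast_nonneg L
  have hsub : ((S * (524288 + L * (S + 2 * S')) : ℕ) : ℝ) - (L * D : ℕ) ≤
      ((S * (524288 + L * (S + 2 * S')) - L * D : ℕ) : ℝ) := by
    rw [sub_le_iff_le_add]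
    exact_mod_cast le_tsub_add
  have hquad : 2 ^ 28 * (L * (K ^ 2 - Q) + 2 * L * K * K' + 32 * K) ≤
      ((S * (524288 + L * (S + 2 * S')) - L * D : ℕ) : ℝ) := by
    refine le_trans ?_ hsub
    push_cast
    have h1 : (2 ^ 14 * K) * (2 ^ 14 * K + 2 * (2 ^ 14 * K')) ≤ (S : ℝ) * (S + 2 * S') := by gcongr
    have h2 := mul_le_mul_of_nonneg_left h1 hLr
    have h3 := mul_le_mul_of_nonneg_left hD hLr
    linarith
  have hthird : ∀ T : ℕ, ∀ k : ℝ, 2 ^ 14 * k ≤ T →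
      2 ^ 28 * (L * k) / 3 ≤ ((L * T / 3 + 1 : ℕ) : ℝ) * 16384 := by
    intro T k hk
    have h1 : ((L * T : ℕ) : ℝ) ≤ ((3 * (L * T / 3 + 1) : ℕ) : ℝ) := by
      exact_mod_cast (by omega)
    push_cast at h1 ⊢
    have h2 := mul_le_mul_of_nonneg_left hk hLr
    linarith
  have hsix : 2 ^ 28 * (2 * ((if 6 ∣ x then L * K' / 6 + (w' : ℝ) else 0) +
      if (2 ∣ x ∧ 3 ∣ L) ∨ (3 ∣ x ∧ 2 ∣ L) then L * K / 6 + (w : ℝ) else 0)) ≤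
      ((if Nat.beq (x % 6) 0 then w' * 536870912 + (L * S' / 3 + 1) * 16384 else
      if Nat.beq (x * L % 6) 0 then
        if Nat.beq (L % 6) 0 then 0 else w * 536870912 + (L * S / 3 + 1) * 16384 else 0 : ℕ) : ℝ) := by
    have hnot : ∀ p, p.Prime → p ∣ x → ¬ p ∣ L := fun p hp h1 h2 =>
      hp.one_lt.ne' (Nat.eq_one_of_dvd_coprimes hcop h1 h2)
    have h2 := hnot 2 Nat.prime_two
    have h3 := hnot 3 Nat.prime_three
    have hT := hthird S K hS
    have hT' := hthird S' K' hS'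
    simp only [Nat.beq_eq, ← Nat.dvd_iff_mod_eq_zero]
    push_cast at hT hT' ⊢
    by_cases h6 : 6 ∣ x
    · rw [if_pos h6, if_pos h6, if_neg (by omega)]
      linarith
    · rw [if_neg h6, if_neg h6]
      split_ifs with h4 h5 h7 h7
      · exfalso; omega
      · linarith
      · exfalso
        apply h5
        rcases h4 with ⟨ha, hb⟩ | ⟨ha, hb⟩
        · exact mul_dvd_mul ha hb
        · rw [mul_comm]; exact mul_dvd_mul hb ha
      · simp
      · simp only [add_zero, mul_zero]; positivity
      · simp
  rcases le_or_gt x M with h | h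
  · simp only [if_neg (not_lt.2 h), if_pos h, Nat.ble_eq]
    push_cast at hsix hquad ⊢
    linarith
  · simp only [if_pos h, if_neg (not_le.2 h), Nat.ble_eq]
    push_cast at hsix hquad ⊢
    linarith

end KernelCheck

namespace KernelCheck

theorem badCount_le_cost {n t M lo x L : ℕ} (hx0 : 0 < x) (hL0 : 0 < L) (hxL : x + L = n)
    (hn : n < 54 ^ 2) (hcop : x.Coprime n) (ht : #n.divisors - 2 = t)
    (hlo : lo < L → 32 < L ∧ 90 ≤ n ∧ 4 ≤ M ∧ 3 * M < n ∧ 3 * n ^ 2 ≤ M * (n - 3 * M) ^ 2) :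
    badCount n x * 2 ^ 28 ≤ cost n t M lo x L (divisorData x) (divisorData L) := by
  have hx : x < 54 ^ 2 := by omega
  have hL : L < 54 ^ 2 := by omega
  have hnx : n - x = L := by omega
  have htriv : badCount n x * 2 ^ 28 ≤ (L - 1) * 268435456 :=
    Nat.mul_le_mul (hnx ▸ badCount_le_sub n x) (by norm_num)
  have hcop' : x.Coprime L := by
    rw [← hxL] at hcop
    exact (Nat.coprime_self_add_right).1 hcop
  rw [cost_eq, divisorCount_divisorData hx0 hx]
  simp only [Nat.ble_eq, Nat.beq_eq]
  split_ifs with h1 h2 h2 h3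
  · exact htriv
  · have hp := prime_of_card_divisors h1
    have h3 := badCount_le_of_prime (n := n) hp
      (fun h => hp.one_lt.ne' (Nat.eq_one_of_dvd_coprimes hcop dvd_rfl h)) (by omega)
    rw [hnx, ht] at h3
    have h4 : badCount n x ≤ 2 * ((L - 1) / x + if (if n % 2 = 0 then 2 else 3) * x < n then t
        else 0) := by exact_mod_cast h3
    rw [primeCost_eq]
    refine Nat.mul_le_mul (h4.trans (le_of_eq ?_)) (by norm_num)
    simp only [Nat.ble_eq, Nat.beq_eq]
    generalize (if n % 2 = 0 then 2 else 3) * x = y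
    split_ifs <;> omega
  · exact htriv
  · exact htriv
  · obtain ⟨h5, h6, h7, h8, h9⟩ := hlo (by omega)
    refine le_min htriv ?_
    have h10 := badCount_le_halfBound h6 h7 h8 h9 hcop (by omega) (by omega)
    rw [hnx] at h10
    have h11 := halfBound_le_mainCost (n := n) (M := M) hx0 hx hL0 hL hcop' ht
    rw [divisorCount_divisorData hx0 hx] at h11
    rw [← Nat.cast_le (α := ℝ)]
    refine le_trans ?_ h11
    push_cast
    linarith

theorem isGood_eq (tab n t M lo th a : ℕ) : isGood tab n t M lo th a =
    Nat.ble (cost n t M lo a (n - a) (entry tab a) (entry tab (n - a)) +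
      cost n t M lo (n - a) a (entry tab (n - a)) (entry tab a) + 1) th := rfl

theorem badCount_add_lt_of_isGood {n t M lo th a : ℕ} (ha0 : 0 < a) (han : a < n)
    (hn : n < 54 ^ 2) (hcop : a.Coprime n) (ht : #n.divisors - 2 = t)
    (hlo : ∀ L < n, lo < L →
      32 < L ∧ 90 ≤ n ∧ 4 ≤ M ∧ 3 * M < n ∧ 3 * n ^ 2 ≤ M * (n - 3 * M) ^ 2)
    (h : isGood table n t M lo th a = true) :
    (badCount n a + badCount n (n - a)) * 2 ^ 28 < th := by
  rw [isGood_eq, Nat.ble_eq, entry_table (by omega), entry_table (by omega)] at h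
  have h1 := badCount_le_cost (t := t) (M := M) (lo := lo) ha0 (show 0 < n - a by omega)
    (by omega) hn hcop ht (hlo _ (by omega))
  have h2 := badCount_le_cost (n := n) (t := t) (M := M) (lo := lo) (x := n - a) (L := a)
    (by omega) ha0 (by omega) hn ((Nat.coprime_self_sub_left han.le).2 hcop) ht (hlo _ han)
  omega

theorem exists_finset_of_hasGood {tab n t M lo th m a k : ℕ}
    (h : hasGood tab n t M lo th m a k = true) :
    ∃ G : Finset ℕ, k ≤ #G ∧ ∀ b ∈ G, a ≤ b ∧ b < a + m ∧ b.Coprime n ∧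
      isGood tab n t M lo th b = true := by
  induction m generalizing a k with
  | zero =>
    refine ⟨∅, ?_, by simp⟩
    have h : Nat.beq k 0 = true := h
    rw [Nat.beq_eq] at h
    simp [h]
  | succ m ih =>
    rcases k with _ | k
    · exact ⟨∅, by simp⟩
    have h' : pick (pick (Nat.beq (Nat.gcd a n) 1) (isGood tab n t M lo th a) false)
        (hasGood tab n t M lo th m (a + 1) k) (hasGood tab n t M lo th m (a + 1) (k + 1)) = true :=
      h
    rw [pick_eq] at h'
    split_ifs at h' with h1
    · obtain ⟨G, hG, hG'⟩ := ih h'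
      have ha : a ∉ G := fun ha => by have := (hG' a ha).1; omega
      refine ⟨insert a G, by rw [card_insert_of_notMem ha]; omega, fun b hb => ?_⟩
      rcases mem_insert.1 hb with rfl | hb
      · rw [pick_eq] at h1
        split_ifs at h1 with h2
        · exact ⟨le_rfl, by omega, Nat.eq_of_beq_eq_true h2, h1⟩
      · have := hG' b hb
        exact ⟨by omega, by omega, this.2.2⟩
    · obtain ⟨G, hG, hG'⟩ := ih h'
      refine ⟨G, hG, fun b hb => ?_⟩
      have := hG' b hb
      exact ⟨by omega, by omega, this.2.2⟩

theorem isValid_iff {n M : ℕ} : isValid n M = true ↔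
    90 ≤ n ∧ 4 ≤ M ∧ 3 * M < n ∧ 3 * n ^ 2 ≤ M * (n - 3 * M) ^ 2 := by
  have h : isValid n M = if Nat.ble 90 n then if Nat.ble 4 M then if Nat.ble (3 * M + 1) n then
      Nat.ble (3 * (n * n)) (M * ((n - 3 * M) * (n - 3 * M))) else false else false else false := by
    simp only [isValid, pick_eq]
    rfl
  rw [h, ← pow_two, ← pow_two]
  simp only [Nat.ble_eq]
  split_ifs with h1 h2 h3
  · rw [Nat.ble_eq]; omega
  · simp; omega
  · simp; omega
  · simp; omega

theorem isqrt_mul_self_le (x m : ℕ) : isqrt x m * isqrt x m ≤ x := by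
  suffices h : ∀ r, r * r ≤ x → (Nat.rec (fun r => r) (fun i ih r =>
      force (Nat.add r (Nat.pow 2 i)) fun r' => pick (Nat.ble (Nat.mul r' r') x) (ih r') (ih r)) m :
        ℕ → ℕ) r * (Nat.rec (fun r => r) (fun i ih r =>
      force (Nat.add r (Nat.pow 2 i)) fun r' => pick (Nat.ble (Nat.mul r' r') x) (ih r') (ih r)) m :
        ℕ → ℕ) r ≤ x from h 0 (Nat.zero_le _)
  induction m with
  | zero => exact fun r hr => hr
  | succ m ih =>
    intro r hr
    simp only [force_eq, pick_eq] at ih ⊢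
    split_ifs with h
    · exact ih _ (Nat.ble_eq.mp h)
    · exact ih _ hr

end KernelCheck

namespace KernelCheck

theorem denProd_pos {n : ℕ} {l : List ℕ} (hl : ∀ p ∈ l, 0 < p) : 0 < denProd n l := by
  induction l with
  | nil => exact Nat.one_pos
  | cons p l ih =>
    have h : denProd n (p :: l) =
        if Nat.beq (n % p) 0 then p * p * denProd n l else denProd n l := pick_eq _ _ _
    have hp := hl p (by simp)
    have := ih fun q hq => hl q (by simp [hq])
    rw [h]
    split_ifs <;> positivity

theorem numProd_eq {n : ℕ} {l : List ℕ} (hl : ∀ p ∈ l, 0 < p) : (numProd n l : ℝ) =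
    denProd n l * ((l.filter (fun p => p ∣ n)).map fun p : ℕ => (1 - 1 / (p : ℝ) ^ 2)).prod := by
  induction l with
  | nil =>
    have h1 : numProd n [] = 1 := rfl
    have h2 : denProd n [] = 1 := rfl
    simp [h1, h2]
  | cons p l ih =>
    have h : denProd n (p :: l) =
        if Nat.beq (n % p) 0 then p * p * denProd n l else denProd n l := pick_eq _ _ _
    have h' : numProd n (p :: l) =
        if Nat.beq (n % p) 0 then (p * p - 1) * numProd n l else numProd n l := pick_eq _ _ _
    have hp := hl p (by simp)
    have ih := ih fun q hq => hl q (by simp [hq])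
    simp only [Nat.beq_eq, ← Nat.dvd_iff_mod_eq_zero] at h h'
    rw [h, h']
    by_cases hpn : p ∣ n
    · rw [if_pos hpn, if_pos hpn, List.filter_cons_of_pos (by simpa using hpn), List.map_cons,
        List.prod_cons, Nat.cast_mul, ih, Nat.cast_mul, Nat.cast_sub (Nat.mul_pos hp hp)]
      have : (p : ℝ) ≠ 0 := by positivity
      push_cast
      field_simp
    · rw [if_neg hpn, if_neg hpn, List.filter_cons_of_neg (by simpa using hpn), ih]

theorem zeta2_mul_denProd_le {n : ℕ} (hn : 0 < n) :
    12 * zeta2 n * denProd n primesList ≤ numProd n primesList := by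
  have hp : ∀ p ∈ primesList, p.Prime := by
    simp only [primesList, List.mem_cons, List.not_mem_nil, or_false]
    rintro p (rfl | rfl | rfl | rfl | rfl | rfl | rfl | rfl | rfl | rfl | rfl | rfl | rfl | rfl |
      rfl | rfl) <;> norm_num
  rw [numProd_eq fun p h => (hp p h).pos, mul_comm]
  refine mul_le_mul_of_nonneg_left ?_ (Nat.cast_nonneg _)
  have hnd : (primesList.filter (fun p => p ∣ n)).Nodup := List.Nodup.filter _ (by decide)
  rw [← List.prod_toFinset _ hnd, zeta2, ← mul_assoc]
  rw [show (12 : ℝ) * (1 / 12) = 1 by norm_num, one_mul]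
  have hsub : (primesList.filter (fun p => p ∣ n)).toFinset ⊆ n.primeFactors := by
    intro p hp'
    simp only [List.mem_toFinset, List.mem_filter, decide_eq_true_eq] at hp'
    exact Nat.mem_primeFactors.2 ⟨hp p hp'.1, hp'.2, hn.ne'⟩
  have h01 : ∀ p : ℕ, p.Prime → 0 ≤ 1 - 1 / (p : ℝ) ^ 2 ∧ 1 - 1 / (p : ℝ) ^ 2 ≤ 1 := by
    intro p hp
    have h1 : (1 : ℝ) ≤ (p : ℝ) ^ 2 := one_le_pow₀ (by exact_mod_cast hp.one_lt.le)
    have h2 : 1 / (p : ℝ) ^ 2 ≤ 1 := by rw [one_div]; exact inv_le_one_of_one_le₀ h1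
    have h3 : 0 ≤ 1 / (p : ℝ) ^ 2 := by positivity
    constructor <;> linarith
  rw [← prod_sdiff hsub]
  refine mul_le_of_le_one_left (prod_nonneg fun p hp' =>
    (h01 p (Nat.prime_of_mem_primeFactors (hsub hp'))).1) (prod_le_one (fun p hp' => ?_) fun p hp' => ?_)
  · exact (h01 p (Nat.prime_of_mem_primeFactors (mem_sdiff.1 hp').1)).1
  · exact (h01 p (Nat.prime_of_mem_primeFactors (mem_sdiff.1 hp').1)).2

theorem exists_of_check {tab n : ℕ} (h : check tab n = true) : ∃ t R k M lo,
    t * t ≤ 1048576 * n ∧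
    R * R ≤ 1048576 * (n * n) * (3 * denProd n primesList - 2 * numProd n primesList) /
      (3 * denProd n primesList) ∧
    k = (1024 * n - R - 2 * t + 2047) / 2048 ∧ lo = (if isValid n M = true then 33 else n) ∧
    hasGood tab n (divisorCount (entry tab n) - 2) M lo ((n + 2 - 4 * k) * 268435456)
      ((n - 1) / 2) 1 k = true := by
  have hf : ∀ (x : ℕ) (f : ℕ → Bool), force x f = true → ∃ y, y = x ∧ f y = true :=
    fun x _ h => ⟨x, rfl, h⟩
  obtain ⟨P, hP, h⟩ := hf _ _ h
  obtain ⟨Q, hQ, h⟩ := hf _ _ h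
  obtain ⟨t, ht, h⟩ := hf _ _ h
  obtain ⟨R, hR, h⟩ := hf _ _ h
  obtain ⟨k, hk, h⟩ := hf _ _ h
  obtain ⟨M, -, h⟩ := hf _ _ h
  obtain ⟨lo, hlo, h⟩ := hf _ _ h
  obtain ⟨τ, hτ, h⟩ := hf _ _ h
  obtain ⟨th, hth, h⟩ := hf _ _ h
  rw [← hP, ← hQ]
  refine ⟨t, R, k, M, lo, ?_, ?_, hk, hlo.trans (pick_eq _ _ _), ?_⟩
  · rw [ht]
    exact isqrt_mul_self_le _ _
  · rw [hR]
    exact isqrt_mul_self_le _ _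
  · rw [hτ, hth] at h
    exact h

theorem le_of_check {n s : ℕ} {X : Finset ℕ} (hn : 0 < n) (hn' : n < 54 ^ 2)
    (h : check table n = true) (hX : IsHittingSet n X) (hs : #X ≤ 2 * s) :
    n / 2 * (1 - √(1 - 8 * zeta2 n)) - √n ≤ s := by
  by_contra! hlt
  have hPQ := zeta2_mul_denProd_le hn
  have hQ : 0 < denProd n primesList := denProd_pos (by simp [primesList])
  obtain ⟨t, R, k, M, lo, ht, hR, rfl, hlo, h⟩ := exists_of_check h
  generalize numProd n primesList = P at *
  generalize denProd n primesList = Q at *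
  rw [entry_table hn', divisorCount_divisorData hn hn'] at h
  obtain ⟨G, hG, hG'⟩ := exists_finset_of_hasGood h
  have h1 : (t : ℝ) ≤ 1024 * √n := by
    refine abs_le_of_sq_le_sq' ?_ (by positivity) |>.2
    rw [mul_pow, Real.sq_sqrt (Nat.cast_nonneg n), pow_two]
    exact_mod_cast (show t * t ≤ 1024 ^ 2 * n by omega)
  have h2 : (R : ℝ) ≤ 1024 * n * √(1 - 8 * zeta2 n) := by
    have h3 : R * R * (3 * Q) ≤ 1048576 * (n * n) * (3 * Q - 2 * P) :=
      (Nat.mul_le_mul_right _ hR).trans (Nat.div_mul_le_self _ _)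
    rcases le_total (3 * Q) (2 * P) with h4 | h4
    · rw [Nat.sub_eq_zero_of_le h4, mul_zero, Nat.le_zero] at h3
      have : R = 0 := by simpa [hQ.ne'] using h3
      rw [this, Nat.cast_zero]
      positivity
    · rw [← Nat.cast_le (α := ℝ), Nat.cast_mul _ (3 * Q - 2 * P), Nat.cast_sub h4] at h3
      push_cast at h3
      have hQ' : (0 : ℝ) < Q := by exact_mod_cast hQ
      have h5 : (R : ℝ) ^ 2 ≤ (1024 * n) ^ 2 * (1 - 8 * zeta2 n) := by
        refine le_of_mul_le_mul_right ?_ (mul_pos three_pos hQ')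
        have h6 := mul_le_mul_of_nonneg_left hPQ (sq_nonneg (1024 * (n : ℝ)))
        nlinarith
      calc (R : ℝ) = √((R : ℝ) ^ 2) := (Real.sqrt_sq (Nat.cast_nonneg _)).symm
        _ ≤ √((1024 * n) ^ 2 * (1 - 8 * zeta2 n)) := Real.sqrt_le_sqrt h5
        _ = _ := by rw [Real.sqrt_mul (by positivity), Real.sqrt_sq (by positivity)]
  have h3 : 2048 * s + R + 2 * t < 1024 * n := by
    have : (2048 * s + R + 2 * t : ℝ) < 1024 * n := by linarith
    exact_mod_cast this
  have h4 : s + 1 ≤ #G := by omega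
  have h5 : #G ≤ s := hX.card_good_le hs G fun a ha => by
    obtain ⟨h5, h6, h7, h8⟩ := hG' a ha
    have h9 := badCount_add_lt_of_isGood (by omega) (by omega) hn' h7 rfl (fun L hL hL' => by
      rw [hlo] at hL'
      split_ifs at hL' with hv
      · exact ⟨by omega, isValid_iff.1 hv⟩
      · omega) h8
    exact ⟨by omega, by omega, by omega⟩
  omega

end KernelCheck

namespace KernelCheck

theorem checkAll_table : force table (fun tab => checkAll tab 2831 20) = true := by decide +kernel

end KernelCheck

namespace KernelCheck

theorem check_of_checkAll {tab m a n : ℕ} (h : checkAll tab m a = true) (han : a ≤ n)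
    (hnm : n < a + m) (hn : n ≤ threshold n) : check tab n = true := by
  induction m generalizing a with
  | zero => omega
  | succ m ih =>
    have h' : pick (pick (Nat.ble a (threshold a)) (check tab a) true)
        (checkAll tab m (a + 1)) false = true := h
    rw [pick_eq] at h'
    split_ifs at h' with h1
    rcases han.eq_or_lt with rfl | h2
    · rwa [pick_eq, if_pos (Nat.ble_eq.mpr hn)] at h1
    · exact ih h' h2 (by omega)

end KernelCheck

open KernelCheck in
theorem IsHittingSet.le_card_of_le_threshold {n s : ℕ} {X : Finset ℕ} (hX : IsHittingSet n X)
    (hs : #X ≤ 2 * s) (hn : 20 ≤ n) (hn' : n ≤ threshold n) :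
    n / 2 * (1 - √(1 - 8 * zeta2 n)) - √n ≤ s := by
  have h1 : n ≤ 2850 := hn'.trans (by
    rw [threshold]
    simp only [pick_eq]
    split_ifs <;> norm_num)
  have h2 := checkAll_table
  rw [force_eq] at h2
  exact le_of_check (by omega) (by omega) (check_of_checkAll h2 hn (by omega) hn') hX hs

/-- The ordered triples of positive integers with sum `n`. -/
def triples (n : ℕ) : Finset (ℕ × ℕ × ℕ) :=
  {t ∈ range n ×ˢ range n ×ˢ range n | 0 < t.1 ∧ 0 < t.2.1 ∧ 0 < t.2.2 ∧ t.1 + t.2.1 + t.2.2 = n}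

theorem mem_triples {n a b c : ℕ} :
    (a, b, c) ∈ triples n ↔ 0 < a ∧ 0 < b ∧ 0 < c ∧ a + b + c = n := by
  simp only [triples, mem_filter, mem_product, mem_range]
  omega

/-- The members of a triple have no common divisor other than `1`. -/
def CoprimeTriple (a b c : ℕ) : Prop := ∀ m, m ∣ a → m ∣ b → m ∣ c → m = 1

/-- At most `x` ordered triples of positive integers with sum `n` satisfy `P`. -/
def TripleBound (n : ℕ) (P : ℕ → ℕ → ℕ → Prop) (x : ℝ) : Prop :=
  CardBound (triples n) (fun t => P t.1 t.2.1 t.2.2) x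

namespace TripleBound

variable {n : ℕ} {ι : Type*} {P Q : ℕ → ℕ → ℕ → Prop} {x y : ℝ}

theorem mono (h : TripleBound n P x)
    (hQ : ∀ a b c, 0 < a → 0 < b → 0 < c → a + b + c = n → Q a b c → P a b c) (hxy : x ≤ y) :
    TripleBound n Q y := by
  refine CardBound.mono h ?_ hxy
  rintro ⟨a, b, c⟩ ht
  have := mem_triples.1 ht
  exact hQ a b c this.1 this.2.1 this.2.2.1 this.2.2.2

theorem or (h : TripleBound n P x) (h' : TripleBound n Q y) :
    TripleBound n (fun a b c => P a b c ∨ Q a b c) (x + y) := CardBound.or h h'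

theorem nonneg (h : TripleBound n P x) : 0 ≤ x := CardBound.nonneg h

theorem exists_mem {I : Finset ι} {P : ι → ℕ → ℕ → ℕ → Prop} {c : ι → ℝ}
    (h : ∀ i ∈ I, TripleBound n (P i) (c i)) :
    TripleBound n (fun a b c => ∃ i ∈ I, P i a b c) (∑ i ∈ I, c i) := CardBound.exists_mem h

theorem swap (h : TripleBound n P x) : TripleBound n (fun a b c => P b a c) x := by
  intro U hU hP
  rw [← card_image_of_injective U
    (f := fun t : ℕ × ℕ × ℕ => (t.2.1, t.1, t.2.2)) (by rintro ⟨a, b, c⟩ ⟨a', b', c'⟩; simp; tauto)]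
  refine h _ (fun t ht => ?_) fun t ht => ?_
  all_goals
    obtain ⟨⟨a, b, c⟩, hu, rfl⟩ := mem_image.1 ht
  · have := mem_triples.1 (hU hu)
    exact (mem_triples (a := b) (b := a) (c := c)).2 ⟨this.2.1, this.1, this.2.2.1, by omega⟩
  · exact hP _ hu

theorem rotate (h : TripleBound n P x) : TripleBound n (fun a b c => P b c a) x := by
  intro U hU hP
  rw [← card_image_of_injective U
    (f := fun t : ℕ × ℕ × ℕ => (t.2.1, t.2.2, t.1)) (by rintro ⟨a, b, c⟩ ⟨a', b', c'⟩; simp; tauto)]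
  refine h _ (fun t ht => ?_) fun t ht => ?_
  all_goals
    obtain ⟨⟨a, b, c⟩, hu, rfl⟩ := mem_image.1 ht
  · have := mem_triples.1 (hU hu)
    exact (mem_triples (a := b) (b := c) (c := a)).2 ⟨this.2.1, this.2.2.1, this.1, by omega⟩
  · exact hP _ hu

theorem rotations (h : TripleBound n P x) :
    TripleBound n (fun a b c => P a b c ∨ P b c a ∨ P c a b) (3 * x) :=
  (h.or (h.rotate.or h.rotate.rotate)).mono (fun _ _ _ _ _ _ _ h => h) (by linarith)

theorem permutations (h : TripleBound n P x) :
    TripleBound n (fun a b c => P a b c ∨ P b c a ∨ P c a b ∨ P b a c ∨ P a c b ∨ P c b a)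
      (6 * x) :=
  (h.rotations.or (h.swap.rotations)).mono (by tauto) (by linarith)

/-- Count the triples with a given first entry. -/
theorem fst_eq {a : ℕ} {R : ℕ → Prop} (h : CardBound (Ico 1 (n - a)) R x)
    (hP : ∀ b c, 0 < b → 0 < c → a + b + c = n → P a b c → R b) :
    TripleBound n (fun i b c => i = a ∧ P i b c) x := by
  intro U hU hP'
  rw [← card_image_of_injOn (s := U) (f := fun t : ℕ × ℕ × ℕ => t.2.1)]
  · refine h _ (fun t ht => ?_) fun t ht => ?_
    all_goals
      obtain ⟨⟨i, b, c⟩, hu, rfl⟩ := mem_image.1 ht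
      have h1 := mem_triples.1 (hU hu)
      obtain ⟨rfl, h2⟩ := hP' _ hu
    · exact mem_Ico.2 (by simp only at *; omega)
    · exact hP _ _ h1.2.1 h1.2.2.1 h1.2.2.2 h2
  · rintro ⟨i, b, c⟩ h1 ⟨i', b', c'⟩ h2 h3
    have e1 := (hP' _ h1).1
    have e2 := (hP' _ h2).1
    have e3 := mem_triples.1 (hU h1)
    have e4 := mem_triples.1 (hU h2)
    simp only at *
    simp only [Prod.mk.injEq]
    omega

/-- Count triples by their first entry. -/
theorem sum_fst {I : Finset ℕ} {R : ℕ → ℕ → Prop} {c : ℕ → ℝ}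
    (h : ∀ a ∈ I, CardBound (Ico 1 (n - a)) (R a) (c a))
    (hP : ∀ i b c, 0 < i → 0 < b → 0 < c → i + b + c = n → P i b c → i ∈ I ∧ R i b) :
    TripleBound n P (∑ a ∈ I, c a) :=
  (exists_mem (P := fun a i b c => i = a ∧ P i b c ∧ 0 < i) fun a ha => by
    refine fst_eq (h a ha) fun b c hb hc hs hP' => ?_
    exact (hP a b c hP'.2 hb hc hs hP'.1).2).mono
    (fun a b c ha hb hc hs hP' => ⟨a, (hP a b c ha hb hc hs hP').1, rfl, hP', ha⟩) le_rfl

end TripleBound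

theorem sum_badCount_le {n : ℕ} {A : Finset ℕ} {N : ℝ} {P : ℕ → ℕ → ℕ → Prop}
    (hA : ∀ a ∈ A, 0 < a ∧ a < n) (h : TripleBound n P N)
    (hP : ∀ a b c, 0 < a → 0 < b → 0 < c → a + b + c = n → a ∈ A → ¬ ForcesAlt n a b c → P a b c) :
    (∑ a ∈ A, badCount n a : ℝ) ≤ N := by
  classical
  have h1 := h ((A.sigma fun a => {b ∈ Ico 1 (n - a) | ¬ ForcesAlt n a b (n - a - b)}).image
    fun s => (s.1, s.2, n - s.1 - s.2)) ?_ ?_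
  · rw [card_image_of_injective _ ?_, card_sigma] at h1
    · simp only [badCount]
      exact_mod_cast h1
    · rintro ⟨a, b⟩ ⟨a', b'⟩ hab
      simp only [Prod.mk.injEq] at hab
      obtain ⟨rfl, rfl, -⟩ := hab
      rfl
  all_goals
    intro t ht
    obtain ⟨⟨a, b⟩, hu, rfl⟩ := mem_image.1 ht
    simp only [mem_sigma, mem_filter, mem_Ico] at hu
    have := hA a hu.1
    dsimp only
  · exact mem_triples.2 (by omega)
  · exact hP _ _ _ this.1 (by omega) (by omega) (by omega) hu.1 hu.2.2

theorem TripleBound.badTriple {n M : ℕ} {P Q C R : ℕ → ℕ → ℕ → Prop} {p q c r : ℝ}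
    (hP : TripleBound n (fun x y z => CoprimeTriple x y z ∧ P x y z) p)
    (hQ : TripleBound n (fun x y z => CoprimeTriple x y z ∧ Q x y z) q)
    (hC : TripleBound n C c) (hR : TripleBound n (fun x y z => CoprimeTriple x y z ∧ R x y z) r)
    (hPs : ∀ x y z, P x y z → P y x z) (hQs : ∀ x y z, Q x y z → Q x z y)
    (hCs : ∀ x y z, C x y z → C y x z ∧ C x z y)
    (h : ∀ x y z, BadCore n M x y z → P x y z ∨ Q x y z ∨ C x y z ∨ R x y z) :
    TripleBound n (fun a b c => CoprimeTriple a b c ∧ BadTriple n M a b c)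
      (3 * (p + q) + c + 6 * r) := by
  refine (hP.rotations.or (hQ.rotations.or (hC.or hR.permutations))).mono ?_ (by linarith)
  intro a b c _ _ _ _ ⟨hc, hbad⟩
  have c1 : CoprimeTriple a c b := fun m h1 h2 h3 => hc m h1 h3 h2
  have c2 : CoprimeTriple b a c := fun m h1 h2 h3 => hc m h2 h1 h3
  have c3 : CoprimeTriple c a b := fun m h1 h2 h3 => hc m h2 h3 h1
  have c4 : CoprimeTriple b c a := fun m h1 h2 h3 => hc m h3 h1 h2
  have c5 : CoprimeTriple c b a := fun m h1 h2 h3 => hc m h3 h2 h1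
  rcases hbad with hbad | hbad | hbad | hbad | hbad | hbad
  all_goals rcases h _ _ _ hbad with h | h | h | h
  · exact .inl (.inl ⟨hc, h⟩)
  · exact .inr (.inl (.inl ⟨hc, h⟩))
  · exact .inr (.inr (.inl h))
  · exact .inr (.inr (.inr (.inl ⟨hc, h⟩)))
  · exact .inl (.inr (.inr ⟨c3, hPs _ _ _ h⟩))
  · exact .inr (.inl (.inl ⟨hc, hQs _ _ _ h⟩))
  · exact .inr (.inr (.inl (hCs _ _ _ h).2))
  · exact .inr (.inr (.inr (.inr (.inr (.inr (.inr (.inl ⟨c1, h⟩)))))))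
  · exact .inl (.inl ⟨hc, hPs _ _ _ h⟩)
  · exact .inr (.inl (.inr (.inl ⟨c4, hQs _ _ _ h⟩)))
  · exact .inr (.inr (.inl (hCs _ _ _ h).1))
  · exact .inr (.inr (.inr (.inr (.inr (.inr (.inl ⟨c2, h⟩))))))
  · exact .inl (.inr (.inr ⟨c3, h⟩))
  · exact .inr (.inl (.inr (.inr ⟨c3, h⟩)))
  · exact .inr (.inr (.inl (hCs _ _ _ (hCs _ _ _ h).1).2))
  · exact .inr (.inr (.inr (.inr (.inr (.inl ⟨c3, h⟩)))))
  · exact .inl (.inr (.inl ⟨c4, h⟩))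
  · exact .inr (.inl (.inr (.inl ⟨c4, h⟩)))
  · exact .inr (.inr (.inl (hCs _ _ _ (hCs _ _ _ h).2).1))
  · exact .inr (.inr (.inr (.inr (.inl ⟨c4, h⟩))))
  · exact .inl (.inr (.inl ⟨c4, hPs _ _ _ h⟩))
  · exact .inr (.inl (.inr (.inr ⟨c3, hQs _ _ _ h⟩)))
  · exact .inr (.inr (.inl (hCs _ _ _ (hCs _ _ _ (hCs _ _ _ h).1).2).1))
  · exact .inr (.inr (.inr (.inr (.inr (.inr (.inr (.inr ⟨c5, h⟩)))))))

/-- The bad triples, counted according to the types of configurations. -/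
theorem sum_badCount_le_of_bounds {n M : ℕ} {A : Finset ℕ}
    {xg xb xt xs xo xi xc xm xp : ℝ} (hn : 90 ≤ n) (hM4 : 4 ≤ M) (hM3 : 3 * M < n)
    (hMn : 3 * n ^ 2 ≤ M * (n - 3 * M) ^ 2) (hA : ∀ a ∈ A, 0 < a ∧ a < n)
    (hg : TripleBound n (fun a b c => a ∈ A ∧ ¬ CoprimeTriple a b c) xg)
    (hb : TripleBound n (fun x y z => CoprimeTriple x y z ∧
      ∃ k, 1 < k ∧ k < n ∧ BlockType k x y z) xb)
    (ht : TripleBound n (fun x y z => CoprimeTriple x y z ∧ ∃ f g, IsKeyDivisor f ∧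
      IsKeyDivisor g ∧ f.Coprime g ∧ f ∣ x ∧ f ∣ y ∧ g ∣ x ∧ g ∣ z) xt)
    (hs : TripleBound n (fun x y z => CoprimeTriple x y z ∧ ∃ f, IsKeyDivisor f ∧ f ∣ x ∧ f ∣ y ∧
      z ≤ 16) xs)
    (ho : TripleBound n (fun x _ _ => x = 1) xo)
    (hi : TripleBound n (fun x y _ => x ≤ 16 ∧ y ≤ 16) xi)
    (hc : TripleBound n (fun x y z => M < x ∧ M < y ∧ M < z) xc)
    (hm : TripleBound n (fun x y z => CoprimeTriple x y z ∧ ∃ p, p.Prime ∧ 5 ≤ p ∧ 2 ∣ x ∧ 2 ∣ y ∧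
      3 ∣ x ∧ 3 ∣ z ∧ p ∣ y ∧ p ∣ z) xm)
    (hp : TripleBound n (fun x y z => CoprimeTriple x y z ∧ ∃ e g, M < x ∧ y ≤ M ∧ e ≤ 4 ∧
      e.Coprime g ∧ y = e * g ∧ e ∣ x ∧ g ∣ z ∧ (M < z ∨ z = g)) xp) :
    (∑ a ∈ A, badCount n a : ℝ) ≤ xg + 3 * (xb + xt + xs + xo + xi) + xc + 6 * (xm + xp) := by
  have hP : TripleBound n (fun x y z => CoprimeTriple x y z ∧ ((∃ k, 1 < k ∧ k < n ∧ BlockType k x y z)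
      ∨ (∃ f, IsKeyDivisor f ∧ f ∣ x ∧ f ∣ y ∧ z ≤ 16) ∨ (x ≤ 16 ∧ y ≤ 16))) (xb + (xs + xi)) :=
    (hb.or (hs.or hi)).mono (by
      rintro x y z _ _ _ _ ⟨h0, h | h | h⟩
      exacts [.inl ⟨h0, h⟩, .inr (.inl ⟨h0, h⟩), .inr (.inr h)]) le_rfl
  have hQ : TripleBound n (fun x y z => CoprimeTriple x y z ∧ ((∃ f g, IsKeyDivisor f ∧
      IsKeyDivisor g ∧ f.Coprime g ∧ f ∣ x ∧ f ∣ y ∧ g ∣ x ∧ g ∣ z) ∨ x = 1)) (xt + xo) :=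
    (ht.or ho).mono (by
      rintro x y z _ _ _ _ ⟨h0, h | h⟩
      exacts [.inl ⟨h0, h⟩, .inr h]) le_rfl
  have hR : TripleBound n (fun x y z => CoprimeTriple x y z ∧ ((∃ p, p.Prime ∧ 5 ≤ p ∧ 2 ∣ x ∧ 2 ∣ y ∧
      3 ∣ x ∧ 3 ∣ z ∧ p ∣ y ∧ p ∣ z) ∨ (∃ e g, M < x ∧ y ≤ M ∧ e ≤ 4 ∧
      e.Coprime g ∧ y = e * g ∧ e ∣ x ∧ g ∣ z ∧ (M < z ∨ z = g)))) (xm + xp) :=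
    (hm.or hp).mono (by
      rintro x y z _ _ _ _ ⟨h0, h | h⟩
      exacts [.inl ⟨h0, h⟩, .inr ⟨h0, h⟩]) le_rfl
  have hB := TripleBound.badTriple (M := M) hP hQ hc hR
    (by
      rintro x y z (⟨k, h1, h2, h3⟩ | ⟨f, h1, h2, h3, h4⟩ | ⟨h1, h2⟩)
      exacts [.inl ⟨k, h1, h2, h3.symm⟩, .inr (.inl ⟨f, h1, h3, h2, h4⟩), .inr (.inr ⟨h2, h1⟩)])
    (by
      rintro x y z (⟨f, g, h1, h2, h3, h4, h5, h6, h7⟩ | h)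
      exacts [.inl ⟨g, f, h2, h1, h3.symm, h6, h7, h4, h5⟩, .inr h])
    (by tauto)
    (by
      intro x y z h
      cases h with
      | block k h1 h2 h => exact .inl (.inl ⟨k, h1, h2, h⟩)
      | two f g hf hg hfg h1 h2 h3 h4 => exact .inr (.inl (.inl ⟨f, g, hf, hg, hfg, h1, h2, h3, h4⟩))
      | mixed p hp h5 h1 h2 h3 h4 hy hz =>
        exact .inr (.inr (.inr (.inl ⟨p, hp, h5, h1, h2, h3, h4, hy, hz⟩)))
      | small f hf h1 h2 h3 => exact .inl (.inr (.inl ⟨f, hf, h1, h2, h3⟩))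
      | one h => exact .inr (.inl (.inr h))
      | tiny h1 h2 => exact .inl (.inr (.inr ⟨h1, h2⟩))
      | central h1 h2 h3 => exact .inr (.inr (.inl ⟨h1, h2, h3⟩))
      | split e g h1 h2 he heg hy hx hz hz' =>
        exact .inr (.inr (.inr (.inr ⟨e, g, h1, h2, he, heg, hy, hx, hz, hz'⟩))))
  refine sum_badCount_le hA ((hg.or hB).mono (fun _ _ _ _ _ _ _ h => h) (by linarith))
    fun a b c ha hb hc hsum haA hF => ?_
  by_cases hcop : CoprimeTriple a b c
  · exact .inr ⟨hcop, badTriple_of_not_forcesAlt hn hM4 hM3 hMn ha hb hc hcop hF⟩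
  · exact .inl ⟨haA, hcop⟩

theorem CardBound.trivial {α : Type*} (S : Finset α) (P : α → Prop) : CardBound S P #S :=
  fun _ hU _ => by exact_mod_cast card_le_card hU

theorem CardBound.Ico_subset {α : Type*} {S : Finset α} {P : α → Prop} [DecidableEq α]
    (T : Finset α) (h : ∀ b ∈ S, P b → b ∈ T) : CardBound S P #T :=
  fun U hU hP => by exact_mod_cast card_le_card fun b hb => h b (hU hb) (hP b hb)

theorem sum_Icc_sub_le {N : ℝ} {J : ℕ} (hJ : J ≤ N) :
    ∑ j ∈ Icc 1 J, (N + 1 - j) ≤ N ^ 2 / 2 + N / 2 := by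
  have h : ∑ j ∈ Icc 1 J, (N + 1 - (j : ℝ)) = J * (N + 1) - J * (J + 1) / 2 := by
    induction J with
    | zero => simp
    | succ k ih =>
      rw [Finset.sum_Icc_succ_top (by omega), ih (by push_cast at hJ; linarith)]
      push_cast
      ring
  rw [h]
  have h0 : (0 : ℝ) ≤ J := Nat.cast_nonneg _
  nlinarith [mul_nonneg (sub_nonneg.2 hJ) (by linarith : (0 : ℝ) ≤ N - J + 1)]

namespace TripleBound

variable {n : ℕ} {P : ℕ → ℕ → ℕ → Prop}

theorem of_fst_eq_one : TripleBound n (fun x _ _ => x = 1) n := by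
  refine (sum_fst (I := {1}) (R := fun _ _ => True) (c := fun _ => ((n - 1 - 1 : ℕ) : ℝ))
    (fun a ha => ?_) (fun i b c _ _ _ _ h => ⟨by simpa using h, True.intro⟩)).mono
      (fun _ _ _ _ _ _ _ h => h) ?_
  · rw [mem_singleton] at ha
    subst ha
    simpa using CardBound.trivial (Ico 1 (n - 1)) fun _ => True
  · simp only [sum_singleton]
    exact_mod_cast by omega

theorem of_le_sixteen : TripleBound n (fun x y _ => x ≤ 16 ∧ y ≤ 16) 256 := by
  refine (sum_fst (I := Icc 1 16) (R := fun _ b => b ≤ 16) (c := fun _ => 16)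
    (fun a ha => ?_) (fun i b c _ _ _ _ h => ⟨by simp; omega, h.2⟩)).mono
      (fun _ _ _ _ _ _ _ h => h) (by norm_num)
  simpa using CardBound.Ico_subset (S := Ico 1 (n - a)) (P := fun b => b ≤ 16) (Icc 1 16)
    fun b hb h => by simp at *; omega

theorem of_forall_lt {M : ℕ} (hM : 3 * M < n) :
    TripleBound n (fun x y z => M < x ∧ M < y ∧ M < z) (((n : ℝ) - 3 * M) ^ 2 / 2) := by
  obtain ⟨D, rfl⟩ := Nat.exists_eq_add_of_le hM
  refine (sum_fst (I := (Icc 1 D).image (M + ·)) (R := fun a b => M < b ∧ b < 2 * M + 1 + D - a)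
    (c := fun a => ((D - (a - M) : ℕ) : ℝ)) (fun a ha => ?_)
    (fun i b c _ _ _ _ h => ⟨mem_image.2 ⟨i - M, mem_Icc.2 (by omega), by omega⟩, by omega⟩)).mono
      (fun _ _ _ _ _ _ _ h => h) ?_
  · obtain ⟨j, hj, rfl⟩ := mem_image.1 ha
    rw [mem_Icc] at hj
    refine (CardBound.Ico_subset (Ico (M + 1) (2 * M + 1 + D - (M + j))) fun b hb h => ?_).le ?_
    · rw [mem_Ico]; omega
    · rw [Nat.card_Ico]
      exact_mod_cast by omega
  · rw [sum_image (by simp)]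
    have h1 : ∀ j ∈ Icc 1 D, (((D - (M + j - M) : ℕ) : ℕ) : ℝ) = (D : ℝ) - 1 + 1 - j := by
      intro j hj
      rw [mem_Icc] at hj
      rw [Nat.add_sub_cancel_left, Nat.cast_sub hj.2]
      ring
    rw [sum_congr rfl h1]
    rcases Nat.eq_zero_or_pos D with rfl | hD
    · simp
    · have h2 : ∑ j ∈ Icc 1 D, ((D : ℝ) - 1 + 1 - j) ≤ ∑ j ∈ Icc 1 D, ((D : ℝ) + 1 - j) :=
        sum_le_sum fun _ _ => by linarith
      have h3 := sum_Icc_sub_le (N := D) (J := D) le_rfl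
      have h4 : (0 : ℝ) ≤ D := Nat.cast_nonneg _
      refine (h2.trans h3).trans (le_of_sub_nonneg ?_)
      push_cast
      ring_nf
      positivity

theorem of_modEq_aux {D i : ℕ} (hD : 0 < D)
    (hx : ∀ x y z x' y' z', 0 < x → x + y + z = n → 0 < x' → x' + y' + z' = n → P x y z →
      P x' y' z' → x ≡ x' [MOD D])
    (hi' : ∀ x y z, 0 < x → P x y z → 1 ≤ x / D + i)
    (hy : ∀ x y z y' z', x + y + z = n → x + y' + z' = n → P x y z →
      P x y' z' → y ≡ y' [MOD D]) :
    TripleBound n P (((n : ℝ) / D + i) ^ 2 / 2 + ((n : ℝ) / D + i) / 2) := by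
  classical
  have hD' : (0 : ℝ) < D := by exact_mod_cast hD
  set I : Finset ℕ := {x ∈ Ico 1 n | ∃ y z, x + y + z = n ∧ P x y z} with hI
  have hinj : Set.InjOn (fun x => x / D + i) (I : Set ℕ) := by
    intro x h1 x' h2 h
    simp only [hI, coe_filter, Set.mem_ofPred_eq, mem_Ico] at h1 h2
    obtain ⟨h3, y, z, h4, h5⟩ := h1
    obtain ⟨h6, y', z', h7, h8⟩ := h2
    have h9 : x % D = x' % D := hx _ _ _ _ _ _ (by omega) h4 (by omega) h7 h5 h8
    have h10 : x / D = x' / D := Nat.add_right_cancel h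
    rw [← Nat.div_add_mod x D, ← Nat.div_add_mod x' D, h9, h10]
  refine (sum_fst (I := I) (R := fun x y => ∃ z, x + y + z = n ∧ P x y z)
    (c := fun x => (n : ℝ) / D + i + 1 - (x / D + i : ℕ)) (fun x hx' => ?_)
    (fun x y z _ _ _ hs h => ⟨by
      rw [hI, mem_filter, mem_Ico]
      exact ⟨by omega, y, z, hs, h⟩, z, hs, h⟩)).mono (fun _ _ _ _ _ _ _ h => h) ?_
  · rw [hI, mem_filter, mem_Ico] at hx'
    refine (CardBound.modEq (m := D) fun y _ y' _ ⟨z, h1, h2⟩ ⟨z', h3, h4⟩ =>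
      hy _ _ _ _ _ h1 h3 h2 h4).le ?_
    have h1 : (n - x - 1) / D + x / D ≤ n / D := by
      refine (Nat.div_add_div_le_add_div).trans (Nat.div_le_div_right (by omega))
    have h2 : (((n - x - 1) / D : ℕ) : ℝ) + ((x / D : ℕ) : ℝ) ≤ (n : ℝ) / D :=
      (by exact_mod_cast h1 : _ ≤ ((n / D : ℕ) : ℝ)).trans Nat.cast_div_le
    push_cast at *
    linarith
  · rw [← sum_image (f := fun j : ℕ => (n : ℝ) / D + i + 1 - j) hinj]
    have hJ : ((n / D + i : ℕ) : ℝ) ≤ (n : ℝ) / D + i := by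
      push_cast
      linarith [Nat.cast_div_le (α := ℝ) (m := n) (n := D)]
    refine le_trans (sum_le_sum_of_subset_of_nonneg (t := Icc 1 (n / D + i)) ?_ ?_)
      (sum_Icc_sub_le hJ)
    · intro j hj
      obtain ⟨x, hx', rfl⟩ := mem_image.1 hj
      rw [hI, mem_filter, mem_Ico] at hx'
      obtain ⟨h3, y, z, h4, h5⟩ := hx'
      exact mem_Icc.2 ⟨hi' _ _ _ (by omega) h5,
        Nat.add_le_add_right (Nat.div_le_div_right (by omega)) _⟩
    · intro j hj _
      have : (j : ℝ) ≤ ((n / D + i : ℕ) : ℝ) := by exact_mod_cast (mem_Icc.1 hj).2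
      linarith

theorem of_dvd_of_modEq {D : ℕ} (hD : 0 < D) (hx : ∀ x y z, P x y z → D ∣ x)
    (hy : ∀ x y z y' z', x + y + z = n → x + y' + z' = n → P x y z →
      P x y' z' → y ≡ y' [MOD D]) :
    TripleBound n P (((n : ℝ) / D) ^ 2 / 2 + ((n : ℝ) / D) / 2) := by
  have := of_modEq_aux (i := 0) hD (fun x y z x' y' z' _ _ _ _ h h' =>
    (Nat.modEq_zero_iff_dvd.2 (hx _ _ _ h)).trans (Nat.modEq_zero_iff_dvd.2 (hx _ _ _ h')).symm)
    (fun x y z h0 h => Nat.div_pos (Nat.le_of_dvd h0 (hx _ _ _ h)) hD) hy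
  simpa using this

theorem of_modEq {D : ℕ} (hD : 0 < D)
    (hx : ∀ x y z x' y' z', 0 < x → x + y + z = n → 0 < x' → x' + y' + z' = n → P x y z →
      P x' y' z' → x ≡ x' [MOD D])
    (hy : ∀ x y z y' z', x + y + z = n → x + y' + z' = n → P x y z →
      P x y' z' → y ≡ y' [MOD D]) :
    TripleBound n P (((n : ℝ) / D) ^ 2 / 2 + 3 * ((n : ℝ) / D) / 2 + 1) := by
  have := of_modEq_aux (i := 1) hD hx (fun _ _ _ _ _ => Nat.le_add_left _ _) hy
  refine this.mono (fun _ _ _ _ _ _ _ h => h) (le_of_eq ?_)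
  push_cast
  ring

end TripleBound

theorem CoprimeTriple.coprime_of_dvd {x y z n f : ℕ} (h : CoprimeTriple x y z)
    (hn : x + y + z = n) (h1 : f ∣ x) (h2 : f ∣ y) : f.Coprime n := by
  have h3 := Nat.gcd_dvd_left f n
  have h4 := h3.trans h1
  have h5 := h3.trans h2
  refine h _ h4 h5 ?_
  rw [← Nat.dvd_add_right (h4.add h5), hn]
  exact Nat.gcd_dvd_right f n

theorem CoprimeTriple.rotate {x y z : ℕ} (h : CoprimeTriple x y z) : CoprimeTriple y z x :=
  fun m h1 h2 h3 => h m h3 h1 h2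

theorem CoprimeTriple.swap {x y z : ℕ} (h : CoprimeTriple x y z) : CoprimeTriple y x z :=
  fun m h1 h2 h3 => h m h2 h1 h3

open Classical in
/-- The key divisors up to `L` which are coprime to `n`. -/
noncomputable def coprimeKeys (n L : ℕ) : Finset ℕ := {f ∈ Icc 1 L | IsKeyDivisor f ∧ f.Coprime n}

theorem mem_coprimeKeys {n L f : ℕ} :
    f ∈ coprimeKeys n L ↔ f ≤ L ∧ IsKeyDivisor f ∧ f.Coprime n := by
  simp only [coprimeKeys, mem_filter, mem_Icc]
  exact ⟨fun h => ⟨h.1.2, h.2⟩, fun h => ⟨⟨h.2.1.pos, h.1⟩, h.2⟩⟩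

theorem IsKeyDivisor.five_le {f : ℕ} (hf : IsKeyDivisor f) : 5 ≤ f := by
  rcases hf with rfl | rfl | rfl | ⟨-, h⟩ <;> omega

/-- The primes `5 ≤ p ≤ L` which do not divide `n`. -/
def coprimePrimes (n L : ℕ) : Finset ℕ := {p ∈ Icc 5 L | p.Prime ∧ p.Coprime n}

namespace TripleBound

variable {n : ℕ}

theorem of_two : TripleBound n (fun x y z => CoprimeTriple x y z ∧ ∃ f g, IsKeyDivisor f ∧
      IsKeyDivisor g ∧ f.Coprime g ∧ f ∣ x ∧ f ∣ y ∧ g ∣ x ∧ g ∣ z)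
    (∑ p ∈ coprimeKeys n (n / 5) ×ˢ coprimeKeys n (n / 5) with p.1.Coprime p.2,
      ((n / (p.1 * p.2 : ℝ)) ^ 2 / 2 + (n / (p.1 * p.2 : ℝ)) / 2)) := by
  refine (exists_mem (P := fun (p : ℕ × ℕ) x y z => p.1 ∣ x ∧ p.1 ∣ y ∧ p.2 ∣ x ∧ p.2 ∣ z)
    fun p hp => ?_).mono ?_ le_rfl
  · obtain ⟨f, g⟩ := p
    simp only [mem_filter, mem_product, mem_coprimeKeys] at hp
    have := of_dvd_of_modEq (n := n) (P := fun x y z => f ∣ x ∧ f ∣ y ∧ g ∣ x ∧ g ∣ z)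
      (D := f * g) (Nat.mul_pos hp.1.1.2.1.pos hp.1.2.2.1.pos)
      (fun x y z h => hp.2.mul_dvd_of_dvd_of_dvd h.1 h.2.2.1)
      (fun x y z y' z' h1 h2 h h' => modEq_of_dvd_of_dvd_sub (L := y + z) hp.2 (by omega) (by omega)
        h.2.1 h'.2.1 (by rw [Nat.add_sub_cancel_left]; exact h.2.2.2)
        (by rw [show y + z - y' = z' by omega]; exact h'.2.2.2))
    simpa using this
  · rintro x y z hx hy hz hs ⟨hc, f, g, hf, hg, hfg, h1, h2, h3, h4⟩
    have h5 := Nat.le_of_dvd hx (hfg.mul_dvd_of_dvd_of_dvd h1 h3)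
    have h6 := Nat.mul_le_mul_left f hg.five_le
    have h7 := Nat.mul_le_mul_right g hf.five_le
    refine ⟨(f, g), ?_, h1, h2, h3, h4⟩
    simp only [mem_filter, mem_product, mem_coprimeKeys]
    exact ⟨⟨⟨(Nat.le_div_iff_mul_le (by omega)).2 (by omega), hf, hc.coprime_of_dvd hs h1 h2⟩,
      (Nat.le_div_iff_mul_le (by omega)).2 (by omega), hg,
      hc.rotate.rotate.coprime_of_dvd (by omega) h4 h3⟩, hfg⟩

theorem of_small : TripleBound n (fun x y z => CoprimeTriple x y z ∧ ∃ f, IsKeyDivisor f ∧ f ∣ x ∧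
      f ∣ y ∧ z ≤ 16) (∑ f ∈ coprimeKeys n (n / 2), ((16 / f : ℕ) + 1) * (n / f : ℝ)) := by
  refine (exists_mem (P := fun f x y z => f ∣ x ∧ f ∣ y ∧ z ≤ 16) fun f hf => ?_).mono ?_ le_rfl
  · have hf0 : 0 < f := (mem_coprimeKeys.1 hf).2.1.pos
    have h := (sum_fst (n := n) (P := fun x y z => f ∣ x ∧ f ∣ y ∧ z ≤ 16)
      (I := {x ∈ Ico 1 n | f ∣ x}) (R := fun x y => n - x ≤ y + 16 ∧ y < n - x ∧ f ∣ y)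
      (c := fun _ => (16 / f : ℕ) + 1) (fun x _ => ?_) fun x y z hx hy hz hs h =>
        ⟨mem_filter.2 ⟨mem_Ico.2 (by omega), h.1⟩, by omega, by omega, h.2.1⟩)
    · refine h.mono (fun _ _ _ _ _ _ _ h => h) ?_
      rw [sum_const, nsmul_eq_mul, mul_comm]
      refine mul_le_mul_of_nonneg_left ?_ (by positivity)
      refine (CardBound.dvd hf0 n _ (filter_subset _ _) (by simp)).trans ?_
      exact Nat.cast_div_le.trans (by gcongr; exact_mod_cast Nat.sub_le n 1)
    · have h1 := (CardBound.modEq (m := f) (lo := n - x - 16) (hi := n - x) (P := fun y => f ∣ y)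
        fun y _ y' _ h h' => (Nat.modEq_zero_iff_dvd.2 h).trans (Nat.modEq_zero_iff_dvd.2 h').symm)
      refine (h1.subset (P := fun y => f ∣ y)
        (S' := {y ∈ Ico 1 (n - x) | n - x ≤ y + 16}) ?_).mono (Q := fun y => n - x ≤ y + 16 ∧ y < n - x ∧ f ∣ y) ?_ ?_ |>.subset ?_
      · intro y hy _
        rw [mem_filter, mem_Ico] at hy
        rw [mem_Ico]; omega
      · exact fun y _ h => h.2.2
      · gcongr
        exact_mod_cast by omega
      · intro y hy h
        rw [mem_filter]
        exact ⟨hy, h.1⟩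
  · rintro x y z hx hy hz hs ⟨hc, f, hf, h1, h2, h3⟩
    have h4 := Nat.le_of_dvd hx h1
    have h5 := Nat.le_of_dvd hy h2
    exact ⟨f, mem_coprimeKeys.2 ⟨(Nat.le_div_iff_mul_le (by omega)).2 (by omega), hf,
      hc.coprime_of_dvd hs h1 h2⟩, h1, h2, h3⟩

theorem of_mixed : TripleBound n (fun x y z => CoprimeTriple x y z ∧ ∃ p, p.Prime ∧ 5 ≤ p ∧ 2 ∣ x ∧
      2 ∣ y ∧ 3 ∣ x ∧ 3 ∣ z ∧ p ∣ y ∧ p ∣ z)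
    (if Nat.Coprime 6 n then ∑ p ∈ coprimePrimes n (n / 5),
      ((n / (6 * p : ℝ)) ^ 2 / 2 + 3 * (n / (6 * p : ℝ)) / 2 + 1) else 0) := by
  split_ifs with h6
  · refine (exists_mem (P := fun p x y z => 2 ∣ x ∧ 2 ∣ y ∧ 3 ∣ x ∧ 3 ∣ z ∧ p ∣ y ∧ p ∣ z)
      fun p hp => ?_).mono ?_ le_rfl
    · rw [coprimePrimes, mem_filter, mem_Icc] at hp
      have h2p : Nat.Coprime 2 p := (Nat.coprime_primes Nat.prime_two hp.2.1).2 (by omega)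
      have h3p : Nat.Coprime 3 p := (Nat.coprime_primes Nat.prime_three hp.2.1).2 (by omega)
      have h6p : Nat.Coprime 6 p := h2p.mul_left h3p
      have := of_modEq (n := n) (P := fun x y z => 2 ∣ x ∧ 2 ∣ y ∧ 3 ∣ x ∧ 3 ∣ z ∧ p ∣ y ∧ p ∣ z)
        (D := 6 * p) (by omega)
        (fun x y z x' y' z' _ h1 _ h2 h h' => modEq_of_dvd_of_dvd_sub (L := n) h6p (by omega)
          (by omega) (by omega) (by omega) (by
            rw [show n - x = y + z by omega]
            exact h.2.2.2.2.1.add h.2.2.2.2.2) (by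
            rw [show n - x' = y' + z' by omega]
            exact h'.2.2.2.2.1.add h'.2.2.2.2.2))
        (fun x y z y' z' h1 h2 h h' => by
          have e1 : y ≡ y' [MOD 2 * p] := (Nat.modEq_zero_iff_dvd.2
            (h2p.mul_dvd_of_dvd_of_dvd h.2.1 h.2.2.2.2.1)).trans (Nat.modEq_zero_iff_dvd.2
              (h2p.mul_dvd_of_dvd_of_dvd h'.2.1 h'.2.2.2.2.1)).symm
          have e2 : y ≡ y' [MOD 3] := by
            have := h.2.2.2.1
            have := h'.2.2.2.1
            unfold Nat.ModEq
            omega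
          have e3 : Nat.Coprime 3 (2 * p) := Nat.Coprime.mul_right (by norm_num) h3p
          rw [show 6 * p = 3 * (2 * p) by ring]
          exact (Nat.modEq_and_modEq_iff_modEq_mul e3).1 ⟨e2, e1⟩)
      simpa using this
    · rintro x y z hx hy hz hs ⟨hc, p, hp, h5, h1, h2, h3, h4, h6, h7⟩
      have h2p : Nat.Coprime 2 p := (Nat.coprime_primes Nat.prime_two hp).2 (by omega)
      have h3p : Nat.Coprime 3 p := (Nat.coprime_primes Nat.prime_three hp).2 (by omega)
      have e1 := Nat.le_of_dvd hy (h2p.mul_dvd_of_dvd_of_dvd h2 h6)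
      have e2 := Nat.le_of_dvd hz (h3p.mul_dvd_of_dvd_of_dvd h4 h7)
      refine ⟨p, ?_, h1, h2, h3, h4, h6, h7⟩
      rw [coprimePrimes, mem_filter, mem_Icc]
      exact ⟨⟨h5, (Nat.le_div_iff_mul_le (by omega)).2 (by omega)⟩, hp,
        hc.rotate.coprime_of_dvd (by omega) h6 h7⟩
  · refine CardBound.of_forall_not ?_
    rintro ⟨x, y, z⟩ ht ⟨hc, p, hp, h5, h1, h2, h3, h4, -, -⟩
    have ht := mem_triples.1 ht
    dsimp only at hc h1 h2 h3 h4
    refine h6 (Nat.Coprime.mul_left (k := n) (m := 2) (n := 3) ?_ ?_)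
    · exact hc.coprime_of_dvd ht.2.2.2 h1 h2
    · exact hc.rotate.rotate.coprime_of_dvd (by omega) h4 h3

theorem of_split {M : ℕ} (hM : 3 * M < n) :
    TripleBound n (fun x y z => CoprimeTriple x y z ∧ ∃ e g, M < x ∧ y ≤ M ∧ e ≤ 4 ∧
      e.Coprime g ∧ y = e * g ∧ e ∣ x ∧ g ∣ z ∧ (M < z ∨ z = g))
      (∑ e ∈ Icc 1 4 with e.Coprime n, ∑ g ∈ Icc 1 (M / e) with g.Coprime n ∧ e.Coprime g,
        ((n - 2 * M) / (e * g : ℝ) + 1)) := by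
  refine (exists_mem (P := fun e x y z => ∃ g ∈ ({g ∈ Icc 1 (M / e) | g.Coprime n ∧ e.Coprime g} : Finset ℕ),
    M < x ∧ y = e * g ∧ e ∣ x ∧ g ∣ z ∧ (M < z ∨ z = g)) fun e he => exists_mem fun g hg => ?_).mono
      ?_ le_rfl
  · rw [mem_filter, mem_Icc] at hg he
    have hMe := (Nat.le_div_iff_mul_le (by omega : 0 < e)).1 hg.1.2
    have hMe' : e * g ≤ M := by rwa [mul_comm]
    have h0 : 0 < e * g := Nat.mul_pos he.1.1 hg.1.1
    have h1 : CardBound (Ico (M + 1) (n - e * g - M)) (fun x => e ∣ x ∧ g ∣ n - e * g - x)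
        (((n - e * g - M - (M + 1)) / (e * g) : ℕ) + 1) :=
      CardBound.modEq fun x hx x' hx' h h' => by
        rw [mem_Ico] at hx hx'
        exact modEq_of_dvd_of_dvd_sub (L := n - e * g) hg.2.2 (by omega) (by omega) h.1 h'.1 h.2 h'.2
    have h2 : CardBound (Ico 1 (n - e * g)) (fun x => M < x ∧ x < n - e * g - M ∧ e ∣ x ∧ g ∣ n - e * g - x)
        (((n - e * g - M - (M + 1)) / (e * g) : ℕ) + 1) :=
      (h1.mono (Q := fun x => M < x ∧ x < n - e * g - M ∧ e ∣ x ∧ g ∣ n - e * g - x)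
        (fun x _ h => h.2.2) le_rfl).subset fun x _ h => mem_Ico.2 ⟨h.1, h.2.1⟩
    have h3 : CardBound (Ico 1 (n - e * g)) (fun x => x ∈ ({n - e * g - g} : Finset ℕ)) 1 := by
      simpa using CardBound.Ico_subset (S := Ico 1 (n - e * g))
        (P := fun x => x ∈ ({n - e * g - g} : Finset ℕ)) {n - e * g - g} fun x _ h => h
    have h4 := (fst_eq (P := fun y x z => M < x ∧ y = e * g ∧ e ∣ x ∧ g ∣ z ∧ (M < z ∨ z = g))
      (h2.or h3) fun x z hx hz hs h => ?_).swap
    · refine h4.mono (fun x y z _ _ _ _ h => ⟨h.2.1, h⟩) ?_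
      have h5 : (n - e * g - M - (M + 1)) / (e * g) + 1 ≤ (n - 2 * M) / (e * g) := by
        rw [← Nat.add_div_right _ h0]
        exact Nat.div_le_div_right (by omega)
      have h6 : (((n - 2 * M) / (e * g) : ℕ) : ℝ) ≤ (n - 2 * M) / (e * g : ℝ) := by
        refine Nat.cast_div_le.trans ?_
        rw [Nat.cast_sub (by omega)]
        push_cast
        exact le_rfl
      have h7 : (((n - e * g - M - (M + 1)) / (e * g) : ℕ) : ℝ) + 1 ≤ ((n - 2 * M) / (e * g) : ℕ) := by
        exact_mod_cast h5
      linarith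
    · rcases h.2.2.2.2 with h5 | h5
      · refine .inl ⟨h.1, by omega, h.2.2.1, ?_⟩
        rw [show n - e * g - x = z by omega]
        exact h.2.2.2.1
      · refine .inr ?_
        rw [mem_singleton]; omega
  · rintro x y z hx hy hz hs ⟨hc, e, g, h1, h2, h3, h4, h5, h6, h7, h8⟩
    have he : 0 < e := Nat.pos_of_ne_zero (by rintro rfl; omega)
    have hg : 0 < g := Nat.pos_of_ne_zero (by rintro rfl; omega)
    refine ⟨e, mem_filter.2 ⟨mem_Icc.2 ⟨he, h3⟩, hc.coprime_of_dvd hs h6 (h5 ▸ Dvd.intro _ rfl)⟩,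
      g, mem_filter.2 ⟨mem_Icc.2 ⟨hg, ?_⟩, ?_, h4⟩, h1, h5, h6, h7, h8⟩
    · rw [Nat.le_div_iff_mul_le he, mul_comm]
      omega
    · exact hc.rotate.coprime_of_dvd (by omega) (h5 ▸ Dvd.intro_left _ rfl) h7

theorem of_block : TripleBound n (fun x y z => CoprimeTriple x y z ∧
      ∃ k, 1 < k ∧ k < n ∧ BlockType k x y z)
      (∑ k ∈ nontrivialDivisors n, (k.totient * (n / k).totient : ℝ)) := by
  refine (exists_mem (P := fun k x y z => CoprimeTriple x y z ∧ BlockType k x y z)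
    fun k hk => ?_).mono ?_ le_rfl
  · rcases Nat.eq_zero_or_pos n with rfl | hn
    · simp [nontrivialDivisors] at hk
    rw [mem_nontrivialDivisors hn] at hk
    intro U hU hP
    have hsub : U ⊆ (({j ∈ range k | k.Coprime j} : Finset ℕ) ×ˢ
        ({d ∈ range (n / k) | (n / k).Coprime d} : Finset ℕ)).image
          fun p => (p.2 * p.1, p.2 * (k - p.1), n - p.2 * k) := by
      rintro ⟨x, y, z⟩ ht
      have hs := mem_triples.1 (hU ht)
      obtain ⟨hc, hkz, d, ⟨i, rfl⟩, ⟨j, rfl⟩, hd⟩ := hP _ ht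
      dsimp only at hc hkz hd
      have hd0 : 0 < d := Nat.pos_of_ne_zero (by rintro rfl; simp at hs)
      have hij : k = i + j := Nat.eq_of_mul_eq_mul_left hd0 (by rw [hd]; ring)
      obtain ⟨m, hm⟩ := hk.2.2
      have hk0 : 0 < k := Nat.pos_of_ne_zero (by rintro rfl; omega)
      have hmk : n / k = m := by rw [hm, Nat.mul_div_cancel_left _ hk0]
      have hz : z = k * (m - d) := by
        rw [Nat.mul_sub, ← hm, mul_comm k d]
        omega
      have hdm : d < m := by
        by_contra h
        rw [show m - d = 0 by omega] at hz
        omega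
      have hi : 0 < i := Nat.pos_of_ne_zero (by rintro rfl; simp at hs)
      have hj : 0 < j := Nat.pos_of_ne_zero (by rintro rfl; simp at hs)
      simp only [mem_image, mem_product, mem_filter, mem_range, Prod.exists]
      refine ⟨i, d, ⟨⟨by omega, ?_⟩, by omega, ?_⟩, ?_⟩
      · have h1 := Nat.gcd_dvd_left k i
        have h2 := Nat.gcd_dvd_right k i
        refine hc _ (h2.mul_left d) (Dvd.dvd.mul_left ?_ d) (h1.trans hkz)
        rw [← Nat.dvd_add_right h2, ← hij]
        exact h1
      · have h1 := Nat.gcd_dvd_left (n / k) d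
        have h2 := Nat.gcd_dvd_right (n / k) d
        refine hc _ (h2.mul_right i) (h2.mul_right j) ?_
        rw [hz]
        rw [hmk] at h1 h2 ⊢
        exact (Nat.dvd_sub h1 h2).mul_left k
      · rw [show k - i = j by omega, show n - d * k = z by omega]
    have h1 := (card_le_card hsub).trans card_image_le
    rw [card_product] at h1
    exact_mod_cast h1
  · rintro x y z hx hy hz hs ⟨hc, k, h1, h2, h3⟩
    refine ⟨k, ?_, hc, h3⟩
    rw [mem_nontrivialDivisors (by omega)]
    exact ⟨by omega, by omega, hs ▸ h3.dvd_sum⟩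

end TripleBound

/-- The positive integers below `n` which are coprime to `c`. -/
def coprimesBelow (n c : ℕ) : Finset ℕ := {a ∈ Ico 1 n | c.Coprime a}

theorem mem_coprimesBelow {n c a : ℕ} : a ∈ coprimesBelow n c ↔ (1 ≤ a ∧ a < n) ∧ c.Coprime a := by
  rw [coprimesBelow, mem_filter, mem_Ico]

theorem sub_mem_coprimesBelow {n c a : ℕ} (hc : c ∣ n) (ha : a ∈ coprimesBelow n c) :
    n - a ∈ coprimesBelow n c := by
  rw [mem_coprimesBelow] at *
  refine ⟨by omega, ?_⟩
  have h1 := Nat.gcd_dvd_left c (n - a)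
  have h2 := Nat.gcd_dvd_right c (n - a)
  have h3 : c.gcd (n - a) ∣ a := by
    rw [← Nat.dvd_add_right h2, Nat.sub_add_cancel ha.1.2.le]
    exact h1.trans hc
  exact Nat.dvd_one.1 (ha.2 ▸ Nat.dvd_gcd h1 h3)

theorem card_range_filter_coprime (c m : ℕ) :
    #{a ∈ range (c * m) | c.Coprime a} = c.totient * m := by
  induction m with
  | zero => simp
  | succ k ih =>
    have h1 := Nat.filter_coprime_Ico_eq_totient c (c * k)
    have h2 : range (c * (k + 1)) = range (c * k) ∪ Ico (c * k) (c * k + c) := by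
      ext x
      simp only [mem_union, mem_range, mem_Ico, mul_add, mul_one]
      omega
    rw [h2, filter_union, card_union_of_disjoint, ih, h1, mul_add, mul_one]
    refine disjoint_filter_filter (disjoint_left.2 fun x h1 h2 => ?_)
    rw [mem_range] at h1
    rw [mem_Ico] at h2
    omega

theorem card_coprimesBelow {n c : ℕ} (hc : c ∣ n) (hn : 0 < n) :
    (#(coprimesBelow n c) : ℝ) = c.totient / c * n - if c = 1 then 1 else 0 := by
  obtain ⟨m, rfl⟩ := hc
  have hc0 : (c : ℝ) ≠ 0 := by
    have := pos_of_mul_pos_left hn (Nat.zero_le _)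
    positivity
  have h1 : c.totient / c * ((c * m : ℕ) : ℝ) = ((c.totient * m : ℕ) : ℝ) := by
    push_cast
    field_simp
  rw [h1, ← card_range_filter_coprime]
  split_ifs with h
  · subst h
    simp [coprimesBelow]
    rw [Nat.cast_sub (by omega)]
    simp
  · rw [sub_zero]
    congr 2
    ext a
    simp only [coprimesBelow, mem_filter, mem_Ico, mem_range]
    refine ⟨fun h => ⟨h.1.2, h.2⟩, fun h' => ⟨⟨Nat.pos_of_ne_zero ?_, h'.1⟩, h'.2⟩⟩
    rintro rfl
    exact h (by simpa using h'.2)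

theorem sum_coprimesBelow {n c : ℕ} (hc : c ∣ n) :
    ∑ a ∈ coprimesBelow n c, ((n : ℝ) - a) = #(coprimesBelow n c) * n / 2 := by
  have h1 : ∑ a ∈ coprimesBelow n c, ((n : ℝ) - a) = ∑ a ∈ coprimesBelow n c, (a : ℝ) := by
    refine sum_bij' (fun a _ => n - a) (fun a _ => n - a)
      (fun a ha => sub_mem_coprimesBelow hc ha) (fun a ha => sub_mem_coprimesBelow hc ha) ?_ ?_ ?_
    all_goals
      intro a ha
      rw [mem_coprimesBelow] at ha
    · omega
    · omega
    · rw [Nat.cast_sub ha.1.2.le]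
  have h2 : ∑ a ∈ coprimesBelow n c, ((n : ℝ) - a) + ∑ a ∈ coprimesBelow n c, (a : ℝ) =
      #(coprimesBelow n c) * n := by
    rw [← sum_add_distrib]
    simp
  linarith

namespace TripleBound

theorem fst_mem_coprimesBelow {n c : ℕ} (hc : c ∣ n) (hn : 0 < n) :
    TripleBound n (fun x _ _ => x ∈ coprimesBelow n c) (c.totient / c * n ^ 2 / 2) := by
  refine (sum_fst (I := coprimesBelow n c) (R := fun _ _ => True) (c := fun a => (n : ℝ) - a)
    (fun a ha => ?_) (fun i b c _ _ _ _ h => ⟨h, True.intro⟩)).mono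
      (fun _ _ _ _ _ _ _ h => h) ?_
  · rw [mem_coprimesBelow] at ha
    refine (CardBound.trivial (Ico 1 (n - a)) fun _ => True).le ?_
    rw [Nat.card_Ico, ← Nat.cast_sub ha.1.2.le]
    exact_mod_cast Nat.sub_le _ _
  · rw [sum_coprimesBelow hc, card_coprimesBelow hc hn]
    have : (0 : ℝ) ≤ if c = 1 then 1 else 0 := by split_ifs <;> norm_num
    nlinarith [mul_nonneg this (Nat.cast_nonneg (α := ℝ) n)]

theorem scale {m p : ℕ} {P : ℕ → ℕ → ℕ → Prop} {x : ℝ} (h : TripleBound m P x) :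
    TripleBound (p * m) (fun a b c => ∃ a' b' c', a = p * a' ∧ b = p * b' ∧ c = p * c' ∧ P a' b' c')
      x := by
  classical
  intro U hU hP
  have hsub : U ⊆ ({t ∈ triples m | P t.1 t.2.1 t.2.2} : Finset (ℕ × ℕ × ℕ)).image
      fun t => (p * t.1, p * t.2.1, p * t.2.2) := by
    rintro ⟨a, b, c⟩ ht
    have h1 := mem_triples.1 (hU ht)
    obtain ⟨a', b', c', ha, hb, hc, h2⟩ := hP _ ht
    dsimp only at ha hb hc
    subst ha hb hc
    refine mem_image.2 ⟨(a', b', c'), mem_filter.2 ⟨mem_triples.2 ⟨?_, ?_, ?_, ?_⟩, h2⟩, rfl⟩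
    · exact pos_of_mul_pos_right h1.1 (Nat.zero_le _)
    · exact pos_of_mul_pos_right h1.2.1 (Nat.zero_le _)
    · exact pos_of_mul_pos_right h1.2.2.1 (Nat.zero_le _)
    · refine Nat.eq_of_mul_eq_mul_left (pos_of_mul_pos_left h1.1 (Nat.zero_le _)) ?_
      rw [mul_add, mul_add, h1.2.2.2]
  refine le_trans ?_ (h _ (filter_subset _ _) fun t ht => (mem_filter.1 ht).2)
  exact_mod_cast (card_le_card hsub).trans card_image_le

theorem of_not_coprimeTriple {n : ℕ} (hn : 0 < n) :
    TripleBound n (fun x y z => x ∈ coprimesBelow n (n.gcd 6) ∧ ¬ CoprimeTriple x y z)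
      ((n.gcd 6).totient / (n.gcd 6 : ℕ) * n ^ 2 / 2 *
        ∑ p ∈ n.primeFactors with 5 ≤ p, 1 / (p : ℝ) ^ 2) := by
  rw [mul_sum]
  refine (exists_mem (P := fun p x y z => x ∈ coprimesBelow n (n.gcd 6) ∧ p ∣ x ∧ p ∣ y ∧ p ∣ z)
    fun p hp => ?_).mono ?_ le_rfl
  · rw [mem_filter, Nat.mem_primeFactors] at hp
    obtain ⟨⟨hp, ⟨m, rfl⟩, -⟩, h5⟩ := hp
    have hm : 0 < m := pos_of_mul_pos_right hn (Nat.zero_le _)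
    have h2p : Nat.Coprime p 2 := (Nat.coprime_primes hp Nat.prime_two).2 (by omega)
    have h3p : Nat.Coprime p 3 := (Nat.coprime_primes hp Nat.prime_three).2 (by omega)
    have h6p : Nat.Coprime p 6 := h2p.mul_right h3p
    have hg : (p * m).gcd 6 = m.gcd 6 := h6p.gcd_mul_left_cancel m
    rw [hg]
    refine (fst_mem_coprimesBelow (Nat.gcd_dvd_left m 6) hm).scale.mono ?_ (le_of_eq ?_)
    · rintro _ _ _ hx - - - ⟨h1, ⟨x, rfl⟩, ⟨y, rfl⟩, ⟨z, rfl⟩⟩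
      refine ⟨x, y, z, rfl, rfl, rfl, ?_⟩
      rw [mem_coprimesBelow] at *
      exact ⟨⟨pos_of_mul_pos_right hx (Nat.zero_le _), lt_of_mul_lt_mul_left h1.1.2 (Nat.zero_le _)⟩,
        h1.2.coprime_mul_left_right⟩
    · have : (p : ℝ) ≠ 0 := by exact_mod_cast hp.ne_zero
      push_cast
      field_simp
  · rintro x y z hx hy hz hs ⟨h1, h2⟩
    unfold CoprimeTriple at h2
    push Not at h2
    obtain ⟨m, hmx, hmy, hmz, hm⟩ := h2
    obtain ⟨p, hp, hpm⟩ := Nat.exists_prime_and_dvd hm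
    have hpn : p ∣ n := hs ▸ ((hpm.trans hmx).add (hpm.trans hmy)).add (hpm.trans hmz)
    refine ⟨p, ?_, h1, hpm.trans hmx, hpm.trans hmy, hpm.trans hmz⟩
    rw [mem_filter, Nat.mem_primeFactors]
    refine ⟨⟨hp, hpn, hn.ne'⟩, ?_⟩
    by_contra h5
    have h6 : p ∣ 6 := by
      have := hp.two_le
      have : p = 2 ∨ p = 3 := by
        have : p ≠ 4 := by rintro rfl; revert hp; norm_num
        omega
      rcases this with rfl | rfl <;> norm_num
    exact hp.one_lt.ne' (Nat.Coprime.eq_one_of_dvd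
      ((mem_coprimesBelow.1 h1).2.coprime_dvd_left (Nat.dvd_gcd hpn h6)) (hpm.trans hmx))

end TripleBound

/-- A bound for the sum of `w` over the primes in `[5, L]`, computed exactly up to `400` and
replacing the primes by the integers coprime to `6` above that. -/
theorem sum_primes_le {w : ℕ → ℝ} (hw : ∀ m, 0 ≤ w m) (L : ℕ) :
    ∑ p ∈ Icc 5 L with p.Prime, w p ≤ ∑ p ∈ {5, 7, 11, 13, 17, 19}, w p +
      ∑ m ∈ Icc 20 400 with m.gcd 9699690 = 1, w m +
      ∑ k ∈ Icc 67 ((L + 1) / 6), (w (6 * k - 1) + w (6 * k + 1)) := by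
  classical
  have hsub : {p ∈ Icc 5 L | p.Prime} ⊆ (({5, 7, 11, 13, 17, 19} : Finset ℕ) ∪
      {m ∈ Icc 20 400 | m.gcd 9699690 = 1}) ∪
      ((Icc 67 ((L + 1) / 6)).image (fun k => 6 * k - 1) ∪
        (Icc 67 ((L + 1) / 6)).image (fun k => 6 * k + 1)) := by
    intro p hp
    simp only [mem_filter, mem_Icc] at hp
    obtain ⟨⟨h5, hL⟩, hp⟩ := hp
    simp only [mem_union, mem_filter, mem_Icc, mem_image]
    rcases lt_or_ge p 20 with h | h
    · refine .inl (.inl ?_)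
      interval_cases p <;> first | decide | (exfalso; revert hp; norm_num)
    · rcases le_or_gt p 400 with h' | h'
      · refine .inl (.inr ⟨⟨h, h'⟩, ?_⟩)
        refine (Nat.Prime.coprime_iff_not_dvd hp).2 fun hd => ?_
        have : (9699690 : ℕ) = 2 * 3 * 5 * 7 * 11 * 13 * 17 * 19 := by norm_num
        rw [this] at hd
        simp only [hp.dvd_mul] at hd
        have key : ∀ q : ℕ, 0 < q → q < 20 → ¬ p ∣ q := fun q h0 hq hd =>
          absurd (Nat.le_of_dvd h0 hd) (by omega)
        rcases hd with ((((((hd | hd) | hd) | hd) | hd) | hd) | hd) | hd <;>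
          exact key _ (by norm_num) (by norm_num) hd
      · right
        have h2 : ¬ 2 ∣ p := fun hd => by
          have := (Nat.prime_dvd_prime_iff_eq Nat.prime_two hp).1 hd
          omega
        have h3 : ¬ 3 ∣ p := fun hd => by
          have := (Nat.prime_dvd_prime_iff_eq Nat.prime_three hp).1 hd
          omega
        have h6 : p % 6 = 1 ∨ p % 6 = 5 := by omega
        rcases h6 with h6 | h6
        · exact .inr ⟨p / 6, by omega, by omega⟩
        · exact .inl ⟨(p + 1) / 6, by omega, by omega⟩
  have hu : ∀ s t : Finset ℕ, ∑ x ∈ s ∪ t, w x ≤ ∑ x ∈ s, w x + ∑ x ∈ t, w x := fun s t => by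
    rw [← sum_union_inter]
    exact le_add_of_nonneg_right (sum_nonneg fun _ _ => hw _)
  refine (sum_le_sum_of_subset_of_nonneg hsub fun _ _ _ => hw _).trans ((hu _ _).trans ?_)
  rw [sum_add_distrib]
  refine add_le_add (hu _ _) ((hu _ _).trans ?_)
  exact add_le_add (sum_image_le_of_nonneg (fun _ _ => hw _))
    (sum_image_le_of_nonneg (fun _ _ => hw _))

theorem sum_coprime_le_nat {N c : ℕ} (w : ℕ → ℝ) (v : ℕ → ℕ) {T : ℕ} (hT : 0 < T)
    (hv : ∀ m, 20 ≤ m → w m ≤ (T / v m + 1 : ℕ) / (T : ℝ))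
    (h : ∑ m ∈ Icc 20 N with m.gcd c = 1, (T / v m + 1) ≤ B) :
    ∑ m ∈ Icc 20 N with m.gcd c = 1, w m ≤ B / (T : ℝ) := by
  calc _ ≤ ∑ m ∈ Icc 20 N with m.gcd c = 1, ((T / v m + 1 : ℕ) / (T : ℝ)) :=
        sum_le_sum fun m hm => hv m (by simp at hm; omega)
    _ = (∑ m ∈ Icc 20 N with m.gcd c = 1, (T / v m + 1) : ℕ) / (T : ℝ) := by
        rw [← sum_div]; push_cast; rfl
    _ ≤ _ := by gcongr

theorem inv_le_div_add_one_div {v T : ℕ} (hv : 0 < v) (hT : 0 < T) :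
    1 / (v : ℝ) ≤ (T / v + 1 : ℕ) / (T : ℝ) := by
  rw [div_le_div_iff₀ (by positivity) (by positivity), one_mul]
  have : T ≤ (T / v + 1) * v := by
    have := Nat.lt_div_mul_add (a := T) hv
    lia
  exact_mod_cast this

theorem sum_telescope_le {a b : ℕ} {w f : ℕ → ℝ} (h : ∀ k, a < k → w k ≤ f k - f (k - 1)) :
    ∑ k ∈ Icc (a + 1) b, w k ≤ f (max a b) - f a := by
  induction b with
  | zero => simp
  | succ b ih =>
    rcases le_or_gt (a + 1) (b + 1) with hb | hb
    · rw [sum_Icc_succ_top hb]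
      have := h (b + 1) (by omega)
      rw [max_eq_right (by omega)] at ih ⊢
      simp only [add_tsub_cancel_right] at this
      linarith
    · rw [Icc_eq_empty (by omega), sum_empty, max_eq_left (by omega), sub_self]

theorem inv_sq_add_inv_sq_le {x : ℝ} (hx : 1 ≤ x) :
    1 / (6 * x - 1) ^ 2 + 1 / (6 * x + 1) ^ 2 ≤ (1 / 18) * (1 / (x - 1 / 2) - 1 / (x + 1 / 2)) := by
  have h1 : 0 < 6 * x - 1 := by linarith
  have h2 : 0 < x - 1 / 2 := by linarith
  have h3 : 0 < x + 1 / 2 := by linarith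
  have h4 : 0 < 6 * x + 1 := by linarith
  rw [div_add_div _ _ (by positivity) (by positivity), div_sub_div _ _ (by positivity) (by positivity),
    div_mul_div_comm, div_le_div_iff₀ (by positivity) (by positivity)]
  nlinarith [sq_nonneg x]

theorem log_div_ge {x d : ℝ} (hd : 0 < d) (hx : d < x) :
    2 * (d / x) + 2 * (d / x) ^ 3 / 3 ≤ Real.log ((x + d) / (x - d)) := by
  have hx0 : 0 < x := hd.trans hx
  have h := Real.sum_range_le_log_div (x := d / x) (by positivity)
    ((div_lt_one hx0).2 hx) 2
  have h2 : (1 + d / x) / (1 - d / x) = (x + d) / (x - d) := by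
    have : x - d ≠ 0 := by linarith
    have : 1 - d / x ≠ 0 := by
      rw [one_sub_div hx0.ne']; exact div_ne_zero this hx0.ne'
    field_simp
  rw [h2] at h
  simp [sum_range_succ] at h
  linarith

theorem inv_add_inv_le {x : ℝ} (hx : 1 ≤ x) :
    1 / (6 * x - 1) + 1 / (6 * x + 1) ≤ (1 / 3) * (Real.log (x + 1 / 2) - Real.log (x - 1 / 2)) := by
  have h := log_div_ge (x := x) (d := 1 / 2) (by norm_num) (by linarith)
  rw [Real.log_div (by linarith) (by linarith)] at h
  refine le_trans ?_ (mul_le_mul_of_nonneg_left h (by norm_num))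
  have h1 : 0 < 6 * x - 1 := by linarith
  have h4 : 0 < 6 * x + 1 := by linarith
  have h5 : 0 < x := by linarith
  have e : (1 : ℝ) / 3 * (2 * (1 / 2 / x) + 2 * (1 / 2 / x) ^ 3 / 3) = (12 * x ^ 2 + 1) / (36 * x ^ 3) := by
    field_simp; ring
  rw [e, div_add_div _ _ (by positivity) (by positivity), div_le_div_iff₀ (by positivity) (by positivity)]
  nlinarith [sq_nonneg x, mul_self_nonneg (x - 1)]

theorem sum_inv_sq_primes_le (L : ℕ) : ∑ p ∈ Icc 5 L with p.Prime, 1 / (p : ℝ) ^ 2 ≤ 0.0917 := by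
  have h1 := sum_primes_le (w := fun p => 1 / (p : ℝ) ^ 2) (fun _ => by positivity) L
  have h2 : ∑ m ∈ Icc (20 : ℕ) 400 with m.gcd 9699690 = 1, 1 / (m : ℝ) ^ 2 ≤
      (995836 : ℕ) / ((10 ^ 8 : ℕ) : ℝ) := by
    refine sum_coprime_le_nat _ (fun m => m ^ 2) (by norm_num) (fun m hm => ?_) (by decide +kernel)
    rw [← Nat.cast_pow]
    exact inv_le_div_add_one_div (by positivity) (by norm_num)
  have h3 := sum_telescope_le (a := 66) (b := (L + 1) / 6)
    (w := fun k : ℕ => 1 / ((6 * k - 1 : ℕ) : ℝ) ^ 2 + 1 / ((6 * k + 1 : ℕ) : ℝ) ^ 2)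
    (f := fun k : ℕ => -(1 / 18) * (1 / ((k : ℝ) + 1 / 2))) (fun k hk => by
      have hk' : (1 : ℝ) ≤ k := by exact_mod_cast (by omega : 1 ≤ k)
      have := inv_sq_add_inv_sq_le hk'
      rw [Nat.cast_sub (by omega), Nat.cast_pred (by omega)]
      push_cast
      rw [show (k : ℝ) - 1 + 1 / 2 = k - 1 / 2 by ring]
      linarith)
  have h4 : 0 ≤ 1 / 18 * (max 66 (((L + 1) / 6 : ℕ) : ℝ) + 1 / 2)⁻¹ := by positivity
  norm_num [sum_insert] at h1 h2 h3 ⊢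
  linarith

/-- An upper bound for `∑ 1 / p` over the primes in `[5, L]`. -/
theorem sum_inv_primes_le {L : ℕ} {y : ℝ} (hy : 399 ≤ y) (hL : L + 4 ≤ y) :
    ∑ p ∈ Icc 5 L with p.Prime, 1 / (p : ℝ) ≤ 1.22548 + 1 / 3 * Real.log (y / 399) := by
  have h1 := sum_primes_le (w := fun p => 1 / (p : ℝ)) (fun _ => by positivity) L
  have h2 : ∑ m ∈ Icc (20 : ℕ) 400 with m.gcd 9699690 = 1, 1 / (m : ℝ) ≤
      (603335 : ℕ) / ((10 ^ 6 : ℕ) : ℝ) := by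
    refine sum_coprime_le_nat _ (fun m => m) (by norm_num) (fun m hm => ?_) (by decide +kernel)
    exact inv_le_div_add_one_div (by omega) (by norm_num)
  have h3 := sum_telescope_le (a := 66) (b := (L + 1) / 6)
    (w := fun k : ℕ => 1 / ((6 * k - 1 : ℕ) : ℝ) + 1 / ((6 * k + 1 : ℕ) : ℝ))
    (f := fun k : ℕ => (1 / 3) * Real.log ((k : ℝ) + 1 / 2)) (fun k hk => by
      have hk' : (1 : ℝ) ≤ k := by exact_mod_cast (by omega : 1 ≤ k)
      have := inv_add_inv_le hk'
      rw [Nat.cast_sub (by omega), Nat.cast_pred (by omega)]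
      push_cast
      rw [show (k : ℝ) - 1 + 1 / 2 = k - 1 / 2 by ring]
      linarith)
  have h4 : Real.log (((max 66 ((L + 1) / 6) : ℕ) : ℝ) + 1 / 2) ≤ Real.log (y / 6) := by
    refine Real.log_le_log (by positivity) ?_
    rcases max_choice 66 ((L + 1) / 6) with h | h <;> rw [h]
    · norm_num; linarith
    · have : (((L + 1) / 6 : ℕ) : ℝ) ≤ ((L + 1 : ℕ) : ℝ) / 6 := Nat.cast_div_le
      push_cast at this
      linarith
  have h5 : Real.log (y / 399) = Real.log (y / 6) - Real.log (66 + 1 / 2) := by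
    rw [← Real.log_div (by linarith) (by norm_num)]
    congr 1
    field_simp; norm_num
  rw [h5]
  simp only [Nat.cast_ofNat] at h3
  norm_num [sum_insert] at h1 h2 h3 h4 ⊢
  linarith

theorem sum_coprimeKeys_le {w : ℕ → ℝ} (hw : ∀ m, 0 ≤ w m) (n L : ℕ) :
    ∑ f ∈ coprimeKeys n L, w f ≤ ∑ f ∈ {6, 8, 9}, (if f.Coprime n then w f else 0) +
      ∑ p ∈ coprimePrimes n L, w p := by
  classical
  rw [← sum_filter, ← sum_union_inter]
  refine le_add_of_le_of_nonneg (sum_le_sum_of_subset_of_nonneg (fun f hf => ?_) fun _ _ _ => hw _)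
    (sum_nonneg fun _ _ => hw _)
  obtain ⟨hL, hf, hn⟩ := mem_coprimeKeys.1 hf
  simp only [mem_union, mem_filter, mem_insert, mem_singleton, coprimePrimes, mem_Icc]
  rcases hf with rfl | rfl | rfl | ⟨hp, h5⟩
  · exact .inl ⟨by simp, hn⟩
  · exact .inl ⟨by simp, hn⟩
  · exact .inl ⟨by simp, hn⟩
  · exact .inr ⟨⟨h5, hL⟩, hp, hn⟩

/-- The sum of `1 / p ^ 2` over the prime divisors `p ≥ 5` of `n`. -/
noncomputable def primeFactorsSum (n : ℕ) : ℝ := ∑ p ∈ n.primeFactors with 5 ≤ p, 1 / (p : ℝ) ^ 2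

theorem primeFactorsSum_nonneg (n : ℕ) : 0 ≤ primeFactorsSum n :=
  sum_nonneg fun _ _ => by positivity

theorem sum_coprimePrimes_inv_sq_le {n : ℕ} (hn : 0 < n) (L : ℕ) :
    ∑ p ∈ coprimePrimes n L, 1 / (p : ℝ) ^ 2 ≤ 0.0917 - primeFactorsSum n := by
  have hd : Disjoint (coprimePrimes n L) {p ∈ n.primeFactors | 5 ≤ p} := by
    refine disjoint_left.2 fun p hp hp' => ?_
    simp only [coprimePrimes, mem_filter, Nat.mem_primeFactors] at hp hp'
    exact (Nat.Prime.coprime_iff_not_dvd hp.2.1).1 hp.2.2 hp'.1.2.1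
  have h := sum_inv_sq_primes_le (max L n)
  have h' : ∑ p ∈ (coprimePrimes n L).disjUnion {p ∈ n.primeFactors | 5 ≤ p} hd, 1 / (p : ℝ) ^ 2 ≤
      ∑ p ∈ Icc 5 (max L n) with p.Prime, 1 / (p : ℝ) ^ 2 := by
    refine sum_le_sum_of_subset_of_nonneg (fun p hp => ?_) fun _ _ _ => by positivity
    simp only [coprimePrimes, mem_disjUnion, mem_filter, Nat.mem_primeFactors, mem_Icc] at hp ⊢
    rcases hp with hp | hp
    · exact ⟨⟨hp.1.1, le_max_of_le_left hp.1.2⟩, hp.2.1⟩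
    · exact ⟨⟨hp.2, le_max_of_le_right (Nat.le_of_dvd hn hp.1.2.1)⟩, hp.1.1⟩
  rw [sum_disjUnion] at h'
  unfold primeFactorsSum
  linarith

theorem primeFactorsSum_le {n : ℕ} (hn : 0 < n) : primeFactorsSum n ≤ 0.0917 := by
  have h := sum_coprimePrimes_inv_sq_le hn 0
  have : 0 ≤ ∑ p ∈ coprimePrimes n 0, 1 / (p : ℝ) ^ 2 := sum_nonneg fun _ _ => by positivity
  linarith

theorem sum_coprimePrimes_inv_le {n L : ℕ} {y : ℝ} (hy : 399 ≤ y) (hL : L + 4 ≤ y) :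
    ∑ p ∈ coprimePrimes n L, 1 / (p : ℝ) ≤ 1.22548 + 1 / 3 * Real.log (y / 399) := by
  refine (sum_le_sum_of_subset_of_nonneg (fun p hp => ?_) fun _ _ _ => by positivity).trans
    (sum_inv_primes_le hy hL)
  simp only [coprimePrimes, mem_filter] at hp ⊢
  exact ⟨hp.1, hp.2.1⟩

theorem sum_coprime_mul_le {n L : ℕ} (hL : 9 ≤ L) {w : ℕ → ℝ} (hw : ∀ m, 0 ≤ w m) :
    ∑ p ∈ coprimeKeys n L ×ˢ coprimeKeys n L with p.1.Coprime p.2, w p.1 * w p.2 ≤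
      (∑ f ∈ coprimeKeys n L, w f) ^ 2 - ∑ f ∈ {5, 6, 7, 8, 9}, ∑ g ∈ {5, 6, 7, 8, 9},
        if f.Coprime n ∧ g.Coprime n ∧ ¬ f.Coprime g then w f * w g else 0 := by
  have h1 : (∑ f ∈ coprimeKeys n L, w f) ^ 2 =
      ∑ p ∈ coprimeKeys n L ×ˢ coprimeKeys n L, w p.1 * w p.2 := by
    rw [sq, sum_mul_sum, sum_product]
  rw [h1, le_sub_iff_add_le, ← sum_product', ← sum_filter,
    ← sum_filter_add_sum_filter_not (coprimeKeys n L ×ˢ coprimeKeys n L)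
      (fun p : ℕ × ℕ => p.1.Coprime p.2)]
  refine add_le_add_right (sum_le_sum_of_subset_of_nonneg (fun p hp => ?_)
    fun _ _ _ => mul_nonneg (hw _) (hw _)) _
  obtain ⟨f, g⟩ := p
  have key : ∀ f, f ∈ ({5, 6, 7, 8, 9} : Finset ℕ) → f ≤ L ∧ IsKeyDivisor f := by
    intro f hf
    simp only [mem_insert, mem_singleton] at hf
    unfold IsKeyDivisor
    refine ⟨by omega, ?_⟩
    rcases hf with rfl | rfl | rfl | rfl | rfl <;> norm_num
  simp only [mem_filter, mem_product, mem_coprimeKeys] at hp ⊢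
  obtain ⟨⟨hf, hg⟩, h2, h3, h4⟩ := hp
  exact ⟨⟨⟨(key f hf).1, (key f hf).2, h2⟩, (key g hg).1, (key g hg).2, h3⟩, h4⟩

/-- `1 / f ^ k` if `f` is coprime to `n`, and `0` otherwise. -/
noncomputable def coprimeInv (n k f : ℕ) : ℝ := if f.Coprime n then 1 / (f : ℝ) ^ k else 0

theorem coprimeInv_nonneg (n k f : ℕ) : 0 ≤ coprimeInv n k f := by
  unfold coprimeInv; split_ifs <;> positivity

theorem sum_noncoprime_ge {n : ℕ} (hn : 0 < n) :
    coprimeInv n 2 6 ^ 2 + coprimeInv n 2 8 ^ 2 + coprimeInv n 2 9 ^ 2 +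
      2 * coprimeInv n 2 6 * (coprimeInv n 2 8 + coprimeInv n 2 9) +
      (1 / 625 + 1 / 2401 - primeFactorsSum n / 25) ≤
      ∑ f ∈ ({5, 6, 7, 8, 9} : Finset ℕ), ∑ g ∈ ({5, 6, 7, 8, 9} : Finset ℕ),
        if f.Coprime n ∧ g.Coprime n ∧ ¬ f.Coprime g then 1 / (f : ℝ) ^ 2 * (1 / (g : ℝ) ^ 2) else 0 := by
  have h5 : 1 / 625 + 1 / 2401 - primeFactorsSum n / 25 ≤ coprimeInv n 2 5 ^ 2 + coprimeInv n 2 7 ^ 2 := by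
    have h : ∑ p ∈ ({5, 7} : Finset ℕ) with ¬ p.Coprime n, 1 / (p : ℝ) ^ 2 ≤ primeFactorsSum n := by
      refine sum_le_sum_of_subset_of_nonneg (fun p hp => ?_) fun _ _ _ => by positivity
      simp only [mem_filter, mem_insert, mem_singleton] at hp
      obtain ⟨rfl | rfl, h⟩ := hp <;>
        rw [Nat.Prime.coprime_iff_not_dvd (by norm_num), not_not] at h <;>
        simp only [mem_filter, Nat.mem_primeFactors] <;> exact ⟨⟨by norm_num, h, hn.ne'⟩, by norm_num⟩
    rw [sum_filter, sum_pair (by norm_num)] at h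
    unfold coprimeInv
    split_ifs at h ⊢ <;> simp_all <;> norm_num at * <;> linarith
  have e : ∑ f ∈ ({5, 6, 7, 8, 9} : Finset ℕ), ∑ g ∈ ({5, 6, 7, 8, 9} : Finset ℕ),
        (if f.Coprime n ∧ g.Coprime n ∧ ¬ f.Coprime g then 1 / (f : ℝ) ^ 2 * (1 / (g : ℝ) ^ 2) else 0) =
      ∑ f ∈ ({5, 6, 7, 8, 9} : Finset ℕ), ∑ g ∈ ({5, 6, 7, 8, 9} : Finset ℕ),
        (if f.Coprime g then 0 else coprimeInv n 2 f * coprimeInv n 2 g) := by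
    refine sum_congr rfl fun f _ => sum_congr rfl fun g _ => ?_
    unfold coprimeInv
    split_ifs <;> first | rfl | tauto | simp
  rw [e]
  have e2 : ∑ f ∈ ({5, 6, 7, 8, 9} : Finset ℕ), ∑ g ∈ ({5, 6, 7, 8, 9} : Finset ℕ),
        (if f.Coprime g then 0 else coprimeInv n 2 f * coprimeInv n 2 g) =
      coprimeInv n 2 5 ^ 2 + coprimeInv n 2 7 ^ 2 + coprimeInv n 2 6 ^ 2 + coprimeInv n 2 8 ^ 2 +
      coprimeInv n 2 9 ^ 2 + 2 * coprimeInv n 2 6 * (coprimeInv n 2 8 + coprimeInv n 2 9) := by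
    norm_num [sum_insert]
    ring
  rw [e2]
  linarith

/-- The total contribution of `1 / f ^ k` for `f = 6, 8, 9` coprime to `n`. -/
noncomputable def smallKeySum (n k : ℕ) : ℝ := coprimeInv n k 6 + coprimeInv n k 8 + coprimeInv n k 9

theorem sum_coprimeKeys_inv_pow_le (n L k : ℕ) :
    ∑ f ∈ coprimeKeys n L, 1 / (f : ℝ) ^ k ≤ smallKeySum n k + ∑ p ∈ coprimePrimes n L, 1 / (p : ℝ) ^ k := by
  refine (sum_coprimeKeys_le (fun _ => by positivity) n L).trans_eq ?_
  simp [sum_insert, smallKeySum, coprimeInv, add_assoc]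

theorem sum_two_le {n : ℕ} (hn : 45 ≤ n) {S : ℝ}
    (hS : ∑ p ∈ coprimePrimes n (n / 5), 1 / (p : ℝ) ≤ S) :
    ∑ p ∈ coprimeKeys n (n / 5) ×ˢ coprimeKeys n (n / 5) with p.1.Coprime p.2,
      ((n / (p.1 * p.2 : ℝ)) ^ 2 / 2 + (n / (p.1 * p.2 : ℝ)) / 2) ≤
    (n : ℝ) ^ 2 / 2 * ((smallKeySum n 2 + 0.0917 - primeFactorsSum n) ^ 2 -
      (coprimeInv n 2 6 ^ 2 + coprimeInv n 2 8 ^ 2 + coprimeInv n 2 9 ^ 2 +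
      2 * coprimeInv n 2 6 * (coprimeInv n 2 8 + coprimeInv n 2 9) +
      (1 / 625 + 1 / 2401 - primeFactorsSum n / 25))) + n / 2 * (smallKeySum n 1 + S) ^ 2 := by
  have h1 := sum_coprime_mul_le (n := n) (L := n / 5) (by omega) (w := fun f => 1 / (f : ℝ) ^ 2)
    (fun _ => by positivity)
  have h2 := sum_noncoprime_ge (n := n) (by omega)
  have h3 : (∑ f ∈ coprimeKeys n (n / 5), 1 / (f : ℝ) ^ 2) ^ 2 ≤
      (smallKeySum n 2 + 0.0917 - primeFactorsSum n) ^ 2 := by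
    gcongr
    have := sum_coprimeKeys_inv_pow_le n (n / 5) 2
    have := sum_coprimePrimes_inv_sq_le (n := n) (by omega) (n / 5)
    linarith
  have h4 : ∑ p ∈ coprimeKeys n (n / 5) ×ˢ coprimeKeys n (n / 5) with p.1.Coprime p.2,
      1 / (p.1 : ℝ) * (1 / (p.2 : ℝ)) ≤ (smallKeySum n 1 + S) ^ 2 := by
    calc _ ≤ ∑ p ∈ coprimeKeys n (n / 5) ×ˢ coprimeKeys n (n / 5), 1 / (p.1 : ℝ) * (1 / (p.2 : ℝ)) :=
          sum_le_sum_of_subset_of_nonneg (filter_subset _ _) fun _ _ _ => by positivity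
      _ = (∑ f ∈ coprimeKeys n (n / 5), 1 / (f : ℝ)) ^ 2 := by rw [sq, sum_mul_sum, sum_product]
      _ ≤ _ := by
        gcongr
        have := sum_coprimeKeys_inv_pow_le n (n / 5) 1
        simp only [pow_one] at this
        linarith
  calc _ = (n : ℝ) ^ 2 / 2 * ∑ p ∈ coprimeKeys n (n / 5) ×ˢ coprimeKeys n (n / 5) with
          p.1.Coprime p.2, 1 / (p.1 : ℝ) ^ 2 * (1 / (p.2 : ℝ) ^ 2) +
        n / 2 * ∑ p ∈ coprimeKeys n (n / 5) ×ˢ coprimeKeys n (n / 5) with p.1.Coprime p.2,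
          1 / (p.1 : ℝ) * (1 / (p.2 : ℝ)) := by
        rw [mul_sum, mul_sum, ← sum_add_distrib]
        refine sum_congr rfl fun p _ => ?_
        simp only [div_eq_mul_inv, mul_inv, one_mul]
        ring
    _ ≤ _ := by
        gcongr
        linarith

theorem sum_le_of_cover {w : ℕ → ℝ} (hw : ∀ m, 0 ≤ w m) {s B I J : Finset ℕ} {c : ℕ}
    (h : ∀ g ∈ s, g ∈ B ∨ ∃ k ∈ I, ∃ j ∈ J, g = c * k + j) :
    ∑ g ∈ s, w g ≤ ∑ g ∈ B, w g + ∑ k ∈ I, ∑ j ∈ J, w (c * k + j) := by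
  classical
  have hsub : s ⊆ B ∪ (I ×ˢ J).image (fun p => c * p.1 + p.2) := by
    intro g hg
    rcases h g hg with h | ⟨k, hk, j, hj, rfl⟩
    · exact mem_union_left _ h
    · exact mem_union_right _ (mem_image.2 ⟨(k, j), mem_product.2 ⟨hk, hj⟩, rfl⟩)
  refine (sum_le_sum_of_subset_of_nonneg hsub fun _ _ _ => hw _).trans ?_
  refine (le_add_of_nonneg_right (sum_nonneg fun _ _ => hw _)).trans (sum_union_inter ..).le |>.trans ?_
  gcongr
  rw [← sum_product']
  exact sum_image_le_of_nonneg fun _ _ => hw _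

theorem sum_inv_le {x : ℕ} {y : ℝ} (hy : 2 ≤ y) (hx : x + 1 ≤ y) :
    ∑ g ∈ Icc 1 x, 1 / (g : ℝ) ≤ 1 + Real.log (y / 1.5) := by
  have h := sum_le_of_cover (w := fun g => 1 / (g : ℝ)) (fun _ => by positivity) (s := Icc 1 x)
    (B := {1}) (I := Icc (1 + 1) x) (J := {0}) (c := 1) (fun g hg => by simp at hg ⊢; omega)
  have h' := sum_telescope_le (a := 1) (b := x) (w := fun k : ℕ => 1 / (k : ℝ))
    (f := fun k : ℕ => Real.log ((k : ℝ) + 1 / 2)) (fun k hk => by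
      have hk' : (2 : ℝ) ≤ k := by exact_mod_cast hk
      have := log_div_ge (x := k) (d := 1 / 2) (by norm_num) (by linarith)
      rw [Nat.cast_sub (by omega), Nat.cast_one, show (k : ℝ) - 1 + 1 / 2 = k - 1 / 2 by ring,
        ← Real.log_div (by linarith) (by linarith)]
      refine le_trans (le_trans (le_of_eq ?_) (le_add_of_nonneg_right (by positivity))) this
      field_simp)
  have hl : Real.log (((max 1 x : ℕ) : ℝ) + 1 / 2) ≤ Real.log y := by
    refine Real.log_le_log (by positivity) ?_
    rcases max_choice 1 x with h | h <;> rw [h] <;> push_cast <;> linarith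
  rw [Real.log_div (by linarith) (by norm_num)]
  norm_num at h h' hl ⊢
  linarith

theorem sum_inv_coprime_two_le {x : ℕ} {y : ℝ} (hy : 2 ≤ y) (hx : x + 1 ≤ y) :
    ∑ g ∈ Icc 1 x with Nat.Coprime 2 g, 1 / (g : ℝ) ≤ 1 + 1 / 2 * Real.log (y / 2) := by
  have h := sum_le_of_cover (w := fun g => 1 / (g : ℝ)) (fun _ => by positivity)
    (s := {g ∈ Icc 1 x | Nat.Coprime 2 g}) (B := {1}) (I := Icc (0 + 1) ((x - 1) / 2)) (J := {1})
    (c := 2) (fun g hg => by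
      simp only [mem_filter, mem_Icc, Nat.coprime_two_left, Nat.odd_iff] at hg
      rcases eq_or_ne g 1 with rfl | h1
      · simp
      · exact .inr ⟨g / 2, by simp; omega, 1, by simp, by omega⟩)
  have h' := sum_telescope_le (a := 0) (b := (x - 1) / 2) (w := fun k : ℕ => 1 / ((2 * k + 1 : ℕ) : ℝ))
    (f := fun k : ℕ => 1 / 2 * Real.log ((k : ℝ) + 1)) (fun k hk => by
      have hk' : (1 : ℝ) ≤ k := by exact_mod_cast hk
      have := log_div_ge (x := 2 * k + 1) (d := 1) (by norm_num) (by linarith)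
      rw [Nat.cast_sub (by omega), Nat.cast_one, sub_add_cancel, ← mul_sub,
        ← Real.log_div (by linarith) (by linarith)]
      rw [show (2 * (k : ℝ) + 1 + 1) / (2 * k + 1 - 1) = (k + 1) / k by field_simp; ring] at this
      have : (0 : ℝ) ≤ 2 * (1 / (2 * k + 1)) ^ 3 / 3 := by positivity
      push_cast
      linarith)
  have hl : Real.log (((max 0 ((x - 1) / 2) : ℕ) : ℝ) + 1) ≤ Real.log (y / 2) := by
    refine Real.log_le_log (by positivity) ?_
    have : max 0 ((x - 1) / 2) * 2 + 2 ≤ x + 1 ∨ max 0 ((x - 1) / 2) * 2 + 2 ≤ 2 := by omega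
    rcases this with h | h
    · have : (max 0 ((x - 1) / 2) : ℕ) * 2 + 2 ≤ (x + 1 : ℝ) := by exact_mod_cast h
      linarith
    · have : (max 0 ((x - 1) / 2) : ℕ) * 2 + 2 ≤ (2 : ℝ) := by exact_mod_cast h
      linarith
  norm_num at h h' hl ⊢
  linarith

theorem sum_inv_coprime_three_le {x : ℕ} {y : ℝ} (hx : x + 3 ≤ y) :
    ∑ g ∈ Icc 1 x with Nat.Coprime 3 g, 1 / (g : ℝ) ≤ 3 / 2 + 2 / 3 * Real.log (y / 3) := by
  have h := sum_le_of_cover (w := fun g => 1 / (g : ℝ)) (fun _ => by positivity)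
    (s := {g ∈ Icc 1 x | Nat.Coprime 3 g}) (B := {1, 2}) (I := Icc (0 + 1) (x / 3)) (J := {1, 2})
    (c := 3) (fun g hg => by
      simp only [mem_filter, mem_Icc, Nat.Prime.coprime_iff_not_dvd Nat.prime_three] at hg
      by_cases h1 : g = 1 ∨ g = 2
      · exact .inl (by simpa using h1)
      · exact .inr ⟨g / 3, by simp; omega, g % 3, by simp; omega, by omega⟩)
  have h' := sum_telescope_le (a := 0) (b := x / 3)
    (w := fun k : ℕ => 1 / ((3 * k + 1 : ℕ) : ℝ) + 1 / ((3 * k + 2 : ℕ) : ℝ))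
    (f := fun k : ℕ => 2 / 3 * Real.log ((k : ℝ) + 1)) (fun k hk => by
      have hk' : (1 : ℝ) ≤ k := by exact_mod_cast hk
      have := log_div_ge (x := 3 * k + 3 / 2) (d := 3 / 2) (by norm_num) (by linarith)
      rw [Nat.cast_sub (by omega), Nat.cast_one, sub_add_cancel, ← mul_sub,
        ← Real.log_div (by linarith) (by linarith)]
      rw [show (3 * (k : ℝ) + 3 / 2 + 3 / 2) / (3 * k + 3 / 2 - 3 / 2) = (k + 1) / k by
        field_simp; ring] at this
      refine le_trans ?_ (mul_le_mul_of_nonneg_left this (by norm_num))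
      push_cast
      rw [show (2 : ℝ) / 3 * (2 * (3 / 2 / (3 * k + 3 / 2)) + 2 * (3 / 2 / (3 * k + 3 / 2)) ^ 3 / 3) =
        (4 * (2 * k + 1) ^ 2 + 4 / 3) / (3 * (2 * k + 1) ^ 3) by field_simp; ring,
        div_add_div _ _ (by positivity) (by positivity), div_le_div_iff₀ (by positivity) (by positivity)]
      nlinarith [mul_nonneg (by linarith : (0 : ℝ) ≤ k) (by linarith : (0 : ℝ) ≤ k - 1),
        pow_nonneg (by linarith : (0 : ℝ) ≤ k) 3])
  have hl : Real.log (((max 0 (x / 3) : ℕ) : ℝ) + 1) ≤ Real.log (y / 3) := by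
    refine Real.log_le_log (by positivity) ?_
    have : max 0 (x / 3) * 3 + 3 ≤ x + 3 := by omega
    have : (max 0 (x / 3) : ℕ) * 3 + 3 ≤ (x + 3 : ℝ) := by exact_mod_cast this
    linarith
  norm_num at h h' hl ⊢
  linarith

theorem sum_inv_coprime_six_le {x : ℕ} {y : ℝ} (hy : 9 ≤ y) (hx : x + 4 ≤ y) :
    ∑ g ∈ Icc 1 x with Nat.Coprime 6 g, 1 / (g : ℝ) ≤ 47 / 35 + 1 / 3 * Real.log (y / 9) := by
  have h := sum_le_of_cover (w := fun g => 1 / (g : ℝ)) (fun _ => by positivity)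
    (s := {g ∈ Icc 1 x | Nat.Coprime 6 g}) (B := {1, 5, 7}) (I := Icc (0 + 1) ((x - 5) / 6))
    (J := {5, 7}) (c := 6) (fun g hg => by
      simp only [mem_filter, mem_Icc, show (6 : ℕ) = 2 * 3 by norm_num, Nat.coprime_mul_iff_left,
        Nat.Prime.coprime_iff_not_dvd Nat.prime_three,
        Nat.Prime.coprime_iff_not_dvd Nat.prime_two] at hg
      by_cases h1 : g = 1 ∨ g = 5 ∨ g = 7
      · exact .inl (by simpa using h1)
      · have : g % 6 = 1 ∨ g % 6 = 5 := by omega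
        rcases this with h | h
        · exact .inr ⟨(g - 7) / 6, by simp; omega, 7, by simp, by omega⟩
        · exact .inr ⟨(g - 5) / 6, by simp; omega, 5, by simp, by omega⟩)
  have h' := sum_telescope_le (a := 0) (b := (x - 5) / 6)
    (w := fun k : ℕ => 1 / ((6 * k + 5 : ℕ) : ℝ) + 1 / ((6 * k + 7 : ℕ) : ℝ))
    (f := fun k : ℕ => 1 / 3 * Real.log ((k : ℝ) + 3 / 2)) (fun k hk => by
      have hk' : (1 : ℝ) ≤ k := by exact_mod_cast hk
      have := inv_add_inv_le (x := k + 1) (by linarith)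
      rw [Nat.cast_sub (by omega), Nat.cast_one]
      push_cast
      rw [show (6 * (k : ℝ) + 5) = 6 * (k + 1) - 1 by ring, show (6 * (k : ℝ) + 7) = 6 * (k + 1) + 1 by ring,
        show (k : ℝ) + 3 / 2 = k + 1 + 1 / 2 by ring, show (k : ℝ) - 1 + 3 / 2 = k + 1 - 1 / 2 by ring]
      linarith)
  have hl : Real.log (((max 0 ((x - 5) / 6) : ℕ) : ℝ) + 3 / 2) ≤ Real.log (y / 6) := by
    refine Real.log_le_log (by positivity) ?_
    have : max 0 ((x - 5) / 6) * 6 + 9 ≤ x + 4 ∨ max 0 ((x - 5) / 6) * 6 + 9 ≤ 9 := by omega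
    rcases this with h | h
    · have : (max 0 ((x - 5) / 6) : ℕ) * 6 + 9 ≤ (x + 4 : ℝ) := by exact_mod_cast h
      linarith
    · have : (max 0 ((x - 5) / 6) : ℕ) * 6 + 9 ≤ (9 : ℝ) := by exact_mod_cast h
      linarith
  have e : Real.log (y / 9) = Real.log (y / 6) - Real.log (3 / 2) := by
    rw [← Real.log_div (by linarith) (by norm_num)]
    congr 1
    field_simp; norm_num
  rw [e]
  norm_num [sum_insert] at h h' hl ⊢
  linarith

theorem card_Icc_coprime_le {d : ℕ} (hd : 0 < d) (hd2 : d.totient ≤ 2) (x : ℕ) :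
    (#{g ∈ Icc 1 x | d.Coprime g} : ℝ) ≤ d.totient / d * x + 2 := by
  have h := Nat.Ico_filter_coprime_le 1 x hd.ne'
  have h' : #{g ∈ Icc 1 x | d.Coprime g} ≤ d.totient * (x / d + 1) := by
    refine le_trans (card_le_card fun g hg => ?_) h
    simp only [mem_filter, mem_Icc, mem_Ico] at hg ⊢
    exact ⟨⟨hg.1.1, by omega⟩, hg.2⟩
  calc (#{g ∈ Icc 1 x | d.Coprime g} : ℝ) ≤ (d.totient * (x / d + 1) : ℕ) := by exact_mod_cast h'
    _ = d.totient * ((x / d : ℕ) : ℝ) + d.totient := by push_cast; ring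
    _ ≤ d.totient * (x / d : ℝ) + 2 := by gcongr; exact Nat.cast_div_le; exact_mod_cast hd2
    _ = _ := by ring

theorem mul_pow_le_of_le {p c : ℝ} {k₀ : ℕ} (hp : 1 ≤ p)
    (h₀ : ((p - 1) * (k₀ + 1)) ^ 4 ≤ c * p ^ (k₀ + 4))
    (hs : ((k₀ : ℝ) + 2) ^ 4 ≤ p * (k₀ + 1) ^ 4) {k : ℕ} (hk : k₀ ≤ k) :
    ((p - 1) * (k + 1)) ^ 4 ≤ c * p ^ (k + 4) := by
  induction k, hk using Nat.le_induction with
  | base => exact h₀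
  | succ k hk ih =>
    have hk' : (k₀ : ℝ) ≤ k := by exact_mod_cast hk
    have h1 : ((k : ℝ) + 2) ^ 4 ≤ p * (k + 1) ^ 4 := by
      have h2 : ((k : ℝ) + 2) * (k₀ + 1) ≤ (k₀ + 2) * (k + 1) := by nlinarith
      have h3 : (((k : ℝ) + 2) * (k₀ + 1)) ^ 4 ≤ ((k₀ + 2) * (k + 1)) ^ 4 := by gcongr
      have h4 : (0 : ℝ) < ((k₀ : ℝ) + 1) ^ 4 := by positivity
      rw [mul_pow, mul_pow] at h3
      have h5 : ((k₀ : ℝ) + 2) ^ 4 * (k + 1) ^ 4 ≤ p * (k₀ + 1) ^ 4 * (k + 1) ^ 4 := by gcongr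
      nlinarith
    push_cast
    calc ((p - 1) * ((k : ℝ) + 1 + 1)) ^ 4 = (p - 1) ^ 4 * (k + 2) ^ 4 := by ring
      _ ≤ (p - 1) ^ 4 * (p * (k + 1) ^ 4) := by gcongr
      _ = p * ((p - 1) * (k + 1)) ^ 4 := by ring
      _ ≤ p * (c * p ^ (k + 4)) := by gcongr
      _ = _ := by ring

/-- The maximum of `(φ(p ^ k) τ(p ^ k)) ^ 4 / p ^ (5 k)` over `k ≥ 1`, for `p = 2, 3, 5, 7`. -/
noncomputable def totientDivisorsConst (p : ℕ) : ℝ :=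
  if p = 2 then 1296 / 512 else if p = 3 then 4096 / 2187 else
    if p = 5 then 20736 / 15625 else if p = 7 then 20736 / 16807 else 1

theorem mul_pow_le_totientDivisorsConst {p k : ℕ} (hp : p.Prime) (hk : 1 ≤ k) :
    (((p : ℝ) - 1) * (k + 1)) ^ 4 ≤ totientDivisorsConst p * (p : ℝ) ^ (k + 4) := by
  have h1 : (1 : ℝ) ≤ p := by exact_mod_cast hp.one_lt.le
  by_cases h2 : p = 2
  · subst h2
    rcases lt_or_ge k 5 with h | h
    · unfold totientDivisorsConst; interval_cases k <;> norm_num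
    · exact mul_pow_le_of_le (k₀ := 5) h1 (by norm_num [totientDivisorsConst]) (by norm_num) h
  by_cases h3 : p = 3
  · subst h3
    rcases lt_or_ge k 3 with h | h
    · unfold totientDivisorsConst; interval_cases k <;> norm_num
    · exact mul_pow_le_of_le (k₀ := 3) h1 (by norm_num [totientDivisorsConst]) (by norm_num) h
  by_cases h5 : p = 5
  · subst h5
    rcases lt_or_ge k 2 with h | h
    · unfold totientDivisorsConst; interval_cases k <;> norm_num
    · exact mul_pow_le_of_le (k₀ := 2) h1 (by norm_num [totientDivisorsConst]) (by norm_num) h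
  by_cases h7 : p = 7
  · subst h7
    exact mul_pow_le_of_le (k₀ := 1) h1 (by norm_num [totientDivisorsConst]) (by norm_num) hk
  have h11 : 11 ≤ p := by
    by_contra! h
    interval_cases p <;> revert hp <;> norm_num <;> omega
  have h11' : (11 : ℝ) ≤ p := by exact_mod_cast h11
  refine mul_pow_le_of_le (k₀ := 1) h1 ?_ (by norm_num; linarith) hk
  simp only [totientDivisorsConst, h2, h3, h5, h7, if_false]
  rcases lt_or_ge p 16 with h | h
  · interval_cases p <;> norm_num
  · have h16 : (16 : ℝ) ≤ p := by exact_mod_cast h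
    have : ((p : ℝ) - 1) ^ 4 ≤ p ^ 4 := by gcongr; linarith
    push_cast
    calc (((p : ℝ) - 1) * (1 + 1)) ^ (4 : ℕ) = (16 : ℝ) * (p - 1) ^ 4 := by ring
      _ ≤ (p : ℝ) * (p : ℝ) ^ 4 := by gcongr
      _ = _ := by ring

theorem totient_mul_card_divisors_pow_le {n : ℕ} (hn : n ≠ 0) :
    ((n.totient : ℝ) * #n.divisors) ^ 4 ≤ (∏ p ∈ n.primeFactors, totientDivisorsConst p) * n ^ 5 := by
  induction n using Nat.recOnPosPrimePosCoprime with
  | zero => exact absurd rfl hn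
  | one => simp
  | prime_pow p k hp hk =>
    rw [Nat.primeFactors_prime_pow hk.ne' hp, prod_singleton, Nat.totient_prime_pow hp hk,
      Nat.divisors_prime_pow hp, card_map, card_range]
    have h := mul_pow_le_totientDivisorsConst hp hk
    have hp0 : (0 : ℝ) < p := by exact_mod_cast hp.pos
    obtain ⟨j, rfl⟩ : ∃ j, k = j + 1 := ⟨k - 1, by omega⟩
    push_cast [Nat.cast_sub hp.one_lt.le] at h ⊢
    calc ((p : ℝ) ^ j * (p - 1) * (j + 1 + 1)) ^ 4 = p ^ (4 * j) * ((p - 1) * (j + 1 + 1)) ^ 4 := by ring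
      _ ≤ p ^ (4 * j) * (totientDivisorsConst p * p ^ (j + 1 + 4)) := by gcongr
      _ = _ := by ring
  | coprime a b ha hb hab iha ihb =>
    have h1 := iha (by omega)
    have h2 := ihb (by omega)
    rw [Nat.totient_mul hab, hab.primeFactors_mul, prod_union hab.disjoint_primeFactors,
      hab.card_divisors_mul]
    push_cast
    calc _ = ((a.totient : ℝ) * #a.divisors) ^ 4 * ((b.totient : ℝ) * #b.divisors) ^ 4 := by ring
      _ ≤ _ := mul_le_mul h1 h2 (by positivity) ((by positivity : (0 : ℝ) ≤ _).trans h1)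
      _ = _ := by ring

theorem prod_totientDivisorsConst_le (n : ℕ) : ∏ p ∈ n.primeFactors, totientDivisorsConst p ≤
    (if 2 ∣ n then 1296 / 512 else 1) * (if 3 ∣ n then 4096 / 2187 else 1) * (1.6374 : ℝ) := by
  rcases eq_or_ne n 0 with rfl | hn
  · simp; norm_num
  have h : ∏ p ∈ n.primeFactors, totientDivisorsConst p =
      ∏ p ∈ {2, 3, 5, 7}, if p ∈ n.primeFactors then totientDivisorsConst p else 1 := by
    rw [prod_ite_mem]
    symm
    refine prod_subset inter_subset_right fun p hp hp' => ?_
    have : p ∉ ({2, 3, 5, 7} : Finset ℕ) := fun h => hp' (mem_inter.2 ⟨h, hp⟩)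
    simp only [mem_insert, mem_singleton, not_or] at this
    simp [totientDivisorsConst, this]
  rw [h]
  have h2 : 2 ∈ n.primeFactors ↔ 2 ∣ n := by simp [Nat.prime_two, hn]
  have h3 : 3 ∈ n.primeFactors ↔ 3 ∣ n := by simp [Nat.prime_three, hn]
  rw [prod_insert (by simp), prod_insert (by simp), prod_pair (by simp)]
  simp only [h2, h3]
  have e2 : totientDivisorsConst 2 = 1296 / 512 := by norm_num [totientDivisorsConst]
  have e3 : totientDivisorsConst 3 = 4096 / 2187 := by norm_num [totientDivisorsConst]
  have e5 : (if 5 ∈ n.primeFactors then totientDivisorsConst 5 else 1) ≤ 20736 / 15625 := by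
    split_ifs <;> norm_num [totientDivisorsConst]
  have e7 : (if 7 ∈ n.primeFactors then totientDivisorsConst 7 else 1) ≤ 20736 / 16807 := by
    split_ifs <;> norm_num [totientDivisorsConst]
  have e7' : 0 ≤ (if 7 ∈ n.primeFactors then totientDivisorsConst 7 else 1) := by
    split_ifs <;> norm_num [totientDivisorsConst]
  have e57 := mul_le_mul e5 e7 e7' (by norm_num)
  rw [e2, e3, ← mul_assoc]
  refine mul_le_mul_of_nonneg_left (e57.trans (by norm_num)) ?_
  split_ifs <;> norm_num

/-- An upper bound for the sum over block types. -/
theorem sum_block_le {n : ℕ} (hn : 1 < n) {u c : ℝ} (hu : 0 ≤ u) (hun : u ^ 4 = n) (hc : 0 ≤ c)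
    (h : (if 2 ∣ n then 1296 / 512 else 1) * (if 3 ∣ n then 4096 / 2187 else 1) * (1.6374 : ℝ) ≤ c ^ 4) :
    ∑ k ∈ nontrivialDivisors n, (k.totient * (n / k).totient : ℝ) ≤ c * n * u := by
  have h1 : ∑ k ∈ nontrivialDivisors n, (k.totient * (n / k).totient : ℝ) ≤
      n.totient * #n.divisors := by
    calc _ ≤ ∑ k ∈ n.divisors, (k.totient * (n / k).totient : ℝ) := by
          refine sum_le_sum_of_subset_of_nonneg (fun k hk => ?_) fun _ _ _ => by positivity
          rw [mem_nontrivialDivisors (by omega)] at hk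
          exact Nat.mem_divisors.2 ⟨hk.2.2, by omega⟩
      _ ≤ ∑ k ∈ n.divisors, (n.totient : ℝ) := by
          refine sum_le_sum fun k hk => ?_
          have := Nat.totient_super_multiplicative k (n / k)
          rw [Nat.mul_div_cancel' (Nat.dvd_of_mem_divisors hk)] at this
          exact_mod_cast this
      _ = _ := by rw [sum_const, nsmul_eq_mul, mul_comm]
  refine h1.trans (le_of_pow_le_pow_left₀ (n := 4) (by norm_num) (by positivity) ?_)
  calc _ ≤ _ := totient_mul_card_divisors_pow_le (by omega)
    _ ≤ c ^ 4 * n ^ 5 := by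
      gcongr
      exact (prod_totientDivisorsConst_le n).trans h
    _ = c ^ 4 * n ^ 4 * n := by ring
    _ = c ^ 4 * n ^ 4 * u ^ 4 := by rw [hun]
    _ = _ := by ring

theorem sum_small_le {n : ℕ} {S : ℝ} (hS : ∑ p ∈ coprimePrimes n (n / 2), 1 / (p : ℝ) ≤ S) :
    ∑ f ∈ coprimeKeys n (n / 2), ((16 / f : ℕ) + 1) * (n / f : ℝ) ≤
      n * (smallKeySum n 1 + S + (1.0538 + 2 * smallKeySum n 1)) := by
  have h1 := sum_coprimeKeys_inv_pow_le n (n / 2) 1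
  have h2 := sum_coprimeKeys_le (w := fun f => ((16 / f : ℕ) : ℝ) * (1 / (f : ℝ)))
    (fun _ => by positivity) n (n / 2)
  have h3 : ∑ p ∈ coprimePrimes n (n / 2), ((16 / p : ℕ) : ℝ) * (1 / (p : ℝ)) ≤ 1.0538 := by
    have : ∑ p ∈ {5, 7, 11, 13}, ((16 / p : ℕ) : ℝ) * (1 / (p : ℝ)) ≤ 1.0538 := by
      norm_num [sum_insert]
    refine le_trans ?_ this
    refine (sum_filter_of_ne (p := fun p => p ≤ 16) fun p hp h0 => ?_).ge.trans
      (sum_le_sum_of_subset_of_nonneg (fun p hp => ?_) fun _ _ _ => by positivity)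
    · by_contra h
      exact h0 (by rw [Nat.div_eq_of_lt (by omega)]; simp)
    · simp only [coprimePrimes, mem_filter, mem_Icc] at hp
      obtain ⟨⟨⟨h5, -⟩, hp, -⟩, h16⟩ := hp
      interval_cases p <;> revert hp <;> norm_num
  have h4 : ∑ f ∈ {6, 8, 9}, (if f.Coprime n then ((16 / f : ℕ) : ℝ) * (1 / (f : ℝ)) else 0) ≤
      2 * smallKeySum n 1 := by
    unfold smallKeySum coprimeInv
    simp only [mem_insert, mem_singleton, sum_insert, sum_singleton, not_false_eq_true,
      show ¬ ((6 : ℕ) = 8 ∨ (6 : ℕ) = 9) by norm_num, show ¬ ((8 : ℕ) = 9) by norm_num]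
    split_ifs <;> norm_num
  calc _ = n * (∑ f ∈ coprimeKeys n (n / 2), 1 / (f : ℝ) +
        ∑ f ∈ coprimeKeys n (n / 2), ((16 / f : ℕ) : ℝ) * (1 / (f : ℝ))) := by
        rw [← sum_add_distrib, mul_sum]
        exact sum_congr rfl fun f _ => by ring
    _ ≤ _ := by
        simp only [pow_one] at h1
        gcongr <;> linarith

theorem sum_mixed_le {n : ℕ} (hn : 0 < n) {S : ℝ}
    (hS : ∑ p ∈ coprimePrimes n (n / 5), 1 / (p : ℝ) ≤ S) :
    ∑ p ∈ coprimePrimes n (n / 5), ((n / (6 * p : ℝ)) ^ 2 / 2 + 3 * (n / (6 * p : ℝ)) / 2 + 1) ≤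
      (n : ℝ) ^ 2 / 72 * (0.0917 - primeFactorsSum n) + 0.45 * n * S := by
  have h1 := sum_coprimePrimes_inv_sq_le hn (n / 5)
  calc _ ≤ ∑ p ∈ coprimePrimes n (n / 5), ((n : ℝ) ^ 2 / 72 * (1 / (p : ℝ) ^ 2) +
        0.45 * n * (1 / (p : ℝ))) := by
        refine sum_le_sum fun p hp => ?_
        simp only [coprimePrimes, mem_filter, mem_Icc] at hp
        have h5 : 5 * p ≤ n := by omega
        have hp0 : (0 : ℝ) < p := by exact_mod_cast (by omega : 0 < p)
        have : (1 : ℝ) ≤ n / p * (1 / 5) := by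
          rw [← div_eq_mul_one_div, div_div, one_le_div (by positivity)]
          exact_mod_cast (by omega : p * 5 ≤ n)
        have e : (n : ℝ) / (6 * p) = n / p / 6 := by field_simp
        have e2 : (n : ℝ) ^ 2 / 72 * (1 / (p : ℝ) ^ 2) = (n / p) ^ 2 / 72 := by ring
        have e3 : 0.45 * n * (1 / (p : ℝ)) = 0.45 * (n / p) := by ring
        rw [e, e2, e3]
        linarith
    _ = (n : ℝ) ^ 2 / 72 * ∑ p ∈ coprimePrimes n (n / 5), 1 / (p : ℝ) ^ 2 +
        0.45 * n * ∑ p ∈ coprimePrimes n (n / 5), 1 / (p : ℝ) := by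
        rw [sum_add_distrib, mul_sum, mul_sum]
    _ ≤ _ := by gcongr

/-- An upper bound for the sum of `1 / g` over the integers `1 ≤ g ≤ y - 4` coprime to `d`, for
`d = 1, 2, 3, 6`. -/
noncomputable def coprimeLog (d : ℕ) (y : ℝ) : ℝ :=
  if d = 1 then 1 + Real.log (y / 1.5) else if d = 2 then 1 + 1 / 2 * Real.log (y / 2) else
    if d = 3 then 3 / 2 + 2 / 3 * Real.log (y / 3) else 47 / 35 + 1 / 3 * Real.log (y / 9)

theorem sum_inv_coprime_le {d x : ℕ} (hd : d = 1 ∨ d = 2 ∨ d = 3 ∨ d = 6) {y : ℝ} (hy : 9 ≤ y)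
    (hx : x + 4 ≤ y) : ∑ g ∈ Icc 1 x with d.Coprime g, 1 / (g : ℝ) ≤ coprimeLog d y := by
  rcases hd with rfl | rfl | rfl | rfl
  · rw [coprimeLog, if_pos rfl]
    exact (sum_le_sum_of_subset_of_nonneg (filter_subset _ _) fun _ _ _ => by positivity).trans
      (sum_inv_le (by linarith) (by linarith))
  · rw [coprimeLog, if_neg (by norm_num), if_pos rfl]
    exact sum_inv_coprime_two_le (by linarith) (by linarith)
  · rw [coprimeLog, if_neg (by norm_num), if_neg (by norm_num), if_pos rfl]
    exact sum_inv_coprime_three_le (by linarith)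
  · rw [coprimeLog, if_neg (by norm_num), if_neg (by norm_num), if_neg (by norm_num)]
    exact sum_inv_coprime_six_le (by linarith) (by linarith)

theorem sum_split_le {n M : ℕ} {N : ℝ} (hM : 3 * M + 48 ≤ n) (hn : 108 ≤ n) (hN : (n : ℝ) - 2 * M ≤ N)
    (d : ℕ → ℕ) (hd : ∀ e, d e = 1 ∨ d e = 2 ∨ d e = 3 ∨ d e = 6)
    (hdn : ∀ e g : ℕ, e ∈ Icc 1 4 → e.Coprime n → g.Coprime n → e.Coprime g → (d e).Coprime g) :
    ∑ e ∈ Icc 1 4 with e.Coprime n, ∑ g ∈ Icc 1 (M / e) with g.Coprime n ∧ e.Coprime g,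
        ((n - 2 * M) / (e * g : ℝ) + 1) ≤
      ∑ e ∈ Icc 1 4 with e.Coprime n, (N / e * coprimeLog (d e) (n / (3 * e)) +
        ((d e).totient / d e * (n / (3 * e)) + 2)) := by
  refine sum_le_sum fun e he => ?_
  obtain ⟨he, hen⟩ := mem_filter.1 he
  have he' := mem_Icc.1 he
  have he0 : (1 : ℝ) ≤ e := by exact_mod_cast he'.1
  have he4 : (e : ℝ) ≤ 4 := by exact_mod_cast he'.2
  have hM' : 3 * (M : ℝ) + 48 ≤ n := by exact_mod_cast hM
  have hn' : 108 ≤ (n : ℝ) := by exact_mod_cast hn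
  have hN0 : (0 : ℝ) ≤ n - 2 * M := by linarith [M.cast_nonneg (α := ℝ)]
  have hMe : ((M / e : ℕ) : ℝ) ≤ M / e := Nat.cast_div_le
  have hMe' : (M : ℝ) / e + 4 ≤ n / (3 * e) := by
    rw [div_add' _ _ _ (by linarith), div_le_div_iff₀ (by linarith) (by linarith)]
    nlinarith
  have h1 := sum_inv_coprime_le (x := M / e) (hd e) (y := n / (3 * e)) (by
    rw [le_div_iff₀ (by positivity)]; linarith) (by linarith)
  have h2 := card_Icc_coprime_le (d := d e) (by rcases hd e with h | h | h | h <;> rw [h] <;> norm_num)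
    (by rcases hd e with h | h | h | h <;> rw [h] <;> decide) (M / e)
  calc _ ≤ ∑ g ∈ Icc 1 (M / e) with (d e).Coprime g, ((n - 2 * M) / (e * g : ℝ) + 1) := by
        refine sum_le_sum_of_subset_of_nonneg (fun g hg => ?_) fun _ _ _ => by positivity
        obtain ⟨hg, h⟩ := mem_filter.1 hg
        exact mem_filter.2 ⟨hg, hdn e g he hen h.1 h.2⟩
    _ = (n - 2 * M) / e * ∑ g ∈ Icc 1 (M / e) with (d e).Coprime g, 1 / (g : ℝ) +
        #{g ∈ Icc 1 (M / e) | (d e).Coprime g} := by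
        rw [sum_add_distrib, sum_const, nsmul_one, mul_sum]
        congr 1
        refine sum_congr rfl fun g _ => ?_
        rw [div_mul_div_comm, mul_one]
    _ ≤ _ := by
        refine add_le_add ?_ (h2.trans ?_)
        · have h0 : 0 ≤ ∑ g ∈ Icc 1 (M / e) with (d e).Coprime g, 1 / (g : ℝ) :=
            sum_nonneg fun _ _ => by positivity
          exact mul_le_mul (by gcongr) h1 h0 (by have := hN0.trans hN; positivity)
        · gcongr
          linarith

theorem exists_central_bound {n : ℕ} {u : ℝ} (hu : 5.69 ≤ u) (hun : u ^ 4 = n) :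
    ∃ M : ℕ, 4 ≤ M ∧ 3 * M + 48 ≤ n ∧ 3 * n ^ 2 ≤ M * (n - 3 * M) ^ 2 ∧
      (n : ℝ) - 3 * M ≤ 3 * u ^ 2 + 8.5 := by
  have hu2 : 32 ≤ u ^ 2 := by nlinarith
  have h4 : (n : ℝ) = (u ^ 2) ^ 2 := by rw [← hun]; ring
  obtain ⟨v, hv⟩ : ∃ v, v = u ^ 2 := ⟨_, rfl⟩
  rw [← hv] at h4 hu2 ⊢
  have h0 : 0 ≤ ((n : ℝ) - 3 * v - 5.5) / 3 := by rw [h4]; nlinarith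
  refine ⟨⌊((n : ℝ) - 3 * v - 5.5) / 3⌋₊, ?_⟩
  have h1 := Nat.floor_le h0
  have h2 := Nat.lt_floor_add_one (((n : ℝ) - 3 * v - 5.5) / 3)
  generalize ⌊((n : ℝ) - 3 * v - 5.5) / 3⌋₊ = M at h1 h2
  have h3 : 3 * M + 48 ≤ n := by
    have : (3 * M + 48 : ℝ) ≤ n := by linarith
    exact_mod_cast this
  refine ⟨?_, h3, ?_, by linarith⟩
  · have : (4 : ℝ) ≤ M := by nlinarith
    exact_mod_cast this
  · obtain ⟨D, hD⟩ : ∃ D, n = 3 * M + D := ⟨n - 3 * M, by omega⟩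
    have hD' : n - 3 * M = D := by omega
    rw [hD']
    have hDr : (n : ℝ) = 3 * M + D := by rw [hD]; push_cast; ring
    have hD1 : 3 * v + 5.5 ≤ D := by linarith
    have hD2 : (D : ℝ) ≤ 3 * v + 8.5 := by linarith
    have hD3 : (3 * v + 5.5) ^ 2 ≤ (D : ℝ) ^ 2 := by gcongr
    have hM : (v ^ 2 - 3 * v - 8.5) / 3 ≤ (M : ℝ) := by linarith
    have hM0 : 0 ≤ (v ^ 2 - 3 * v - 8.5) / 3 := by nlinarith
    have : 3 * (n : ℝ) ^ 2 ≤ M * D ^ 2 := by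
      refine le_trans ?_ (mul_le_mul hM hD3 (by positivity) (by positivity))
      rw [h4]
      obtain ⟨w, rfl⟩ : ∃ w, v = 32 + w := ⟨v - 32, by ring⟩
      have hw : 0 ≤ w := by linarith
      rw [← sub_nonneg]
      ring_nf
      positivity
    exact_mod_cast this

theorem IsHittingSet.averaging {n s : ℕ} {X : Finset ℕ} (hX : IsHittingSet n X) (hs : #X ≤ 2 * s)
    (h4 : 4 * s ≤ n - 2) {u S S' c : ℝ} (hu : 5.69 ≤ u) (hun : u ^ 4 = n) (hc0 : 0 ≤ c)
    (hc : (if 2 ∣ n then 1296 / 512 else 1) * (if 3 ∣ n then 4096 / 2187 else 1) * (1.6374 : ℝ) ≤ c ^ 4)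
    (hS : ∑ p ∈ coprimePrimes n (n / 5), 1 / (p : ℝ) ≤ S)
    (hS' : ∑ p ∈ coprimePrimes n (n / 2), 1 / (p : ℝ) ≤ S')
    (d : ℕ → ℕ) (hd : ∀ e, d e = 1 ∨ d e = 2 ∨ d e = 3 ∨ d e = 6)
    (hdn : ∀ e g : ℕ, e ∈ Icc 1 4 → e.Coprime n → g.Coprime n → e.Coprime g → (d e).Coprime g) :
    (((n.gcd 6).totient / (n.gcd 6 : ℕ) * n - if n.gcd 6 = 1 then 1 else 0) - 2 * s : ℝ) *
      (n - 2 - 4 * s) ≤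
    2 * ((n.gcd 6).totient / (n.gcd 6 : ℕ) * n ^ 2 / 2 * primeFactorsSum n +
      3 * (c * n * u + ((n : ℝ) ^ 2 / 2 * ((smallKeySum n 2 + 0.0917 - primeFactorsSum n) ^ 2 -
        (coprimeInv n 2 6 ^ 2 + coprimeInv n 2 8 ^ 2 + coprimeInv n 2 9 ^ 2 +
        2 * coprimeInv n 2 6 * (coprimeInv n 2 8 + coprimeInv n 2 9) +
        (1 / 625 + 1 / 2401 - primeFactorsSum n / 25))) + n / 2 * (smallKeySum n 1 + S) ^ 2) +
        n * (smallKeySum n 1 + S' + (1.0538 + 2 * smallKeySum n 1)) + n + 256) +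
      (3 * u ^ 2 + 8.5) ^ 2 / 2 +
      6 * ((if Nat.Coprime 6 n then (n : ℝ) ^ 2 / 72 * (0.0917 - primeFactorsSum n) + 0.45 * n * S
          else 0) +
        ∑ e ∈ Icc 1 4 with e.Coprime n, ((n / 3 + 2 * u ^ 2 + 17 / 3) / e *
          coprimeLog (d e) (n / (3 * e)) + ((d e).totient / d e * (n / (3 * e)) + 2)))) := by
  obtain ⟨M, hM4, hM3, hMn, hD⟩ := exists_central_bound hu hun
  have hn : 1048 ≤ n := by
    have : (1048 : ℝ) ≤ n := by
      rw [← hun]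
      calc (1048 : ℝ) ≤ 5.69 ^ 4 := by norm_num
        _ ≤ _ := by gcongr
    exact_mod_cast this
  have hcd : n.gcd 6 ∣ n := Nat.gcd_dvd_left n 6
  have hub := sum_badCount_le_of_bounds (A := coprimesBelow n (n.gcd 6)) (by omega) hM4 (by omega) hMn
    (fun a ha => by have := (mem_coprimesBelow.1 ha).1; omega)
    (TripleBound.of_not_coprimeTriple (by omega)) TripleBound.of_block TripleBound.of_two
    TripleBound.of_small TripleBound.of_fst_eq_one TripleBound.of_le_sixteen
    (TripleBound.of_forall_lt (by omega)) TripleBound.of_mixed (TripleBound.of_split (by omega))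
  have hlb := hX.sum_badCount_ge hs h4 (coprimesBelow n (n.gcd 6)) (fun a ha => by
    have h1 := (mem_coprimesBelow.1 ha).1
    exact ⟨by omega, by omega, sub_mem_coprimesBelow hcd ha⟩)
  have hcard := card_coprimesBelow hcd (by omega : 0 < n)
  have hlb' : ((#(coprimesBelow n (n.gcd 6)) : ℝ) - 2 * s) * (n - 2 - 4 * s) ≤
      2 * ∑ a ∈ coprimesBelow n (n.gcd 6), (badCount n a : ℝ) := by
    have h1 : (#(coprimesBelow n (n.gcd 6)) : ℝ) - 2 * s ≤ (#(coprimesBelow n (n.gcd 6)) - 2 * s : ℕ) := by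
      rw [sub_le_iff_le_add]
      exact_mod_cast (by omega : _ ≤ #(coprimesBelow n (n.gcd 6)) - 2 * s + 2 * s)
    have h2 : (n : ℝ) - 2 - 4 * s = (n - 2 - 4 * s : ℕ) := by
      rw [Nat.cast_sub h4, Nat.cast_sub (by omega)]; push_cast; ring
    rw [h2]
    calc _ ≤ ((#(coprimesBelow n (n.gcd 6)) - 2 * s : ℕ) : ℝ) * (n - 2 - 4 * s : ℕ) := by gcongr
      _ ≤ _ := by exact_mod_cast hlb
  rw [hcard] at hlb'
  refine hlb'.trans (mul_le_mul_of_nonneg_left (hub.trans ?_) (by norm_num))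
  have e1 := sum_block_le (by omega) (by linarith) hun hc0 hc
  have e2 := sum_two_le (by omega) hS
  have e3 := sum_small_le hS'
  have e4 : (if Nat.Coprime 6 n then ∑ p ∈ coprimePrimes n (n / 5),
      ((n / (6 * p : ℝ)) ^ 2 / 2 + 3 * (n / (6 * p : ℝ)) / 2 + 1) else 0) ≤
      (if Nat.Coprime 6 n then (n : ℝ) ^ 2 / 72 * (0.0917 - primeFactorsSum n) + 0.45 * n * S
          else 0) := by
    split_ifs
    · exact sum_mixed_le (by omega) hS
    · rfl
  have e5 := sum_split_le (N := n / 3 + 2 * u ^ 2 + 17 / 3) hM3 (by omega) (by linarith) d hd hdn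
  have e6 : ((n : ℝ) - 3 * M) ^ 2 / 2 ≤ (3 * u ^ 2 + 8.5) ^ 2 / 2 := by
    have : (3 * M + 48 : ℝ) ≤ n := by exact_mod_cast hM3
    have : (0 : ℝ) ≤ n - 3 * M := by linarith
    gcongr
  unfold primeFactorsSum at *
  gcongr

theorem prod_one_sub_mul_one_add_sum_le {ι : Type*} (s : Finset ι) {x : ι → ℝ}
    (h0 : ∀ i ∈ s, 0 ≤ x i) (h1 : ∀ i ∈ s, x i ≤ 1) :
    0 ≤ ∏ i ∈ s, (1 - x i) ∧ (∏ i ∈ s, (1 - x i)) * (1 + ∑ i ∈ s, x i) ≤ 1 := by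
  classical
  induction s using Finset.induction_on with
  | empty => simp
  | insert a s ha ih =>
    obtain ⟨h, h'⟩ := ih (fun i hi => h0 i (mem_insert_of_mem hi))
      fun i hi => h1 i (mem_insert_of_mem hi)
    rw [prod_insert ha, sum_insert ha]
    have ha0 := h0 a (mem_insert_self _ _)
    have ha1 := h1 a (mem_insert_self _ _)
    have hs : 0 ≤ ∑ i ∈ s, x i := sum_nonneg fun i hi => h0 i (mem_insert_of_mem hi)
    refine ⟨mul_nonneg (by linarith) h, ?_⟩
    have hp : (∏ i ∈ s, (1 - x i)) * ((1 - x a) * (1 + (x a + ∑ i ∈ s, x i))) ≤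
        (∏ i ∈ s, (1 - x i)) * (1 + ∑ i ∈ s, x i) :=
      mul_le_mul_of_nonneg_left (by nlinarith [mul_nonneg ha0 hs]) h
    linarith

theorem zeta2_mul_le {n : ℕ} (hn : 0 < n) :
    12 * zeta2 n * (1 + primeFactorsSum n) ≤
      (if 2 ∣ n then 3 / 4 else 1) * (if 3 ∣ n then 8 / 9 else 1) := by
  have hsplit := prod_filter_mul_prod_filter_not n.primeFactors (fun p => 5 ≤ p)
    (fun p : ℕ => (1 - 1 / (p : ℝ) ^ 2))
  have hsmall : {p ∈ n.primeFactors | ¬ 5 ≤ p} = {p ∈ ({2, 3} : Finset ℕ) | p ∣ n} := by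
    ext p
    simp only [mem_filter, Nat.mem_primeFactors, mem_insert, mem_singleton]
    constructor
    · rintro ⟨⟨hp, hd, -⟩, h⟩
      refine ⟨?_, hd⟩
      interval_cases p <;> first | omega | exact absurd hp (by decide)
    · rintro ⟨rfl | rfl, hd⟩
      · exact ⟨⟨Nat.prime_two, hd, hn.ne'⟩, by decide⟩
      · exact ⟨⟨Nat.prime_three, hd, hn.ne'⟩, by decide⟩
  have hB : ∏ p ∈ ({2, 3} : Finset ℕ) with p ∣ n, (1 - 1 / (p : ℝ) ^ 2) =
      (if 2 ∣ n then 3 / 4 else 1) * (if 3 ∣ n then 8 / 9 else 1) := by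
    rw [prod_filter, prod_insert (by decide), prod_singleton]
    congr 1 <;> split_ifs <;> norm_num
  obtain ⟨-, h⟩ := prod_one_sub_mul_one_add_sum_le {p ∈ n.primeFactors | 5 ≤ p}
    (x := fun p : ℕ => 1 / (p : ℝ) ^ 2) (fun _ _ => by positivity) fun p hp => by
      have : (5 : ℝ) ≤ p := by exact_mod_cast (mem_filter.1 hp).2
      rw [div_le_one (by positivity)]
      nlinarith
  rw [hsmall, hB] at hsplit
  unfold zeta2 primeFactorsSum
  rw [← hsplit]
  have hB0 : (0 : ℝ) ≤ (if 2 ∣ n then 3 / 4 else 1) * (if 3 ∣ n then 8 / 9 else 1) := by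
    split_ifs <;> norm_num
  nlinarith [mul_le_mul_of_nonneg_left h hB0]

theorem chord_le_sqrt {n : ℕ} (hn : 0 < n) {r ρ B : ℝ}
    (hB : (if 2 ∣ n then 3 / 4 else 1) * (if 3 ∣ n then 8 / 9 else 1) ≤ B)
    (h : ∀ q : ℝ, 0 ≤ q → q ≤ 0.0917 → 2 / 3 * B ≤ (1 + q) * (1 - (r + ρ * q) ^ 2)) :
    r + ρ * primeFactorsSum n ≤ √(1 - 8 * zeta2 n) := by
  have hq := primeFactorsSum_nonneg n
  refine Real.le_sqrt_of_sq_le ?_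
  have h1 := h _ hq (primeFactorsSum_le hn)
  have h2 := zeta2_mul_le hn
  have h3 : (1 + primeFactorsSum n) * (8 * zeta2 n) ≤
      (1 + primeFactorsSum n) * (1 - (r + ρ * primeFactorsSum n) ^ 2) := by linarith
  linarith [le_of_mul_le_mul_left h3 (by linarith)]

theorem log_mul_pow_four_le {a u v b : ℝ} (ha : 0 < a) (hu : 0 < u) (hv : 0 < v)
    (hb : Real.log (a * v ^ 4) ≤ b) : Real.log (a * u ^ 4) ≤ b + 4 * (u / v - 1) := by
  have h := Real.log_le_sub_one_of_pos (div_pos hu hv)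
  rw [Real.log_div hu.ne' hv.ne'] at h
  rw [Real.log_mul ha.ne' (by positivity), Real.log_pow] at *
  push_cast at *
  linarith

theorem log_le_of_pow_five_le {x : ℝ} (hx : 0 < x) {p : ℕ} (h : x ^ 5 ≤ 2 ^ p) :
    Real.log x ≤ p / 5 * 0.6931472 := by
  have h1 := Real.log_le_log (by positivity) h
  rw [Real.log_pow, Real.log_pow] at h1
  push_cast at h1
  have h2 := Real.log_two_lt_d9
  have h3 : (p : ℝ) * Real.log 2 ≤ p * 0.6931472 := by gcongr; linarith
  linarith

theorem sum_coprimePrimes_inv_le_linear {n L p : ℕ} {u v Y : ℝ} (hv : 0 < v) (hvu : v ≤ u)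
    (hY : 399 ≤ Y) (hL : L + 4 ≤ Y * (u / v) ^ 4) (h : (Y / 399) ^ 5 ≤ 2 ^ p) :
    ∑ p ∈ coprimePrimes n L, 1 / (p : ℝ) ≤
      1.22548 + 1 / 3 * (p / 5 * 0.6931472 + 4 * (u / v - 1)) := by
  have h1 : 1 ≤ u / v := (one_le_div hv).2 hvu
  have h2 : 399 ≤ Y * (u / v) ^ 4 := by
    have := one_le_pow₀ h1 (n := 4)
    nlinarith
  refine (sum_coprimePrimes_inv_le h2 hL).trans ?_
  have := log_mul_pow_four_le (a := Y / 399) (u := u / v) (v := 1) (by positivity) (by positivity)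
    one_pos (by simpa using log_le_of_pow_five_le (by positivity) h)
  rw [div_one] at this
  rw [mul_div_right_comm]
  gcongr

/-- The lower bound for the quantity averaged, when `2 * s ≤ N * (1 - R) - 2 * √N`. -/
theorem averaged_ge {N u s κ δ R r : ℝ} (hs : 2 * s ≤ N * (1 - R) - 2 * u ^ 2) (hN : 0 ≤ N)
    (hr : r ≤ R) (hδ : δ ≤ 2 * u ^ 2) (hu : 1 ≤ 2 * u ^ 2) (hκ : 1 - κ ≤ r) (hr' : 1 / 2 ≤ r) :
    N ^ 2 * ((κ - 1 + R) * (2 * R - 1)) + N * (κ - 1 + r) * (4 * u ^ 2 - 2) +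
      N * (2 * r - 1) * (2 * u ^ 2 - δ) + (2 * u ^ 2 - δ) * (4 * u ^ 2 - 2) ≤
      (κ * N - δ - 2 * s) * (N - 2 - 4 * s) := by
  have h1 : 0 ≤ N * (κ - 1 + R) + (2 * u ^ 2 - δ) := by
    have := mul_nonneg hN (by linarith : 0 ≤ κ - 1 + R)
    linarith
  have h2 : 0 ≤ N * (2 * R - 1) + (4 * u ^ 2 - 2) := by
    have := mul_nonneg hN (by linarith : 0 ≤ 2 * R - 1)
    linarith
  have h3 : (N * (κ - 1 + R) + (2 * u ^ 2 - δ)) * (N * (2 * R - 1) + (4 * u ^ 2 - 2)) ≤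
      (κ * N - δ - 2 * s) * (N - 2 - 4 * s) :=
    mul_le_mul (by linarith) (by linarith) h2 (by linarith)
  have h4 : N * (κ - 1 + r) * (4 * u ^ 2 - 2) ≤ N * (κ - 1 + R) * (4 * u ^ 2 - 2) := by
    gcongr
    linarith
  have h5 : N * (2 * r - 1) * (2 * u ^ 2 - δ) ≤ N * (2 * R - 1) * (2 * u ^ 2 - δ) := by gcongr
  linarith

theorem IsHittingSet.averaged_le_of_lt {n s : ℕ} {X : Finset ℕ} (hX : IsHittingSet n X)
    (hs : #X ≤ 2 * s) (hlt : (s : ℝ) < n / 2 * (1 - √(1 - 8 * zeta2 n)) - √n)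
    {v c r ρ Y Y' : ℝ} {p p' : ℕ} (hv : 5.69 ≤ v) (hvn : v ^ 4 ≤ n) (hc0 : 0 ≤ c)
    (hc : (if 2 ∣ n then 1296 / 512 else 1) * (if 3 ∣ n then 4096 / 2187 else 1) * (1.6374 : ℝ) ≤
      c ^ 4)
    (hr : ∀ q : ℝ, 0 ≤ q → q ≤ 0.0917 →
      2 / 3 * ((if 2 ∣ n then 3 / 4 else 1) * (if 3 ∣ n then 8 / 9 else 1)) ≤
        (1 + q) * (1 - (r + ρ * q) ^ 2))
    (hr' : 1 / 2 ≤ r) (hκ : 1 - (n.gcd 6).totient / (n.gcd 6 : ℕ) ≤ r) (hρ : 0 ≤ ρ)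
    (hY : 399 ≤ Y) (hYv : v ^ 4 / 5 + 4 ≤ Y) (hp : (Y / 399) ^ 5 ≤ 2 ^ p)
    (hY' : 399 ≤ Y') (hYv' : v ^ 4 / 2 + 4 ≤ Y') (hp' : (Y' / 399) ^ 5 ≤ 2 ^ p')
    (d : ℕ → ℕ) (hd : ∀ e, d e = 1 ∨ d e = 2 ∨ d e = 3 ∨ d e = 6)
    (hdn : ∀ e g, e ∈ Icc 1 4 → e.Coprime n → g.Coprime n → e.Coprime g → (d e).Coprime g) :
    ∃ u : ℝ, v ≤ u ∧ u ^ 4 = n ∧ ∀ S S' κ δ : ℝ,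
      S = 1.22548 + 1 / 3 * (p / 5 * 0.6931472 + 4 * (u / v - 1)) →
      S' = 1.22548 + 1 / 3 * (p' / 5 * 0.6931472 + 4 * (u / v - 1)) →
      κ = (n.gcd 6).totient / (n.gcd 6 : ℕ) → δ = (if n.gcd 6 = 1 then 1 else 0) →
      (n : ℝ) ^ 2 * ((κ - 1 + (r + ρ * primeFactorsSum n)) * (2 * (r + ρ * primeFactorsSum n) - 1)) +
        n * (κ - 1 + r) * (4 * u ^ 2 - 2) + n * (2 * r - 1) * (2 * u ^ 2 - δ) +
        (2 * u ^ 2 - δ) * (4 * u ^ 2 - 2) ≤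
      2 * (κ * n ^ 2 / 2 * primeFactorsSum n + 3 * (c * n * u +
        ((n : ℝ) ^ 2 / 2 * ((smallKeySum n 2 + 0.0917 - primeFactorsSum n) ^ 2 -
          (coprimeInv n 2 6 ^ 2 + coprimeInv n 2 8 ^ 2 + coprimeInv n 2 9 ^ 2 +
            2 * coprimeInv n 2 6 * (coprimeInv n 2 8 + coprimeInv n 2 9) +
            (1 / 625 + 1 / 2401 - primeFactorsSum n / 25))) +
          n / 2 * (smallKeySum n 1 + S) ^ 2) +
        n * (smallKeySum n 1 + S' + (1.0538 + 2 * smallKeySum n 1)) + n + 256) +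
        (3 * u ^ 2 + 8.5) ^ 2 / 2 +
        6 * ((if Nat.Coprime 6 n then (n : ℝ) ^ 2 / 72 * (0.0917 - primeFactorsSum n) +
          0.45 * n * S else 0) +
          ∑ e ∈ Icc 1 4 with e.Coprime n, ((n / 3 + 2 * u ^ 2 + 17 / 3) / e *
            coprimeLog (d e) (n / (3 * e)) + ((d e).totient / d e * (n / (3 * e)) + 2)))) := by
  have hn0 : (0 : ℝ) < n := lt_of_lt_of_le (by positivity) hvn
  set u : ℝ := √√n with hu_def
  have hu2 : u ^ 2 = √n := Real.sq_sqrt (Real.sqrt_nonneg _)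
  have hu4 : u ^ 4 = n := by
    rw [show u ^ 4 = (u ^ 2) ^ 2 by ring, hu2, Real.sq_sqrt hn0.le]
  have hvu : v ≤ u := le_of_pow_le_pow_left₀ four_ne_zero (Real.sqrt_nonneg _) (hu4 ▸ hvn)
  refine ⟨u, hvu, hu4, ?_⟩
  rintro S S' κ δ rfl rfl hκ' hδ
  have hR := chord_le_sqrt (by exact_mod_cast hn0) le_rfl hr
  have hq := primeFactorsSum_nonneg n
  set R := r + ρ * primeFactorsSum n with hR_def
  have hrR : r ≤ R := le_add_of_nonneg_right (by positivity)
  have hs' : 2 * (s : ℝ) ≤ n * (1 - R) - 2 * u ^ 2 := by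
    rw [hu2]
    nlinarith [mul_le_mul_of_nonneg_left hR hn0.le]
  have hu5 : 32 ≤ u ^ 2 := by nlinarith
  have h4 : 4 * s ≤ n - 2 := by
    have h : (4 * s + 2 : ℝ) ≤ n := by nlinarith [mul_le_mul_of_nonneg_left (hr'.trans hrR) hn0.le]
    have : 4 * s + 2 ≤ n := by exact_mod_cast h
    omega
  have hratio : (u / v) ^ 4 * v ^ 4 = n := by
    rw [← mul_pow, div_mul_cancel₀ _ (by linarith), hu4]
  have h1 : 1 ≤ (u / v) ^ 4 := one_le_pow₀ ((one_le_div (by linarith)).2 hvu)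
  have hL : ((n / 5 : ℕ) : ℝ) + 4 ≤ Y * (u / v) ^ 4 := by
    have : ((n / 5 : ℕ) : ℝ) ≤ n / 5 := Nat.cast_div_le
    nlinarith
  have hL' : ((n / 2 : ℕ) : ℝ) + 4 ≤ Y' * (u / v) ^ 4 := by
    have : ((n / 2 : ℕ) : ℝ) ≤ n / 2 := Nat.cast_div_le
    nlinarith
  have key := hX.averaging hs h4 (hv.trans hvu) hu4 hc0 hc
    (sum_coprimePrimes_inv_le_linear (by linarith) hvu hY hL hp)
    (sum_coprimePrimes_inv_le_linear (by linarith) hvu hY' hL' hp') d hd hdn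
  rw [← hκ', ← hδ] at key
  rw [← hκ'] at hκ
  have hδ1 : δ ≤ 1 := by rw [hδ]; split_ifs <;> norm_num
  exact (averaged_ge hs' hn0.le hrR (by linarith) (by linarith) hκ hr').trans key

theorem two_coprime_iff {n : ℕ} : Nat.Coprime 2 n ↔ ¬ 2 ∣ n :=
  Nat.prime_two.coprime_iff_not_dvd

theorem three_coprime_iff {n : ℕ} : Nat.Coprime 3 n ↔ ¬ 3 ∣ n :=
  Nat.prime_three.coprime_iff_not_dvd

theorem four_coprime_iff {n : ℕ} : Nat.Coprime 4 n ↔ ¬ 2 ∣ n := by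
  rw [← two_coprime_iff, show 4 = 2 ^ 2 from rfl, Nat.coprime_pow_left_iff two_pos]

theorem six_coprime_iff {n : ℕ} : Nat.Coprime 6 n ↔ ¬ 2 ∣ n ∧ ¬ 3 ∣ n := by
  rw [← two_coprime_iff, ← three_coprime_iff, ← Nat.coprime_mul_iff_left]

theorem eight_coprime_iff {n : ℕ} : Nat.Coprime 8 n ↔ ¬ 2 ∣ n := by
  rw [← two_coprime_iff, show 8 = 2 ^ 3 from rfl, Nat.coprime_pow_left_iff three_pos]

theorem nine_coprime_iff {n : ℕ} : Nat.Coprime 9 n ↔ ¬ 3 ∣ n := by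
  rw [← three_coprime_iff, show 9 = 3 ^ 2 from rfl, Nat.coprime_pow_left_iff two_pos]

theorem sum_Icc_one_four_coprime (n : ℕ) (f : ℕ → ℝ) :
    ∑ e ∈ Icc 1 4 with e.Coprime n, f e =
      f 1 + (if 2 ∣ n then 0 else f 2) + (if 3 ∣ n then 0 else f 3) +
        (if 2 ∣ n then 0 else f 4) := by
  rw [sum_filter, show Icc 1 4 = ({1, 2, 3, 4} : Finset ℕ) from rfl, sum_insert (by decide),
    sum_insert (by decide), sum_insert (by decide), sum_singleton]
  simp only [two_coprime_iff, three_coprime_iff, four_coprime_iff, Nat.coprime_one_left_eq_true,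
    if_true, ite_not]
  ring

theorem gcd_six_eq {n : ℕ} : n.gcd 6 = (if 2 ∣ n then 2 else 1) * (if 3 ∣ n then 3 else 1) := by
  rw [show 6 = 2 * 3 from rfl, Nat.Coprime.gcd_mul n (by decide : Nat.Coprime 2 3), Nat.gcd_comm n,
    Nat.gcd_comm n]
  congr 1 <;> split_ifs with h
  · exact Nat.gcd_eq_left h
  · exact two_coprime_iff.2 h
  · exact Nat.gcd_eq_left h
  · exact three_coprime_iff.2 h

theorem log_div_le_linear {u v w : ℝ} {p : ℕ} (hw : 0 < w) (hv : 0 < v) (hu : 0 < u)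
    (h : (v ^ 4 / w) ^ 5 ≤ 2 ^ p) :
    Real.log (u ^ 4 / w) ≤ p / 5 * 0.6931472 + 4 * (u / v - 1) := by
  rw [show u ^ 4 / w = 1 / w * u ^ 4 by ring]
  refine log_mul_pow_four_le (by positivity) hu hv ?_
  rw [show 1 / w * v ^ 4 = v ^ 4 / w by ring]
  exact log_le_of_pow_five_le (by positivity) h

theorem IsHittingSet.le_card_of_six_dvd {n s : ℕ} {X : Finset ℕ} (hX : IsHittingSet n X)
    (hs : #X ≤ 2 * s) (h2 : 2 ∣ n) (h3 : 3 ∣ n) (hn : 2850 ≤ n) :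
    n / 2 * (1 - √(1 - 8 * zeta2 n)) - √n ≤ s := by
  by_contra! hlt
  have h6 : n.gcd 6 = 6 := by simp [gcd_six_eq, h2, h3]
  have hnR : (2850 : ℝ) ≤ n := by exact_mod_cast hn
  obtain ⟨u, hvu, hu4, key⟩ := hX.averaged_le_of_lt hs hlt (v := 7.306) (c := 1.670)
    (r := 0.7453) (ρ := 0.2692) (Y := 574) (Y' := 1429) (p := 3) (p' := 10) (by norm_num)
    (le_trans (by norm_num) hnR) (by norm_num) (by rw [if_pos h2, if_pos h3]; norm_num)
    (fun q hq hq' => by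
      rw [if_pos h2, if_pos h3]; nlinarith [mul_nonneg hq (sub_nonneg.2 hq')])
    (by norm_num) (by rw [h6, show Nat.totient 6 = 2 from rfl]; norm_num) (by norm_num)
    (by norm_num) (by norm_num) (by norm_num) (by norm_num) (by norm_num) (by norm_num)
    (fun _ => 6) (by simp)
    (fun e g _ _ hg _ => six_coprime_iff.2 ⟨fun h => two_coprime_iff.1 (hg.coprime_dvd_left h) h2,
      fun h => three_coprime_iff.1 (hg.coprime_dvd_left h) h3⟩)
  have key := key _ _ (1 / 3) 0 rfl rfl (by rw [h6, show Nat.totient 6 = 2 from rfl]; norm_num)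
    (by simp [h6])
  have hq := primeFactorsSum_nonneg n
  have hq' : primeFactorsSum n ≤ 0.0917 := primeFactorsSum_le (by omega)
  rw [sum_Icc_one_four_coprime, ← hu4] at key
  generalize hqq : primeFactorsSum n = q at *
  norm_num only [smallKeySum, coprimeInv, six_coprime_iff, eight_coprime_iff, nine_coprime_iff, h2,
    h3, coprimeLog, show Nat.totient 6 = 2 from rfl, if_true, if_false, and_self, not_true, Nat.cast_ofNat,
    Nat.cast_one, div_div] at key
  have hG : 0.0194 ≤ (1 / 3 - 1 + (0.7453 + 0.2692 * q)) * (2 * (0.7453 + 0.2692 * q) - 1) -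
      1 / 3 * q - 3 * ((0.0917 - q) ^ 2 - (1 / 625 + 1 / 2401 - q / 25)) := by
    nlinarith [mul_nonneg hq (sub_nonneg.2 hq')]
  have hl := log_div_le_linear (v := 7.306) (u := u) (w := 27) (p := 34) (by norm_num)
    (by norm_num) (by linarith) (by norm_num)
  obtain ⟨t, ht, rfl⟩ : ∃ t, 0 ≤ t ∧ u = 7.306 + t := ⟨u - 7.306, by linarith, by ring⟩
  have hG := mul_le_mul_of_nonneg_left hG (by positivity : 0 ≤ ((7.306 + t) ^ 4) ^ 2)
  have hl := mul_le_mul_of_nonneg_left hl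
    (by positivity : 0 ≤ (7.306 + t) ^ 4 / 3 + 2 * (7.306 + t) ^ 2 + 17 / 3)
  generalize Real.log ((7.306 + t) ^ 4 / 27) = l at *
  norm_num only at hl hG
  linarith [pow_nonneg ht 2, pow_nonneg ht 3, pow_nonneg ht 4, pow_nonneg ht 5, pow_nonneg ht 6,
    pow_nonneg ht 7, pow_nonneg ht 8]

theorem IsHittingSet.le_card_of_two_dvd {n s : ℕ} {X : Finset ℕ} (hX : IsHittingSet n X)
    (hs : #X ≤ 2 * s) (h2 : 2 ∣ n) (h3 : ¬ 3 ∣ n) (hn : 1050 ≤ n) :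
    n / 2 * (1 - √(1 - 8 * zeta2 n)) - √n ≤ s := by
  by_contra! hlt
  have h6 : n.gcd 6 = 2 := by simp [gcd_six_eq, h2, h3]
  have hnR : (1050 : ℝ) ≤ n := by exact_mod_cast hn
  obtain ⟨u, hvu, hu4, key⟩ := hX.averaged_le_of_lt hs hlt (v := 5.692) (c := 1.427)
    (r := 0.7071) (ρ := 0.3174) (Y := 399) (Y' := 529) (p := 0) (p' := 3) (by norm_num)
    (le_trans (by norm_num) hnR) (by norm_num) (by rw [if_pos h2, if_neg h3]; norm_num)
    (fun q hq hq' => by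
      rw [if_pos h2, if_neg h3]; nlinarith [mul_nonneg hq (sub_nonneg.2 hq')])
    (by norm_num) (by rw [h6, show Nat.totient 2 = 1 from rfl]; norm_num) (by norm_num)
    (by norm_num) (by norm_num) (by norm_num) (by norm_num) (by norm_num) (by norm_num)
    (fun e => if e = 3 then 6 else 2) (fun e => by split_ifs <;> simp)
    (fun e g he hen hg heg => by
      have h2g : ¬ 2 ∣ g := fun h => two_coprime_iff.1 (hg.coprime_dvd_left h) h2
      split_ifs with he3
      · exact six_coprime_iff.2 ⟨h2g, three_coprime_iff.1 (he3 ▸ heg)⟩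
      · exact two_coprime_iff.2 h2g)
  have key := key _ _ (1 / 2) 0 rfl rfl (by rw [h6, show Nat.totient 2 = 1 from rfl]; norm_num)
    (by simp [h6])
  have hq := primeFactorsSum_nonneg n
  have hq' : primeFactorsSum n ≤ 0.0917 := primeFactorsSum_le (by omega)
  rw [sum_Icc_one_four_coprime, ← hu4] at key
  generalize hqq : primeFactorsSum n = q at *
  norm_num only [smallKeySum, coprimeInv, six_coprime_iff, eight_coprime_iff, nine_coprime_iff, h2,
    h3, coprimeLog, show Nat.totient 2 = 1 from rfl, show Nat.totient 3 = 2 from rfl,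
    show Nat.totient 6 = 2 from rfl, Nat.totient_one, if_true, if_false, and_self, and_true,
    and_false, not_true, not_false_eq_true, Nat.cast_ofNat, Nat.cast_one, div_div] at key
  have hG : 0.0598 ≤ (1 / 2 - 1 + (0.7071 + 0.3174 * q)) * (2 * (0.7071 + 0.3174 * q) - 1) -
      1 / 2 * q - 3 * ((1 / 81 + 0.0917 - q) ^ 2 - (1 / 81 ^ 2 + 1 / 625 + 1 / 2401 - q / 25)) := by
    nlinarith [mul_nonneg hq (sub_nonneg.2 hq')]
  have hl6 := log_div_le_linear (v := 5.692) (u := u) (w := 6) (p := 38) (by norm_num)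
    (by norm_num) (by linarith) (by norm_num)
  have hl81 := log_div_le_linear (v := 5.692) (u := u) (w := 81) (p := 19) (by norm_num)
    (by norm_num) (by linarith) (by norm_num)
  obtain ⟨t, ht, rfl⟩ : ∃ t, 0 ≤ t ∧ u = 5.692 + t := ⟨u - 5.692, by linarith, by ring⟩
  have hG := mul_le_mul_of_nonneg_left hG (by positivity : 0 ≤ ((5.692 + t) ^ 4) ^ 2)
  have hw : 0 ≤ (5.692 + t) ^ 4 / 3 + 2 * (5.692 + t) ^ 2 + 17 / 3 := by positivity
  have hl6 := mul_le_mul_of_nonneg_left hl6 hw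
  have hl81 := mul_le_mul_of_nonneg_left hl81 hw
  generalize Real.log ((5.692 + t) ^ 4 / 6) = l6 at *
  generalize Real.log ((5.692 + t) ^ 4 / 81) = l81 at *
  norm_num only at hG hl6 hl81
  linarith [pow_nonneg ht 2, pow_nonneg ht 3, pow_nonneg ht 4, pow_nonneg ht 5, pow_nonneg ht 6,
    pow_nonneg ht 7, pow_nonneg ht 8]

theorem IsHittingSet.le_card_of_three_dvd {n s : ℕ} {X : Finset ℕ} (hX : IsHittingSet n X)
    (hs : #X ≤ 2 * s) (h2 : ¬ 2 ∣ n) (h3 : 3 ∣ n) (hn : 1200 ≤ n) :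
    n / 2 * (1 - √(1 - 8 * zeta2 n)) - √n ≤ s := by
  by_contra! hlt
  have h6 : n.gcd 6 = 3 := by simp [gcd_six_eq, h2, h3]
  have hnR : (1200 : ℝ) ≤ n := by exact_mod_cast hn
  obtain ⟨u, hvu, hu4, key⟩ := hX.averaged_le_of_lt hs hlt (v := 5.885) (c := 1.324)
    (r := 0.6382) (ρ := 0.4138) (Y := 399) (Y' := 604) (p := 0) (p' := 3) (by norm_num)
    (le_trans (by norm_num) hnR) (by norm_num) (by rw [if_neg h2, if_pos h3]; norm_num)
    (fun q hq hq' => by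
      rw [if_neg h2, if_pos h3]; nlinarith [mul_nonneg hq (sub_nonneg.2 hq')])
    (by norm_num) (by rw [h6, show Nat.totient 3 = 2 from rfl]; norm_num) (by norm_num)
    (by norm_num) (by norm_num) (by norm_num) (by norm_num) (by norm_num) (by norm_num)
    (fun e => if e = 1 then 3 else 6) (fun e => by split_ifs <;> simp)
    (fun e g he hen hg heg => by
      have h3g : ¬ 3 ∣ g := fun h => three_coprime_iff.1 (hg.coprime_dvd_left h) h3
      have := mem_Icc.1 he
      split_ifs with he1
      · exact three_coprime_iff.2 h3g
      · refine six_coprime_iff.2 ⟨?_, h3g⟩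
        obtain rfl | rfl | rfl : e = 2 ∨ e = 3 ∨ e = 4 := by omega
        · exact two_coprime_iff.1 heg
        · exact absurd h3 (three_coprime_iff.1 hen)
        · exact four_coprime_iff.1 heg)
  have key := key _ _ (2 / 3) 0 rfl rfl (by rw [h6, show Nat.totient 3 = 2 from rfl]; norm_num)
    (by simp [h6])
  have hq := primeFactorsSum_nonneg n
  have hq' : primeFactorsSum n ≤ 0.0917 := primeFactorsSum_le (by omega)
  rw [sum_Icc_one_four_coprime, ← hu4] at key
  generalize hqq : primeFactorsSum n = q at *
  norm_num only [smallKeySum, coprimeInv, six_coprime_iff, eight_coprime_iff, nine_coprime_iff, h2,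
    h3, coprimeLog, show Nat.totient 2 = 1 from rfl, show Nat.totient 3 = 2 from rfl,
    show Nat.totient 6 = 2 from rfl, Nat.totient_one, if_true, if_false, and_self, and_true,
    and_false, not_true, not_false_eq_true, Nat.cast_ofNat, Nat.cast_one, div_div] at key
  have hG : 0.0546 ≤ (2 / 3 - 1 + (0.6382 + 0.4138 * q)) * (2 * (0.6382 + 0.4138 * q) - 1) -
      2 / 3 * q - 3 * ((1 / 64 + 0.0917 - q) ^ 2 - (1 / 64 ^ 2 + 1 / 625 + 1 / 2401 - q / 25)) := by
    nlinarith [mul_nonneg hq (sub_nonneg.2 hq')]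
  have hl9 := log_div_le_linear (v := 5.885) (u := u) (w := 9) (p := 36) (by norm_num)
    (by norm_num) (by linarith) (by norm_num)
  have hl54 := log_div_le_linear (v := 5.885) (u := u) (w := 54) (p := 23) (by norm_num)
    (by norm_num) (by linarith) (by norm_num)
  have hl108 := log_div_le_linear (v := 5.885) (u := u) (w := 108) (p := 18) (by norm_num)
    (by norm_num) (by linarith) (by norm_num)
  obtain ⟨t, ht, rfl⟩ : ∃ t, 0 ≤ t ∧ u = 5.885 + t := ⟨u - 5.885, by linarith, by ring⟩
  have hG := mul_le_mul_of_nonneg_left hG (by positivity : 0 ≤ ((5.885 + t) ^ 4) ^ 2)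
  have hw : 0 ≤ (5.885 + t) ^ 4 / 3 + 2 * (5.885 + t) ^ 2 + 17 / 3 := by positivity
  have hl9 := mul_le_mul_of_nonneg_left hl9 hw
  have hl54 := mul_le_mul_of_nonneg_left hl54 hw
  have hl108 := mul_le_mul_of_nonneg_left hl108 hw
  generalize Real.log ((5.885 + t) ^ 4 / 9) = l9 at *
  generalize Real.log ((5.885 + t) ^ 4 / 54) = l54 at *
  generalize Real.log ((5.885 + t) ^ 4 / 108) = l108 at *
  norm_num only at hG hl9 hl54 hl108
  linarith [pow_nonneg ht 2, pow_nonneg ht 3, pow_nonneg ht 4, pow_nonneg ht 5, pow_nonneg ht 6,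
    pow_nonneg ht 7, pow_nonneg ht 8]

theorem IsHittingSet.le_card_of_coprime_six {n s : ℕ} {X : Finset ℕ} (hX : IsHittingSet n X)
    (hs : #X ≤ 2 * s) (h2 : ¬ 2 ∣ n) (h3 : ¬ 3 ∣ n) (hn : 2000 ≤ n) :
    n / 2 * (1 - √(1 - 8 * zeta2 n)) - √n ≤ s := by
  by_contra! hlt
  have h6 : n.gcd 6 = 1 := by simp [gcd_six_eq, h2, h3]
  have hnR : (2000 : ℝ) ≤ n := by exact_mod_cast hn
  obtain ⟨u, hvu, hu4, key⟩ := hX.averaged_le_of_lt hs hlt (v := 6.687) (c := 1.132)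
    (r := 0.5773) (ρ := 0.5088) (Y := 404) (Y' := 1004) (p := 1) (p' := 7) (by norm_num)
    (le_trans (by norm_num) hnR) (by norm_num) (by rw [if_neg h2, if_neg h3]; norm_num)
    (fun q hq hq' => by
      rw [if_neg h2, if_neg h3]; nlinarith [mul_nonneg hq (sub_nonneg.2 hq')])
    (by norm_num) (by rw [h6, show Nat.totient 1 = 1 from rfl]; norm_num) (by norm_num)
    (by norm_num) (by norm_num) (by norm_num) (by norm_num) (by norm_num) (by norm_num)
    (fun e => if e = 1 then 1 else if e = 3 then 3 else 2) (fun e => by split_ifs <;> simp)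
    (fun e g he hen hg heg => by
      have := mem_Icc.1 he
      split_ifs with he1 he3
      · exact Nat.coprime_one_left g
      · exact he3 ▸ heg
      · obtain rfl | rfl : e = 2 ∨ e = 4 := by omega
        · exact heg
        · exact two_coprime_iff.2 (four_coprime_iff.1 heg))
  have key := key _ _ (1) 1 rfl rfl (by rw [h6, show Nat.totient 1 = 1 from rfl]; norm_num)
    (by simp [h6])
  have hq := primeFactorsSum_nonneg n
  have hq' : primeFactorsSum n ≤ 0.0917 := primeFactorsSum_le (by omega)
  rw [sum_Icc_one_four_coprime, ← hu4] at key
  generalize hqq : primeFactorsSum n = q at *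
  norm_num only [smallKeySum, coprimeInv, six_coprime_iff, eight_coprime_iff, nine_coprime_iff, h2,
    h3, coprimeLog, show Nat.totient 2 = 1 from rfl, show Nat.totient 3 = 2 from rfl,
    show Nat.totient 6 = 2 from rfl, Nat.totient_one, if_true, if_false, and_self, and_true,
    and_false, not_true, not_false_eq_true, Nat.cast_ofNat, Nat.cast_one, div_div] at key
  have hG : 0.0229 ≤ (1 - 1 + (0.5773 + 0.5088 * q)) * (2 * (0.5773 + 0.5088 * q) - 1) -
      1 * q - 3 * ((1 / 36 + 1 / 64 + 1 / 81 + 0.0917 - q) ^ 2 - (1 / 36 ^ 2 + 1 / 64 ^ 2 + 1 / 81 ^ 2 +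
        2 * (1 / 36) * (1 / 64 + 1 / 81) + 1 / 625 + 1 / 2401 - q / 25)) - 1 / 6 * (0.0917 - q) := by
    nlinarith [mul_nonneg hq (sub_nonneg.2 hq')]
  have hl4_5 := log_div_le_linear (v := 6.687) (u := u) (w := 9 / 2) (p := 44) (by norm_num)
    (by norm_num) (by linarith) (by norm_num)
  have hl12 := log_div_le_linear (v := 6.687) (u := u) (w := 12) (p := 37) (by norm_num)
    (by norm_num) (by linarith) (by norm_num)
  have hl27 := log_div_le_linear (v := 6.687) (u := u) (w := 27) (p := 32) (by norm_num)
    (by norm_num) (by linarith) (by norm_num)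
  have hl24 := log_div_le_linear (v := 6.687) (u := u) (w := 24) (p := 32) (by norm_num)
    (by norm_num) (by linarith) (by norm_num)
  obtain ⟨t, ht, rfl⟩ : ∃ t, 0 ≤ t ∧ u = 6.687 + t := ⟨u - 6.687, by linarith, by ring⟩
  have hG := mul_le_mul_of_nonneg_left hG (by positivity : 0 ≤ ((6.687 + t) ^ 4) ^ 2)
  have hw : 0 ≤ (6.687 + t) ^ 4 / 3 + 2 * (6.687 + t) ^ 2 + 17 / 3 := by positivity
  have hl4_5 := mul_le_mul_of_nonneg_left hl4_5 hw
  have hl12 := mul_le_mul_of_nonneg_left hl12 hw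
  have hl27 := mul_le_mul_of_nonneg_left hl27 hw
  have hl24 := mul_le_mul_of_nonneg_left hl24 hw
  generalize Real.log ((6.687 + t) ^ 4 / (9 / 2)) = l4_5 at *
  generalize Real.log ((6.687 + t) ^ 4 / 12) = l12 at *
  generalize Real.log ((6.687 + t) ^ 4 / 27) = l27 at *
  generalize Real.log ((6.687 + t) ^ 4 / 24) = l24 at *
  norm_num only at hG hl4_5 hl12 hl27 hl24
  linarith [pow_nonneg ht 2, pow_nonneg ht 3, pow_nonneg ht 4, pow_nonneg ht 5, pow_nonneg ht 6,
    pow_nonneg ht 7, pow_nonneg ht 8]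

theorem IsHittingSet.le_card {n s : ℕ} {X : Finset ℕ} (hX : IsHittingSet n X)
    (hs : #X ≤ 2 * s) (hn : 20 ≤ n) : n / 2 * (1 - √(1 - 8 * zeta2 n)) - √n ≤ s := by
  rcases le_or_gt n (KernelCheck.threshold n) with h | h
  · exact hX.le_card_of_le_threshold hs hn h
  simp only [KernelCheck.threshold, KernelCheck.pick_eq, Nat.beq_eq, show n.mod 2 = n % 2 from rfl,
    show n.mod 3 = n % 3 from rfl, ← Nat.dvd_iff_mod_eq_zero] at h
  by_cases h2 : 2 ∣ n <;> by_cases h3 : 3 ∣ n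
  · exact hX.le_card_of_six_dvd hs h2 h3 (by simpa [h2, h3] using h.le)
  · exact hX.le_card_of_two_dvd hs h2 h3 (by simpa [h2, h3] using h.le)
  · exact hX.le_card_of_three_dvd hs h2 h3 (by simpa [h2, h3] using h.le)
  · exact hX.le_card_of_coprime_six hs h2 h3 (by simpa [h2, h3] using h.le)

theorem gamma_lower_bound_zeta2 (n : ℕ) (hn : 20 ≤ n) :
    (Even n →
      (normalCoveringNumber (Equiv.Perm (Fin n)) : ℝ) ≥
        (n / 2) * (1 - Real.sqrt (1 - 8 * zeta2 n)) - Real.sqrt n) ∧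
    (Odd n →
      (normalCoveringNumber (alternatingGroup (Fin n)) : ℝ) ≥
        (n / 2) * (1 - Real.sqrt (1 - 8 * zeta2 n)) - Real.sqrt n) := by
  constructor <;> intro h
  · obtain ⟨X, hs, hX, hits⟩ := exists_hitting_set_perm (by omega) h
    exact IsHittingSet.le_card ⟨fun x hx => (hX x hx).1, fun x hx => (hX x hx).2.1,
      fun x hx => (hX x hx).2.2, hits⟩ hs hn
  · obtain ⟨X, hs, hX, hits⟩ := exists_hitting_set_alternatingGroup (by omega) h
    exact IsHittingSet.le_card ⟨fun x hx => (hX x hx).1, fun x hx => (hX x hx).2.1,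
      fun x hx => (hX x hx).2.2, hits⟩ hs hn
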